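/- Let c satisfy (B0)–(B3) and (B2s). If u is a c-convex solution of: λ ≤ |∂ᶜu| ≤ 1/λ on an open set U^λ ⊂ U and |∂ᶜu| ≤ Λ on cl U, then u ∈ C^{1, 1/K}_loc(U^λ), i.e. u is locally of class C¹ with locally (1/K)-Hölder continuous gradient in U^λ, where K > 1 is the engulfing constant, depending only on the dimension n and on γ_c⁺ γ_c⁻/λ. -/

import Mathlib

open Set MeasureTheory Metric Bornology
open scoped ENNReal NNReal Pointwise

noncomputable section

abbrev Euc (n : ℕ) := EuclideanSpace ℝ (Fin n)

/-- Partial gradient of the cost in the first variable: `D_x c(x,y)`. -/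
noncomputable def gradX (n : ℕ) (c : Euc n → Euc n → ℝ) (x y : Euc n) : Euc n :=
  gradient (fun x' => c x' y) x

/-- Partial gradient of the cost in the second variable: `D_y c(x,y)`. -/
noncomputable def gradY (n : ℕ) (c : Euc n → Euc n → ℝ) (x y : Euc n) : Euc n :=
  gradient (fun y' => c x y') y

/-- Mixed second derivative `D²_{xy} c` as a continuous linear map. -/
noncomputable def DxyC (n : ℕ) (c : Euc n → Euc n → ℝ) (x y : Euc n) : Euc n →L[ℝ] Euc n :=
  fderiv ℝ (fun x' => gradY n c x' y) x

/-- Second derivative `D²_{xx} c`. -/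
noncomputable def DxxC (n : ℕ) (c : Euc n → Euc n → ℝ) (x y : Euc n) : Euc n →L[ℝ] Euc n :=
  fderiv ℝ (fun x' => gradX n c x' y) x

/-- Third derivative `D²_{xx} D_y c`. -/
noncomputable def DxxyC (n : ℕ) (c : Euc n → Euc n → ℝ) (x y : Euc n) :
    Euc n →L[ℝ] Euc n →L[ℝ] Euc n :=
  fderiv ℝ (fun x' => DxyC n c x' y) x

/-- `β⁺_c = ‖D²_{xy} c‖_{L∞(U×V)}`. -/
noncomputable def betaPlus (n : ℕ) (c : Euc n → Euc n → ℝ) (U V : Set (Euc n)) : ℝ :=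
  sSup ((fun p : Euc n × Euc n => ‖DxyC n c p.1 p.2‖) '' (U ×ˢ V))

/-- `β⁻_c = ‖(D²_{xy} c)⁻¹‖_{L∞(U×V)}`. -/
noncomputable def betaMinus (n : ℕ) (c : Euc n → Euc n → ℝ) (U V : Set (Euc n)) : ℝ :=
  sSup ((fun p : Euc n × Euc n => ‖(DxyC n c p.1 p.2).inverse‖) '' (U ×ˢ V))

/-- `γ⁺_c = ‖det D²_{xy} c‖_{L∞(U×V)}`. -/
noncomputable def gammaPlus (n : ℕ) (c : Euc n → Euc n → ℝ) (U V : Set (Euc n)) : ℝ :=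
  sSup ((fun p : Euc n × Euc n =>
    |LinearMap.det ((DxyC n c p.1 p.2 : Euc n →L[ℝ] Euc n) : Euc n →ₗ[ℝ] Euc n)|) '' (U ×ˢ V))

/-- `γ⁻_c = ‖(det D²_{xy} c)⁻¹‖_{L∞(U×V)}`. -/
noncomputable def gammaMinus (n : ℕ) (c : Euc n → Euc n → ℝ) (U V : Set (Euc n)) : ℝ :=
  sSup ((fun p : Euc n × Euc n =>
    |LinearMap.det ((DxyC n c p.1 p.2 : Euc n →L[ℝ] Euc n) : Euc n →ₗ[ℝ] Euc n)|⁻¹) '' (U ×ˢ V))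

noncomputable def supDxx (n : ℕ) (c : Euc n → Euc n → ℝ) (U V : Set (Euc n)) : ℝ :=
  sSup ((fun p : Euc n × Euc n => ‖DxxC n c p.1 p.2‖) '' (U ×ˢ V))

noncomputable def supDx (n : ℕ) (c : Euc n → Euc n → ℝ) (U V : Set (Euc n)) : ℝ :=
  sSup ((fun p : Euc n × Euc n => ‖gradX n c p.1 p.2‖) '' (U ×ˢ V))

noncomputable def supDxxy (n : ℕ) (c : Euc n → Euc n → ℝ) (U V : Set (Euc n)) : ℝ :=
  sSup ((fun p : Euc n × Euc n => ‖DxxyC n c p.1 p.2‖) '' (U ×ˢ V))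

/-- The constant `M_c` from Theorem 4.3. -/
noncomputable def Mconst (n : ℕ) (c : Euc n → Euc n → ℝ) (U V : Set (Euc n)) : ℝ :=
  (betaMinus n c U V) ^ 2 * supDxx n c U V +
    (betaMinus n c U V) ^ 3 * supDx n c U V * supDxxy n c U V

/-- The constant `ε_c` of Lemma 6.1: `1/ε_c = 2 (β⁺)⁴ (β⁻)⁶ ‖D³_{xxy} c‖_∞`. -/
noncomputable def epsC (n : ℕ) (c : Euc n → Euc n → ℝ) (U V : Set (Euc n)) : ℝ :=
  (2 * (betaPlus n c U V) ^ 4 * (betaMinus n c U V) ^ 6 * supDxxy n c U V)⁻¹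

/-- Condition (B0). -/
def B0cond (n : ℕ) (c : Euc n → Euc n → ℝ) (U V : Set (Euc n)) : Prop :=
  IsOpen U ∧ IsBounded U ∧ IsOpen V ∧ IsBounded V ∧
    ContDiffOn ℝ 4 (Function.uncurry c) (closure U ×ˢ closure V)

/-- `f` is a (C¹-) diffeomorphism from `S` onto its range. -/
def DiffeoOnto (n : ℕ) (f : Euc n → Euc n) (S : Set (Euc n)) : Prop :=
  Set.InjOn f S ∧ ContDiffOn ℝ 1 f S ∧ ContDiffOn ℝ 1 (Function.invFunOn f S) (f '' S)

/-- Condition (B1) (bi-twist). -/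
def B1cond (n : ℕ) (c : Euc n → Euc n → ℝ) (U V : Set (Euc n)) : Prop :=
  (∀ y ∈ closure V, DiffeoOnto n (fun x => -gradY n c x y) (closure U)) ∧
  (∀ x ∈ closure U, DiffeoOnto n (fun y => -gradX n c x y) (closure V))

/-- `U_ȳ := -D_y c(U, ȳ)`. -/
def Uyset (n : ℕ) (c : Euc n → Euc n → ℝ) (U : Set (Euc n)) (ybar : Euc n) : Set (Euc n) :=
  (fun x => -gradY n c x ybar) '' U

/-- `V_x̄ := -D_x c(x̄, V)`. -/
def Vxset (n : ℕ) (c : Euc n → Euc n → ℝ) (V : Set (Euc n)) (xbar : Euc n) : Set (Euc n) :=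
  (fun y => -gradX n c xbar y) '' V

/-- Condition (B2) (bi-convexity). -/
def B2cond (n : ℕ) (c : Euc n → Euc n → ℝ) (U V : Set (Euc n)) : Prop :=
  (∀ y ∈ closure V, Convex ℝ (Uyset n c U y)) ∧ (∀ x ∈ closure U, Convex ℝ (Vxset n c V x))

/-- A strongly convex set: each boundary point is touched from outside by a sphere of
radius `R` enclosing the set. -/
def StronglyConvexSet (n : ℕ) (Q : Set (Euc n)) : Prop :=
  Convex ℝ Q ∧ ∃ R : ℝ, 0 < R ∧ ∀ x ∈ frontier Q, ∃ z : Euc n, dist x z = R ∧ Q ⊆ closedBall z R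

/-- Condition (B2s). -/
def B2scond (n : ℕ) (c : Euc n → Euc n → ℝ) (U V : Set (Euc n)) : Prop :=
  (∀ y ∈ closure V, StronglyConvexSet n (Uyset n c U y)) ∧
  (∀ x ∈ closure U, StronglyConvexSet n (Vxset n c V x))

/-- An affinely parameterized line segment on `[-1,1]`. -/
def IsAffineSeg (n : ℕ) (F : ℝ → Euc n × Euc n) : Prop :=
  ∃ a b : Euc n × Euc n, ∀ t ∈ Icc (-1 : ℝ) 1, F t = a + t • b

/-- `∂²/∂s∂t c(x(s), y(t))` at `(0,0)`. -/
noncomputable def crossDiff2 (n : ℕ) (c : Euc n → Euc n → ℝ) (x y : ℝ → Euc n) : ℝ :=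
  deriv (fun s => deriv (fun t => c (x s) (y t)) 0) 0

/-- `∂⁴/∂s²∂t² c(x(s), y(t))` at `(0,0)`. -/
noncomputable def crossDiff4 (n : ℕ) (c : Euc n → Euc n → ℝ) (x y : ℝ → Euc n) : ℝ :=
  deriv (deriv (fun s => deriv (deriv (fun t => c (x s) (y t))) 0)) 0

/-- Condition (B3) (= A3w). -/
def B3cond (n : ℕ) (c : Euc n → Euc n → ℝ) (U V : Set (Euc n)) : Prop :=
  ∀ x y : ℝ → Euc n, (∀ t ∈ Icc (-1 : ℝ) 1, x t ∈ closure U) →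
    (∀ t ∈ Icc (-1 : ℝ) 1, y t ∈ closure V) →
    IsAffineSeg n (fun t => (gradY n c (x t) (y 0), gradX n c (x 0) (y t))) →
    crossDiff2 n c x y = 0 → crossDiff4 n c x y ≤ 0

/-- Condition (B4) (non-negative cross-curvature). -/
def B4cond (n : ℕ) (c : Euc n → Euc n → ℝ) (U V : Set (Euc n)) : Prop :=
  ∀ x y : ℝ → Euc n, (∀ t ∈ Icc (-1 : ℝ) 1, x t ∈ closure U) →
    (∀ t ∈ Icc (-1 : ℝ) 1, y t ∈ closure V) →
    IsAffineSeg n (fun t => (gradY n c (x t) (y 0), gradX n c (x 0) (y t))) →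
    crossDiff4 n c x y ≤ 0

/-- The `c*`-transform `u^{c*}(y) = sup_{x ∈ A} (-c(x,y) - u(x))`. -/
noncomputable def cStarT (n : ℕ) (c : Euc n → Euc n → ℝ) (A : Set (Euc n)) (u : Euc n → ℝ)
    (y : Euc n) : ℝ :=
  sSup ((fun x => -c x y - u x) '' A)

/-- `u` is `c`-convex on `A` (relative to the target set `B`): `u = (u^{c*})^c`. -/
def CConvexOn (n : ℕ) (c : Euc n → Euc n → ℝ) (A B : Set (Euc n)) (u : Euc n → ℝ) : Prop :=
  ∀ x ∈ A, u x = sSup ((fun y => -c x y - cStarT n c A u y) '' B)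

/-- The `c`-subdifferential `∂ᶜu ⊂ A × B`. -/
def cSubdiff (n : ℕ) (c : Euc n → Euc n → ℝ) (A B : Set (Euc n)) (u : Euc n → ℝ) :
    Set (Euc n × Euc n) :=
  {p | p.1 ∈ A ∧ p.2 ∈ B ∧ u p.1 + cStarT n c A u p.2 + c p.1 p.2 = 0}

def cSubdiffAt (n : ℕ) (c : Euc n → Euc n → ℝ) (A B : Set (Euc n)) (u : Euc n → ℝ)
    (x : Euc n) : Set (Euc n) :=
  {y | (x, y) ∈ cSubdiff n c A B u}

def cSubdiffImg (n : ℕ) (c : Euc n → Euc n → ℝ) (A B : Set (Euc n)) (u : Euc n → ℝ)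
    (X : Set (Euc n)) : Set (Euc n) :=
  ⋃ x ∈ X, cSubdiffAt n c A B u x

/-- `∂^{c*}u^{c*}(Y) = {x : ∃ y ∈ Y, (x,y) ∈ ∂ᶜu}`. -/
def cSubdiffPre (n : ℕ) (c : Euc n → Euc n → ℝ) (A B : Set (Euc n)) (u : Euc n → ℝ)
    (Y : Set (Euc n)) : Set (Euc n) :=
  {x | ∃ y ∈ Y, (x, y) ∈ cSubdiff n c A B u}

/-- `|∂ᶜu| ≥ lam` on `S`. -/
def MAge (n : ℕ) (c : Euc n → Euc n → ℝ) (A B : Set (Euc n)) (u : Euc n → ℝ) (lam : ℝ)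
    (S : Set (Euc n)) : Prop :=
  ∀ X : Set (Euc n), X ⊆ S → MeasurableSet X →
    ENNReal.ofReal lam * volume X ≤ volume (cSubdiffImg n c A B u X)

/-- `|∂ᶜu| ≤ lam` on `S`. -/
def MAle (n : ℕ) (c : Euc n → Euc n → ℝ) (A B : Set (Euc n)) (u : Euc n → ℝ) (lam : ℝ)
    (S : Set (Euc n)) : Prop :=
  ∀ X : Set (Euc n), X ⊆ S → MeasurableSet X →
    volume (cSubdiffImg n c A B u X) ≤ ENNReal.ofReal lam * volume X

/-- The inverse of the cost-exponential coordinate change `q(x) = -D_y c(x, ȳ)`. -/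
noncomputable def xOf (n : ℕ) (c : Euc n → Euc n → ℝ) (U : Set (Euc n)) (ybar : Euc n) :
    Euc n → Euc n :=
  Function.invFunOn (fun x => -gradY n c x ybar) (closure U)

/-- `cl U_ȳ := -D_y c(cl U, ȳ)`. -/
def clUy (n : ℕ) (c : Euc n → Euc n → ℝ) (U : Set (Euc n)) (ybar : Euc n) : Set (Euc n) :=
  (fun x => -gradY n c x ybar) '' closure U

/-- The modified cost `c̃(q,y) = c(x(q), y) - c(x(q), ȳ)`. -/
noncomputable def modCost (n : ℕ) (c : Euc n → Euc n → ℝ) (U : Set (Euc n)) (ybar : Euc n)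
    (q y : Euc n) : ℝ :=
  c (xOf n c U ybar q) y - c (xOf n c U ybar q) ybar

/-- The modified potential `ũ(q) = u(x(q)) + c(x(q), ȳ)`. -/
noncomputable def modPot (n : ℕ) (c : Euc n → Euc n → ℝ) (U : Set (Euc n)) (ybar : Euc n)
    (u : Euc n → ℝ) (q : Euc n) : ℝ :=
  u (xOf n c U ybar q) + c (xOf n c U ybar q) ybar

/-- The `c̃`-cone generated by `qt` and `Q` with height `-h0 > 0`. -/
noncomputable def cConeFun (n : ℕ) (ct : Euc n → Euc n → ℝ) (B Q : Set (Euc n)) (qt : Euc n)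
    (h0 : ℝ) (q : Euc n) : ℝ :=
  sSup {r : ℝ | ∃ y ∈ B, r = -ct q y + ct qt y + h0 ∧
    ∀ p ∈ frontier Q, -ct p y + ct qt y + h0 ≤ 0}

/-- The ordinary subdifferential `∂u(x)` relative to a domain `A`. -/
def subdiffAt (n : ℕ) (A : Set (Euc n)) (u : Euc n → ℝ) (x : Euc n) : Set (Euc n) :=
  {p | ∀ ε > 0, ∃ δ > 0, ∀ x' ∈ A, ‖x' - x‖ < δ →
    u x + @inner ℝ _ _ p (x' - x) - ε * ‖x' - x‖ ≤ u x'}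

/-- The dual norm `‖v‖*_K = sup_{w ∈ K} ⟨w, v⟩`. -/
noncomputable def dualNorm (n : ℕ) (K : Set (Euc n)) (v : Euc n) : ℝ :=
  sSup ((fun w => (@inner ℝ _ _ w v : ℝ)) '' K)

/-- The section `S(x̄, ȳ, τ)`. -/
def sectS (n : ℕ) (c : Euc n → Euc n → ℝ) (U : Set (Euc n)) (u : Euc n → ℝ)
    (xbar ybar : Euc n) (τ : ℝ) : Set (Euc n) :=
  {x ∈ U | u x ≤ u xbar - c x ybar + c xbar ybar + τ}

/-- The measure with density `f` restricted to `A`. -/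
noncomputable def densMeasure (n : ℕ) (A : Set (Euc n)) (f : Euc n → ℝ) : Measure (Euc n) :=
  (volume.restrict A).withDensity fun x => ENNReal.ofReal (f x)

end

open Set MeasureTheory Metric Bornology
open scoped ENNReal NNReal Pointwise

namespace FKM
open Filter Topology

/-- Geometric package extracted from the hypotheses on the cost. -/
structure Pkg0 (n : ℕ) (c : Euc n → Euc n → ℝ) (U V : Set (Euc n)) (p q : Euc n → Euc n → Euc n)
    (A : Euc n → Euc n → Euc n →L[ℝ] Euc n) : Prop where
  oU : IsOpen U
  oV : IsOpen V
  bU : IsBounded U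
  bV : IsBounded V
  neU : U.Nonempty
  neV : V.Nonempty
  cc : ContinuousOn (Function.uncurry c) (closure U ×ˢ closure V)
  pc : ContinuousOn (Function.uncurry p) (closure U ×ˢ closure V)
  qc : ContinuousOn (Function.uncurry q) (closure U ×ˢ closure V)
  Ac : ContinuousOn (Function.uncurry A) (closure U ×ˢ closure V)
  c_x : ∀ x ∈ U, ∀ y ∈ closure V, HasFDerivAt (fun x' => c x' y) (-(innerSL ℝ (p x y))) x
  c_y : ∀ x ∈ closure U, ∀ y ∈ V, HasFDerivAt (fun y' => c x y') (-(innerSL ℝ (q x y))) y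
  q_x : ∀ x ∈ closure U, ∀ y ∈ closure V,
    HasFDerivWithinAt (fun x' => q x' y) (A x y) (closure U) x
  p_y : ∀ x ∈ closure U, ∀ y ∈ closure V,
    HasFDerivWithinAt (fun y' => p x y') (ContinuousLinearMap.adjoint (A x y)) (closure V) y
  A_inv : ∀ x ∈ closure U, ∀ y ∈ closure V, Function.Injective (A x y)
  At_inv : ∀ x ∈ closure U, ∀ y ∈ closure V,
    Function.Injective (ContinuousLinearMap.adjoint (A x y))
  q_inj : ∀ y ∈ closure V, InjOn (fun x => q x y) (closure U)
  p_inj : ∀ x ∈ closure U, InjOn (fun y => p x y) (closure V)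
  q_conv : ∀ y ∈ closure V, Convex ℝ ((fun x => q x y) '' closure U)
  p_conv : ∀ x ∈ closure U, Convex ℝ ((fun y => p x y) '' closure V)
  q_str : ∀ y ∈ closure V, ∃ R : ℝ, 0 < R ∧ ∀ a ∈ (fun x => q x y) '' closure U,
    ∀ b ∈ (fun x => q x y) '' closure U, ∀ v : Euc n, ‖v‖ ≤ ‖a - b‖ ^ 2 / R →
      (1 / 2 : ℝ) • (a + b) + v ∈ (fun x => q x y) '' closure U
  p_str : ∀ x ∈ closure U, ∃ R : ℝ, 0 < R ∧ ∀ a ∈ (fun y => p x y) '' closure V,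
    ∀ b ∈ (fun y => p x y) '' closure V, ∀ v : Euc n, ‖v‖ ≤ ‖a - b‖ ^ 2 / R →
      (1 / 2 : ℝ) • (a + b) + v ∈ (fun y => p x y) '' closure V
  q_int : ∀ y ∈ closure V, interior ((fun x => q x y) '' closure U) = (fun x => q x y) '' U
  p_int : ∀ x ∈ closure U, interior ((fun y => p x y) '' closure V) = (fun y => p x y) '' V

/-- Full package, including quantitative quasi-convexity. -/
structure Pkg (n : ℕ) (c : Euc n → Euc n → ℝ) (U V : Set (Euc n)) (p q : Euc n → Euc n → Euc n)
    (A : Euc n → Euc n → Euc n →L[ℝ] Euc n) (C0 : ℝ) : Prop extends Pkg0 n c U V p q A where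
  C0nn : 0 ≤ C0
  QQx : ∀ y0 ∈ closure V, ∀ y1 ∈ closure V, ∀ x0 ∈ closure U, ∀ x1 ∈ closure U,
    ∀ x ∈ closure U, ∀ t : ℝ, 0 < t → t < 1 →
    q x y0 = (1 - t) • q x0 y0 + t • q x1 y0 →
    c x0 y0 - c x0 y1 < c x y0 - c x y1 →
    (1 - t) * ((c x y0 - c x y1) - (c x0 y0 - c x0 y1)) ≤
      Real.exp (C0 * ‖x1 - x0‖ * ‖y1 - y0‖) * t * ((c x1 y0 - c x1 y1) - (c x y0 - c x y1))
  QQy : ∀ x0 ∈ closure U, ∀ x1 ∈ closure U, ∀ y0 ∈ closure V, ∀ y1 ∈ closure V,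
    ∀ y ∈ closure V, ∀ t : ℝ, 0 < t → t < 1 →
    p x0 y = (1 - t) • p x0 y0 + t • p x0 y1 →
    c x0 y0 - c x1 y0 < c x0 y - c x1 y →
    (1 - t) * ((c x0 y - c x1 y) - (c x0 y0 - c x1 y0)) ≤
      Real.exp (C0 * ‖y1 - y0‖ * ‖x1 - x0‖) * t * ((c x0 y1 - c x1 y1) - (c x0 y - c x1 y))

section basics
variable {n : ℕ} {c : Euc n → Euc n → ℝ} {U V : Set (Euc n)} {p q : Euc n → Euc n → Euc n}
  {A : Euc n → Euc n → Euc n →L[ℝ] Euc n} {C0 : ℝ}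

theorem uncurry_flip_cont {α : Type*} [TopologicalSpace α] {f : Euc n → Euc n → α}
    (h : ContinuousOn (Function.uncurry f) (closure U ×ˢ closure V)) :
    ContinuousOn (Function.uncurry fun y x => f x y) (closure V ×ˢ closure U) := by
  have : (Function.uncurry fun y x => f x y) = Function.uncurry f ∘ Prod.swap := by
    ext ⟨a, b⟩; rfl
  rw [this]
  refine h.comp continuous_swap.continuousOn ?_
  rintro ⟨a, b⟩ ⟨ha, hb⟩
  exact ⟨hb, ha⟩

theorem Pkg0.swap (P : Pkg0 n c U V p q A) :
    Pkg0 n (fun y x => c x y) V U (fun y x => q x y) (fun y x => p x y)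
      (fun y x => ContinuousLinearMap.adjoint (A x y)) where
  oU := P.oV
  oV := P.oU
  bU := P.bV
  bV := P.bU
  neU := P.neV
  neV := P.neU
  cc := uncurry_flip_cont P.cc
  pc := uncurry_flip_cont P.qc
  qc := uncurry_flip_cont P.pc
  Ac := by
    have := uncurry_flip_cont P.Ac
    exact (ContinuousLinearMap.adjoint (𝕜 := ℝ) (E := Euc n) (F := Euc n)).continuous.comp_continuousOn this
  c_x := fun y hy x hx => P.c_y x hx y hy
  c_y := fun y hy x hx => P.c_x x hx y hy
  q_x := fun y hy x hx => P.p_y x hx y hy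
  p_y := fun y hy x hx => by
    rw [ContinuousLinearMap.adjoint_adjoint]; exact P.q_x x hx y hy
  A_inv := fun y hy x hx => P.At_inv x hx y hy
  At_inv := fun y hy x hx => by
    rw [ContinuousLinearMap.adjoint_adjoint]; exact P.A_inv x hx y hy
  q_inj := fun x hx => P.p_inj x hx
  p_inj := fun y hy => P.q_inj y hy
  q_conv := fun x hx => P.p_conv x hx
  p_conv := fun y hy => P.q_conv y hy
  q_str := fun x hx => P.p_str x hx
  p_str := fun y hy => P.q_str y hy
  q_int := fun x hx => P.p_int x hx
  p_int := fun y hy => P.q_int y hy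
theorem Pkg.swap (P : Pkg n c U V p q A C0) :
    Pkg n (fun y x => c x y) V U (fun y x => q x y) (fun y x => p x y)
      (fun y x => ContinuousLinearMap.adjoint (A x y)) C0 where
  toPkg0 := P.toPkg0.swap
  C0nn := P.C0nn
  QQx := fun x0 h0 x1 h1 y0 k0 y1 k1 y k t ht0 ht1 => P.QQy x0 h0 x1 h1 y0 k0 y1 k1 y k t ht0 ht1
  QQy := fun y0 h0 y1 h1 x0 k0 x1 k1 x k t ht0 ht1 => P.QQx y0 h0 y1 h1 x0 k0 x1 k1 x k t ht0 ht1

/-- The inverse of `A`. -/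
noncomputable def Ai (A : Euc n → Euc n → Euc n →L[ℝ] Euc n) (x y : Euc n) : Euc n →L[ℝ] Euc n :=
  (A x y).inverse

/-- invertible CLM from injective in finite dimension -/
theorem exists_equiv {L : Euc n →L[ℝ] Euc n} (h : Function.Injective L) :
    ∃ e : Euc n ≃L[ℝ] Euc n, (e : Euc n →L[ℝ] Euc n) = L := by
  refine ⟨(LinearEquiv.ofInjectiveEndo (L : Euc n →ₗ[ℝ] Euc n) h).toContinuousLinearEquiv, ?_⟩
  ext v; rfl

theorem inverse_left {L : Euc n →L[ℝ] Euc n} (h : Function.Injective L) (v : Euc n) :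
    L.inverse (L v) = v := by
  obtain ⟨e, rfl⟩ := exists_equiv h
  simp

theorem inverse_right {L : Euc n →L[ℝ] Euc n} (h : Function.Injective L) (v : Euc n) :
    L (L.inverse v) = v := by
  obtain ⟨e, rfl⟩ := exists_equiv h
  simp

theorem inverse_contAt {L : Euc n →L[ℝ] Euc n} (h : Function.Injective L) :
    ContinuousAt (ContinuousLinearMap.inverse : (Euc n →L[ℝ] Euc n) → _) L := by
  obtain ⟨e, rfl⟩ := exists_equiv h
  exact (contDiffAt_map_inverse (𝕜 := ℝ) (n := 1) e).continuousAt

theorem Pkg0.Ai_cont (P : Pkg0 n c U V p q A) :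
    ContinuousOn (Function.uncurry (Ai A)) (closure U ×ˢ closure V) := by
  rintro ⟨x, y⟩ ⟨hx, hy⟩
  exact ContinuousAt.comp_continuousWithinAt (f := Function.uncurry A) (x := (x, y))
    (g := ContinuousLinearMap.inverse)
    (inverse_contAt (P.A_inv x hx y hy)) (P.Ac ⟨x, y⟩ ⟨hx, hy⟩)

theorem Pkg0.compU (P : Pkg0 n c U V p q A) : IsCompact (closure U) :=
  Metric.isCompact_of_isClosed_isBounded isClosed_closure P.bU.closure
theorem Pkg0.compV (P : Pkg0 n c U V p q A) : IsCompact (closure V) :=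
  Metric.isCompact_of_isClosed_isBounded isClosed_closure P.bV.closure
theorem Pkg0.compS (P : Pkg0 n c U V p q A) : IsCompact (closure U ×ˢ closure V) :=
  P.compU.prod P.compV

theorem Pkg0.Ai_bound (P : Pkg0 n c U V p q A) :
    ∃ B : ℝ, 0 < B ∧ ∀ x ∈ closure U, ∀ y ∈ closure V, ‖A x y‖ ≤ B ∧ ‖Ai A x y‖ ≤ B := by
  obtain ⟨B1, h1⟩ := P.compS.exists_bound_of_continuousOn P.Ac
  obtain ⟨B2, h2⟩ := P.compS.exists_bound_of_continuousOn P.Ai_cont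
  refine ⟨max (max B1 B2) 1, by positivity, fun x hx y hy => ⟨?_, ?_⟩⟩
  · exact (h1 ⟨x, y⟩ ⟨hx, hy⟩).trans (by simp)
  · exact (h2 ⟨x, y⟩ ⟨hx, hy⟩).trans (by simp)

theorem Pkg0.Ai_left (P : Pkg0 n c U V p q A) {x y : Euc n} (hx : x ∈ closure U)
    (hy : y ∈ closure V) (v : Euc n) : Ai A x y (A x y v) = v := inverse_left (P.A_inv x hx y hy) v
theorem Pkg0.Ai_right (P : Pkg0 n c U V p q A) {x y : Euc n} (hx : x ∈ closure U)
    (hy : y ∈ closure V) (v : Euc n) : A x y (Ai A x y v) = v := inverse_right (P.A_inv x hx y hy) v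

/-- derivative of the inverse map in `x` coordinates. -/
noncomputable def Xi (q : Euc n → Euc n → Euc n) (U : Set (Euc n)) (y a : Euc n) : Euc n :=
  Function.invFunOn (fun x => q x y) (closure U) a

theorem Xi_mem {y a : Euc n} (ha : a ∈ (fun x => q x y) '' closure U) : Xi q U y a ∈ closure U :=
  Function.invFunOn_mem ha
theorem Xi_eq {y a : Euc n} (ha : a ∈ (fun x => q x y) '' closure U) : q (Xi q U y a) y = a :=
  Function.invFunOn_eq ha

theorem Pkg0.Xi_q (P : Pkg0 n c U V p q A) {x y : Euc n} (hx : x ∈ closure U)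
    (hy : y ∈ closure V) : Xi q U y (q x y) = x :=
  (P.q_inj y hy).leftInvOn_invFunOn hx

theorem Pkg0.q_cont (P : Pkg0 n c U V p q A) {y : Euc n} (hy : y ∈ closure V) :
    ContinuousOn (fun x => q x y) (closure U) := by
  refine P.qc.comp (f := fun x => (x, y)) (by fun_prop) (fun x hx => ⟨hx, hy⟩)

theorem contOn_left {α : Type*} [TopologicalSpace α] {f : Euc n → Euc n → α} {S T : Set (Euc n)}
    (h : ContinuousOn (Function.uncurry f) (S ×ˢ T)) {y : Euc n} (hy : y ∈ T) :
    ContinuousOn (fun x => f x y) S :=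
  h.comp (f := fun x => (x, y)) (by fun_prop) (fun x hx => ⟨hx, hy⟩)
theorem contOn_right {α : Type*} [TopologicalSpace α] {f : Euc n → Euc n → α} {S T : Set (Euc n)}
    (h : ContinuousOn (Function.uncurry f) (S ×ˢ T)) {x : Euc n} (hx : x ∈ S) :
    ContinuousOn (fun y => f x y) T :=
  h.comp (f := fun y => (x, y)) (by fun_prop) (fun y hy => ⟨hx, hy⟩)

theorem invFunOn_cont {f : Euc n → Euc n} {K : Set (Euc n)} (hK : IsCompact K)
    (hf : ContinuousOn f K) (hi : InjOn f K) : ContinuousOn (Function.invFunOn f K) (f '' K) := by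
  rw [continuousOn_iff_isClosed]
  intro t ht
  refine ⟨f '' (t ∩ K), ((hK.inter_left ht).image_of_continuousOn (hf.mono inter_subset_right)).isClosed, ?_⟩
  ext a
  constructor
  · rintro ⟨h1, h2⟩
    exact ⟨⟨_, ⟨h1, Function.invFunOn_mem h2⟩, Function.invFunOn_eq h2⟩, h2⟩
  · rintro ⟨⟨x, ⟨hx, hxK⟩, rfl⟩, h2⟩
    refine ⟨?_, h2⟩
    simp only [mem_preimage]
    rw [hi.leftInvOn_invFunOn hxK]; exact hx

theorem Pkg0.Xi_cont (P : Pkg0 n c U V p q A) {y : Euc n} (hy : y ∈ closure V) :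
    ContinuousOn (Xi q U y) ((fun x => q x y) '' closure U) :=
  invFunOn_cont P.compU (P.q_cont hy) (P.q_inj y hy)

theorem Pkg0.Xi_deriv (P : Pkg0 n c U V p q A) {y a : Euc n} (hy : y ∈ closure V)
    (ha : a ∈ (fun x => q x y) '' closure U) :
    HasFDerivWithinAt (Xi q U y) (Ai A (Xi q U y a) y) ((fun x => q x y) '' closure U) a := by
  have hx := Xi_mem ha
  obtain ⟨e, he⟩ := exists_equiv (P.A_inv _ hx y hy)
  have h1 := P.q_x _ hx y hy
  rw [← he] at h1
  have : Ai A (Xi q U y a) y = (e.symm : Euc n →L[ℝ] Euc n) := by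
    unfold Ai; rw [← he]; simp
  rw [this]
  refine HasFDerivWithinAt.of_local_left_inverse (f := fun x => q x y) (s := (fun x => q x y) '' closure U) (t := closure U) ?_ ?_ ha ?_
  · exact tendsto_nhdsWithin_iff.2 ⟨(P.Xi_cont hy a ha), eventually_mem_nhdsWithin.mono fun b hb => Xi_mem hb⟩
  · exact h1
  · exact eventually_mem_nhdsWithin.mono fun b hb => Xi_eq hb

theorem Pkg0.exX (P : Pkg0 n c U V p q A) {y x0 x1 : Euc n} {t : ℝ} (hy : y ∈ closure V)
    (h0 : x0 ∈ closure U) (h1 : x1 ∈ closure U) (ht0 : 0 ≤ t) (ht1 : t ≤ 1) :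
    ∃ x ∈ closure U, q x y = (1 - t) • q x0 y + t • q x1 y := by
  obtain ⟨x, hx, h⟩ := P.q_conv y hy (mem_image_of_mem _ h0) (mem_image_of_mem _ h1)
    (sub_nonneg.2 ht1) ht0 (by ring)
  exact ⟨x, hx, h⟩

theorem Pkg0.exY (P : Pkg0 n c U V p q A) {x y0 y1 : Euc n} {t : ℝ} (hx : x ∈ closure U)
    (h0 : y0 ∈ closure V) (h1 : y1 ∈ closure V) (ht0 : 0 ≤ t) (ht1 : t ≤ 1) :
    ∃ y ∈ closure V, p x y = (1 - t) • p x y0 + t • p x y1 :=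
  P.swap.exX hx h0 h1 ht0 ht1

/-- quasi-convexity along `x`-segments -/
theorem Pkg.dasmX (P : Pkg n c U V p q A C0) {y0 y1 x0 x1 x : Euc n} {t : ℝ} (hy0 : y0 ∈ closure V)
    (hy1 : y1 ∈ closure V)
    (h0 : x0 ∈ closure U) (h1 : x1 ∈ closure U) (hx : x ∈ closure U) (ht0 : 0 ≤ t) (ht1 : t ≤ 1)
    (h : q x y0 = (1 - t) • q x0 y0 + t • q x1 y0) :
    c x y0 - c x y1 ≤ max (c x0 y0 - c x0 y1) (c x1 y0 - c x1 y1) := by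
  rcases ht0.eq_or_lt with rfl | ht0
  · have : x = x0 := P.q_inj y0 hy0 hx h0 (by simpa using h)
    subst this; simp
  rcases ht1.eq_or_lt with rfl | ht1
  · have : x = x1 := P.q_inj y0 hy0 hx h1 (by simpa using h)
    subst this; simp
  by_contra hcon
  rw [not_le, max_lt_iff] at hcon
  have := P.QQx y0 hy0 y1 hy1 x0 h0 x1 h1 x hx t ht0 ht1 h hcon.1
  have h2 : 0 < (1 - t) * ((c x y0 - c x y1) - (c x0 y0 - c x0 y1)) :=
    mul_pos (by linarith) (by linarith)
  have h3 : Real.exp (C0 * ‖x1 - x0‖ * ‖y1 - y0‖) * t * ((c x1 y0 - c x1 y1) - (c x y0 - c x y1)) ≤ 0 :=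
    mul_nonpos_of_nonneg_of_nonpos (by positivity) (by linarith)
  linarith

theorem Pkg.dasmY (P : Pkg n c U V p q A C0) {x0 x1 y0 y1 y : Euc n} {t : ℝ} (hx0 : x0 ∈ closure U)
    (hx1 : x1 ∈ closure U)
    (h0 : y0 ∈ closure V) (h1 : y1 ∈ closure V) (hy : y ∈ closure V) (ht0 : 0 ≤ t) (ht1 : t ≤ 1)
    (h : p x0 y = (1 - t) • p x0 y0 + t • p x0 y1) :
    c x0 y - c x1 y ≤ max (c x0 y0 - c x1 y0) (c x0 y1 - c x1 y1) :=
  P.swap.dasmX hx0 hx1 h0 h1 hy ht0 ht1 h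

end basics
end FKM

open Set MeasureTheory Metric Bornology
open scoped ENNReal NNReal Pointwise
namespace FKM
open Filter Topology
section slopes
variable {n : ℕ} {c : Euc n → Euc n → ℝ} {U V : Set (Euc n)} {p q : Euc n → Euc n → Euc n}
  {A : Euc n → Euc n → Euc n →L[ℝ] Euc n} {C0 : ℝ}

/-- gradient of `c(.,yb) - c(.,y)` in the coordinates `q(.,yb)`. -/
noncomputable def hat (p : Euc n → Euc n → Euc n) (A : Euc n → Euc n → Euc n →L[ℝ] Euc n)
    (x yb y : Euc n) : Euc n :=
  ContinuousLinearMap.adjoint (Ai A x yb) (p x y - p x yb)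

theorem Pkg.seg_deriv (P : Pkg n c U V p q A C0) {yb y x0 x1 : Euc n} {t : ℝ}
    (hyb : yb ∈ closure V) (hy : y ∈ closure V) (h0 : x0 ∈ closure U) (h1 : x1 ∈ closure U)
    (ht : t ∈ Icc (0 : ℝ) 1)
    (hU : Xi q U yb ((1 - t) • q x0 yb + t • q x1 yb) ∈ U) :
    HasDerivWithinAt (fun t => c (Xi q U yb ((1 - t) • q x0 yb + t • q x1 yb)) yb
      - c (Xi q U yb ((1 - t) • q x0 yb + t • q x1 yb)) y)
      (@inner ℝ _ _ (hat p A (Xi q U yb ((1 - t) • q x0 yb + t • q x1 yb)) yb y)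
        (q x1 yb - q x0 yb)) (Icc 0 1) t := by
  set a : ℝ → Euc n := fun t => (1 - t) • q x0 yb + t • q x1 yb with ha
  have hmaps : MapsTo a (Icc 0 1) ((fun x => q x yb) '' closure U) := fun s hs =>
    P.q_conv yb hyb (mem_image_of_mem _ h0) (mem_image_of_mem _ h1) (sub_nonneg.2 hs.2) hs.1 (by ring)
  have hda : HasDerivWithinAt a (q x1 yb - q x0 yb) (Icc 0 1) t := by
    have h1 : HasDerivAt a ((-1 : ℝ) • q x0 yb + (1 : ℝ) • q x1 yb) t := by
      refine HasDerivAt.add ?_ ?_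
      · exact ((hasDerivAt_id t).const_sub 1).smul_const _
      · exact (hasDerivAt_id t).smul_const _
    have h2 : (-1 : ℝ) • q x0 yb + (1 : ℝ) • q x1 yb = q x1 yb - q x0 yb := by
      rw [neg_one_smul, one_smul]; abel
    rw [h2] at h1
    exact h1.hasDerivWithinAt
  have hX := (P.Xi_deriv hyb (hmaps ht)).comp_hasDerivWithinAt t hda hmaps
  set x := Xi q U yb (a t) with hx
  have hc : HasFDerivAt (fun x' => c x' yb - c x' y)
      (-(innerSL ℝ (p x yb)) - -(innerSL ℝ (p x y))) x := (P.c_x x hU yb hyb).sub (P.c_x x hU y hy)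
  have := hc.comp_hasDerivWithinAt t hX
  refine this.congr_deriv ?_
  simp only [hat, ContinuousLinearMap.adjoint_inner_left]
  simp [inner_sub_left]
  ring

theorem Pkg.seg_eq (P : Pkg n c U V p q A C0) {yb x0 : Euc n} (hyb : yb ∈ closure V)
    (h0 : x0 ∈ closure U) (x1 : Euc n) : Xi q U yb ((1 - (0:ℝ)) • q x0 yb + (0:ℝ) • q x1 yb) = x0 := by
  simpa using P.Xi_q h0 hyb
theorem Pkg.seg_eq1 (P : Pkg n c U V p q A C0) {yb x1 : Euc n} (hyb : yb ∈ closure V)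
    (h1 : x1 ∈ closure U) (x0 : Euc n) : Xi q U yb ((1 - (1:ℝ)) • q x0 yb + (1:ℝ) • q x1 yb) = x1 := by
  simpa using P.Xi_q h1 hyb

/-- slope at the initial point -/
theorem Pkg.slope0 (P : Pkg n c U V p q A C0) {yb y x0 x1 : Euc n}
    (hyb : yb ∈ closure V) (hy : y ∈ closure V) (h0 : x0 ∈ U) (h1 : x1 ∈ closure U)
    (hpos : 0 < @inner ℝ _ _ (hat p A x0 yb y) (q x1 yb - q x0 yb)) :
    @inner ℝ _ _ (hat p A x0 yb y) (q x1 yb - q x0 yb) ≤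
      Real.exp (C0 * ‖x1 - x0‖ * ‖y - yb‖) * ((c x1 yb - c x1 y) - (c x0 yb - c x0 y)) := by
  have h0' := subset_closure h0
  set X : ℝ → Euc n := fun t => Xi q U yb ((1 - t) • q x0 yb + t • q x1 yb) with hX
  have hX0 : X 0 = x0 := P.seg_eq hyb h0' x1
  set f : ℝ → ℝ := fun t => c (X t) yb - c (X t) y with hf
  set a := @inner ℝ _ _ (hat p A x0 yb y) (q x1 yb - q x0 yb) with ha
  have hd : HasDerivWithinAt f a (Icc 0 1) 0 := by
    have := P.seg_deriv (t := 0) hyb hy h0' h1 (by simp) (by rw [P.seg_eq hyb h0' x1]; exact h0)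
    rw [P.seg_eq hyb h0' x1] at this
    exact this
  have hd' : HasDerivWithinAt f a (Ioi 0) 0 :=
    (hd.mono_of_mem_nhdsWithin (by exact Icc_mem_nhdsGE one_pos : Icc (0:ℝ) 1 ∈ 𝓝[≥] 0)).mono Ioi_subset_Ici_self
  have hs := (hasDerivWithinAt_iff_tendsto_slope' (by simp)).1 hd'
  set M := Real.exp (C0 * ‖x1 - x0‖ * ‖y - yb‖) with hM
  have hMpos : 0 < M := Real.exp_pos _
  set D := (c x1 yb - c x1 y) - (c x0 yb - c x0 y) with hD
  -- for small t
  have hev : ∀ᶠ t in 𝓝[>] (0:ℝ), (1 - t) * slope f 0 t ≤ M * (D - t * slope f 0 t) := by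
    have e1 : ∀ᶠ t in 𝓝[>] (0:ℝ), 0 < slope f 0 t := hs.eventually (lt_mem_nhds hpos)
    have e2 : ∀ᶠ t in 𝓝[>] (0:ℝ), t ∈ Ioo (0:ℝ) 1 := Ioo_mem_nhdsGT one_pos
    filter_upwards [e1, e2] with t ht1 ht2
    have hmem : ((1 - t) • q x0 yb + t • q x1 yb) ∈ (fun x => q x yb) '' closure U :=
      P.q_conv yb hyb (mem_image_of_mem _ h0') (mem_image_of_mem _ h1)
        (sub_nonneg.2 ht2.2.le) ht2.1.le (by ring)
    have hft : f t - f 0 = t * slope f 0 t := by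
      rw [slope_def_field]; field_simp [ht2.1.ne']; ring
    have hQ := P.QQx yb hyb y hy x0 h0' x1 h1 (X t) (Xi_mem hmem) t ht2.1 ht2.2 (Xi_eq hmem) (by
      have : f 0 < f t := by
        have := mul_pos ht2.1 ht1
        linarith
      simpa [hf, hX0] using this)
    have hf0 : f 0 = c x0 yb - c x0 y := by simp [hf, hX0]
    rw [← hf0] at hQ
    change (1 - t) * (f t - f 0) ≤ M * t * ((c x1 yb - c x1 y) - f t) at hQ
    have h3 : (c x1 yb - c x1 y) - f t = D - t * slope f 0 t := by
      rw [← hft, hf0, hD]; ring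
    rw [hft, h3] at hQ
    have : t * ((1 - t) * slope f 0 t) ≤ t * (M * (D - t * slope f 0 t)) := by linarith
    exact le_of_mul_le_mul_left this ht2.1
  have ht : Tendsto (fun t : ℝ => t) (𝓝[>] (0:ℝ)) (𝓝 0) := tendsto_nhdsWithin_of_tendsto_nhds tendsto_id
  have l1 : Tendsto (fun t => (1 - t) * slope f 0 t) (𝓝[>] (0:ℝ)) (𝓝 ((1 - 0) * a)) :=
    (tendsto_const_nhds.sub ht).mul hs
  have l2 : Tendsto (fun t => M * (D - t * slope f 0 t)) (𝓝[>] (0:ℝ)) (𝓝 (M * (D - 0 * a))) :=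
    tendsto_const_nhds.mul (tendsto_const_nhds.sub (ht.mul hs))
  have := le_of_tendsto_of_tendsto l1 l2 hev
  simpa using this

/-- slope at the end point -/
theorem Pkg.slope1 (P : Pkg n c U V p q A C0) {yb y x0 x1 : Euc n}
    (hyb : yb ∈ closure V) (hy : y ∈ closure V) (h0 : x0 ∈ closure U) (h1 : x1 ∈ U)
    (hpos : c x0 yb - c x0 y < c x1 yb - c x1 y) :
    ((c x1 yb - c x1 y) - (c x0 yb - c x0 y)) ≤ Real.exp (C0 * ‖x1 - x0‖ * ‖y - yb‖) *
    @inner ℝ _ _ (hat p A x1 yb y) (q x1 yb - q x0 yb) := by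
  have h1' := subset_closure h1
  set X : ℝ → Euc n := fun t => Xi q U yb ((1 - t) • q x0 yb + t • q x1 yb) with hX
  have hX0 : X 0 = x0 := P.seg_eq hyb h0 x1
  have hX1 : X 1 = x1 := P.seg_eq1 hyb h1' x0
  set f : ℝ → ℝ := fun t => c (X t) yb - c (X t) y with hf
  set a := @inner ℝ _ _ (hat p A x1 yb y) (q x1 yb - q x0 yb) with ha
  have hd : HasDerivWithinAt f a (Icc 0 1) 1 := by
    have := P.seg_deriv (t := 1) hyb hy h0 h1' (by simp) (by rw [P.seg_eq1 hyb h1' x0]; exact h1)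
    rw [P.seg_eq1 hyb h1' x0] at this
    exact this
  have hd' : HasDerivWithinAt f a (Iio 1) 1 :=
    (hd.mono_of_mem_nhdsWithin (by exact Icc_mem_nhdsLE one_pos : Icc (0:ℝ) 1 ∈ 𝓝[≤] 1)).mono Iio_subset_Iic_self
  have hs := (hasDerivWithinAt_iff_tendsto_slope' (by simp)).1 hd'
  set M := Real.exp (C0 * ‖x1 - x0‖ * ‖y - yb‖) with hM
  have hMpos : 0 < M := Real.exp_pos _
  have hf0 : f 0 = c x0 yb - c x0 y := by simp [hf, hX0]
  have hf1 : f 1 = c x1 yb - c x1 y := by simp [hf, hX1]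
  rw [← hf0, ← hf1] at hpos ⊢
  have hcont : Tendsto f (𝓝[<] 1) (𝓝 (f 1)) := hd'.continuousWithinAt
  have hev : ∀ᶠ t in 𝓝[<] (1:ℝ), f t - f 0 ≤ M * t * slope f 1 t := by
    have e1 : ∀ᶠ t in 𝓝[<] (1:ℝ), f 0 < f t := hcont.eventually (lt_mem_nhds hpos)
    have e2 : ∀ᶠ t in 𝓝[<] (1:ℝ), t ∈ Ioo (0:ℝ) 1 := Ioo_mem_nhdsLT one_pos
    filter_upwards [e1, e2] with t ht1 ht2
    have hmem : ((1 - t) • q x0 yb + t • q x1 yb) ∈ (fun x => q x yb) '' closure U :=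
      P.q_conv yb hyb (mem_image_of_mem _ h0) (mem_image_of_mem _ h1')
        (sub_nonneg.2 ht2.2.le) ht2.1.le (by ring)
    have hQ := P.QQx yb hyb y hy x0 h0 x1 h1' (X t) (Xi_mem hmem) t ht2.1 ht2.2 (Xi_eq hmem) (by
      rw [hf0] at ht1; exact ht1)
    rw [← hf0, ← hf1] at hQ
    change (1 - t) * (f t - f 0) ≤ M * t * (f 1 - f t) at hQ
    have hpos' : 0 < 1 - t := by linarith [ht2.2]
    have hft : f 1 - f t = (1 - t) * slope f 1 t := by
      rw [slope_def_field]
      have : t - 1 ≠ 0 := by linarith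
      field_simp; ring
    rw [hft] at hQ
    have : (1 - t) * (f t - f 0) ≤ (1 - t) * (M * t * slope f 1 t) := by linarith
    exact le_of_mul_le_mul_left this hpos'
  have ht : Tendsto (fun t : ℝ => t) (𝓝[<] (1:ℝ)) (𝓝 1) := tendsto_nhdsWithin_of_tendsto_nhds tendsto_id
  have l1 : Tendsto (fun t => f t - f 0) (𝓝[<] (1:ℝ)) (𝓝 (f 1 - f 0)) := hcont.sub_const _
  have l2 : Tendsto (fun t => M * t * slope f 1 t) (𝓝[<] (1:ℝ)) (𝓝 (M * 1 * a)) :=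
    (tendsto_const_nhds.mul ht).mul hs
  have := le_of_tendsto_of_tendsto l1 l2 hev
  simpa using this

end slopes
end FKM

open Set MeasureTheory Metric Bornology
open scoped ENNReal NNReal Pointwise
namespace FKM
open Filter Topology
section compare
variable {n : ℕ} {c : Euc n → Euc n → ℝ} {U V : Set (Euc n)} {p q : Euc n → Euc n → Euc n}
  {A : Euc n → Euc n → Euc n →L[ℝ] Euc n} {C0 : ℝ}

theorem Pkg0.lipX (P : Pkg0 n c U V p q A) : ∃ L : ℝ, 0 < L ∧ ∀ y ∈ closure V, ∀ x ∈ closure U,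
    ∀ x' ∈ closure U, ‖x - x'‖ ≤ L * ‖q x y - q x' y‖ := by
  obtain ⟨B, hB, h⟩ := P.Ai_bound
  refine ⟨B, hB, fun y hy x hx x' hx' => ?_⟩
  have := Convex.norm_image_sub_le_of_norm_hasFDerivWithin_le (f := Xi q U y)
    (s := (fun x => q x y) '' closure U) (C := B)
    (fun a ha => P.Xi_deriv hy ha) (fun a ha => (h _ (Xi_mem ha) y hy).2) (P.q_conv y hy)
    (mem_image_of_mem _ hx') (mem_image_of_mem _ hx)
  simpa [P.Xi_q hx hy, P.Xi_q hx' hy] using this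

theorem Pkg0.lipY (P : Pkg0 n c U V p q A) : ∃ L : ℝ, 0 < L ∧ ∀ x ∈ closure U, ∀ y ∈ closure V,
    ∀ y' ∈ closure V, ‖y - y'‖ ≤ L * ‖p x y - p x y'‖ := P.swap.lipX

theorem adj_inv {L : Euc n →L[ℝ] Euc n} (h : Function.Injective L) :
    (ContinuousLinearMap.adjoint L).inverse = ContinuousLinearMap.adjoint L.inverse := by
  have hl : L ∘L L.inverse = ContinuousLinearMap.id ℝ _ := by ext v; simp [inverse_right h]
  have hr : L.inverse ∘L L = ContinuousLinearMap.id ℝ _ := by ext v; simp [inverse_left h]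
  apply ContinuousLinearMap.inverse_eq
  · rw [← ContinuousLinearMap.adjoint_comp, hr, ContinuousLinearMap.adjoint_id]
  · rw [← ContinuousLinearMap.adjoint_comp, hl, ContinuousLinearMap.adjoint_id]

theorem Pkg0.Ai_swap (P : Pkg0 n c U V p q A) {x y : Euc n} (hx : x ∈ closure U)
    (hy : y ∈ closure V) :
    Ai (fun y x => ContinuousLinearMap.adjoint (A x y)) y x = ContinuousLinearMap.adjoint (Ai A x y) :=
  adj_inv (P.A_inv x hx y hy)

/-- the error operator -/
noncomputable def FF (A : Euc n → Euc n → Euc n →L[ℝ] Euc n)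
    (z : (Euc n × Euc n) × (Euc n × Euc n)) : Euc n →L[ℝ] Euc n :=
  Ai A z.1.1 z.2.2 ∘L A z.1.2 z.2.2 ∘L Ai A z.1.2 z.2.1 - Ai A z.1.1 z.2.1

theorem Pkg.FF_cont (P : Pkg n c U V p q A C0) :
    ContinuousOn (FF A) ((closure U ×ˢ closure U) ×ˢ (closure V ×ˢ closure V)) := by
  have h1 : ContinuousOn (fun z : (Euc n × Euc n) × (Euc n × Euc n) => Ai A z.1.1 z.2.2)
      ((closure U ×ˢ closure U) ×ˢ (closure V ×ˢ closure V)) :=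
    P.Ai_cont.comp (f := fun z : (Euc n × Euc n) × (Euc n × Euc n) => (z.1.1, z.2.2)) (by fun_prop)
      (fun z hz => ⟨hz.1.1, hz.2.2⟩)
  have h2 : ContinuousOn (fun z : (Euc n × Euc n) × (Euc n × Euc n) => A z.1.2 z.2.2)
      ((closure U ×ˢ closure U) ×ˢ (closure V ×ˢ closure V)) :=
    P.Ac.comp (f := fun z : (Euc n × Euc n) × (Euc n × Euc n) => (z.1.2, z.2.2)) (by fun_prop)
      (fun z hz => ⟨hz.1.2, hz.2.2⟩)
  have h3 : ContinuousOn (fun z : (Euc n × Euc n) × (Euc n × Euc n) => Ai A z.1.2 z.2.1)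
      ((closure U ×ˢ closure U) ×ˢ (closure V ×ˢ closure V)) :=
    P.Ai_cont.comp (f := fun z : (Euc n × Euc n) × (Euc n × Euc n) => (z.1.2, z.2.1)) (by fun_prop)
      (fun z hz => ⟨hz.1.2, hz.2.1⟩)
  have h4 : ContinuousOn (fun z : (Euc n × Euc n) × (Euc n × Euc n) => Ai A z.1.1 z.2.1)
      ((closure U ×ˢ closure U) ×ˢ (closure V ×ˢ closure V)) :=
    P.Ai_cont.comp (f := fun z : (Euc n × Euc n) × (Euc n × Euc n) => (z.1.1, z.2.1)) (by fun_prop)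
      (fun z hz => ⟨hz.1.1, hz.2.1⟩)
  exact (h1.clm_comp (h2.clm_comp h3)).sub h4

theorem Pkg.FF_small (P : Pkg n c U V p q A C0) {ε : ℝ} (hε : 0 < ε) : ∃ δ > 0,
    ∀ x ∈ closure U, ∀ x' ∈ closure U, ∀ yb ∈ closure V, ∀ y ∈ closure V,
      (‖x - x'‖ < δ ∨ ‖y - yb‖ < δ) → ‖FF A ((x, x'), (yb, y))‖ ≤ ε := by
  have hc : IsCompact ((closure U ×ˢ closure U) ×ˢ (closure V ×ˢ closure V)) :=
    (P.compU.prod P.compU).prod (P.compV.prod P.compV)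
  have hu := hc.uniformContinuousOn_of_continuous P.FF_cont
  rw [Metric.uniformContinuousOn_iff] at hu
  obtain ⟨δ, hδ, h⟩ := hu ε hε
  refine ⟨δ, hδ, fun x hx x' hx' yb hyb y hy hor => ?_⟩
  rcases hor with hor | hor
  · have h0 : FF A ((x, x), (yb, y)) = 0 := by
      ext1 v
      simp [FF, P.Ai_left hx hy]
    have := h ((x, x'), (yb, y)) ⟨⟨hx, hx'⟩, ⟨hyb, hy⟩⟩ ((x, x), (yb, y)) ⟨⟨hx, hx⟩, ⟨hyb, hy⟩⟩ (by
      simp [Prod.dist_eq, dist_eq_norm, norm_sub_rev x' x, hor, hδ])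
    rw [h0, dist_zero_right] at this
    exact this.le
  · have h0 : FF A ((x, x'), (yb, yb)) = 0 := by
      ext1 v
      simp [FF, P.Ai_right hx' hyb]
    have := h ((x, x'), (yb, y)) ⟨⟨hx, hx'⟩, ⟨hyb, hy⟩⟩ ((x, x'), (yb, yb)) ⟨⟨hx, hx'⟩, ⟨hyb, hyb⟩⟩ (by
      simp [Prod.dist_eq, dist_eq_norm, hor, hδ])
    rw [h0, dist_zero_right] at this
    exact this.le

theorem Pkg.hat_compare (P : Pkg n c U V p q A C0) {ε : ℝ} (hε : 0 < ε) : ∃ δ > 0,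
    ∀ x ∈ closure U, ∀ x' ∈ closure U, ∀ yb ∈ closure V, ∀ y ∈ closure V,
      (‖x - x'‖ < δ ∨ ‖hat p A x yb y‖ < δ) →
        ‖hat p A x' yb y - hat p A x yb y‖ ≤ ε * ‖hat p A x yb y‖ := by
  obtain ⟨B, hB, hBb⟩ := P.Ai_bound
  obtain ⟨L, hL, hLip⟩ := P.lipY
  obtain ⟨δ, hδ, h⟩ := P.FF_small (div_pos hε hB)
  have hp : ∀ x ∈ closure U, ∀ yb ∈ closure V, ∀ y, ‖p x y - p x yb‖ ≤ B * ‖hat p A x yb y‖ := by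
    intro x hx yb hyb y
    have h1 : p x y - p x yb = ContinuousLinearMap.adjoint (A x yb) (hat p A x yb y) := by
      have : ContinuousLinearMap.adjoint (A x yb) ∘L ContinuousLinearMap.adjoint (Ai A x yb)
          = ContinuousLinearMap.id ℝ _ := by
        rw [← ContinuousLinearMap.adjoint_comp]
        have : Ai A x yb ∘L A x yb = ContinuousLinearMap.id ℝ _ := by
          ext1 v; simp [P.Ai_left hx hyb]
        rw [this, ContinuousLinearMap.adjoint_id]
      have := congrArg (fun T => T (p x y - p x yb)) this
      simpa [hat] using this.symm
    rw [h1]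
    refine (ContinuousLinearMap.le_opNorm _ _).trans ?_
    gcongr
    rw [LinearIsometryEquiv.norm_map]
    exact (hBb x hx yb hyb).1
  refine ⟨min δ (δ / (L * B)), by positivity, fun x hx x' hx' yb hyb y hy hor => ?_⟩
  set K := (fun y => p x y) '' closure V with hK
  set Y := Xi (fun y x => p x y) V x with hY
  set L0 := ContinuousLinearMap.adjoint (Ai A x yb)
  set L1 := ContinuousLinearMap.adjoint (Ai A x' yb)
  set T := segment ℝ (p x yb) (p x y) with hT
  have hTK : T ⊆ K := (P.p_conv x hx).segment_subset (mem_image_of_mem _ hyb) (mem_image_of_mem _ hy)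
  have hder : ∀ a ∈ T, HasFDerivWithinAt (fun a => L1 (p x' (Y a)) - L0 a)
      (ContinuousLinearMap.adjoint (FF A ((x, x'), (yb, Y a)))) T a := by
    intro a ha
    have hYm : Y a ∈ closure V := Xi_mem (hTK ha)
    have d1 : HasFDerivWithinAt Y (ContinuousLinearMap.adjoint (Ai A x (Y a))) K a := by
      have := P.swap.Xi_deriv hx (hTK ha)
      rw [P.Ai_swap hx hYm] at this
      exact this
    have d2 := (P.p_y x' hx' (Y a) hYm)
    have d3 := (d2.comp a d1 (fun b hb => Xi_mem hb)).mono hTK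
    have d4 := (L1.hasFDerivAt.comp_hasFDerivWithinAt a d3).sub (L0.hasFDerivWithinAt (s := T) (x := a))
    refine d4.congr_fderiv ?_
    simp only [FF, map_sub, ContinuousLinearMap.adjoint_comp, L0, L1]
    rfl
  have hbd : ∀ a ∈ T, ‖ContinuousLinearMap.adjoint (FF A ((x, x'), (yb, Y a)))‖ ≤ ε / B := by
    intro a ha
    have hYm : Y a ∈ closure V := Xi_mem (hTK ha)
    rw [LinearIsometryEquiv.norm_map]
    refine h x hx x' hx' yb hyb _ hYm ?_
    rcases hor with hor | hor
    · left; exact hor.trans_le (min_le_left _ _)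
    · right
      have e1 := hLip x hx _ hYm _ hyb
      have e2 : p x (Y a) = a := Xi_eq (q := fun y x => p x y) (U := V) (y := x) (hTK ha)
      rw [e2] at e1
      have e3 : ‖a - p x yb‖ ≤ ‖p x y - p x yb‖ := by
        rw [← dist_eq_norm, ← dist_eq_norm]
        have ha' := ha
        rw [hT, segment_eq_image_lineMap] at ha'
        obtain ⟨s, ⟨hs0, hs1⟩, rfl⟩ := ha'
        rw [dist_lineMap_left, Real.norm_eq_abs, abs_of_nonneg hs0, dist_comm (p x y)]
        exact mul_le_of_le_one_left dist_nonneg hs1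
      have e4 := hp x hx yb hyb y
      have e5 : ‖hat p A x yb y‖ < δ / (L * B) := hor.trans_le (min_le_right _ _)
      calc ‖Y a - yb‖ ≤ L * ‖a - p x yb‖ := e1
        _ ≤ L * (B * ‖hat p A x yb y‖) := by gcongr; exact e3.trans e4
        _ = (L * B) * ‖hat p A x yb y‖ := by ring
        _ < (L * B) * (δ / (L * B)) := by gcongr
        _ = δ := by field_simp
  have hfin := Convex.norm_image_sub_le_of_norm_hasFDerivWithin_le hder hbd (convex_segment _ _)
    (left_mem_segment ℝ _ _) (right_mem_segment ℝ _ _)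
  have hY1 : Y (p x y) = y := P.swap.Xi_q hy hx
  have hY2 : Y (p x yb) = yb := P.swap.Xi_q hyb hx
  rw [hY1, hY2] at hfin
  have e6 : hat p A x' yb y - hat p A x yb y = L1 (p x' y) - L0 (p x y) - (L1 (p x' yb) - L0 (p x yb)) := by
    simp only [hat, L0, L1, map_sub]; abel
  rw [e6]
  refine hfin.trans ?_
  calc ε / B * ‖p x y - p x yb‖ ≤ ε / B * (B * ‖hat p A x yb y‖) := by
        gcongr; exact hp x hx yb hyb y
    _ = ε * ‖hat p A x yb y‖ := by field_simp

theorem Pkg.adj_hat (P : Pkg n c U V p q A C0) {x yb : Euc n} (hx : x ∈ closure U)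
    (hyb : yb ∈ closure V) (y : Euc n) :
    ContinuousLinearMap.adjoint (A x yb) (hat p A x yb y) = p x y - p x yb := by
  have : ContinuousLinearMap.adjoint (A x yb) ∘L ContinuousLinearMap.adjoint (Ai A x yb)
      = ContinuousLinearMap.id ℝ _ := by
    rw [← ContinuousLinearMap.adjoint_comp]
    have : Ai A x yb ∘L A x yb = ContinuousLinearMap.id ℝ _ := by
      ext1 v; simp [P.Ai_left hx hyb]
    rw [this, ContinuousLinearMap.adjoint_id]
  have := congrArg (fun T => T (p x y - p x yb)) this
  simpa [hat] using this

end compare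
end FKM

open Set MeasureTheory Metric Bornology
open scoped ENNReal NNReal Pointwise

namespace FKM
open Filter Topology

/-- conjugate pair of potentials -/
structure Pot (n : ℕ) (c : Euc n → Euc n → ℝ) (U V : Set (Euc n)) (u v : Euc n → ℝ) : Prop where
  ge : ∀ x ∈ closure U, ∀ y ∈ closure V, 0 ≤ u x + v y + c x y
  ex : ∀ x ∈ closure U, ∃ y ∈ closure V, u x + v y + c x y = 0
  ey : ∀ y ∈ closure V, ∃ x ∈ closure U, u x + v y + c x y = 0
  uc : ContinuousOn u (closure U)
  vc : ContinuousOn v (closure V)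

/-- contact relation -/
def Con {n : ℕ} (c : Euc n → Euc n → ℝ) (U V : Set (Euc n)) (u v : Euc n → ℝ) (x y : Euc n) : Prop :=
  x ∈ closure U ∧ y ∈ closure V ∧ u x + v y + c x y = 0

section pot
variable {n : ℕ} {c : Euc n → Euc n → ℝ} {U V : Set (Euc n)} {p q : Euc n → Euc n → Euc n}
  {A : Euc n → Euc n → Euc n →L[ℝ] Euc n} {C0 : ℝ} {u v : Euc n → ℝ}

theorem Pot.swap (H : Pot n c U V u v) : Pot n (fun y x => c x y) V U v u where
  ge := fun y hy x hx => by linarith [H.ge x hx y hy]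
  ex := fun y hy => by
    obtain ⟨x, hx, h⟩ := H.ey y hy
    exact ⟨x, hx, by linarith⟩
  ey := fun x hx => by
    obtain ⟨y, hy, h⟩ := H.ex x hx
    exact ⟨y, hy, by linarith⟩
  uc := H.vc
  vc := H.uc

theorem con_swap {x y : Euc n} : Con (fun y x => c x y) V U v u y x ↔ Con c U V u v x y := by
  constructor
  · rintro ⟨h1, h2, h3⟩; exact ⟨h2, h1, by linarith⟩
  · rintro ⟨h1, h2, h3⟩; exact ⟨h2, h1, by linarith⟩

/-- image of a set under the contact relation -/
def Im (c : Euc n → Euc n → ℝ) (U V : Set (Euc n)) (u v : Euc n → ℝ) (X : Set (Euc n)) : Set (Euc n) :=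
  {y | ∃ x ∈ X, Con c U V u v x y}

theorem Pot.graph_compact (H : Pot n c U V u v) (P : Pkg n c U V p q A C0) :
    IsCompact {z : Euc n × Euc n | Con c U V u v z.1 z.2} := by
  have hS := P.compS
  have hf : ContinuousOn (fun z : Euc n × Euc n => u z.1 + v z.2 + Function.uncurry c z)
      (closure U ×ˢ closure V) := by
    refine ((H.uc.comp continuousOn_fst (fun z hz => hz.1)).add
      (H.vc.comp continuousOn_snd (fun z hz => hz.2))).add P.cc
  have h2 := hf.preimage_isClosed_of_isClosed hS.isClosed (isClosed_singleton (x := (0:ℝ)))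
  have : {z : Euc n × Euc n | Con c U V u v z.1 z.2} = (closure U ×ˢ closure V) ∩
      (fun z : Euc n × Euc n => u z.1 + v z.2 + Function.uncurry c z) ⁻¹' {0} := by
    ext ⟨x, y⟩
    simp [Con, Function.uncurry, and_assoc]
  rw [this]
  exact hS.of_isClosed_subset h2 inter_subset_left

theorem Pot.Im_compact (H : Pot n c U V u v) (P : Pkg n c U V p q A C0) {X : Set (Euc n)}
    (hX : IsClosed X) : IsCompact (Im c U V u v X) := by
  have h := (H.graph_compact P).inter_right (hX.preimage continuous_fst)
  have h2 := h.image continuous_snd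
  convert h2 using 1
  ext y
  constructor
  · rintro ⟨x, hx, h⟩; exact ⟨(x, y), ⟨h, hx⟩, rfl⟩
  · rintro ⟨⟨x, y'⟩, ⟨h, hx⟩, rfl⟩; exact ⟨x, hx, h⟩

theorem Pot.con_of_support (H : Pot n c U V u v) {x y : Euc n} (hx : x ∈ closure U)
    (hy : y ∈ closure V) (h : ∀ z ∈ closure U, u x + c x y - c z y ≤ u z) : Con c U V u v x y := by
  obtain ⟨z, hz, e⟩ := H.ey y hy
  refine ⟨hx, hy, le_antisymm ?_ (H.ge x hx y hy)⟩
  linarith [h z hz]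

theorem Pot.support (H : Pot n c U V u v) {x y z : Euc n} (h : Con c U V u v x y)
    (hz : z ∈ closure U) : u x + c x y - c z y ≤ u z := by
  linarith [h.2.2, H.ge z hz y h.2.1]

theorem Pot.con_seg (H : Pot n c U V u v) (P : Pkg n c U V p q A C0) {x y0 y1 y : Euc n} {t : ℝ}
    (h0 : Con c U V u v x y0) (h1 : Con c U V u v x y1) (hy : y ∈ closure V) (ht0 : 0 ≤ t)
    (ht1 : t ≤ 1) (h : p x y = (1 - t) • p x y0 + t • p x y1) : Con c U V u v x y := by
  refine H.con_of_support h0.1 hy fun z hz => ?_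
  have := P.dasmY h0.1 hz h0.2.1 h1.2.1 hy ht0 ht1 h
  have e0 := H.support h0 hz
  have e1 := H.support h1 hz
  rcases le_max_iff.1 this with h | h <;> linarith

theorem Pot.sub_convex (H : Pot n c U V u v) (P : Pkg n c U V p q A C0) {x : Euc n} :
    Convex ℝ {a | ∃ y, Con c U V u v x y ∧ a = p x y} := by
  rintro a ⟨y0, h0, rfl⟩ b ⟨y1, h1, rfl⟩ s t hs ht hst
  obtain ⟨y, hy, e⟩ := P.exY h0.1 h0.2.1 h1.2.1 ht (by linarith)
  obtain rfl : s = 1 - t := by linarith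
  exact ⟨y, H.con_seg P h0 h1 hy ht (by linarith) e, e.symm⟩

theorem Pot.sub_compact (H : Pot n c U V u v) (P : Pkg n c U V p q A C0) {x : Euc n}
    (hx : x ∈ closure U) :
    IsCompact {a | ∃ y, Con c U V u v x y ∧ a = p x y} := by
  have h := H.Im_compact P (isClosed_singleton (x := x))
  have h2 := h.image_of_continuousOn (f := fun y => p x y)
    ((contOn_right P.pc hx).mono (by rintro y ⟨x, -, h⟩; exact h.2.1))
  convert h2 using 1
  ext a
  constructor
  · rintro ⟨y, h, rfl⟩; exact ⟨y, ⟨x, rfl, h⟩, rfl⟩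
  · rintro ⟨y, ⟨_, rfl, h'⟩, rfl⟩; exact ⟨y, h', rfl⟩

/-- sections are c-convex -/
theorem Pot.sec_conv (H : Pot n c U V u v) (P : Pkg n c U V p q A C0) {yb x0 x1 x : Euc n} {t b : ℝ}
    (hyb : yb ∈ closure V) (h0 : x0 ∈ closure U) (h1 : x1 ∈ closure U) (hx : x ∈ closure U)
    (ht0 : 0 ≤ t) (ht1 : t ≤ 1) (h : q x yb = (1 - t) • q x0 yb + t • q x1 yb)
    (e0 : u x0 + c x0 yb ≤ b) (e1 : u x1 + c x1 yb ≤ b) : u x + c x yb ≤ b := by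
  obtain ⟨y, hy, e⟩ := H.ex x hx
  have := P.dasmX hyb hy h0 h1 hx ht0 ht1 h
  have g0 := H.ge x0 h0 y hy
  have g1 := H.ge x1 h1 y hy
  rcases le_max_iff.1 this with h | h <;> linarith

theorem Pot.near (H : Pot n c U V u v) (P : Pkg n c U V p q A C0) {z d : Euc n} {a : ℝ}
    (hz : z ∈ U) (h : ∀ y, Con c U V u v z y → @inner ℝ _ _ (p z y) d < a) :
    ∃ δ > 0, ball z δ ⊆ U ∧ ∀ x ∈ ball z δ, ∀ x' ∈ ball z δ, ∀ y, Con c U V u v x y →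
      @inner ℝ _ _ (p x' y) d < a := by
  have hc : IsCompact ({w : Euc n × Euc n | Con c U V u v w.1 w.2} ×ˢ closure U) :=
    (H.graph_compact P).prod P.compU
  have hf : ContinuousOn (fun w : (Euc n × Euc n) × Euc n => (@inner ℝ _ _ (p w.2 w.1.2) d : ℝ))
      ({w : Euc n × Euc n | Con c U V u v w.1 w.2} ×ˢ closure U) := by
    refine ContinuousOn.inner ?_ continuousOn_const
    exact P.pc.comp (f := fun w : (Euc n × Euc n) × Euc n => (w.2, w.1.2)) (by fun_prop)
      (fun w hw => ⟨hw.2, hw.1.2.1⟩)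
  have h2 := hf.preimage_isClosed_of_isClosed hc.isClosed (isClosed_Ici (a := a))
  have h3 := hc.of_isClosed_subset h2 inter_subset_left
  have h4 := (h3.image (f := fun w : (Euc n × Euc n) × Euc n => (w.1.1, w.2)) (by fun_prop)).isClosed
  have h5 : (z, z) ∉ (fun w : (Euc n × Euc n) × Euc n => (w.1.1, w.2)) ''
      ({w : Euc n × Euc n | Con c U V u v w.1 w.2} ×ˢ closure U ∩
      (fun w : (Euc n × Euc n) × Euc n => (@inner ℝ _ _ (p w.2 w.1.2) d : ℝ)) ⁻¹' Ici a) := by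
    rintro ⟨⟨⟨x, y⟩, x'⟩, ⟨⟨hw, -⟩, hw2⟩, hw3⟩
    simp only [Prod.mk.injEq] at hw3
    obtain ⟨rfl, rfl⟩ := hw3
    exact absurd (h y hw) (not_lt.2 hw2)
  have h6 := h4.isOpen_compl.mem_nhds h5
  obtain ⟨δ, hδ, hb⟩ := Metric.mem_nhds_iff.1 h6
  obtain ⟨δ', hδ', hb'⟩ := Metric.mem_nhds_iff.1 (P.oU.mem_nhds hz)
  refine ⟨min δ δ', lt_min hδ hδ', (ball_subset_ball (min_le_right _ _)).trans hb', ?_⟩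
  intro x hx x' hx' y hy
  by_contra hcon
  have hxx : (x, x') ∈ ball (z, z) δ := by
    rw [← ball_prod_same]
    exact ⟨ball_subset_ball (min_le_left _ _) hx, ball_subset_ball (min_le_left _ _) hx'⟩
  exact hb hxx ⟨⟨⟨x, y⟩, x'⟩, ⟨⟨hy, subset_closure (hb' (ball_subset_ball (min_le_right _ _) hx'))⟩,
    not_lt.1 hcon⟩, rfl⟩

/-- derivative of cost along a straight line -/
theorem Pkg.line_deriv (P : Pkg n c U V p q A C0) {z d y : Euc n} {t : ℝ} (hz : z + t • d ∈ U)
    (hy : y ∈ closure V) :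
    HasDerivAt (fun t : ℝ => c (z + t • d) y) (-(@inner ℝ _ _ (p (z + t • d) y) d)) t := by
  have h1 : HasDerivAt (fun t : ℝ => z + t • d) d t := by
    simpa using ((hasDerivAt_id t).smul_const d).const_add z
  have := (P.c_x _ hz y hy).comp_hasDerivAt t h1
  have e : (-(innerSL ℝ (p (z + t • d) y))) d = -(@inner ℝ _ _ (p (z + t • d) y) d) := by
    simp [innerSL_apply_apply]
  rw [e] at this
  exact this

theorem Pkg.line_mvt (P : Pkg n c U V p q A C0) {z d y : Euc n} {t a : ℝ} (ht : 0 < t)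
    (hz : ∀ s ∈ Icc (0:ℝ) t, z + s • d ∈ U) (hy : y ∈ closure V)
    (h : ∀ s ∈ Icc (0:ℝ) t, @inner ℝ _ _ (p (z + s • d) y) d < a) :
    c z y - c (z + t • d) y < t * a := by
  obtain ⟨s, hs, e⟩ := exists_deriv_eq_slope (fun t : ℝ => c (z + t • d) y) ht
    (fun s hs => (P.line_deriv (hz s hs) hy).continuousAt.continuousWithinAt)
    (fun s hs => (P.line_deriv (hz s (Ioo_subset_Icc_self hs)) hy).differentiableAt.differentiableWithinAt)
  rw [(P.line_deriv (hz s (Ioo_subset_Icc_self hs)) hy).deriv] at e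
  have := h s (Ioo_subset_Icc_self hs)
  rw [eq_div_iff (by linarith)] at e
  simp only [zero_smul, add_zero, sub_zero] at e
  nlinarith

theorem Pot.direction (H : Pot n c U V u v) (P : Pkg n c U V p q A C0) {z d : Euc n} {a : ℝ}
    (hz : z ∈ U) (h : ∀ y, Con c U V u v z y → @inner ℝ _ _ (p z y) d < a) :
    ∃ δ > 0, ∀ t, 0 < t → t < δ → z + t • d ∈ U ∧ u (z + t • d) - u z < t * a := by
  obtain ⟨δ, hδ, hU, hn⟩ := H.near P hz h
  refine ⟨δ / (‖d‖ + 1), by positivity, fun t ht0 ht => ?_⟩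
  have hb : ∀ s ∈ Icc (0:ℝ) t, z + s • d ∈ ball z δ := by
    intro s hs
    rw [mem_ball, dist_eq_norm, add_sub_cancel_left, norm_smul, Real.norm_eq_abs, abs_of_nonneg hs.1]
    rw [lt_div_iff₀ (by positivity)] at ht
    nlinarith [hs.1, hs.2, norm_nonneg d]
  have hzt := hU (hb t ⟨ht0.le, le_rfl⟩)
  refine ⟨hzt, ?_⟩
  obtain ⟨y, hy, e⟩ := H.ex _ (subset_closure hzt)
  have h1 := P.line_mvt ht0 (fun s hs => hU (hb s hs)) hy
    (fun s hs => hn _ (hb t ⟨ht0.le, le_rfl⟩) _ (hb s hs) y ⟨subset_closure hzt, hy, e⟩)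
  linarith [H.ge z (subset_closure hz) y hy]

theorem Pkg.line_lower (P : Pkg n c U V p q A C0) {z d y : Euc n} {a : ℝ} (hz : z ∈ U)
    (hy : y ∈ closure V) (h : a < @inner ℝ _ _ (p z y) d) :
    ∃ δ > 0, ∀ t, 0 < t → t < δ → t * a < c z y - c (z + t • d) y := by
  have h1 : HasDerivAt (fun t : ℝ => c (z + t • d) y) (-(@inner ℝ _ _ (p z y) d)) 0 := by
    have := P.line_deriv (z := z) (d := d) (t := 0) (by simpa using hz) hy
    simpa using this
  have h2 := (hasDerivAt_iff_tendsto_slope.1 h1).eventually (eventually_lt_nhds (b := -a) (by linarith))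
  rw [eventually_nhdsWithin_iff, Metric.eventually_nhds_iff] at h2
  obtain ⟨δ, hδ, h3⟩ := h2
  refine ⟨δ, hδ, fun t ht0 ht => ?_⟩
  have := h3 (y := t) (by simpa [abs_of_pos ht0] using ht) (by simpa using ht0.ne')
  rw [slope_def_field, div_lt_iff₀ (by linarith)] at this
  simp only [zero_smul, add_zero, sub_zero] at this
  linarith

/-- descent direction: if no contact `y` at `z` lies on the ray -/
theorem Pot.descend (H : Pot n c U V u v) (P : Pkg n c U V p q A C0) {z yb w : Euc n}
    (hz : z ∈ U) (hyb : yb ∈ closure V)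
    (h : ∀ y, Con c U V u v z y → ∀ κ : ℝ, 0 ≤ κ → p z y ≠ p z yb + κ • w) :
    ∃ d : Euc n, (w ≠ 0 → 0 < @inner ℝ _ _ w d) ∧ ∃ δ > 0, ∀ t : ℝ, 0 < t → t < δ →
      z + t • d ∈ U ∧ u (z + t • d) + c (z + t • d) yb < u z + c z yb := by
  set D := {a | ∃ y, Con c U V u v z y ∧ a = p z y} with hD
  set R := (fun κ : ℝ => p z yb + κ • w) '' Ici 0 with hR
  have hRc : Convex ℝ R := by
    rintro _ ⟨k1, h1, rfl⟩ _ ⟨k2, h2, rfl⟩ s t hs ht hst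
    refine ⟨s * k1 + t * k2, add_nonneg (mul_nonneg hs h1) (mul_nonneg ht h2), ?_⟩
    have : p z yb = (s + t) • p z yb := by rw [hst, one_smul]
    show p z yb + (s * k1 + t * k2) • w = _
    nth_rewrite 1 [this]
    module
  have hRcl : IsClosed R := by
    by_cases hw : w = 0
    · have : R = {p z yb} := by
        rw [hR, hw]; ext a
        constructor
        · rintro ⟨_, _, h⟩; simpa using h.symm
        · rintro rfl; exact ⟨0, self_mem_Ici, by simp⟩
      rw [this]; exact isClosed_singleton
    · have h1 : IsClosedEmbedding (fun κ : ℝ => κ • w) := isClosedEmbedding_smul_left hw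
      have h2 : IsClosedEmbedding (fun κ : ℝ => p z yb + κ • w) :=
        (Homeomorph.addLeft (p z yb)).isClosedEmbedding.comp h1
      exact h2.isClosedMap _ isClosed_Ici
  have hdis : Disjoint D R := by
    rw [Set.disjoint_left]
    rintro _ ⟨y, hy, rfl⟩ ⟨κ, hκ, e⟩
    exact h y hy κ hκ e.symm
  obtain ⟨f, a, b, hfa, hab, hfb⟩ := geometric_hahn_banach_compact_closed (H.sub_convex P)
    (H.sub_compact P (subset_closure hz)) hRc hRcl hdis
  obtain ⟨d0, rfl⟩ := (InnerProductSpace.toDual ℝ (Euc n)).surjective f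
  simp only [InnerProductSpace.toDual_apply_apply] at hfa hfb
  have hw0 : 0 ≤ @inner ℝ _ _ d0 w := by
    by_contra hneg
    push Not at hneg
    set g := (@inner ℝ _ _ d0 w : ℝ)
    set k := (|@inner ℝ _ _ d0 (p z yb) - b| + 1) / (-g)
    have hk : 0 ≤ k := div_nonneg (by positivity) (by linarith)
    have := hfb _ ⟨k, hk, rfl⟩
    simp only [inner_add_right, inner_smul_right] at this
    have e : k * g = -(|@inner ℝ _ _ d0 (p z yb) - b| + 1) := by
      have : g ≠ 0 := hneg.ne
      simp only [k]; field_simp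
    change b < _ + k * g at this
    rw [e] at this
    linarith [le_abs_self (@inner ℝ _ _ d0 (p z yb) - b)]
  have hyb0 : b < @inner ℝ _ _ d0 (p z yb) := by
    have := hfb _ ⟨0, self_mem_Ici, rfl⟩
    simpa using this
  -- perturb
  obtain ⟨B, hB⟩ := (H.sub_compact P (subset_closure hz)).isBounded.exists_norm_le
  set B' := max B 0 + 1 + ‖p z yb‖
  have hB' : 0 < B' := by positivity
  set ε := (b - a) / 4 / (B' * (‖w‖ + 1)) with hε
  have hε0 : 0 < ε := by
    have : 0 < b - a := by linarith
    positivity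
  have hεw : ε * (‖w‖ * B') ≤ (b - a) / 4 := by
    have : 0 < b - a := by linarith
    rw [hε, div_mul_eq_mul_div, div_le_iff₀ (by positivity)]
    nlinarith [mul_nonneg this.le hB'.le, norm_nonneg w]
  have hin2 : ∀ e : Euc n, ‖e‖ ≤ B' → |@inner ℝ _ _ e (ε • w)| ≤ (b - a) / 4 := by
    intro e he
    refine (abs_real_inner_le_norm _ _).trans ?_
    rw [norm_smul, Real.norm_eq_abs, abs_of_pos hε0]
    calc ‖e‖ * (ε * ‖w‖) ≤ B' * (ε * ‖w‖) := by gcongr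
      _ = ε * (‖w‖ * B') := by ring
      _ ≤ _ := hεw
  refine ⟨d0 + ε • w, fun hw => ?_, ?_⟩
  · rw [inner_add_right, inner_smul_right, real_inner_comm, real_inner_self_eq_norm_sq]
    have : 0 < ‖w‖ := norm_pos_iff.2 hw
    positivity
  have k1 : ∀ y, Con c U V u v z y → @inner ℝ _ _ (p z y) (d0 + ε • w) < (a + b) / 2 := by
    intro y hy
    have e1 := hfa (p z y) ⟨y, hy, rfl⟩
    have e2 := hin2 (p z y) ((hB _ ⟨y, hy, rfl⟩).trans (by
      have := le_max_left B 0
      have := norm_nonneg (p z yb)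
      simp only [B']; linarith))
    rw [inner_add_right, real_inner_comm]
    linarith [le_abs_self (@inner ℝ _ _ (p z y) (ε • w))]
  have k2 : (a + b) / 2 < @inner ℝ _ _ (p z yb) (d0 + ε • w) := by
    have e2 := hin2 (p z yb) (by
      have := le_max_right B 0
      simp only [B']; linarith)
    rw [inner_add_right, real_inner_comm]
    linarith [neg_abs_le (@inner ℝ _ _ (p z yb) (ε • w))]
  obtain ⟨δ1, hδ1, g1⟩ := H.direction P hz k1
  obtain ⟨δ2, hδ2, g2⟩ := P.line_lower hz hyb k2
  refine ⟨min δ1 δ2, lt_min hδ1 hδ2, fun t ht0 ht => ?_⟩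
  have e1 := g1 t ht0 (ht.trans_le (min_le_left _ _))
  have e2 := g2 t ht0 (ht.trans_le (min_le_right _ _))
  exact ⟨e1.1, by linarith [e1.2]⟩

theorem Pot.loc_glob (H : Pot n c U V u v) (P : Pkg n c U V p q A C0) {z y : Euc n}
    (hz : z ∈ U) (hy : y ∈ closure V)
    (h : ∀ᶠ x in 𝓝 z, u z + c z y ≤ u x + c x y) : Con c U V u v z y := by
  by_contra hcon
  obtain ⟨d, -, δ, hδ, hd⟩ := H.descend P (w := 0) hz hy (by
    intro y' hy' κ _ e
    simp only [smul_zero, add_zero] at e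
    have := P.p_inj z (subset_closure hz) hy'.2.1 hy e
    exact hcon (this ▸ hy'))
  have ht : Tendsto (fun t : ℝ => z + t • d) (𝓝[>] 0) (𝓝 z) := by
    have : Tendsto (fun t : ℝ => z + t • d) (𝓝 0) (𝓝 (z + (0:ℝ) • d)) :=
      (by fun_prop : Continuous fun t : ℝ => z + t • d).tendsto 0
    simpa using this.mono_left nhdsWithin_le_nhds
  have h1 := ht.eventually h
  have h2 : ∀ᶠ t in 𝓝[>] (0:ℝ), t ∈ Ioo 0 δ := Ioo_mem_nhdsGT hδ
  obtain ⟨t, ht1, ht2⟩ := (h1.and h2).exists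
  linarith [(hd t ht2.1 ht2.2).2]

end pot

/-! ### potentials from c-convexity -/
section der
variable {n : ℕ} {c : Euc n → Euc n → ℝ} {S T : Set (Euc n)} {u : Euc n → ℝ}

theorem supT (hS : IsCompact S) (hT : IsCompact T) (hne : S.Nonempty)
    (hc : ContinuousOn (Function.uncurry c) (S ×ˢ T)) {m : ℝ} (hm : ∀ x ∈ S, m ≤ u x) :
    (∀ y ∈ T, IsLUB ((fun x => -c x y - u x) '' S) (cStarT n c S u y)) ∧
      ContinuousOn (cStarT n c S u) T := by
  obtain ⟨B, hB⟩ := (hS.prod hT).exists_bound_of_continuousOn hc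
  have h1 : ∀ y ∈ T, IsLUB ((fun x => -c x y - u x) '' S) (cStarT n c S u y) := by
    intro y hy
    refine isLUB_csSup (hne.image _) ⟨B - m, ?_⟩
    rintro _ ⟨x, hx, rfl⟩
    have := hB (x, y) ⟨hx, hy⟩
    have h2 := (abs_le.1 this).1
    simp only [Function.uncurry] at h2
    have := hm x hx
    show -c x y - u x ≤ B - m
    linarith
  refine ⟨h1, ?_⟩
  have hu := (hS.prod hT).uniformContinuousOn_of_continuous hc
  rw [Metric.uniformContinuousOn_iff] at hu
  rw [Metric.continuousOn_iff]
  have key : ∀ ε > 0, ∃ δ > 0, ∀ y ∈ T, ∀ y' ∈ T, dist y y' < δ →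
      cStarT n c S u y ≤ cStarT n c S u y' + ε := by
    intro ε hε
    obtain ⟨δ, hδ, h⟩ := hu ε hε
    refine ⟨δ, hδ, fun y hy y' hy' hd => (h1 y hy).2 ?_⟩
    rintro _ ⟨x, hx, rfl⟩
    have e1 := (h1 y' hy').1 ⟨x, hx, rfl⟩
    have e2 := h (x, y) ⟨hx, hy⟩ (x, y') ⟨hx, hy'⟩ (by simpa [Prod.dist_eq] using hd)
    rw [Real.dist_eq] at e2
    have e3 := (abs_lt.1 e2).1
    simp only [Function.uncurry] at e3
    simp only at e1
    show -c x y - u x ≤ _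
    linarith
  intro y hy ε hε
  obtain ⟨δ, hδ, h⟩ := key (ε / 2) (by positivity)
  refine ⟨δ, hδ, fun y' hy' hd => ?_⟩
  rw [Real.dist_eq, abs_lt]
  have e1 := h y hy y' hy' (by rwa [dist_comm])
  have e2 := h y' hy' y hy hd
  constructor <;> linarith

end der

theorem Pot.of_cconvex {n : ℕ} {c : Euc n → Euc n → ℝ} {U V : Set (Euc n)} {u : Euc n → ℝ}
    (hU : IsCompact (closure U)) (hV : IsCompact (closure V)) (neU : U.Nonempty) (neV : V.Nonempty)
    (hc : ContinuousOn (Function.uncurry c) (closure U ×ˢ closure V))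
    (h : CConvexOn n c (closure U) (closure V) u) :
    Pot n c U V u (cStarT n c (closure U) u) := by
  obtain ⟨B, hB⟩ := (hU.prod hV).exists_bound_of_continuousOn hc
  have hBc : ∀ x ∈ closure U, ∀ y ∈ closure V, -B ≤ c x y ∧ c x y ≤ B := fun x hx y hy =>
    abs_le.1 (hB (x, y) ⟨hx, hy⟩)
  have hbd : ∃ m, ∀ x ∈ closure U, m ≤ u x := by
    by_contra hcon
    push Not at hcon
    have hz : ∀ y ∈ closure V, cStarT n c (closure U) u y = 0 := by
      intro y hy
      refine Real.sSup_of_not_bddAbove ?_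
      rintro ⟨M, hM⟩
      obtain ⟨x, hx, hlt⟩ := hcon (-B - M)
      have := hM ⟨x, hx, rfl⟩
      simp only at this
      linarith [(hBc x hx y hy).2]
    obtain ⟨x, hx, hlt⟩ := hcon (-B)
    have e := h x hx
    obtain ⟨y, hy⟩ := neV.closure
    have : -c x y ≤ u x := by
      rw [e]
      refine le_csSup ⟨B, ?_⟩ ⟨y, hy, by simp [hz y hy]⟩
      rintro _ ⟨y', hy', rfl⟩
      simp only [hz y' hy']
      linarith [(hBc x hx y' hy').1]
    linarith [(hBc x hx y hy).2]
  obtain ⟨m, hm⟩ := hbd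
  obtain ⟨hlub, hvc⟩ := supT hU hV neU.closure hc hm
  set v := cStarT n c (closure U) u with hv
  obtain ⟨m', hm'⟩ := hV.exists_bound_of_continuousOn hvc
  have hc' : ContinuousOn (Function.uncurry fun y x => c x y) (closure V ×ˢ closure U) :=
    uncurry_flip_cont hc
  obtain ⟨hlub2, huc2⟩ := supT (c := fun y x => c x y) (u := v) hV hU neV.closure hc' (m := -m')
    (fun y hy => (abs_le.1 (hm' y hy)).1)
  have hueq : ∀ x ∈ closure U, u x = cStarT n (fun y x => c x y) (closure V) v x := fun x hx => h x hx
  have huc : ContinuousOn u (closure U) := huc2.congr hueq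
  have hge : ∀ x ∈ closure U, ∀ y ∈ closure V, 0 ≤ u x + v y + c x y := by
    intro x hx y hy
    have := (hlub y hy).1 ⟨x, hx, rfl⟩
    simp only at this
    linarith
  refine ⟨hge, fun x hx => ?_, fun y hy => ?_, huc, hvc⟩
  · obtain ⟨y, hy, hmax⟩ := hV.exists_isMaxOn neV.closure
      (f := fun y => -c x y - v y) ((contOn_right hc hx).neg.sub hvc)
    refine ⟨y, hy, le_antisymm ?_ (hge x hx y hy)⟩
    have := (hlub2 x hx).2 (by
      rintro _ ⟨y', hy', rfl⟩
      exact hmax hy')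
    rw [← hueq x hx] at this
    simp only at this
    linarith
  · obtain ⟨x, hx, hmax⟩ := hU.exists_isMaxOn neU.closure
      (f := fun x => -c x y - u x) ((contOn_left hc hy).neg.sub huc)
    refine ⟨x, hx, le_antisymm ?_ (hge x hx y hy)⟩
    have := (hlub y hy).2 (by
      rintro _ ⟨x', hx', rfl⟩
      exact hmax hx')
    simp only at this
    linarith

end FKM

open Set MeasureTheory Metric Bornology
open scoped ENNReal NNReal Pointwise

namespace FKM
open Filter Topology
section vol
variable {n : ℕ} {c : Euc n → Euc n → ℝ} {U V : Set (Euc n)} {p q : Euc n → Euc n → Euc n}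
  {A : Euc n → Euc n → Euc n →L[ℝ] Euc n} {C0 : ℝ}

theorem det_adj (L : Euc n →L[ℝ] Euc n) : (ContinuousLinearMap.adjoint L).det = L.det := by
  have h := LinearMap.toMatrix_adjoint (EuclideanSpace.basisFun (Fin n) ℝ) (EuclideanSpace.basisFun (Fin n) ℝ)
    (L : Euc n →ₗ[ℝ] Euc n)
  have h1 : (ContinuousLinearMap.adjoint L).det = LinearMap.det (LinearMap.adjoint (L : Euc n →ₗ[ℝ] Euc n)) := by
    rw [LinearMap.adjoint_eq_toCLM_adjoint]; rfl
  rw [h1, ← LinearMap.det_toMatrix (EuclideanSpace.basisFun (Fin n) ℝ).toBasis, h,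
    Matrix.det_conjTranspose, LinearMap.det_toMatrix]
  rfl

/-- determinant bounds -/
def Dt (U V : Set (Euc n)) (A : Euc n → Euc n → Euc n →L[ℝ] Euc n) (g1 g2 : ℝ) : Prop :=
  0 < g1 ∧ g1 ≤ g2 ∧ ∀ x ∈ closure U, ∀ y ∈ closure V, g1 ≤ |(A x y).det| ∧ |(A x y).det| ≤ g2

theorem Dt.swap {g1 g2 : ℝ} (h : Dt U V A g1 g2) :
    Dt V U (fun y x => ContinuousLinearMap.adjoint (A x y)) g1 g2 :=
  ⟨h.1, h.2.1, fun y hy x hx => by rw [det_adj]; exact h.2.2 x hx y hy⟩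

theorem det_cont : Continuous fun L : Euc n →L[ℝ] Euc n => L.det :=
  ContinuousLinearMap.continuous_det

theorem det_ne {L : Euc n →L[ℝ] Euc n} (h : Function.Injective L) : L.det ≠ 0 := by
  obtain ⟨e, rfl⟩ := exists_equiv h
  exact e.toLinearEquiv.isUnit_det'.ne_zero

theorem Pkg.exDt (P : Pkg n c U V p q A C0) : ∃ g1 g2, Dt U V A g1 g2 := by
  have hc : ContinuousOn (fun z : Euc n × Euc n => |(Function.uncurry A z).det|)
    (closure U ×ˢ closure V) := (det_cont.comp_continuousOn P.Ac).abs
  have hne : (closure U ×ˢ closure V).Nonempty := P.neU.closure.prod P.neV.closure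
  obtain ⟨a, ha, hmin⟩ := P.compS.exists_isMinOn hne hc
  obtain ⟨b, hb, hmax⟩ := P.compS.exists_isMaxOn hne hc
  refine ⟨_, _, abs_pos.2 (det_ne (P.A_inv a.1 ha.1 a.2 ha.2)), hmin hb, fun x hx y hy =>
    ⟨hmin (mk_mem_prod hx hy), hmax (mk_mem_prod hx hy)⟩⟩

/-- volume comparison in `q` coordinates -/
theorem Pkg.volq (P : Pkg n c U V p q A C0) {g1 g2 : ℝ} (h : Dt U V A g1 g2) {y : Euc n}
    (hy : y ∈ closure V) {X : Set (Euc n)} (hX : MeasurableSet X) (hXU : X ⊆ closure U) :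
    ENNReal.ofReal g1 * volume X ≤ volume ((fun x => q x y) '' X) ∧
      volume ((fun x => q x y) '' X) ≤ ENNReal.ofReal g2 * volume X := by
  rw [← lintegral_abs_det_fderiv_eq_addHaar_image volume hX
    (fun x hx => (P.q_x x (hXU hx) y hy).mono hXU) ((P.q_inj y hy).mono hXU)]
  constructor
  · rw [← setLIntegral_const]
    exact setLIntegral_mono' hX fun x hx => ENNReal.ofReal_le_ofReal (h.2.2 x (hXU hx) y hy).1
  · rw [← setLIntegral_const]
    exact setLIntegral_mono' hX fun x hx => ENNReal.ofReal_le_ofReal (h.2.2 x (hXU hx) y hy).2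

theorem Pkg.volp (P : Pkg n c U V p q A C0) {g1 g2 : ℝ} (h : Dt U V A g1 g2) {x : Euc n}
    (hx : x ∈ closure U) {Y : Set (Euc n)} (hY : MeasurableSet Y) (hYV : Y ⊆ closure V) :
    ENNReal.ofReal g1 * volume Y ≤ volume ((fun y => p x y) '' Y) ∧
      volume ((fun y => p x y) '' Y) ≤ ENNReal.ofReal g2 * volume Y :=
  P.swap.volq h.swap hx hY hYV

/-- Lipschitz comparison between different `p` coordinates -/
theorem Pkg.lipPP (P : Pkg n c U V p q A C0) : ∃ L : ℝ, 0 < L ∧ ∀ x ∈ closure U, ∀ x' ∈ closure U,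
    ∀ y ∈ closure V, ∀ y' ∈ closure V, ‖p x y - p x y'‖ ≤ L * ‖p x' y - p x' y'‖ := by
  obtain ⟨B, hB, hb⟩ := P.Ai_bound
  refine ⟨B * B, by positivity, fun x hx x' hx' y hy y' hy' => ?_⟩
  set K := (fun y => p x' y) '' closure V
  set Y := Xi (fun y x => p x y) V x'
  have := Convex.norm_image_sub_le_of_norm_hasFDerivWithin_le (f := fun a => p x (Y a))
    (f' := fun a => ContinuousLinearMap.adjoint (A x (Y a)) ∘L
      ContinuousLinearMap.adjoint (Ai A x' (Y a)))
    (s := K) (C := B * B) (x := p x' y') (y := p x' y) ?_ ?_ (P.p_conv x' hx')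
    (mem_image_of_mem _ hy') (mem_image_of_mem _ hy)
  · have e1 : Y (p x' y') = y' := P.swap.Xi_q hy' hx'
    have e2 : Y (p x' y) = y := P.swap.Xi_q hy hx'
    simpa only [e1, e2] using this
  · intro a ha
    have hYm : Y a ∈ closure V := Xi_mem ha
    have d1 : HasFDerivWithinAt Y (ContinuousLinearMap.adjoint (Ai A x' (Y a))) K a := by
      have := P.swap.Xi_deriv hx' ha
      rw [P.Ai_swap hx' hYm] at this
      exact this
    exact (P.p_y x hx (Y a) hYm).comp a d1 (fun b hb => Xi_mem hb)
  · intro a ha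
    have hYm : Y a ∈ closure V := Xi_mem ha
    refine (ContinuousLinearMap.opNorm_comp_le _ _).trans ?_
    rw [LinearIsometryEquiv.norm_map, LinearIsometryEquiv.norm_map]
    gcongr
    · exact (hb x hx _ hYm).1
    · exact (hb x' hx' _ hYm).2

/-- slab volumes tend to zero -/
theorem slab_vol (e : Euc n) (he : e ≠ 0) (C C' : ℝ) {η : ℝ≥0∞} (hη : 0 < η) : ∃ ε0 > 0,
    ∀ ε, 0 < ε → ε ≤ ε0 → volume {P : Euc n | ‖P‖ ≤ C ∧ |@inner ℝ _ _ P e| ≤ C' * ε} < η := by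
  set S : ℕ → Set (Euc n) := fun k => {P : Euc n | ‖P‖ ≤ C ∧ |@inner ℝ _ _ P e| ≤ |C'| * (1 / ((k:ℝ) + 1))}
  have hcl : ∀ k, IsClosed (S k) := by
    intro k
    have h1 : IsClosed {P : Euc n | ‖P‖ ≤ C} := isClosed_le (by fun_prop) (by fun_prop)
    have h2 : IsClosed {P : Euc n | |@inner ℝ _ _ P e| ≤ |C'| * (1 / ((k:ℝ) + 1))} :=
      isClosed_le (by fun_prop) (by fun_prop)
    exact h1.inter h2
  have hanti : Antitone S := by
    intro k l hkl P hP
    refine ⟨hP.1, hP.2.trans ?_⟩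
    have := one_div_le_one_div_of_le (by positivity : (0:ℝ) < k + 1)
      (by have : (k:ℝ) ≤ l := by exact_mod_cast hkl
          linarith : (k:ℝ) + 1 ≤ l + 1)
    exact mul_le_mul_of_nonneg_left this (abs_nonneg _)
  have hfin : volume (S 0) ≠ ⊤ := by
    refine ((measure_mono (fun P hP => ?_)).trans_lt (measure_closedBall_lt_top (x := (0:Euc n)) (r := C))).ne
    simpa using hP.1
  have ht := tendsto_measure_iInter_atTop (μ := (volume : Measure (Euc n)))
    (fun k => (hcl k).measurableSet.nullMeasurableSet) hanti ⟨0, hfin⟩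
  have hz : volume (⋂ k, S k) = 0 := by
    refine measure_mono_null (t := ((LinearMap.ker ((innerSL ℝ e : Euc n →L[ℝ] ℝ) : Euc n →ₗ[ℝ] ℝ) : Submodule ℝ (Euc n)) : Set (Euc n))) ?_ ?_
    · intro P hP
      rw [mem_iInter] at hP
      have h0 : |@inner ℝ _ _ P e| ≤ 0 := by
        have hlim : Tendsto (fun k : ℕ => |C'| * (1 / ((k:ℝ) + 1))) atTop (𝓝 0) := by
          simpa using tendsto_one_div_add_atTop_nhds_zero_nat.const_mul |C'|
        exact ge_of_tendsto' hlim (fun k => (hP k).2)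
      have : @inner ℝ _ _ P e = 0 := abs_nonpos_iff.1 h0
      simpa [real_inner_comm] using this
    · apply Measure.addHaar_submodule
      intro htop
      have : e ∈ LinearMap.ker ((innerSL ℝ e : Euc n →L[ℝ] ℝ) : Euc n →ₗ[ℝ] ℝ) := by rw [htop]; trivial
      simp [he] at this
  rw [hz] at ht
  obtain ⟨k, hk⟩ := (ht.eventually (gt_mem_nhds hη)).exists
  refine ⟨1 / ((k:ℝ) + 1), by positivity, fun ε h0 h1 => lt_of_le_of_lt (measure_mono ?_) hk⟩
  intro P hP
  refine ⟨hP.1, hP.2.trans ?_⟩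
  exact mul_le_mul (le_abs_self _) h1 h0.le (abs_nonneg _)

end vol
end FKM

open Set MeasureTheory Metric Bornology
open scoped ENNReal NNReal Pointwise

namespace FKM
open Filter Topology
section lemE
variable {n : ℕ} {c : Euc n → Euc n → ℝ} {U V : Set (Euc n)} {p q : Euc n → Euc n → Euc n}
  {A : Euc n → Euc n → Euc n →L[ℝ] Euc n} {C0 : ℝ} {u v : Euc n → ℝ}

/-- outer normal at a boundary point, in dual form, valid for all `x` -/
theorem Pkg.normal (P : Pkg n c U V p q A C0) {xt yt : Euc n} (hxt : xt ∈ closure U)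
    (hyt : yt ∈ closure V) (hbd : yt ∉ V) : ∃ N : Euc n, N ≠ 0 ∧ ∀ x ∈ closure U, ∀ y ∈ closure V,
      @inner ℝ _ _ (hat p A x yt y) N ≤ 0 := by
  set D := (fun y => p xt y) '' closure V with hD
  have hDint : (interior D).Nonempty := by
    rw [hD, P.p_int xt hxt]; exact P.neV.image _
  have hDc := P.p_conv xt hxt
  have hnot : p xt yt ∉ interior D := by
    rw [hD, P.p_int xt hxt]
    rintro ⟨y, hy, e⟩
    exact hbd (P.p_inj xt hxt (subset_closure hy) hyt e ▸ hy)
  obtain ⟨f, hf⟩ := geometric_hahn_banach_open_point hDc.interior isOpen_interior hnot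
  obtain ⟨e, rfl⟩ := (InnerProductSpace.toDual ℝ (Euc n)).surjective f
  simp only [InnerProductSpace.toDual_apply_apply] at hf
  have he : e ≠ 0 := by
    rintro rfl
    obtain ⟨a, ha⟩ := hDint
    simpa using hf a ha
  have hle : ∀ y ∈ closure V, @inner ℝ _ _ e (p xt y) ≤ @inner ℝ _ _ e (p xt yt) := by
    intro y hy
    have h1 : p xt y ∈ closure (interior D) := by
      rw [hDc.closure_interior_eq_closure_of_nonempty_interior hDint]
      exact subset_closure (mem_image_of_mem _ hy)
    have h2 : IsClosed {a : Euc n | @inner ℝ _ _ e a ≤ @inner ℝ _ _ e (p xt yt)} :=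
      isClosed_le (by fun_prop) (by fun_prop)
    exact h2.closure_subset_iff.2 (fun a ha => (hf a ha).le) h1
  refine ⟨A xt yt e, ?_, fun x hx y hy => ?_⟩
  · intro h0
    exact he (P.A_inv xt hxt yt hyt (by rw [h0, map_zero]))
  set K := (fun y => p x y) '' closure V
  set Y := Xi (fun y x => p x y) V x
  have hseg : ∀ r ∈ Icc (0:ℝ) 1, p x yt + r • (p x y - p x yt) ∈ K := by
    intro r hr
    exact (P.p_conv x hx).add_smul_sub_mem (mem_image_of_mem _ hyt) (mem_image_of_mem _ hy) hr
  have hY0 : Y (p x yt) = yt := P.swap.Xi_q hyt hx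
  have d1 : HasFDerivWithinAt Y (ContinuousLinearMap.adjoint (Ai A x yt)) K (p x yt) := by
    have := P.swap.Xi_deriv hx (mem_image_of_mem (fun y => p x y) hyt)
    have e0 : Xi (fun y x => p x y) V x ((fun y => p x y) yt) = yt := hY0
    rw [e0, P.Ai_swap hx hyt] at this
    exact this
  have d2 : HasFDerivWithinAt (fun a => p xt (Y a)) (ContinuousLinearMap.adjoint (A xt yt) ∘L
      ContinuousLinearMap.adjoint (Ai A x yt)) K (p x yt) := by
    have h := P.p_y xt hxt yt hyt
    rw [← hY0] at h
    have := h.comp (p x yt) d1 (fun b hb => Xi_mem hb)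
    rwa [hY0] at this
  have d3 : HasDerivWithinAt (fun r : ℝ => p x yt + r • (p x y - p x yt)) (p x y - p x yt) (Icc 0 1) 0 := by
    have : HasDerivAt (fun r : ℝ => p x yt + r • (p x y - p x yt)) (p x y - p x yt) 0 := by
      simpa using ((hasDerivAt_id (0:ℝ)).smul_const (p x y - p x yt)).const_add (p x yt)
    exact this.hasDerivWithinAt
  have e0 : p x yt + (0:ℝ) • (p x y - p x yt) = p x yt := by simp
  have d4 : HasDerivWithinAt (fun r : ℝ => p xt (Y (p x yt + r • (p x y - p x yt))))
      (ContinuousLinearMap.adjoint (A xt yt) (hat p A x yt y)) (Icc 0 1) 0 := by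
    rw [← e0] at d2
    have := HasFDerivWithinAt.comp_hasDerivWithinAt (t := K) (l := fun a => p xt (Y a))
      (f := fun r : ℝ => p x yt + r • (p x y - p x yt)) (0:ℝ) d2 d3 (fun r hr => hseg r hr)
    exact this
  have d5 : HasDerivWithinAt (fun r : ℝ => (@inner ℝ _ _ e (p xt (Y (p x yt + r • (p x y - p x yt)))) : ℝ))
      (@inner ℝ _ _ e (ContinuousLinearMap.adjoint (A xt yt) (hat p A x yt y))) (Icc 0 1) 0 :=
    ((innerSL ℝ e).hasFDerivAt.comp_hasDerivWithinAt (0:ℝ) d4)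
  rw [ContinuousLinearMap.adjoint_inner_right] at d5
  rw [real_inner_comm]
  have hs := (hasDerivWithinAt_iff_tendsto_slope.1 d5)
  have : (Icc (0:ℝ) 1) \ {0} = Ioc 0 1 := by
    ext r; simp only [Set.mem_sdiff, mem_Icc, mem_singleton_iff, mem_Ioc]
    constructor
    · rintro ⟨⟨a, b⟩, c⟩; exact ⟨lt_of_le_of_ne a (Ne.symm c), b⟩
    · rintro ⟨a, b⟩; exact ⟨⟨a.le, b⟩, a.ne'⟩
  rw [this] at hs
  haveI : (𝓝[Ioc (0:ℝ) 1] 0).NeBot := by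
    rw [nhdsWithin_Ioc_eq_nhdsGT one_pos]; infer_instance
  refine le_of_tendsto hs ?_
  filter_upwards [self_mem_nhdsWithin] with r hr
  rw [slope_def_field]
  refine div_nonpos_of_nonpos_of_nonneg ?_ (by linarith [hr.1])
  rw [e0, hY0]
  have := hle _ (Xi_mem (q := fun y x => p x y) (U := V) (y := x) (hseg r ⟨hr.1.le, hr.2⟩))
  linarith

/-- existence of the shifted contact point -/
theorem Pot.shift (H : Pot n c U V u v) (P : Pkg n c U V p q A C0) {xt yt N : Euc n} (hxt : xt ∈ U)
    (hc : Con c U V u v xt yt)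
    (hN : ∀ x ∈ closure U, ∀ y ∈ closure V, @inner ℝ _ _ (hat p A x yt y) N ≤ 0)
    {r : ℝ} (hr : 0 < r) : ∃ T : ℝ, T > 0 ∧ ∃ x1 ∈ U, ‖x1 - xt‖ < r ∧ q x1 yt = q xt yt + T • N ∧
      Con c U V u v x1 yt := by
  have hyt := hc.2.1
  obtain ⟨L, hL, hLip⟩ := P.lipX
  have hinter : q xt yt ∈ interior ((fun x => q x yt) '' closure U) := by
    rw [P.q_int yt hyt]; exact mem_image_of_mem _ hxt
  obtain ⟨ρ, hρ, hball⟩ := Metric.isOpen_iff.1 isOpen_interior _ hinter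
  set T := min (ρ / 2) (r / (2 * L)) / (‖N‖ + 1) with hT
  have hT0 : 0 < T := by positivity
  have hTN : ‖T • N‖ ≤ min (ρ / 2) (r / (2 * L)) := by
    rw [norm_smul, Real.norm_eq_abs, abs_of_pos hT0, hT, div_mul_eq_mul_div, div_le_iff₀ (by positivity)]
    have : 0 ≤ min (ρ / 2) (r / (2 * L)) := by positivity
    nlinarith [norm_nonneg N]
  have hin : ∀ s ∈ Icc (0:ℝ) 1, q xt yt + s • (T • N) ∈ (fun x => q x yt) '' U := by
    intro s hs
    rw [← P.q_int yt hyt]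
    apply hball
    rw [mem_ball, dist_eq_norm, add_sub_cancel_left, norm_smul, Real.norm_eq_abs, abs_of_nonneg hs.1]
    calc s * ‖T • N‖ ≤ 1 * ‖T • N‖ := by gcongr; exact hs.2
      _ ≤ ρ / 2 := by rw [one_mul]; exact hTN.trans (min_le_left _ _)
      _ < ρ := by linarith
  obtain ⟨x1, hx1, e1⟩ := hin 1 ⟨zero_le_one, le_rfl⟩
  simp only [one_smul] at e1
  refine ⟨T, hT0, x1, hx1, ?_, e1, ?_⟩
  · have := hLip yt hyt x1 (subset_closure hx1) xt (subset_closure hxt)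
    rw [e1, add_sub_cancel_left] at this
    calc _ ≤ _ := this
      _ ≤ L * (r / (2 * L)) := by gcongr; exact hTN.trans (min_le_right _ _)
      _ = r / 2 := by field_simp
      _ < r := by linarith
  · obtain ⟨y, hy, ey⟩ := H.ex x1 (subset_closure hx1)
    have hX : ∀ t ∈ Icc (0:ℝ) 1, Xi q U yt ((1 - t) • q xt yt + t • q x1 yt) ∈ U := by
      intro t ht
      have e : (1 - t) • q xt yt + t • q x1 yt = q xt yt + t • (T • N) := by
        rw [e1]; module
      obtain ⟨x, hx, ex⟩ := hin t ht
      rw [e, ← ex]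
      simp only
      rw [P.Xi_q (subset_closure hx) hyt]; exact hx
    have hanti : AntitoneOn (fun t => c (Xi q U yt ((1 - t) • q xt yt + t • q x1 yt)) yt
      - c (Xi q U yt ((1 - t) • q xt yt + t • q x1 yt)) y) (Icc (0:ℝ) 1) := by
      apply antitoneOn_of_hasDerivWithinAt_nonpos (convex_Icc 0 1)
        (f' := fun t => (@inner ℝ _ _ (hat p A (Xi q U yt ((1 - t) • q xt yt + t • q x1 yt)) yt y)
        (q x1 yt - q xt yt) : ℝ))
      · intro t ht
        exact (P.seg_deriv hyt hy (subset_closure hxt) (subset_closure hx1) ht (hX t ht)).continuousWithinAt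
      · intro t ht
        exact (P.seg_deriv hyt hy (subset_closure hxt) (subset_closure hx1) (interior_subset ht)
          (hX t (interior_subset ht))).mono interior_subset
      · intro t ht
        have e2 : q x1 yt - q xt yt = T • N := by rw [e1, add_sub_cancel_left]
        simp only [e2, inner_smul_right]
        exact mul_nonpos_of_nonneg_of_nonpos hT0.le
          (hN _ (subset_closure (hX t (interior_subset ht))) y hy)
    have := hanti (left_mem_Icc.2 zero_le_one) (right_mem_Icc.2 zero_le_one) zero_le_one
    simp only [P.seg_eq hyt (subset_closure hxt) x1, P.seg_eq1 hyt (subset_closure hx1) xt] at this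
    refine ⟨subset_closure hx1, hyt, le_antisymm ?_ (H.ge _ (subset_closure hx1) _ hyt)⟩
    have g := H.ge xt (subset_closure hxt) y hy
    have := hc.2.2
    linarith

/-- Lipschitz bound of differences of costs on a ball -/
theorem Pkg.fy_lip (P : Pkg n c U V p q A C0) {x1 z yt y : Euc n} {r B : ℝ} (hb : ball x1 r ⊆ U)
    (hyt : yt ∈ closure V) (hy : y ∈ closure V) (hB : ∀ x ∈ closure U, ‖p x y - p x yt‖ ≤ B)
    (hz : z ∈ ball x1 r) :
    |(c z yt - c z y) - (c x1 yt - c x1 y)| ≤ B * ‖z - x1‖ := by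
  have hr : 0 < r := pos_of_mem_ball hz
  have := Convex.norm_image_sub_le_of_norm_hasFDerivWithin_le (f := fun x => c x yt - c x y)
    (f' := fun x => innerSL ℝ (p x y) - innerSL ℝ (p x yt)) (s := ball x1 r) (C := B)
    (fun x hx => by
      have := ((P.c_x x (hb hx) yt hyt).sub (P.c_x x (hb hx) y hy)).hasFDerivWithinAt (s := ball x1 r)
      refine this.congr_fderiv ?_
      abel)
    (fun x hx => by
      rw [← map_sub, innerSL_apply_norm]
      exact hB x (subset_closure (hb hx))) (convex_ball _ _) (mem_ball_self hr) hz
  simpa [Real.norm_eq_abs] using this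

theorem Pot.lemE (H : Pot n c U V u v) (P : Pkg n c U V p q A C0) {xt yt : Euc n} {r0 lam : ℝ}
    (hr0 : 0 < r0) (hlam : 0 < lam) (hxt : xt ∈ U) (hc : Con c U V u v xt yt)
    (hlow : ∀ K : Set (Euc n), IsCompact K → K ⊆ ball xt r0 →
      ENNReal.ofReal lam * volume K ≤ volume (Im c U V u v K)) : yt ∈ V := by
  by_contra hbd
  have hyt := hc.2.1
  obtain ⟨N, hN0, hN⟩ := P.normal (subset_closure hxt) hyt hbd
  obtain ⟨T, hT, x1, hx1, hx1r, e1, hc1⟩ := H.shift P hxt hc hN (half_pos hr0)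
  have hx1' := subset_closure hx1
  obtain ⟨g1, g2, hg⟩ := P.exDt
  obtain ⟨L, hL, hLip⟩ := P.lipPP
  obtain ⟨R, hR, hstr⟩ := P.p_str x1 hx1'
  obtain ⟨Bd, hBd⟩ := P.compV.isBounded.exists_norm_le
  obtain ⟨r1, hr1, hball⟩ := Metric.isOpen_iff.1 P.oU _ hx1
  set e := Ai A x1 yt N with he
  have he0 : e ≠ 0 := by
    intro h0
    apply hN0
    have := P.Ai_right hx1' hyt N
    rw [← this, ← he, h0, map_zero]
  have hea : ∀ y, @inner ℝ _ _ (hat p A x1 yt y) N = @inner ℝ _ _ (p x1 y - p x1 yt) e := by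
    intro y
    rw [hat, ContinuousLinearMap.adjoint_inner_left]
  set M := Real.exp (C0 * ‖xt - x1‖ * (2 * |Bd|)) with hM
  have hM0 : 0 < M := Real.exp_pos _
  -- constants
  set C1 := M * L / T with hC1
  set C2 := R * C1 / ‖e‖ with hC2
  have hen : 0 < ‖e‖ := norm_pos_iff.2 he0
  have hC1p : 0 < C1 := by positivity
  have hC2p : 0 < C2 := by positivity
  have main : ∀ ε, 0 < ε → ε < r1 → ∀ y ∈ Im c U V u v (closedBall x1 ε),
      ‖p x1 y - p x1 yt‖ ≤ C2 * ε ∧ |@inner ℝ _ _ (p x1 y - p x1 yt) e| ≤ C1 * C2 * ε ^ 2 := by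
    rintro ε hε hεr y ⟨z, hz, hcz⟩
    have hy := hcz.2.1
    set Q := p x1 y - p x1 yt with hQ
    set a := -(@inner ℝ _ _ Q e : ℝ) with ha
    have ha0 : 0 ≤ a := by
      have := hN x1 hx1' y hy
      rw [hea] at this
      linarith
    have hfz : c xt yt - c xt y ≤ c z yt - c z y := by
      have g1 := H.ge z hcz.1 yt hyt
      have g2 := H.ge xt (subset_closure hxt) y hy
      linarith [hc.2.2, hcz.2.2]
    have hfl := P.fy_lip hball hyt hy (B := L * ‖Q‖) (fun x hx => hLip x hx x1 hx1' y hy yt hyt)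
      (closedBall_subset_ball hεr hz)
    have hzn : ‖z - x1‖ ≤ ε := by simpa [dist_eq_norm] using hz
    have hfl2 : c xt yt - c xt y - (c x1 yt - c x1 y) ≤ L * ‖Q‖ * ε := by
      have := (abs_le.1 hfl).2
      have h3 : L * ‖Q‖ * ‖z - x1‖ ≤ L * ‖Q‖ * ε := by gcongr
      linarith
    have haC : a ≤ C1 * ε * ‖Q‖ := by
      rcases ha0.eq_or_lt with h0 | hpos
      · rw [← h0]; positivity
      have e2 : (@inner ℝ _ _ (hat p A x1 yt y) (q xt yt - q x1 yt) : ℝ) = T * a := by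
        rw [e1, sub_add_cancel_left, inner_neg_right, inner_smul_right, hea, ha]; ring
      have := P.slope0 hyt hy hx1 (subset_closure hxt) (by rw [e2]; positivity)
      rw [e2] at this
      have hMle : Real.exp (C0 * ‖xt - x1‖ * ‖y - yt‖) ≤ M := by
        apply Real.exp_le_exp.2
        have : ‖y - yt‖ ≤ 2 * |Bd| := by
          have := norm_sub_le y yt
          have h1 := hBd y hy
          have h2 := hBd yt hyt
          have := le_abs_self Bd
          linarith
        have := P.C0nn
        gcongr
      have hΔ : 0 < c xt yt - c xt y - (c x1 yt - c x1 y) := by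
        by_contra hcon
        push Not at hcon
        have := mul_nonpos_of_nonneg_of_nonpos (Real.exp_pos (C0 * ‖xt - x1‖ * ‖y - yt‖)).le hcon
        nlinarith
      have : T * a ≤ M * (L * ‖Q‖ * ε) := this.trans (mul_le_mul hMle hfl2 hΔ.le hM0.le)
      rw [hC1, div_mul_eq_mul_div, div_mul_eq_mul_div, le_div_iff₀ hT]
      linarith
    have hst : ‖Q‖ ^ 2 ≤ R / ‖e‖ * a := by
      have hw := hstr _ (mem_image_of_mem _ hyt) _ (mem_image_of_mem _ hy)
        ((‖Q‖ ^ 2 / R / ‖e‖) • e) (by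
          rw [norm_smul, Real.norm_eq_abs, abs_of_nonneg (by positivity), div_mul_cancel₀ _ hen.ne',
            hQ, norm_sub_rev])
      obtain ⟨y', hy', ey'⟩ := hw
      have := hN x1 hx1' y' hy'
      rw [hea] at this
      simp only at ey'
      have e3 : p x1 y' - p x1 yt = (1/2 : ℝ) • Q + (‖Q‖ ^ 2 / R / ‖e‖) • e := by
        rw [ey', hQ]; module
      rw [e3, inner_add_left, inner_smul_left, inner_smul_left, real_inner_self_eq_norm_sq] at this
      simp only [conj_trivial] at this
      have h4 : ‖Q‖ ^ 2 / R / ‖e‖ * ‖e‖ ^ 2 ≤ a := by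
        have : (1/2:ℝ) * @inner ℝ _ _ Q e = -(a / 2) := by rw [ha]; ring
        linarith
      have h5 : ‖Q‖ ^ 2 / R / ‖e‖ * ‖e‖ ^ 2 = ‖Q‖ ^ 2 * ‖e‖ / R := by field_simp
      rw [h5, div_le_iff₀ hR] at h4
      rw [div_mul_eq_mul_div, le_div_iff₀ hen]
      linarith
    have hQ1 : ‖Q‖ ≤ C2 * ε := by
      by_contra hcon
      push Not at hcon
      have hQp : 0 < ‖Q‖ := lt_trans (by positivity) hcon
      have : ‖Q‖ ^ 2 ≤ C2 * ε * ‖Q‖ := by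
        calc ‖Q‖ ^ 2 ≤ R / ‖e‖ * a := hst
          _ ≤ R / ‖e‖ * (C1 * ε * ‖Q‖) := by gcongr
          _ = C2 * ε * ‖Q‖ := by rw [hC2]; ring
      nlinarith
    refine ⟨hQ1, ?_⟩
    have : |@inner ℝ _ _ Q e| = a := by
      rw [ha, abs_of_nonpos (by linarith)]
    rw [this]
    calc a ≤ C1 * ε * ‖Q‖ := haC
      _ ≤ C1 * ε * (C2 * ε) := by gcongr
      _ = _ := by ring
  -- volume contradiction
  set ω := volume (closedBall (0 : Euc n) 1) with hω
  have hω0 : ω ≠ 0 := (measure_closedBall_pos volume 0 one_pos).ne'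
  have hωt : ω ≠ ⊤ := measure_closedBall_lt_top.ne
  obtain ⟨ε0, hε0, hsl⟩ := slab_vol e he0 C2 (C1 * C2) (η := ENNReal.ofReal g1 * (ENNReal.ofReal lam * ω)) (by
    apply ENNReal.mul_pos (by simpa using hg.1)
    exact (ENNReal.mul_pos (by simpa using hlam) hω0).ne')
  set ε := min (min ε0 (r1 / 2)) (r0 / 2) with hε
  have hεp : 0 < ε := by positivity
  have hε1 : ε ≤ ε0 := (min_le_left _ _).trans (min_le_left _ _)
  have hε2 : ε < r1 := ((min_le_left _ _).trans (min_le_right _ _)).trans_lt (by linarith)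
  have hε3 : ε ≤ r0 / 2 := min_le_right _ _
  have hsub : closedBall x1 ε ⊆ ball xt r0 := by
    intro z hz
    rw [mem_ball]
    have h1 : dist z x1 ≤ ε := hz
    have h2 : dist x1 xt < r0 / 2 := by rwa [dist_eq_norm]
    linarith [dist_triangle z x1 xt]
  have hl := hlow _ (isCompact_closedBall x1 ε) hsub
  have himc := H.Im_compact P (isClosed_closedBall (x := x1) (ε := ε))
  have hv := (P.volp hg hx1' himc.measurableSet (by rintro y ⟨z, -, h⟩; exact h.2.1)).1
  have hfr : Module.finrank ℝ (Euc n) = n := by simp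
  have hsc : volume ((fun y => p x1 y) '' Im c U V u v (closedBall x1 ε)) ≤
      ENNReal.ofReal (ε ^ n) * volume {Q : Euc n | ‖Q‖ ≤ C2 ∧ |@inner ℝ _ _ Q e| ≤ C1 * C2 * ε} := by
    have := Measure.addHaar_smul (volume : Measure (Euc n)) ε {Q : Euc n | ‖Q‖ ≤ C2 ∧ |@inner ℝ _ _ Q e| ≤ C1 * C2 * ε}
    rw [hfr, abs_of_pos (by positivity)] at this
    rw [← this, ← measure_preimage_add volume (p x1 yt)]
    refine measure_mono ?_
    rintro Q ⟨y, hy, ey⟩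
    have hm := main ε hεp hε2 y hy
    have hQ : p x1 y - p x1 yt = Q := by
      have : p x1 y = p x1 yt + Q := ey
      rw [this, add_sub_cancel_left]
    rw [hQ] at hm
    rw [mem_smul_set_iff_inv_smul_mem₀ hεp.ne']
    refine ⟨?_, ?_⟩
    · rw [norm_smul, norm_inv, Real.norm_eq_abs, abs_of_pos hεp, inv_mul_le_iff₀ hεp]
      linarith [hm.1]
    · rw [inner_smul_left, abs_mul]
      simp only [conj_trivial, abs_inv, abs_of_pos hεp]
      rw [inv_mul_le_iff₀ hεp]
      linarith [hm.2]
  have hbv : volume (closedBall x1 ε) = ENNReal.ofReal (ε ^ n) * ω := by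
    rw [Measure.addHaar_closedBall' volume x1 hεp.le, hfr]
  rw [hbv] at hl
  have hε' : ENNReal.ofReal (ε ^ n) ≠ 0 := by simpa using by positivity
  have hfinal : ENNReal.ofReal (ε ^ n) * (ENNReal.ofReal g1 * (ENNReal.ofReal lam * ω)) <
      ENNReal.ofReal (ε ^ n) * (ENNReal.ofReal g1 * (ENNReal.ofReal lam * ω)) := by
    calc ENNReal.ofReal (ε ^ n) * (ENNReal.ofReal g1 * (ENNReal.ofReal lam * ω))
        = ENNReal.ofReal g1 * (ENNReal.ofReal lam * (ENNReal.ofReal (ε ^ n) * ω)) := by ring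
      _ ≤ ENNReal.ofReal g1 * volume (Im c U V u v (closedBall x1 ε)) := by gcongr
      _ ≤ _ := hv
      _ ≤ _ := hsc
      _ < _ := ENNReal.mul_lt_mul_right hε' ENNReal.ofReal_ne_top (hsl ε hεp hε1)
  exact lt_irrefl _ hfinal

end lemE
end FKM

open Set MeasureTheory Metric Bornology
open scoped ENNReal NNReal Pointwise

namespace FKM
open Filter Topology
section cg
variable {n : ℕ}

/-- linear map sending `b i` to `z i` -/
noncomputable def LL (b : OrthonormalBasis (Fin n) ℝ (Euc n)) (z : Fin n → Euc n) : Euc n →L[ℝ] Euc n :=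
  ∑ i, (innerSL ℝ (b i)).smulRight (z i)

theorem LL_apply (b : OrthonormalBasis (Fin n) ℝ (Euc n)) (z : Fin n → Euc n) (w : Euc n) :
    LL b z w = ∑ i, (inner ℝ (b i) w : ℝ) • z i := by
  simp [LL, ContinuousLinearMap.sum_apply]

theorem LL_basis (b : OrthonormalBasis (Fin n) ℝ (Euc n)) (z : Fin n → Euc n) (i : Fin n) :
    LL b z (b i) = z i := by
  rw [LL_apply]
  simp [orthonormal_iff_ite.1 b.orthonormal]

theorem LL_cont (b : OrthonormalBasis (Fin n) ℝ (Euc n)) : Continuous (LL b) := by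
  unfold LL
  refine continuous_finset_sum _ fun i _ => ?_
  have : Continuous fun w : Euc n => (innerSL ℝ (b i)).smulRight w :=
    (ContinuousLinearMap.smulRightL ℝ (Euc n) (Euc n) (innerSL ℝ (b i))).continuous
  exact this.comp (continuous_apply i)

theorem LL_ext (b : OrthonormalBasis (Fin n) ℝ (Euc n)) {L M : Euc n →L[ℝ] Euc n}
    (h : ∀ i, L (b i) = M (b i)) : L = M := by
  ext1 w
  rw [← b.sum_repr' w]
  simp [h]

theorem det_comp' (L M : Euc n →L[ℝ] Euc n) : (L.comp M).det = L.det * M.det := by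
  show LinearMap.det ((L.comp M : Euc n →L[ℝ] Euc n) : Euc n →ₗ[ℝ] Euc n) = _
  exact LinearMap.det_comp (L : Euc n →ₗ[ℝ] Euc n) (M : Euc n →ₗ[ℝ] Euc n)

theorem LL_update (b : OrthonormalBasis (Fin n) ℝ (Euc n)) (z : Fin n → Euc n) (i : Fin n) (w : Euc n) :
    (LL b (Function.update z i (LL b z w))).det = (inner ℝ (b i) w : ℝ) * (LL b z).det := by
  set T := LinearMap.transvection (innerSL ℝ (b i) : Module.Dual ℝ (Euc n)) (w - b i)
  have h : LL b (Function.update z i (LL b z w)) = (LL b z).comp (LinearMap.toContinuousLinearMap T) := by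
    refine LL_ext b fun j => ?_
    rw [LL_basis]
    simp only [ContinuousLinearMap.comp_apply, LinearMap.coe_toContinuousLinearMap', T,
      LinearMap.transvection.apply]
    by_cases hj : j = i
    · subst hj; simp
    · have : (inner ℝ (b i) (b j) : ℝ) = 0 := b.orthonormal.2 (Ne.symm hj)
      simp [hj, this, LL_basis]
  rw [h, det_comp', mul_comm]
  congr 1
  show LinearMap.det T = _
  rw [LinearMap.transvection.det]
  simp [inner_sub_right]

theorem box_vol (b : OrthonormalBasis (Fin n) ℝ (Euc n)) (a a' : ℝ) :
    volume {w : Euc n | ∀ i, a ≤ (inner ℝ (b i) w : ℝ) ∧ (inner ℝ (b i) w : ℝ) ≤ a'}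
      = ENNReal.ofReal (a' - a) ^ n := by
  have h1 := b.measurePreserving_repr
  have h2 := EuclideanSpace.volume_preserving_symm_measurableEquiv_toLp (Fin n)
  have h3 := h2.comp h1
  have : {w : Euc n | ∀ i, a ≤ (inner ℝ (b i) w : ℝ) ∧ (inner ℝ (b i) w : ℝ) ≤ a'}
      = ((MeasurableEquiv.toLp 2 (Fin n → ℝ)).symm ∘ b.repr) ⁻¹' (Icc (fun _ => a) (fun _ => a')) := by
    ext w
    simp only [mem_ofPred_eq, mem_preimage, mem_Icc, Pi.le_def, Function.comp]
    have : ∀ i, (MeasurableEquiv.toLp 2 (Fin n → ℝ)).symm (b.repr w) i = inner ℝ (b i) w := fun i => by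
      rw [← b.repr_apply_apply]; rfl
    simp only [this]
    exact forall_and
  rw [this, h3.measure_preimage measurableSet_Icc.nullMeasurableSet, Real.volume_Icc_pi]
  simp

theorem simp_vol (b : OrthonormalBasis (Fin n) ℝ (Euc n)) {S : Set (Euc n)} (hS : Convex ℝ S) {v0 : Euc n}
    (h0 : v0 ∈ S) {z : Fin n → Euc n} (hz : ∀ i, v0 + z i ∈ S) :
    ENNReal.ofReal (|(LL b z).det| * (1 / (n + 1)) ^ n) ≤ volume S := by
  have hsub : (fun x => v0 + x) '' (LL b z '' {w : Euc n | ∀ i, 0 ≤ (inner ℝ (b i) w : ℝ) ∧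
      (inner ℝ (b i) w : ℝ) ≤ 1 / (n + 1)}) ⊆ S := by
    rintro _ ⟨_, ⟨w, hw, rfl⟩, rfl⟩
    show v0 + LL b z w ∈ S
    set a : Fin n → ℝ := fun i => inner ℝ (b i) w
    have hs : ∑ i, a i ≤ 1 := by
      calc ∑ i, a i ≤ ∑ i : Fin n, (1 / (n + 1) : ℝ) := Finset.sum_le_sum fun i _ => (hw i).2
        _ = n / (n + 1) := by simp; ring
        _ ≤ 1 := by rw [div_le_one (by positivity)]; linarith
    have := hS.sum_mem (t := Finset.univ) (w := fun o : Option (Fin n) => o.elim (1 - ∑ i, a i) a)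
      (z := fun o : Option (Fin n) => o.elim v0 (fun i => v0 + z i)) ?_ ?_ ?_
    · rw [Fintype.sum_option] at this
      simp only [Option.elim] at this
      convert this using 1
      rw [LL_apply]
      simp only [smul_add, Finset.sum_add_distrib, ← Finset.sum_smul]
      module
    · rintro (_ | i) _
      · simpa using hs
      · exact (hw i).1
    · rw [Fintype.sum_option]; simp
    · rintro (_ | i) _
      · exact h0
      · exact hz i
  refine le_trans (le_of_eq ?_) (measure_mono hsub)
  rw [image_add_left, measure_preimage_add, Measure.addHaar_image_continuousLinearMap, box_vol,
    ENNReal.ofReal_mul (abs_nonneg _), ENNReal.ofReal_pow (by positivity)]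
  simp only [sub_zero]

/-- maximal simplex -/
theorem john (b : OrthonormalBasis (Fin n) ℝ (Euc n)) {Q : Set (Euc n)} (hQ : IsCompact Q)
    (hi : (interior Q).Nonempty) : ∃ v0 ∈ Q, ∃ z : Fin n → Euc n,
    (∀ i, v0 + z i ∈ Q) ∧ (LL b z).det ≠ 0 ∧ ∀ x ∈ Q, ∃ w : Euc n, x = v0 + LL b z w ∧
      ∀ i, |(inner ℝ (b i) w : ℝ)| ≤ 1 := by
  obtain ⟨x0, hx0⟩ := hi
  obtain ⟨r, hr, hball⟩ := Metric.isOpen_iff.1 isOpen_interior x0 hx0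
  have hball' : ball x0 r ⊆ Q := hball.trans interior_subset
  have hx0Q : x0 ∈ Q := interior_subset hx0
  have hcomp : IsCompact (Q ×ˢ (Set.pi univ fun _ : Fin n => Q)) := hQ.prod (isCompact_univ_pi fun _ => hQ)
  obtain ⟨⟨v0, Z⟩, ⟨hv0, hZ⟩, hmax⟩ := hcomp.exists_isMaxOn (f := fun P : Euc n × (Fin n → Euc n) =>
    |(LL b (fun i => P.2 i - P.1)).det|) ⟨(x0, fun _ => x0), hx0Q, fun _ _ => hx0Q⟩
    (Continuous.continuousOn (by
      refine (det_cont.comp ((LL_cont b).comp ?_)).abs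
      exact continuous_pi fun i => ((continuous_apply i).comp continuous_snd).sub continuous_fst))
  simp only [mem_univ_pi] at hZ
  have hdet : (LL b (fun i => Z i - v0)).det ≠ 0 := by
    have h := hmax (show (x0, fun i => x0 + (r / 2) • b i) ∈ _ from ⟨hx0Q, fun i _ => hball' (by
      have : ‖b i‖ = 1 := b.orthonormal.1 i
      rw [mem_ball, dist_eq_norm]; simp [norm_smul, this, abs_of_pos hr]; linarith)⟩)
    have h2 : LL b (fun i => (r / 2) • b i) = (r / 2) • ContinuousLinearMap.id ℝ (Euc n) :=
      LL_ext b fun i => by rw [LL_basis]; simp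
    have h3 : (LL b (fun i => (r / 2) • b i)).det ≠ 0 := by
      apply det_ne
      rw [h2]
      intro x y hxy
      simpa [hr.ne'] using hxy
    intro h0
    simp only [mem_ofPred_eq, h0, abs_zero] at h
    refine h3 (abs_nonpos_iff.1 ?_)
    have h5 : (fun i => (r / 2) • b i) = fun i => x0 + (r / 2) • b i - x0 := by
      ext1 i; abel
    rw [h5]; exact h
  refine ⟨v0, hv0, fun i => Z i - v0, fun i => by simpa using hZ i, hdet, fun x hx => ?_⟩
  obtain ⟨w, hw⟩ : ∃ w, LL b (fun i => Z i - v0) w = x - v0 := by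
    have : Function.Surjective (LL b (fun i => Z i - v0) : Euc n →ₗ[ℝ] Euc n) := by
      have hu : IsUnit (LinearMap.det (LL b (fun i => Z i - v0) : Euc n →ₗ[ℝ] Euc n)) := isUnit_iff_ne_zero.2 hdet
      exact (LinearEquiv.ofIsUnitDet (f := (LL b (fun i => Z i - v0) : Euc n →ₗ[ℝ] Euc n))
        (v := (EuclideanSpace.basisFun (Fin n) ℝ).toBasis) (v' := (EuclideanSpace.basisFun (Fin n) ℝ).toBasis)
        (by rw [LinearMap.det_toMatrix]; exact hu)).surjective
    exact this _
  refine ⟨w, by rw [hw]; simp, fun i => ?_⟩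
  have h := hmax (show (v0, Function.update Z i x) ∈ _ from ⟨hv0, fun j _ => by
    by_cases hj : j = i
    · subst hj; simpa using hx
    · simpa [hj] using hZ j⟩)
  have h2 : (fun j => Function.update Z i x j - v0) = Function.update (fun i => Z i - v0) i
      (LL b (fun i => Z i - v0) w) := by
    ext1 j
    by_cases hj : j = i
    · subst hj; simp [hw]
    · simp [hj]
  simp only [mem_ofPred_eq, h2, LL_update, abs_mul] at h
  exact le_of_mul_le_mul_right (by linarith) (abs_pos.2 hdet)

theorem john_vol (b : OrthonormalBasis (Fin n) ℝ (Euc n)) {Q : Set (Euc n)} {v0 : Euc n} {z : Fin n → Euc n}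
    (h : ∀ x ∈ Q, ∃ w : Euc n, x = v0 + LL b z w ∧ ∀ i, |(inner ℝ (b i) w : ℝ)| ≤ 1) :
    volume Q ≤ ENNReal.ofReal (|(LL b z).det| * 2 ^ n) := by
  have hsub : Q ⊆ (fun x => v0 + x) '' (LL b z '' {w : Euc n | ∀ i, -1 ≤ (inner ℝ (b i) w : ℝ) ∧
      (inner ℝ (b i) w : ℝ) ≤ 1}) := by
    intro x hx
    obtain ⟨w, hw, hw1⟩ := h x hx
    exact ⟨_, ⟨w, fun i => abs_le.1 (hw1 i), rfl⟩, hw.symm⟩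
  refine (measure_mono hsub).trans (le_of_eq ?_)
  rw [image_add_left, measure_preimage_add, Measure.addHaar_image_continuousLinearMap, box_vol,
    ENNReal.ofReal_mul (abs_nonneg _), ENNReal.ofReal_pow (by positivity)]
  norm_num

/-- bounding box adapted to a convex body -/
theorem convex_frame (n : ℕ) : ∃ Cn : ℝ, 0 < Cn ∧ ∀ Q : Set (Euc n), IsCompact Q → Convex ℝ Q →
    (interior Q).Nonempty → ∃ e : OrthonormalBasis (Fin n) ℝ (Euc n), ∃ w : Fin n → ℝ,
    (∀ i, 0 < w i) ∧ (∀ i, ∀ z ∈ Q, ∀ z' ∈ Q, (inner ℝ (e i) (z - z') : ℝ) ≤ w i) ∧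
    ENNReal.ofReal (∏ i, w i) ≤ ENNReal.ofReal Cn * volume Q := by
  refine ⟨((2 * n + 1) * (n + 1)) ^ n, by positivity, fun Q hQ hc hi => ?_⟩
  set b := EuclideanSpace.basisFun (Fin n) ℝ
  obtain ⟨v0, hv0, z, hz, hdet, hrep⟩ := john b hQ hi
  set L := LL b z
  set T : Euc n →L[ℝ] Euc n := L.comp (ContinuousLinearMap.adjoint L)
  have hT : (T : Euc n →ₗ[ℝ] Euc n).IsSymmetric := by
    intro x y
    simp only [T, ContinuousLinearMap.coe_coe, ContinuousLinearMap.comp_apply]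
    rw [← ContinuousLinearMap.adjoint_inner_right, ContinuousLinearMap.adjoint_inner_left]
  have hn : Module.finrank ℝ (Euc n) = n := finrank_euclideanSpace_fin
  set e := hT.eigenvectorBasis hn
  have heig : ∀ i, hT.eigenvalues hn i = ‖ContinuousLinearMap.adjoint L (e i)‖ ^ 2 := by
    intro i
    have h1 := hT.apply_eigenvectorBasis hn i
    have h2 : (inner ℝ (e i) (T (e i)) : ℝ) = hT.eigenvalues hn i := by
      have : T (e i) = (hT.eigenvalues hn i) • e i := h1
      rw [this, inner_smul_right, real_inner_self_eq_norm_sq, e.orthonormal.1 i]; simp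
    rw [← h2]
    simp only [T, ContinuousLinearMap.comp_apply]
    rw [← ContinuousLinearMap.adjoint_inner_left, real_inner_self_eq_norm_sq]
  have hprod : (∏ i, ‖ContinuousLinearMap.adjoint L (e i)‖) = |L.det| := by
    have h1 := hT.det_eq_prod_eigenvalues hn
    have h2 : LinearMap.det (T : Euc n →ₗ[ℝ] Euc n) = L.det ^ 2 := by
      show T.det = _
      rw [det_comp', det_adj]; ring
    rw [h2] at h1
    simp only [heig, RCLike.ofReal_real_eq_id, id, Finset.prod_pow] at h1
    rw [← abs_of_nonneg (Finset.prod_nonneg fun i _ => norm_nonneg (ContinuousLinearMap.adjoint L (e i)))]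
    exact ((sq_eq_sq_iff_abs_eq_abs _ _).1 h1).symm
  have hpos : ∀ i, 0 < ‖ContinuousLinearMap.adjoint L (e i)‖ := fun i => by
    refine lt_of_le_of_ne (norm_nonneg _) fun h => hdet ?_
    rw [Finset.prod_eq_zero (Finset.mem_univ i) h.symm] at hprod
    exact abs_eq_zero.1 hprod.symm
  refine ⟨e, fun i => (2 * n + 1) * ‖ContinuousLinearMap.adjoint L (e i)‖, fun i => by
    have := hpos i; positivity, fun i x hx x' hx' => ?_, ?_⟩
  · obtain ⟨a, rfl, ha⟩ := hrep x hx
    obtain ⟨a', rfl, ha'⟩ := hrep x' hx'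
    have hnorm : ∀ a : Euc n, (∀ i, |(inner ℝ (b i) a : ℝ)| ≤ 1) → ‖a‖ ≤ n := by
      intro a ha
      rw [← b.sum_repr' a]
      refine (norm_sum_le _ _).trans ?_
      calc _ ≤ ∑ i : Fin n, (1 : ℝ) := Finset.sum_le_sum fun i _ => by
            rw [norm_smul, b.orthonormal.1 i, mul_one]; exact ha i
        _ = n := by simp
    have h1 := hnorm a ha
    have h2 := hnorm a' ha'
    have h3 : (v0 + L a) - (v0 + L a') = L (a - a') := by rw [map_sub]; abel
    rw [h3, ← ContinuousLinearMap.adjoint_inner_left]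
    refine (real_inner_le_norm _ _).trans ?_
    have h4 : ‖a - a'‖ ≤ 2 * n + 1 := (norm_sub_le _ _).trans (by linarith)
    nlinarith [hpos i]
  · rw [Finset.prod_mul_distrib, hprod]
    have h1 := simp_vol b hc hv0 hz
    calc _ = ENNReal.ofReal (((2 * n + 1) * (n + 1)) ^ n) * ENNReal.ofReal (|L.det| * (1 / (n + 1)) ^ n) := by
          rw [← ENNReal.ofReal_mul (by positivity)]
          congr 1
          simp only [Finset.prod_const, Finset.card_univ, Fintype.card_fin]
          rw [mul_pow, one_div, inv_pow]
          field_simp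
      _ ≤ _ := by gcongr

/-- polar body about a center -/
theorem convex_center (n : ℕ) : ∃ Cn : ℝ, 0 < Cn ∧ ∀ Q : Set (Euc n), IsCompact Q → Convex ℝ Q →
    (interior Q).Nonempty → ∃ qc ∈ Q, ∀ H : ℝ, 0 ≤ H →
    volume {P : Euc n | ∀ z ∈ Q, (inner ℝ P (z - qc) : ℝ) ≤ H} * volume Q ≤ ENNReal.ofReal (Cn * H ^ n) := by
  refine ⟨(2 * (n + 1)) ^ n * 2 ^ n, by positivity, fun Q hQ hc hi => ?_⟩
  set b := EuclideanSpace.basisFun (Fin n) ℝ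
  obtain ⟨v0, hv0, z, hz, hdet, hrep⟩ := john b hQ hi
  set L := LL b z with hL
  set s : ℝ := 1 / (n + 1) with hs
  have hs1 : (n + 1 : ℝ) * s = 1 := by rw [hs]; field_simp
  have hs0 : 0 ≤ s := by positivity
  refine ⟨v0 + ∑ i, s • z i, ?_, fun H hH => ?_⟩
  · have := hc.sum_mem (t := Finset.univ) (w := fun o : Option (Fin n) => s)
      (z := fun o : Option (Fin n) => o.elim v0 (fun i => v0 + z i)) ?_ ?_ ?_
    · rw [Fintype.sum_option] at this
      simp only [Option.elim, smul_add, Finset.sum_add_distrib, Finset.sum_const, Finset.card_univ,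
        Fintype.card_fin] at this
      convert this using 1
      rw [← add_assoc, ← Nat.cast_smul_eq_nsmul ℝ, smul_smul, ← add_smul]
      congr 1
      rw [show s + n * s = 1 by linarith, one_smul]
    · intro i _; exact hs0
    · simp; linarith
    · rintro (_ | i) _
      · exact hv0
      · exact hz i
  · have hsub : ContinuousLinearMap.adjoint L '' {P : Euc n | ∀ z' ∈ Q, (inner ℝ P (z' - (v0 + ∑ i, s • z i)) : ℝ) ≤ H} ⊆
        {w : Euc n | ∀ i, -((n + 1) * H) ≤ (inner ℝ (b i) w : ℝ) ∧ (inner ℝ (b i) w : ℝ) ≤ (n + 1) * H} := by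
      rintro _ ⟨P, hP, rfl⟩ i
      have hin : ∀ j, (inner ℝ (b j) (ContinuousLinearMap.adjoint L P) : ℝ) = inner ℝ P (z j) := fun j => by
        rw [ContinuousLinearMap.adjoint_inner_right, hL, LL_basis, real_inner_comm]
      rw [hin]
      set a : Fin n → ℝ := fun j => inner ℝ P (z j)
      have h0 := hP v0 hv0
      have h1 := fun j => hP _ (hz j)
      simp only [sub_add_cancel_left, inner_neg_right, inner_sum, inner_smul_right, ← Finset.mul_sum,
        add_sub_add_left_eq_sub, inner_sub_right] at h0 h1
      change -(s * ∑ j, a j) ≤ H at h0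
      change ∀ j, a j - s * ∑ j, a j ≤ H at h1
      set S := ∑ j, a j
      have hsum : S ≤ n * (H + s * S) := by
        calc S ≤ ∑ j : Fin n, (H + s * S) := Finset.sum_le_sum fun j _ => by linarith [h1 j]
          _ = _ := by rw [Finset.sum_const, Finset.card_univ, Fintype.card_fin, nsmul_eq_mul]
      have hS : S = (n + 1) * (s * S) := by rw [← mul_assoc, hs1, one_mul]
      have hsS : s * S ≤ n * H := by nlinarith
      have herase : S = a i + ∑ j ∈ Finset.univ.erase i, a j := by
        rw [Finset.add_sum_erase _ _ (Finset.mem_univ i)]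
      have hle : ∑ j ∈ Finset.univ.erase i, a j ≤ (n - 1) * (H + s * S) := by
        calc _ ≤ ∑ j ∈ Finset.univ.erase i, (H + s * S) := Finset.sum_le_sum fun j _ => by linarith [h1 j]
          _ = _ := by
            have : 1 ≤ n := Nat.one_le_iff_ne_zero.2 (by rintro rfl; exact i.elim0)
            rw [Finset.sum_const, Finset.card_erase_of_mem (Finset.mem_univ i)]
            rw [nsmul_eq_mul, Finset.card_univ, Fintype.card_fin, Nat.cast_sub this, Nat.cast_one]
      show -((n + 1) * H) ≤ a i ∧ a i ≤ (n + 1) * H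
      constructor
      · nlinarith
      · nlinarith [h1 i]
    have hv1 := measure_mono (μ := volume) hsub
    rw [Measure.addHaar_image_continuousLinearMap, box_vol] at hv1
    have hdd : LinearMap.det ((ContinuousLinearMap.adjoint L : Euc n →L[ℝ] Euc n) : Euc n →ₗ[ℝ] Euc n) = L.det := det_adj L
    rw [hdd] at hv1
    have hv2 := john_vol b hrep
    calc _ ≤ volume {P : Euc n | ∀ z' ∈ Q, (inner ℝ P (z' - (v0 + ∑ i, s • z i)) : ℝ) ≤ H} * ENNReal.ofReal (|L.det| * 2 ^ n) := by
          gcongr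
      _ = (ENNReal.ofReal |L.det| * volume {P : Euc n | ∀ z' ∈ Q, (inner ℝ P (z' - (v0 + ∑ i, s • z i)) : ℝ) ≤ H}) * ENNReal.ofReal (2 ^ n) := by
          rw [ENNReal.ofReal_mul (abs_nonneg _)]; ring
      _ ≤ (ENNReal.ofReal ((n + 1) * H - -((n + 1) * H)) ^ n) * ENNReal.ofReal (2 ^ n) := by gcongr
      _ = _ := by
          rw [← ENNReal.ofReal_pow (by nlinarith), ← ENNReal.ofReal_mul (by
            apply pow_nonneg; nlinarith)]
          congr 1
          rw [show (n + 1) * H - -((n + 1) * H) = (2 * (n + 1)) * H by ring, mul_pow]; ring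

theorem LL_diag (e : OrthonormalBasis (Fin n) ℝ (Euc n)) (k : Fin n → ℝ) :
    (LL e (fun i => k i • e i)).det = ∏ i, k i := by
  show LinearMap.det ((LL e (fun i => k i • e i) : Euc n →L[ℝ] Euc n) : Euc n →ₗ[ℝ] Euc n) = _
  rw [← LinearMap.det_toMatrix e.toBasis]
  have : LinearMap.toMatrix e.toBasis e.toBasis ((LL e (fun i => k i • e i) : Euc n →L[ℝ] Euc n) : Euc n →ₗ[ℝ] Euc n)
      = Matrix.diagonal k := by
    ext i j
    rw [LinearMap.toMatrix_apply]
    simp only [OrthonormalBasis.coe_toBasis, ContinuousLinearMap.coe_coe, LL_basis,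
      OrthonormalBasis.coe_toBasis_repr_apply, e.repr_apply_apply, inner_smul_right,
      orthonormal_iff_ite.1 e.orthonormal, Matrix.diagonal_apply]
    by_cases h : i = j
    · subst h; simp
    · simp [h]
  rw [this, Matrix.det_diagonal]

theorem perturb_vol (n : ℕ) : ∃ εn > 0, ∃ cn : ℝ, 0 < cn ∧ ∀ (e : OrthonormalBasis (Fin n) ℝ (Euc n))
    (η : Fin n → Euc n), (∀ i, ‖η i‖ ≤ εn) → ∀ (k : Fin n → ℝ), (∀ i, 0 ≤ k i) → ∀ S : Set (Euc n), Convex ℝ S →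
    ∀ v0 ∈ S, (∀ i, v0 + k i • (e i + η i) ∈ S) → ENNReal.ofReal (cn * ∏ i, k i) ≤ volume S := by
  have hc : ContinuousAt (fun L : Euc n →L[ℝ] Euc n => |L.det|) (ContinuousLinearMap.id ℝ (Euc n)) :=
    det_cont.abs.continuousAt
  have h1 : |(ContinuousLinearMap.id ℝ (Euc n)).det| = 1 := by
    have : (ContinuousLinearMap.id ℝ (Euc n)).det = 1 := LinearMap.det_id
    rw [this, abs_one]
  obtain ⟨δ, hδ, hd⟩ := Metric.continuousAt_iff.1 hc (1 / 2) (by norm_num)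
  refine ⟨δ / (2 * (n + 1)), by positivity, 1 / 2 * (1 / (n + 1)) ^ n, by positivity,
    fun e η hη k hk S hS v0 hv0 hv => ?_⟩
  have hN : dist (LL e (fun i => e i + η i)) (ContinuousLinearMap.id ℝ (Euc n)) < δ := by
    have : LL e (fun i => e i + η i) - ContinuousLinearMap.id ℝ (Euc n) = LL e η :=
      LL_ext e fun i => by simp [LL_basis]
    rw [dist_eq_norm, this, LL]
    refine lt_of_le_of_lt (norm_sum_le _ _) ?_
    calc _ ≤ ∑ i : Fin n, δ / (2 * (n + 1)) := Finset.sum_le_sum fun i _ => by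
          rw [ContinuousLinearMap.norm_smulRight_apply, innerSL_apply_norm, e.orthonormal.1 i, one_mul]
          exact hη i
      _ = n * (δ / (2 * (n + 1))) := by simp
      _ < δ := by rw [mul_div_assoc', div_lt_iff₀ (by positivity)]; nlinarith
  have h2 := hd hN
  rw [h1, Real.dist_eq, abs_lt] at h2
  have h3 := simp_vol e hS hv0 hv
  have h4 : LL e (fun i => k i • (e i + η i)) = (LL e (fun i => e i + η i)).comp (LL e (fun i => k i • e i)) :=
    LL_ext e fun i => by simp [LL_basis]
  rw [h4, det_comp', LL_diag, abs_mul, abs_of_nonneg (Finset.prod_nonneg fun i _ => hk i)] at h3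
  refine le_trans (ENNReal.ofReal_le_ofReal ?_) h3
  have h5 : 0 ≤ ∏ i, k i := Finset.prod_nonneg fun i _ => hk i
  have h6 : (0 : ℝ) ≤ (1 / (n + 1)) ^ n := by positivity
  have := mul_nonneg h5 h6
  nlinarith
end cg
end FKM

open Set MeasureTheory Metric Bornology
open scoped ENNReal NNReal Pointwise

namespace FKM
open Filter Topology
section ve
variable {n : ℕ} {c : Euc n → Euc n → ℝ} {U V : Set (Euc n)} {p q : Euc n → Euc n → Euc n}
  {A : Euc n → Euc n → Euc n →L[ℝ] Euc n} {C0 : ℝ} {u v : Euc n → ℝ}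

/-- sections -/
def Sec (c : Euc n → Euc n → ℝ) (U : Set (Euc n)) (u : Euc n → ℝ) (yb : Euc n) (b : ℝ) : Set (Euc n) :=
  {x | x ∈ closure U ∧ u x + c x yb ≤ b}

theorem Pot.ut_cont (H : Pot n c U V u v) (P : Pkg n c U V p q A C0) {yb : Euc n} (hyb : yb ∈ closure V) :
    ContinuousOn (fun x => u x + c x yb) (closure U) :=
  H.uc.add (contOn_left P.cc hyb)

theorem Pot.sec_compact (H : Pot n c U V u v) (P : Pkg n c U V p q A C0) {yb : Euc n} (hyb : yb ∈ closure V)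
    (b : ℝ) : IsCompact (Sec c U u yb b) := by
  have := (H.ut_cont P hyb).preimage_isClosed_of_isClosed isClosed_closure (isClosed_Iic (a := b))
  exact P.compU.of_isClosed_subset this inter_subset_left

theorem Pot.secq_compact (H : Pot n c U V u v) (P : Pkg n c U V p q A C0) {yb : Euc n} (hyb : yb ∈ closure V)
    (b : ℝ) : IsCompact ((fun x => q x yb) '' Sec c U u yb b) :=
  (H.sec_compact P hyb b).image_of_continuousOn ((P.q_cont hyb).mono fun _ h => h.1)

theorem Pot.secq_convex (H : Pot n c U V u v) (P : Pkg n c U V p q A C0) {yb : Euc n} (hyb : yb ∈ closure V)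
    (b : ℝ) : Convex ℝ ((fun x => q x yb) '' Sec c U u yb b) := by
  rintro _ ⟨x0, h0, rfl⟩ _ ⟨x1, h1, rfl⟩ s t hs ht hst
  obtain ⟨x, hx, e⟩ := P.exX hyb h0.1 h1.1 ht (by linarith)
  obtain rfl : s = 1 - t := by linarith
  exact ⟨x, ⟨hx, H.sec_conv P hyb h0.1 h1.1 hx ht (by linarith) e h0.2 h1.2⟩, e⟩

/-- interior points of sections -/
theorem Pot.secq_int (H : Pot n c U V u v) (P : Pkg n c U V p q A C0) {yb x0 : Euc n} (hyb : yb ∈ closure V)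
    {b : ℝ} (hx0 : x0 ∈ U) (h : u x0 + c x0 yb < b) :
    q x0 yb ∈ interior ((fun x => q x yb) '' Sec c U u yb b) := by
  have hinter := P.q_int yb hyb
  have hmem : q x0 yb ∈ interior ((fun x => q x yb) '' closure U) := by
    rw [hinter]; exact mem_image_of_mem _ hx0
  have hx0' := subset_closure hx0
  have hc : ContinuousAt (fun a => u (Xi q U yb a) + c (Xi q U yb a) yb) (q x0 yb) := by
    have : ContinuousOn (fun a => u (Xi q U yb a) + c (Xi q U yb a) yb) ((fun x => q x yb) '' closure U) :=
      (H.ut_cont P hyb).comp (P.Xi_cont hyb) fun a ha => Xi_mem ha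
    exact this.continuousAt (mem_interior_iff_mem_nhds.1 hmem)
  have hev : ∀ᶠ a in 𝓝 (q x0 yb), u (Xi q U yb a) + c (Xi q U yb a) yb < b :=
    hc.eventually_lt continuousAt_const (by simpa [P.Xi_q hx0' hyb] using h)
  rw [mem_interior_iff_mem_nhds]
  filter_upwards [hev, mem_interior_iff_mem_nhds.1 hmem] with a ha ha'
  exact ⟨Xi q U yb a, ⟨Xi_mem ha', ha.le⟩, Xi_eq ha'⟩

/-- linearised displacement -/
theorem Pkg.q_dir (P : Pkg n c U V p q A C0) {x yb d e : Euc n} (hx : x ∈ U) (hyb : yb ∈ closure V)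
    (hpos : 0 < @inner ℝ _ _ e (A x yb d)) : ∃ δ > 0, ∀ t : ℝ, 0 < t → t < δ →
      @inner ℝ _ _ e (q x yb) < @inner ℝ _ _ e (q (x + t • d) yb) := by
  have h1 : HasFDerivAt (fun x' => q x' yb) (A x yb) x :=
    (P.q_x x (subset_closure hx) yb hyb).hasFDerivAt
      (mem_of_superset (P.oU.mem_nhds hx) subset_closure)
  have h2 : HasDerivAt (fun t : ℝ => x + t • d) d 0 := by
    simpa using ((hasDerivAt_id (0:ℝ)).smul_const d).const_add x
  have h3 : HasDerivAt (fun t : ℝ => q (x + t • d) yb) (A x yb d) 0 := by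
    have h1' : HasFDerivAt (fun x' => q x' yb) (A x yb) (x + (0:ℝ) • d) := by simpa using h1
    exact h1'.comp_hasDerivAt (0:ℝ) h2
  have h4 : HasDerivAt (fun t : ℝ => (innerSL ℝ e) (q (x + t • d) yb)) (innerSL ℝ e (A x yb d)) 0 :=
    (innerSL ℝ e).hasFDerivAt.comp_hasDerivAt (0:ℝ) h3
  have h5 := (hasDerivAt_iff_tendsto_slope.1 h4).eventually (lt_mem_nhds (show 0 < innerSL ℝ e (A x yb d) from hpos))
  rw [eventually_nhdsWithin_iff] at h5
  obtain ⟨δ, hδ, h6⟩ := Metric.eventually_nhds_iff.1 h5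
  refine ⟨δ, hδ, fun t ht htd => ?_⟩
  have := h6 (y := t) (by simpa [abs_of_pos ht] using htd) ht.ne'
  rw [slope_def_field] at this
  simp only [sub_zero, zero_smul, add_zero, innerSL_apply_apply] at this
  have := (div_pos_iff_of_pos_right ht).1 this
  linarith

theorem Pkg.inner_hat_smul (P : Pkg n c U V p q A C0) {x yb y e : Euc n} {k : ℝ} (hx : x ∈ closure U)
    (hyb : yb ∈ closure V)
    (h : p x y = p x yb + k • ContinuousLinearMap.adjoint (A x yb) e) : hat p A x yb y = k • e := by
  apply P.At_inv x hx yb hyb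
  rw [P.adj_hat hx hyb, h, map_smul]; abel

/-- sets sliding under a section -/
theorem Pot.slide (H : Pot n c U V u v) (P : Pkg n c U V p q A C0) {yb x0 y : Euc n} {b h : ℝ}
    (hyb : yb ∈ closure V) (hy : y ∈ closure V) (hX : Sec c U u yb b ⊆ U) (hx0 : x0 ∈ Sec c U u yb b)
    (hh : 0 < h) (hh' : u x0 + c x0 yb = b - h)
    (hP : ∀ x ∈ Sec c U u yb b, (c x yb - c x y) - (c x0 yb - c x0 y) ≤ h) :
    y ∈ Im c U V u v (Sec c U u yb b) := by
  obtain ⟨z, hz, hmin⟩ := (H.sec_compact P hyb b).exists_isMinOn ⟨x0, hx0⟩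
    ((H.ut_cont P hy).mono fun _ h => h.1)
  have key : ∃ z ∈ Sec c U u yb b, u z + c z yb < b ∧ ∀ x ∈ Sec c U u yb b, u z + c z y ≤ u x + c x y := by
    rcases lt_or_eq_of_le hz.2 with h1 | h1
    · exact ⟨z, hz, h1, fun x hx => hmin hx⟩
    · refine ⟨x0, hx0, by linarith, fun x hx => ?_⟩
      have e1 := hmin hx
      have e2 := hP z hz
      simp only [mem_ofPred_eq] at e1
      linarith
  obtain ⟨z, hz, hlt, hm⟩ := key
  refine ⟨z, hz, H.loc_glob P (hX hz) hy ?_⟩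
  have hcz : ContinuousAt (fun x => u x + c x yb) z := (H.ut_cont P hyb).continuousAt
    (mem_of_superset (P.oU.mem_nhds (hX hz)) subset_closure)
  filter_upwards [hcz.eventually_lt continuousAt_const hlt, P.oU.mem_nhds (hX hz)] with x h1 h2
  exact hm x ⟨subset_closure h2, h1.le⟩

/-- one steep mountain in a given direction -/
theorem Pot.steep (H : Pot n c U V u v) (P : Pkg n c U V p q A C0) {yb x0 e : Euc n} {b h M k w : ℝ}
    (hyb : yb ∈ closure V) (hX : Sec c U u yb b ⊆ U) (hx0 : x0 ∈ Sec c U u yb b)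
    (hh : 0 < h) (hh' : u x0 + c x0 yb = b - h) (hw : 0 < w) (he : e ≠ 0)
    (hM : ∀ x ∈ Sec c U u yb b, ∀ x' ∈ Sec c U u yb b, ∀ y ∈ closure V,
      Real.exp (C0 * ‖x - x'‖ * ‖y - yb‖) ≤ M) (hM0 : 0 < M) (hk : 0 < k) (hkM : k * M ≤ 1)
    (hwd : ∀ x ∈ Sec c U u yb b, ∀ x' ∈ Sec c U u yb b, (inner ℝ e (q x yb - q x' yb) : ℝ) ≤ w) :
    ∃ xi ∈ Sec c U u yb b, ∃ y ∈ closure V, hat p A xi yb y = (k * h / w) • e ∧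
      ∀ x ∈ Sec c U u yb b, (c x yb - c x y) - (c x0 yb - c x0 y) ≤ h := by
  obtain ⟨xi, hxi, hmax⟩ := (H.sec_compact P hyb b).exists_isMaxOn ⟨x0, hx0⟩
    (f := fun x => (inner ℝ e (q x yb) : ℝ))
    ((continuous_const.inner continuous_id).comp_continuousOn ((P.q_cont hyb).mono fun _ h => h.1))
  have hmax' : ∀ x ∈ Sec c U u yb b, (inner ℝ e (q x yb) : ℝ) ≤ inner ℝ e (q xi yb) := fun x hx => hmax hx
  have hxiU := hX hxi
  have htop : u xi + c xi yb = b := by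
    refine le_antisymm hxi.2 (not_lt.1 fun hlt => ?_)
    obtain ⟨δ, hδ, hd⟩ := P.q_dir (d := Ai A xi yb e) (e := e) hxiU hyb (by
      rw [P.Ai_right hxi.1 hyb]; exact real_inner_self_pos.2 he)
    have hcz : ContinuousAt (fun x => u x + c x yb) xi := (H.ut_cont P hyb).continuousAt
      (mem_of_superset (P.oU.mem_nhds hxiU) subset_closure)
    have hev : ∀ᶠ x in 𝓝 xi, x ∈ Sec c U u yb b := by
      filter_upwards [hcz.eventually_lt continuousAt_const hlt, P.oU.mem_nhds hxiU] with x h1 h2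
      exact ⟨subset_closure h2, h1.le⟩
    have ht : Tendsto (fun t : ℝ => xi + t • Ai A xi yb e) (𝓝[>] 0) (𝓝 xi) := by
      have : Continuous fun t : ℝ => xi + t • Ai A xi yb e := by fun_prop
      have := this.tendsto 0
      simp only [zero_smul, add_zero] at this
      exact this.mono_left nhdsWithin_le_nhds
    obtain ⟨t, ht1, ht2⟩ := ((ht.eventually hev).and (Ioo_mem_nhdsGT hδ)).exists
    exact absurd (hmax' _ ht1) (not_le.2 (hd t ht2.1 ht2.2))
  have hcon : ∃ y0, Con c U V u v xi y0 ∧ ∃ κ : ℝ, 0 ≤ κ ∧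
      p xi y0 = p xi yb + κ • ContinuousLinearMap.adjoint (A xi yb) e := by
    by_contra hno
    push Not at hno
    obtain ⟨d, hd1, δ, hδ, hd⟩ := H.descend P (w := ContinuousLinearMap.adjoint (A xi yb) e) hxiU hyb hno
    have hw0 : ContinuousLinearMap.adjoint (A xi yb) e ≠ 0 := by
      intro h0
      exact he (P.At_inv xi hxi.1 yb hyb (by simpa using h0))
    have hpos := hd1 hw0
    rw [ContinuousLinearMap.adjoint_inner_left] at hpos
    obtain ⟨δ', hδ', hd'⟩ := P.q_dir hxiU hyb hpos
    set t := min δ δ' / 2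
    have ht : 0 < min δ δ' := lt_min hδ hδ'
    have ht0 : 0 < t := half_pos ht
    have ht1 : t < δ := lt_of_lt_of_le (half_lt_self ht) (min_le_left _ _)
    have ht2 : t < δ' := lt_of_lt_of_le (half_lt_self ht) (min_le_right _ _)
    have h1 := hd t ht0 ht1
    exact absurd (hmax' _ ⟨subset_closure h1.1, by linarith [h1.2]⟩) (not_le.2 (hd' t ht0 ht2))
  obtain ⟨y0, hy0, κ, hκ, hp⟩ := hcon
  have hhat := P.inner_hat_smul hxi.1 hyb hp
  have hsl : h ≤ M * (κ * w) := by
    have h1 := H.support hy0 hx0.1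
    have h2 := P.slope1 hyb hy0.2.1 hx0.1 hxiU (by linarith)
    rw [hhat, inner_smul_left] at h2
    have h3 := hM xi hxi x0 hx0 y0 hy0.2.1
    have h4 := hwd xi hxi x0 hx0
    have h5 := hmax' x0 hx0
    rw [inner_sub_right] at h4 h2
    simp only [conj_trivial] at h2
    have h6 : κ * (inner ℝ e (q xi yb) - inner ℝ e (q x0 yb)) ≤ κ * w := by gcongr
    have h7 : 0 ≤ κ * (inner ℝ e (q xi yb) - inner ℝ e (q x0 yb)) := mul_nonneg hκ (by linarith)
    have h8 := mul_le_mul h3 h6 h7 hM0.le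
    linarith
  have hκ1 : k * h / w ≤ κ := by
    rw [div_le_iff₀ hw]
    calc k * h ≤ k * (M * (κ * w)) := by gcongr
      _ = (k * M) * (κ * w) := by ring
      _ ≤ 1 * (κ * w) := by
        have : 0 ≤ κ * w := by positivity
        gcongr
      _ = κ * w := one_mul _
  have hκ0 : 0 < κ := lt_of_lt_of_le (by positivity) hκ1
  set s := (k * h / w) / κ with hs
  have hs0 : 0 ≤ s := by positivity
  have hs1 : s ≤ 1 := (div_le_one hκ0).2 hκ1
  obtain ⟨y, hy, ey⟩ := P.exY hxi.1 hyb hy0.2.1 hs0 hs1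
  have hhy : hat p A xi yb y = (k * h / w) • e := by
    apply P.inner_hat_smul hxi.1 hyb
    rw [ey, hp]
    have : (k * h / w) = s * κ := by rw [hs]; field_simp
    rw [this]; module
  refine ⟨xi, hxi, y, hy, hhy, fun x hx => ?_⟩
  have h1 : (c x yb - c x y) - (c xi yb - c xi y) ≤ 0 := by
    have h2 := P.dasmY hxi.1 hx.1 hyb hy0.2.1 hy hs0 hs1 ey
    have h3 := H.support hy0 hx.1
    have h4 := hx.2
    rcases le_max_iff.1 h2 with h | h <;> linarith
  have h2 : (c xi yb - c xi y) - (c x0 yb - c x0 y) ≤ h := by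
    rcases le_or_gt (c xi yb - c xi y) (c x0 yb - c x0 y) with h3 | h3
    · linarith
    have h2 := P.slope1 hyb hy hx0.1 hxiU h3
    rw [hhy, inner_smul_left] at h2
    have h3 := hM xi hxi x0 hx0 y hy
    have h4 := hwd xi hxi x0 hx0
    have h5 := hmax' x0 hx0
    rw [inner_sub_right] at h4 h2
    simp only [conj_trivial] at h2
    have h6 : (k * h / w) * (inner ℝ e (q xi yb) - inner ℝ e (q x0 yb)) ≤ (k * h / w) * w := by gcongr
    have h7 : 0 ≤ (k * h / w) * (inner ℝ e (q xi yb) - inner ℝ e (q x0 yb)) := mul_nonneg (by positivity) (by linarith)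
    have h8 := mul_le_mul h3 h6 h7 hM0.le
    have h9 : M * (k * h / w * w) = (k * M) * h := by field_simp
    have h10 : (k * M) * h ≤ 1 * h := by gcongr
    linarith
  linarith

/-- lower volume estimate -/
theorem vlower (n : ℕ) : ∃ εn > 0, ∃ cn : ℝ, 0 < cn ∧ ∀ {c : Euc n → Euc n → ℝ} {U V : Set (Euc n)}
    {p q : Euc n → Euc n → Euc n} {A : Euc n → Euc n → Euc n →L[ℝ] Euc n} {C0 : ℝ} {u v : Euc n → ℝ},
    Pot n c U V u v → Pkg n c U V p q A C0 → ∀ {g1 g2 : ℝ}, Dt U V A g1 g2 →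
    ∀ {yb x0 : Euc n} {b h M k d : ℝ}, yb ∈ closure V → Sec c U u yb b ⊆ U → x0 ∈ Sec c U u yb b →
    0 < h → u x0 + c x0 yb = b - h → (∀ x ∈ Sec c U u yb b, ∀ x' ∈ Sec c U u yb b, ∀ y ∈ closure V,
      Real.exp (C0 * ‖x - x'‖ * ‖y - yb‖) ≤ M) → 0 < M → 0 < k → k * M ≤ 1 → 0 < d →
    (∀ x ∈ Sec c U u yb b, ∀ x' ∈ Sec c U u yb b, ∀ y ∈ closure V, ‖hat p A x yb y‖ ≤ d →
      ‖hat p A x' yb y - hat p A x yb y‖ ≤ εn * ‖hat p A x yb y‖) →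
    (∀ e : Euc n, ‖e‖ = 1 → ∃ x ∈ Sec c U u yb b, ∃ x' ∈ Sec c U u yb b,
      k * h ≤ d * (inner ℝ e (q x yb - q x' yb) : ℝ)) →
    ENNReal.ofReal (cn * (g1 / g2 ^ 2) * (k * h) ^ n) ≤
      volume (Im c U V u v (Sec c U u yb b)) * volume (Sec c U u yb b) := by
  obtain ⟨εn, hε, cn, hcn, hpert⟩ := perturb_vol n
  obtain ⟨Cn, hCn, hframe⟩ := convex_frame n
  refine ⟨εn, hε, cn / Cn, by positivity, ?_⟩
  intro c U V p q A C0 u v H P g1 g2 hg yb x0 b h M k d hyb hX hx0 hh hh' hM hM0 hk hkM hdpos hcomp hwid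
  have hx0U := hX hx0
  have hg1 := hg.1
  have hg2 : 0 < g2 := hg.1.trans_le hg.2.1
  obtain ⟨e, w, hw, hwd, hvol⟩ := hframe _ (H.secq_compact P hyb b) (H.secq_convex P hyb b)
    ⟨_, H.secq_int P hyb hx0U (by linarith)⟩
  have hwd' : ∀ i, ∀ x ∈ Sec c U u yb b, ∀ x' ∈ Sec c U u yb b, (inner ℝ (e i) (q x yb - q x' yb) : ℝ) ≤ w i :=
    fun i x hx x' hx' => hwd i _ (mem_image_of_mem _ hx) _ (mem_image_of_mem _ hx')
  have hst := fun i => H.steep P hyb hX hx0 hh hh' (hw i) (e.orthonormal.ne_zero i) hM hM0 hk hkM (hwd' i)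
  choose xi hxi y hy hhat hPy using hst
  set S : Set (Euc n) := {y | y ∈ closure V ∧ ∀ x ∈ Sec c U u yb b, (c x yb - c x y) - (c x0 yb - c x0 y) ≤ h} with hS
  have hSIm : S ⊆ Im c U V u v (Sec c U u yb b) := fun y hy => H.slide P hyb hy.1 hX hx0 hh hh' hy.2
  have hScl : IsCompact S := by
    have : S = closure V ∩ ⋂ x ∈ Sec c U u yb b, (closure V ∩ (fun y => (c x yb - c x y) - (c x0 yb - c x0 y)) ⁻¹' Iic h) := by
      ext y; simp only [hS, mem_ofPred_eq, mem_inter_iff, mem_iInter, mem_preimage, mem_Iic]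
      exact ⟨fun hy => ⟨hy.1, fun x hx => ⟨hy.1, hy.2 x hx⟩⟩, fun hy => ⟨hy.1, fun x hx => (hy.2 x hx).2⟩⟩
    rw [this]
    refine P.compV.inter_right (isClosed_biInter fun x hx => ?_)
    refine ContinuousOn.preimage_isClosed_of_isClosed ?_ isClosed_closure isClosed_Iic
    exact ((continuousOn_const.sub (contOn_right P.cc hx.1)).sub (continuousOn_const.sub (contOn_right P.cc hx0.1)))
  have hSV : S ⊆ closure V := fun y hy => hy.1
  have hybS : yb ∈ S := ⟨hyb, fun x hx => by simp [hh.le]⟩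
  have hconv : Convex ℝ ((fun y => p x0 y) '' S) := by
    rintro _ ⟨y0, h0, rfl⟩ _ ⟨y1, h1, rfl⟩ s t hs ht hst
    obtain ⟨z, hz, ez⟩ := P.exY hx0.1 h0.1 h1.1 ht (by linarith)
    obtain rfl : s = 1 - t := by linarith
    refine ⟨z, ⟨hz, fun x hx => ?_⟩, ez⟩
    have h2 := P.dasmY hx0.1 hx.1 h0.1 h1.1 hz ht (by linarith) ez
    have e0 := h0.2 x hx
    have e1 := h1.2 x hx
    rcases le_max_iff.1 h2 with h | h <;> linarith
  -- transport to hat coordinates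
  set B := ContinuousLinearMap.adjoint (Ai A x0 yb) with hB
  have hconv2 : Convex ℝ (B '' ((fun y => p x0 y) '' S)) := hconv.linear_image (B : Euc n →ₗ[ℝ] Euc n)
  have hBy : ∀ y, B (p x0 y) = B (p x0 yb) + hat p A x0 yb y := fun y => by
    rw [hat, ← hB, map_sub]; abel
  set κ : Fin n → ℝ := fun i => k * h / w i with hκ
  have hκ0 : ∀ i, 0 < κ i := fun i => div_pos (mul_pos hk hh) (hw i)
  set η : Fin n → Euc n := fun i => (κ i)⁻¹ • (hat p A x0 yb (y i) - κ i • e i) with hη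
  have hηb : ∀ i, ‖η i‖ ≤ εn := by
    intro i
    have hn1 : ‖hat p A (xi i) yb (y i)‖ = κ i := by
      rw [hhat i, norm_smul, e.orthonormal.1 i, mul_one, Real.norm_of_nonneg (hκ0 i).le]
    have hd : κ i ≤ d := by
      obtain ⟨x, hx, x', hx', hle⟩ := hwid (e i) (e.orthonormal.1 i)
      have h1 := hwd' i x hx x' hx'
      have hkh : 0 < k * h := mul_pos hk hh
      rw [hκ]; simp only
      rw [div_le_iff₀ (hw i)]
      nlinarith
    have h1 := hcomp (xi i) (hxi i) x0 hx0 (y i) (hy i) (by rw [hn1]; exact hd)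
    rw [hn1, hhat i] at h1
    rw [hη]; simp only
    rw [norm_smul, norm_inv, Real.norm_of_nonneg (hκ0 i).le, inv_mul_le_iff₀ (hκ0 i), mul_comm]
    exact h1
  have hv := hpert e η hηb κ (fun i => (hκ0 i).le) _ hconv2 (B (p x0 yb)) ⟨_, ⟨yb, hybS, rfl⟩, rfl⟩ (fun i => by
    refine ⟨_, ⟨y i, ⟨hy i, hPy i⟩, rfl⟩, ?_⟩
    rw [hBy]
    congr 1
    rw [hη]; simp only [smul_add, smul_smul, mul_inv_cancel₀ (hκ0 i).ne', one_smul]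
    abel)
  have hdet : LinearMap.det (B : Euc n →ₗ[ℝ] Euc n) = ((A x0 yb).det)⁻¹ := by
    have h1 : (Ai A x0 yb).det * (A x0 yb).det = 1 := by
      rw [← det_comp']
      have : (Ai A x0 yb).comp (A x0 yb) = ContinuousLinearMap.id ℝ _ := by
        ext1 z; exact P.Ai_left hx0.1 hyb z
      rw [this]; exact LinearMap.det_id
    have h2 : LinearMap.det (B : Euc n →ₗ[ℝ] Euc n) = (Ai A x0 yb).det := det_adj _
    rw [h2]; exact eq_inv_of_mul_eq_one_left h1
  rw [Measure.addHaar_image_continuousLinearMap, hdet, abs_inv] at hv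
  have hv1 := (P.volp hg hx0.1 hScl.measurableSet hSV).2
  have hv2 := (P.volq hg hyb (H.sec_compact P hyb b).measurableSet fun x hx => hx.1).2
  have hdl := (hg.2.2 x0 hx0.1 yb hyb).1
  have hi : |(A x0 yb).det|⁻¹ ≤ g1⁻¹ := inv_anti₀ hg1 hdl
  have hkw : (∏ i, κ i) * ∏ i, w i = (k * h) ^ n := by
    rw [← Finset.prod_mul_distrib]
    rw [Finset.prod_congr rfl fun i _ => show κ i * w i = k * h by
      rw [hκ]; exact div_mul_cancel₀ _ (hw i).ne']
    simp
  have hkp : 0 < ∏ i, κ i := Finset.prod_pos fun i _ => hκ0 i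
  have hwp : 0 < ∏ i, w i := Finset.prod_pos fun i _ => hw i
  have hSle := measure_mono (μ := volume) hSIm
  calc ENNReal.ofReal (cn / Cn * (g1 / g2 ^ 2) * (k * h) ^ n)
      = ENNReal.ofReal (g1 / (g2 ^ 2 * Cn)) * (ENNReal.ofReal (cn * ∏ i, κ i) * ENNReal.ofReal (∏ i, w i)) := by
        rw [← ENNReal.ofReal_mul (by positivity), ← ENNReal.ofReal_mul (by positivity)]
        congr 1
        rw [mul_assoc cn, hkw]; field_simp
    _ ≤ ENNReal.ofReal (g1 / (g2 ^ 2 * Cn)) * ((ENNReal.ofReal g1⁻¹ * (ENNReal.ofReal g2 *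
        volume (Im c U V u v (Sec c U u yb b)))) * (ENNReal.ofReal Cn * (ENNReal.ofReal g2 * volume (Sec c U u yb b)))) := by
        gcongr
        · refine hv.trans ?_
          gcongr
          refine hv1.trans ?_
          gcongr
        · refine hvol.trans ?_
          gcongr
    _ = (ENNReal.ofReal (g1 / (g2 ^ 2 * Cn)) * ENNReal.ofReal g1⁻¹ * ENNReal.ofReal g2 * ENNReal.ofReal Cn * ENNReal.ofReal g2) *
        (volume (Im c U V u v (Sec c U u yb b)) * volume (Sec c U u yb b)) := by ring
    _ = 1 * (volume (Im c U V u v (Sec c U u yb b)) * volume (Sec c U u yb b)) := by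
        congr 1
        rw [← ENNReal.ofReal_mul (by positivity), ← ENNReal.ofReal_mul (by positivity),
          ← ENNReal.ofReal_mul (by positivity), ← ENNReal.ofReal_mul (by positivity), ← ENNReal.ofReal_one]
        congr 1
        field_simp
    _ = _ := one_mul _
end ve
end FKM

open Set MeasureTheory Metric Bornology
open scoped ENNReal NNReal Pointwise

namespace FKM
open Filter Topology
section ve

theorem Pkg.det_hat {n : ℕ} {c : Euc n → Euc n → ℝ} {U V : Set (Euc n)}
    {p q : Euc n → Euc n → Euc n} {A : Euc n → Euc n → Euc n →L[ℝ] Euc n} {C0 : ℝ}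
    (P : Pkg n c U V p q A C0) {x0 yb : Euc n} (hx0 : x0 ∈ closure U) (hyb : yb ∈ closure V) :
    LinearMap.det ((ContinuousLinearMap.adjoint (Ai A x0 yb) : Euc n →L[ℝ] Euc n) : Euc n →ₗ[ℝ] Euc n)
      = ((A x0 yb).det)⁻¹ := by
  have h1 : (Ai A x0 yb).det * (A x0 yb).det = 1 := by
    rw [← det_comp']
    have : (Ai A x0 yb).comp (A x0 yb) = ContinuousLinearMap.id ℝ _ := by
      ext1 z; exact P.Ai_left hx0 hyb z
    rw [this]; exact LinearMap.det_id
  have h2 : LinearMap.det ((ContinuousLinearMap.adjoint (Ai A x0 yb) : Euc n →L[ℝ] Euc n) : Euc n →ₗ[ℝ] Euc n)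
    = (Ai A x0 yb).det := det_adj _
  rw [h2]; exact eq_inv_of_mul_eq_one_left h1

/-- upper volume estimate -/
theorem vupper (n : ℕ) : ∃ Cn : ℝ, 0 < Cn ∧ ∀ {c : Euc n → Euc n → ℝ} {U V : Set (Euc n)}
    {p q : Euc n → Euc n → Euc n} {A : Euc n → Euc n → Euc n →L[ℝ] Euc n} {C0 : ℝ} {u v : Euc n → ℝ},
    Pot n c U V u v → Pkg n c U V p q A C0 → ∀ {g1 g2 : ℝ}, Dt U V A g1 g2 →
    ∀ {yb x0 : Euc n} {b h M : ℝ}, yb ∈ closure V → Sec c U u yb b ⊆ U → x0 ∈ Sec c U u yb b →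
    u x0 + c x0 yb < b → (∀ x ∈ Sec c U u yb b, b - h ≤ u x + c x yb) →
    (∀ x ∈ Sec c U u yb b, ∀ x' ∈ Sec c U u yb b, ∀ y ∈ closure V,
      Real.exp (C0 * ‖x - x'‖ * ‖y - yb‖) ≤ M) → 0 < M →
    ∃ xc ∈ Sec c U u yb b, ∀ t : ℝ, 0 < t → t < 1 → ∀ W ⊆ Sec c U u yb b, IsClosed W →
      (∀ x ∈ W, ∃ z ∈ Sec c U u yb b, q x yb = (1 - t) • q xc yb + t • q z yb) →
    volume (Im c U V u v W) * volume (Sec c U u yb b) ≤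
      ENNReal.ofReal (Cn * (g2 / g1 ^ 2) * (M * (h * (1 + M * t / (1 - t)))) ^ n) := by
  obtain ⟨Cn, hCn, hcen⟩ := convex_center n
  refine ⟨Cn, hCn, ?_⟩
  intro c U V p q A C0 u v H P g1 g2 hg yb x0 b h M hyb hX hx0 hlt hlow hM hM0
  have hg1 := hg.1
  have hg2 : 0 < g2 := hg.1.trans_le hg.2.1
  obtain ⟨_, ⟨xc, hxc, rfl⟩, hpol⟩ := hcen _ (H.secq_compact P hyb b) (H.secq_convex P hyb b)
    ⟨_, H.secq_int P hyb (hX hx0) hlt⟩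
  refine ⟨xc, hxc, fun t ht0 ht1 W hWX hW hWz => ?_⟩
  have hh : 0 < h := by linarith [hlow x0 hx0]
  have ht1' : 0 < 1 - t := by linarith
  set Hh := h * (1 + M * t / (1 - t)) with hHh
  have hHh0 : 0 < Hh := by positivity
  have hImc := H.Im_compact P hW
  have hImV : Im c U V u v W ⊆ closure V := by rintro y ⟨x, -, h⟩; exact h.2.1
  set B := ContinuousLinearMap.adjoint (Ai A xc yb) with hB
  have hsub : (fun a => -B (p xc yb) + a) '' (B '' ((fun y => p xc y) '' Im c U V u v W)) ⊆
      {Q : Euc n | ∀ z ∈ (fun x => q x yb) '' Sec c U u yb b, (inner ℝ Q (z - q xc yb) : ℝ) ≤ M * Hh} := by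
    rintro _ ⟨_, ⟨_, ⟨y, ⟨x, hx, hcon⟩, rfl⟩, rfl⟩, rfl⟩ _ ⟨z, hz, rfl⟩
    have hhat : -B (p xc yb) + B (p xc y) = hat p A xc yb y := by rw [hat, ← hB, map_sub]; abel
    simp only [hhat]
    have hy := hcon.2.1
    have hxX := hWX hx
    have hMb : ∀ x ∈ Sec c U u yb b, ∀ x' ∈ Sec c U u yb b, Real.exp (C0 * ‖x - x'‖ * ‖y - yb‖) ≤ M :=
      fun x hx x' hx' => hM x hx x' hx' y hy
    have hsup : ∀ z ∈ Sec c U u yb b, (c z yb - c z y) - (c x yb - c x y) ≤ h := fun z hz => by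
      have := H.support hcon hz.1
      linarith [hz.2, hlow x hxX]
    have hxcb : (c x yb - c x y) - (c xc yb - c xc y) ≤ h * (M * t / (1 - t)) := by
      rcases le_or_gt (c x yb - c x y) (c xc yb - c xc y) with h3 | h3
      · have : 0 ≤ h * (M * t / (1 - t)) := by positivity
        linarith
      obtain ⟨z', hz', ez⟩ := hWz x hx
      have h4 := P.QQx yb hyb y hy xc hxc.1 z' hz'.1 x hxX.1 t ht0 ht1 ez h3
      have h5 := hMb z' hz' xc hxc
      have h6 := hsup z' hz'
      have h7 : 0 ≤ (c z' yb - c z' y) - (c x yb - c x y) := by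
        by_contra hneg
        have a1 : 0 < (1 - t) * ((c x yb - c x y) - (c xc yb - c xc y)) := mul_pos ht1' (by linarith)
        have a2 : Real.exp (C0 * ‖z' - xc‖ * ‖y - yb‖) * t * ((c z' yb - c z' y) - (c x yb - c x y)) ≤ 0 :=
          mul_nonpos_of_nonneg_of_nonpos (by positivity) (by linarith)
        linarith
      have h8 : Real.exp (C0 * ‖z' - xc‖ * ‖y - yb‖) * t * ((c z' yb - c z' y) - (c x yb - c x y)) ≤ M * t * h := by
        gcongr
      rw [show h * (M * t / (1 - t)) = (M * t * h) / (1 - t) by ring, le_div_iff₀ ht1']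
      linarith
    rcases le_or_gt (inner ℝ (hat p A xc yb y) (q z yb - q xc yb) : ℝ) 0 with h3 | h3
    · exact h3.trans (by positivity)
    have h4 := P.slope0 hyb hy (hX hxc) hz.1 h3
    have h5 := hMb z hz xc hxc
    have h6 : (c z yb - c z y) - (c xc yb - c xc y) ≤ Hh := by
      have := hsup z hz
      rw [hHh]; linarith
    refine h4.trans ?_
    rcases le_or_gt ((c z yb - c z y) - (c xc yb - c xc y)) 0 with h7 | h7
    · exact (mul_nonpos_of_nonneg_of_nonpos (by positivity) h7).trans (by positivity)
    · exact mul_le_mul h5 h6 h7.le hM0.le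
  have hv := measure_mono (μ := volume) hsub
  rw [image_add_left, measure_preimage_add, Measure.addHaar_image_continuousLinearMap,
    P.det_hat hxc.1 hyb, abs_inv] at hv
  have hp := hpol (M * Hh) (by positivity)
  have hv1 := (P.volp hg hxc.1 hImc.measurableSet hImV).1
  have hv2 := (P.volq hg hyb (H.sec_compact P hyb b).measurableSet fun x hx => hx.1).1
  have hdl := (hg.2.2 xc hxc.1 yb hyb)
  have hi : g2⁻¹ ≤ |(A xc yb).det|⁻¹ := inv_anti₀ (hg1.trans_le hdl.1) hdl.2
  calc volume (Im c U V u v W) * volume (Sec c U u yb b)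
      = (ENNReal.ofReal (g2 / g1 ^ 2) * ENNReal.ofReal g2⁻¹ * ENNReal.ofReal g1 * ENNReal.ofReal g1) *
        (volume (Im c U V u v W) * volume (Sec c U u yb b)) := by
        rw [← ENNReal.ofReal_mul (by positivity), ← ENNReal.ofReal_mul (by positivity),
          ← ENNReal.ofReal_mul (by positivity), show g2 / g1 ^ 2 * g2⁻¹ * g1 * g1 = 1 by field_simp,
          ENNReal.ofReal_one, one_mul]
    _ = ENNReal.ofReal (g2 / g1 ^ 2) * ((ENNReal.ofReal g2⁻¹ * (ENNReal.ofReal g1 * volume (Im c U V u v W)))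
        * (ENNReal.ofReal g1 * volume (Sec c U u yb b))) := by ring
    _ ≤ ENNReal.ofReal (g2 / g1 ^ 2) * ENNReal.ofReal (Cn * (M * Hh) ^ n) := by
        gcongr
        refine le_trans ?_ hp
        gcongr
        refine le_trans ?_ hv
        gcongr
    _ = _ := by
        rw [← ENNReal.ofReal_mul (by positivity)]
        congr 1; ring
end ve
end FKM

open Set MeasureTheory Metric Bornology
open scoped ENNReal NNReal Pointwise

namespace FKM
open Filter Topology
section hm

theorem homoth_count {n : ℕ} {Q R : Set (Euc n)} {a : Euc n} (hQ : IsCompact Q) (hR : Convex ℝ R)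
    (ha : a ∈ R) (hQR : Q ⊆ R) {N : ℕ} (hN : 0 < N)
    (hsep : ∀ z ∈ Q, ∀ z' ∈ Q, ∀ r : ℝ, 0 < r → r ≤ 1 - 1 / (2 * N) → z ≠ (1 - r) • a + r • z') :
    (N : ℝ≥0∞) * volume Q ≤ 2 ^ n * volume R := by
  set t : Fin N → ℝ := fun k => 1 - (k : ℝ) / (2 * N) with ht
  have hN' : (0:ℝ) < N := by exact_mod_cast hN
  have ht1 : ∀ k, 1 / 2 ≤ t k ∧ t k ≤ 1 := by
    intro k
    have hk : (k : ℝ) < N := by exact_mod_cast k.2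
    have h1 : (k : ℝ) / (2 * N) ≤ 1 / 2 := by rw [div_le_div_iff₀ (by positivity) (by norm_num)]; linarith
    have h2 : 0 ≤ (k : ℝ) / (2 * N) := by positivity
    constructor <;> simp only [ht] <;> linarith
  set I : Fin N → Set (Euc n) := fun k => AffineMap.homothety a (t k) '' Q with hI
  have hhom : ∀ k z, AffineMap.homothety a (t k) z = (1 - t k) • a + t k • z := fun k z => by
    rw [AffineMap.homothety_apply]; simp only [vsub_eq_sub, vadd_eq_add]; module
  have hIR : ∀ k, I k ⊆ R := by
    rintro k _ ⟨z, hz, rfl⟩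
    rw [hhom]
    exact hR ha (hQR hz) (by linarith [(ht1 k).2]) (by linarith [(ht1 k).1]) (by ring)
  have hIm : ∀ k, MeasurableSet (I k) := fun k =>
    (hQ.image (AffineMap.homothety_continuous a (t k))).measurableSet
  have key : ∀ i j : Fin N, i < j → ∀ w, w ∈ I i → w ∈ I j → False := by
    rintro i j hij _ ⟨z, hz, rfl⟩ ⟨z', hz', e⟩
    rw [hhom, hhom] at e
    have hti := (ht1 i).1
    have htj := (ht1 j).1
    have hti' := (ht1 i).2
    have h0 : 0 < t i := by linarith
    have hd : t i - t j ≥ 1 / (2 * N) := by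
      have : (i : ℝ) + 1 ≤ j := by exact_mod_cast hij
      have h1 : t i - t j = ((j : ℝ) - i) / (2 * N) := by simp only [ht]; ring
      rw [h1, ge_iff_le]
      gcongr; linarith
    have h2N : 0 < 1 / (2 * (N:ℝ)) := by positivity
    refine hsep z hz z' hz' (t j / t i) (by positivity) ?_ ?_
    · rw [div_le_iff₀ h0]
      have : (1 / (2 * (N:ℝ))) * t i ≤ 1 / (2 * (N:ℝ)) * 1 := by gcongr
      linarith
    · have : t i • z = (t i - t j) • a + t j • z' := by
        have : t i • z = (1 - t j) • a + t j • z' - (1 - t i) • a := by rw [e]; module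
        rw [this]; module
      have h3 : z = (t i)⁻¹ • ((t i - t j) • a + t j • z') := by
        rw [← this, smul_smul, inv_mul_cancel₀ h0.ne', one_smul]
      rw [h3, smul_add, smul_smul, smul_smul]
      congr 2 <;> field_simp
  have hdisj : Pairwise (Function.onFun Disjoint I) := by
    intro i j hij
    rw [Function.onFun, Set.disjoint_left]
    intro w h1 h2
    rcases lt_or_gt_of_ne hij with h | h
    · exact key i j h w h1 h2
    · exact key j i h w h2 h1
  have hvol : ∀ k, ENNReal.ofReal ((1 / 2) ^ n) * volume Q ≤ volume (I k) := by
    intro k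
    rw [hI]; simp only
    rw [Measure.addHaar_image_homothety, finrank_euclideanSpace_fin]
    gcongr
    have h1 := (ht1 k).1
    rw [abs_of_nonneg (by positivity)]
    gcongr
  have hU := measure_iUnion (μ := volume) hdisj hIm
  rw [tsum_fintype] at hU
  have h1 : (N : ℝ≥0∞) * (ENNReal.ofReal ((1 / 2) ^ n) * volume Q) ≤ volume R := by
    calc _ = ∑ k : Fin N, ENNReal.ofReal ((1 / 2) ^ n) * volume Q := by simp
      _ ≤ ∑ k : Fin N, volume (I k) := Finset.sum_le_sum fun k _ => hvol k
      _ = volume (⋃ k, I k) := hU.symm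
      _ ≤ volume R := measure_mono (iUnion_subset hIR)
  have h2 : (2 : ℝ≥0∞) ^ n * ENNReal.ofReal ((1 / 2) ^ n) = 1 := by
    rw [show (2 : ℝ≥0∞) ^ n = ENNReal.ofReal (2 ^ n) by
      rw [ENNReal.ofReal_pow (by norm_num)]; simp, ← ENNReal.ofReal_mul (by positivity), ← mul_pow]
    norm_num
  calc (N : ℝ≥0∞) * volume Q = 2 ^ n * ((N : ℝ≥0∞) * (ENNReal.ofReal ((1 / 2) ^ n) * volume Q)) := by
        rw [show (2 : ℝ≥0∞) ^ n * ((N : ℝ≥0∞) * (ENNReal.ofReal ((1 / 2) ^ n) * volume Q)) =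
          (2 ^ n * ENNReal.ofReal ((1 / 2) ^ n)) * (N * volume Q) by ring, h2, one_mul]
    _ ≤ _ := by gcongr

/-- separation of copies -/
theorem Pkg.sep {n : ℕ} {c : Euc n → Euc n → ℝ} {U V : Set (Euc n)} {p q : Euc n → Euc n → Euc n}
    {A : Euc n → Euc n → Euc n →L[ℝ] Euc n} {C0 : ℝ} (P : Pkg n c U V p q A C0)
    {yt y1 xt x x' : Euc n} {g0 Cb D M r : ℝ} {N : ℕ} (hyt : yt ∈ closure V) (hy1 : y1 ∈ closure V)
    (hxt : xt ∈ closure U) (hx : x ∈ closure U) (hx' : x' ∈ closure U) (hN : 0 < N)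
    (hM : Real.exp (C0 * ‖x' - xt‖ * ‖y1 - yt‖) ≤ M)
    (hb : |c x yt - c x y1 - g0| ≤ Cb) (hb' : |c x' yt - c x' y1 - g0| ≤ Cb)
    (ht : c xt yt - c xt y1 ≤ g0 - D) (hD : Cb * (1 + 4 * N * M) < D)
    (hr0 : 0 < r) (hr : r ≤ 1 - 1 / (2 * N)) : q x yt ≠ (1 - r) • q xt yt + r • q x' yt := by
  intro e
  have hN' : (0:ℝ) < N := by exact_mod_cast hN
  have h2N : 0 < 1 / (2 * (N:ℝ)) := by positivity
  rw [abs_le] at hb hb'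
  have hM0 : 0 < M := lt_of_lt_of_le (Real.exp_pos _) hM
  have hCb : 0 ≤ Cb := by linarith
  have hCb2 : 0 ≤ Cb * (4 * N * M) := by positivity
  have h1 := P.QQx yt hyt y1 hy1 xt hxt x' hx' x hx r hr0 (by linarith) e (by linarith)
  have h2 : (1 / (2 * (N:ℝ))) * (D - Cb) ≤ (1 - r) * (c x yt - c x y1 - (c xt yt - c xt y1)) := by
    apply mul_le_mul <;> linarith
  have h3 : Real.exp (C0 * ‖x' - xt‖ * ‖y1 - yt‖) * r * (c x' yt - c x' y1 - (c x yt - c x y1)) ≤ M * 1 * (2 * Cb) := by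
    rcases le_or_gt (c x' yt - c x' y1 - (c x yt - c x y1)) 0 with h | h
    · exact (mul_nonpos_of_nonneg_of_nonpos (by positivity) h).trans (by positivity)
    · apply mul_le_mul _ (by linarith) h.le (by positivity)
      apply mul_le_mul hM (by linarith) hr0.le hM0.le
  have h4 : (1 / (2 * (N:ℝ))) * (D - Cb) ≤ 2 * M * Cb := by linarith
  rw [div_mul_eq_mul_div, one_mul, div_le_iff₀ (by positivity)] at h4
  nlinarith
end hm
end FKM

open Set MeasureTheory Metric Bornology
open scoped ENNReal NNReal Pointwise

namespace FKM
open Filter Topology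
section core

theorem core_arith {n : ℕ} {a s w iX iW g1 g2 lam L cn Cn r k T N : ℝ} (ha : 0 < a) (hs : 0 < s)
    (hg1 : 0 < g1) (hg2 : 0 < g2) (hlam : 0 < lam) (hL : 0 < L)
    (hcn : 0 < cn) (hCn : 0 < Cn) (hr : 0 < r) (hk : 0 < k) (hN : 0 ≤ N) 
    (e1 : cn * (g1 / g2 ^ 2) * k ^ n ≤ iX * a) (e2 : iX ≤ L * a) (e3 : iW * s ≤ Cn * (g2 / g1 ^ 2) * T ^ n)
    (e4 : lam * w ≤ iW) (e5 : r ^ n * (g1 * s) ≤ g2 * w) (e6 : N * (g1 * a) ≤ 2 ^ n * (g2 * s)) :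
    N ^ 2 ≤ (4 ^ n * Cn / cn) * (g2 / g1) ^ 6 * (L / lam) * (T / (r * k)) ^ n := by
  have f1 : cn * (g1 / g2 ^ 2) * k ^ n ≤ L * a ^ 2 := by nlinarith
  have f2 : lam * (r ^ n * (g1 * s)) * s ≤ g2 * (Cn * (g2 / g1 ^ 2) * T ^ n) := by
    have : lam * (r ^ n * (g1 * s)) ≤ g2 * iW := by nlinarith
    nlinarith
  have f3 : (N * (g1 * a)) ^ 2 ≤ (2 ^ n * (g2 * s)) ^ 2 := pow_le_pow_left₀ (by positivity) e6 2
  have h4 : (4:ℝ) ^ n = 2 ^ n * 2 ^ n := by rw [← mul_pow]; norm_num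
  have g3 : N ^ 2 ≤ 4 ^ n * g2 ^ 2 * s ^ 2 / (g1 ^ 2 * a ^ 2) := by
    rw [le_div_iff₀ (by positivity), h4]; nlinarith
  have g2' : s ^ 2 ≤ g2 * (Cn * (g2 / g1 ^ 2) * T ^ n) / (lam * r ^ n * g1) := by
    rw [le_div_iff₀ (by positivity)]; nlinarith
  have hz : 0 ≤ g2 * (Cn * (g2 / g1 ^ 2) * T ^ n) / (lam * r ^ n * g1) := le_trans (by positivity) g2'
  have g1' : 1 / a ^ 2 ≤ L / (cn * (g1 / g2 ^ 2) * k ^ n) := by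
    rw [div_le_div_iff₀ (by positivity) (by positivity)]; linarith
  calc N ^ 2 ≤ 4 ^ n * g2 ^ 2 / g1 ^ 2 * s ^ 2 * (1 / a ^ 2) := by
        refine g3.trans (le_of_eq ?_); field_simp
    _ ≤ 4 ^ n * g2 ^ 2 / g1 ^ 2 * (g2 * (Cn * (g2 / g1 ^ 2) * T ^ n) / (lam * r ^ n * g1)) *
        (L / (cn * (g1 / g2 ^ 2) * k ^ n)) := by gcongr
    _ = _ := by rw [div_pow T, mul_pow]; field_simp

theorem toReal_conv {X Y : ℝ≥0∞} {α : ℝ} (hα : 0 ≤ α) (hY : Y ≠ ⊤)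
    (h : ENNReal.ofReal α * X ≤ Y) : α * X.toReal ≤ Y.toReal := by
  have := ENNReal.toReal_mono hY h
  rwa [ENNReal.toReal_mul, ENNReal.toReal_ofReal hα] at this

theorem core (n : ℕ) : ∃ εn > 0, ∃ Kn : ℝ, 0 < Kn ∧ ∀ {c : Euc n → Euc n → ℝ} {U V : Set (Euc n)}
    {p q : Euc n → Euc n → Euc n} {A : Euc n → Euc n → Euc n →L[ℝ] Euc n} {C0 : ℝ} {u v : Euc n → ℝ},
    Pot n c U V u v → Pkg n c U V p q A C0 → ∀ {g1 g2 : ℝ}, Dt U V A g1 g2 →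
    ∀ {yt ys y1 x0 xt : Euc n} {bs bB h hB M k d ρ lam Lp g0 Cb D : ℝ} {N : ℕ} {Ul : Set (Euc n)},
    yt ∈ closure V → ys ∈ closure V → y1 ∈ closure V → Sec c U u ys bs ⊆ Sec c U u yt bB →
    Sec c U u yt bB ⊆ U → x0 ∈ Sec c U u ys bs → 0 < h → u x0 + c x0 ys = bs - h →
    xt ∈ Sec c U u yt bB → u xt + c xt yt < bB → (∀ x ∈ Sec c U u yt bB, bB - hB ≤ u x + c x yt) →
    (∀ x ∈ Sec c U u yt bB, ∀ x' ∈ Sec c U u yt bB, ∀ y ∈ closure V, ∀ y' ∈ closure V,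
      Real.exp (C0 * ‖x - x'‖ * ‖y - y'‖) ≤ M) → 0 < k → k * M ≤ 1 → 0 < d →
    (∀ x ∈ Sec c U u ys bs, ∀ x' ∈ Sec c U u ys bs, ∀ y ∈ closure V, ‖hat p A x ys y‖ ≤ d →
      ‖hat p A x' ys y - hat p A x ys y‖ ≤ εn * ‖hat p A x ys y‖) →
    (∀ e : Euc n, ‖e‖ = 1 → ∃ x ∈ Sec c U u ys bs, ∃ x' ∈ Sec c U u ys bs,
      k * h ≤ d * (inner ℝ e (q x ys - q x' ys) : ℝ)) →
    0 < ρ → ρ ≤ 1 → (∀ x ∈ Sec c U u yt bB, ∀ z ∈ Sec c U u yt bB,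
      q x yt = (1 - ρ) • q xt yt + ρ • q z yt → x ∈ Ul) →
    0 < lam → (∀ W ⊆ Ul, IsCompact W → ENNReal.ofReal lam * volume W ≤ volume (Im c U V u v W)) →
    0 < Lp → volume (Im c U V u v (Sec c U u ys bs)) ≤ ENNReal.ofReal Lp * volume (Sec c U u ys bs) →
    (∀ x ∈ Sec c U u ys bs, |c x yt - c x y1 - g0| ≤ Cb) → c xt yt - c xt y1 ≤ g0 - D →
    Cb * (1 + 4 * N * M) < D → 0 < N →
    (N : ℝ) ^ 2 ≤ Kn * (g2 / g1) ^ 6 * (Lp / lam) *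
      ((M * (hB * (1 + M * (1 - ρ / 2) / (ρ / 2)))) / (ρ / 2 * (k * h))) ^ n := by
  obtain ⟨εn, hε, cn, hcn, hlow⟩ := vlower n
  obtain ⟨Cn, hCn, hup⟩ := vupper n
  refine ⟨εn, hε, 4 ^ n * Cn / cn, by positivity, ?_⟩
  intro c U V p q A C0 u v H P g1 g2 hg yt ys y1 x0 xt bs bB h hB M k d ρ lam Lp g0 Cb D N Ul
    hyt hys hy1 hsB hBU hx0 hh hh' hxt hxtb hbot hM hk hkM hd hcomp hwid hρ0 hρ1 hρ hlam hMA hLp hMA' hcb hD hND hN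
  have hg1 := hg.1
  have hg2 : 0 < g2 := hg.1.trans_le hg.2.1
  have hM0 : 0 < M := (Real.exp_pos _).trans_le (hM xt hxt xt hxt yt hyt yt hyt)
  have hXc := H.sec_compact P hys bs
  have hBc := H.sec_compact P hyt bB
  have k1 := hlow H P hg hys (hsB.trans hBU) hx0 hh hh' (fun x hx x' hx' y hy => hM x (hsB hx) x' (hsB hx') y hy ys hys)
    hM0 hk hkM hd hcomp hwid
  obtain ⟨xc, hxc, hup⟩ := hup H P hg hyt hBU hxt hxtb hbot (fun x hx x' hx' y hy => hM x hx x' hx' y hy yt hyt) hM0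
  set Q : Set (Euc n) := (fun x => q x yt) '' Sec c U u yt bB with hQ
  have hQc : IsCompact Q := H.secq_compact P hyt bB
  have hQv : Convex ℝ Q := H.secq_convex P hyt bB
  set w0 : Euc n := (1 - ρ) • q xt yt + (ρ / 2) • q xc yt with hw0
  set R : Set (Euc n) := w0 +ᵥ (ρ / 2) • Q with hR
  have hRc : IsCompact R := (hQc.smul _).vadd _
  set W : Set (Euc n) := Sec c U u yt bB ∩ (fun x => q x yt) ⁻¹' R with hW
  have hWc : IsCompact W := by
    refine hBc.of_isClosed_subset ?_ inter_subset_left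
    exact ((P.q_cont hyt).mono fun _ h => h.1).preimage_isClosed_of_isClosed hBc.isClosed hRc.isClosed
  have hxtQ : q xt yt ∈ Q := mem_image_of_mem _ hxt
  have hxcQ : q xc yt ∈ Q := mem_image_of_mem _ hxc
  have hWR : (fun x => q x yt) '' W = R := by
    apply subset_antisymm
    · rintro _ ⟨x, hx, rfl⟩; exact hx.2
    · rintro _ ⟨_, ⟨a, ha, rfl⟩, rfl⟩
      have hm : (1 / 2 : ℝ) • q xc yt + (1 / 2 : ℝ) • a ∈ Q := hQv hxcQ ha (by norm_num) (by norm_num) (by norm_num)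
      have hm2 := hQv hxtQ hm (a := 1 - ρ) (b := ρ) (by linarith) hρ0.le (by ring)
      have he : (1 - ρ) • q xt yt + ρ • ((1 / 2 : ℝ) • q xc yt + (1 / 2 : ℝ) • a) = w0 + (ρ / 2) • a := by
        rw [hw0]; module
      rw [he] at hm2
      obtain ⟨x, hx, ex⟩ := hm2
      exact ⟨x, ⟨hx, ⟨_, ⟨a, ha, rfl⟩, ex.symm⟩⟩, ex⟩
  have hWz : ∀ x ∈ W, ∃ z ∈ Sec c U u yt bB, q x yt = w0 + (ρ / 2) • q z yt := by
    rintro x ⟨hx, ⟨_, ⟨_, ⟨z, hz, rfl⟩, rfl⟩, e⟩⟩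
    exact ⟨z, hz, e.symm⟩
  have hWU : W ⊆ Ul := by
    intro x hx
    obtain ⟨z, hz, e⟩ := hWz x hx
    have hm : (1 / 2 : ℝ) • q xc yt + (1 / 2 : ℝ) • q z yt ∈ Q :=
      hQv hxcQ (mem_image_of_mem _ hz) (by norm_num) (by norm_num) (by norm_num)
    obtain ⟨z', hz', ez'⟩ := hm
    refine hρ x hx.1 z' hz' ?_
    simp only at ez'
    rw [e, ez', hw0]; module
  have hvW : volume R = ENNReal.ofReal ((ρ / 2) ^ n) * volume Q := by
    rw [hR, measure_vadd, Measure.addHaar_smul]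
    congr 2
    rw [abs_of_pos (by positivity)]; simp
  have k3 := hup (1 - ρ / 2) (by linarith) (by linarith) W inter_subset_left hWc.isClosed (by
    intro x hx
    obtain ⟨z, hz, e⟩ := hWz x hx
    have hpos : 0 < 1 - ρ / 2 := by linarith
    have hm := hQv hxtQ (mem_image_of_mem (fun x => q x yt) hz) (a := (1 - ρ) / (1 - ρ / 2)) (b := (ρ / 2) / (1 - ρ / 2))
      (by apply div_nonneg <;> linarith) (by positivity) (by rw [← add_div, div_eq_one_iff_eq hpos.ne']; ring)
    obtain ⟨z', hz', ez'⟩ := hm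
    refine ⟨z', hz', ?_⟩
    simp only at ez'
    rw [ez', e, hw0, smul_add, smul_smul, smul_smul, mul_div_cancel₀ _ hpos.ne', mul_div_cancel₀ _ hpos.ne']
    module)
  have k4 := hMA W hWU hWc
  have k5a := P.volq hg hyt hBc.measurableSet fun _ h => h.1
  have k5b := P.volq hg hyt hWc.measurableSet fun x h => h.1.1
  have k5c := P.volq hg hyt hXc.measurableSet fun _ h => h.1
  rw [hWR, hvW] at k5b
  have k6 := homoth_count (n := n) (Q := (fun x => q x yt) '' Sec c U u ys bs) (R := Q) (a := q xt yt)
    (hXc.image_of_continuousOn ((P.q_cont hyt).mono fun _ h => h.1)) hQv hxtQ (image_mono hsB) hN (by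
    rintro _ ⟨x, hx, rfl⟩ _ ⟨x', hx', rfl⟩ r hr0 hr
    exact P.sep hyt hy1 hxt.1 hx.1 hx'.1 hN (hM x' (hsB hx') xt hxt y1 hy1 yt hyt) (hcb x hx) (hcb x' hx') hD hND hr0 hr)
  have fX : volume (Sec c U u ys bs) ≠ ⊤ := hXc.measure_ne_top
  have fB : volume (Sec c U u yt bB) ≠ ⊤ := hBc.measure_ne_top
  have fW : volume W ≠ ⊤ := hWc.measure_ne_top
  have fIX : volume (Im c U V u v (Sec c U u ys bs)) ≠ ⊤ := (H.Im_compact P hXc.isClosed).measure_ne_top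
  have fIW : volume (Im c U V u v W) ≠ ⊤ := (H.Im_compact P hWc.isClosed).measure_ne_top
  have fQ : volume Q ≠ ⊤ := hQc.measure_ne_top
  have hbB : 0 ≤ hB := by linarith [hbot xt hxt]
  have e1 := ENNReal.toReal_mono (ENNReal.mul_ne_top fIX fX) k1
  rw [ENNReal.toReal_ofReal (by positivity), ENNReal.toReal_mul] at e1
  have e2 := ENNReal.toReal_mono (ENNReal.mul_ne_top ENNReal.ofReal_ne_top fX) hMA'
  rw [ENNReal.toReal_mul, ENNReal.toReal_ofReal hLp.le] at e2
  have hT : 0 ≤ M * (hB * (1 + M * (1 - ρ / 2) / (1 - (1 - ρ / 2)))) := by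
    have h1 : 0 ≤ 1 - ρ / 2 := by linarith
    have h2 : 0 ≤ 1 - (1 - ρ / 2) := by linarith
    positivity
  have e3 := ENNReal.toReal_mono ENNReal.ofReal_ne_top k3
  rw [ENNReal.toReal_mul, ENNReal.toReal_ofReal (by positivity)] at e3
  rw [show 1 - (1 - ρ / 2) = ρ / 2 by ring] at e3
  have e4 := toReal_conv hlam.le fIW k4
  have e5a := toReal_conv hg1.le fQ k5a.1
  have e5b := ENNReal.toReal_mono (ENNReal.mul_ne_top ENNReal.ofReal_ne_top fW) k5b.2
  rw [ENNReal.toReal_mul, ENNReal.toReal_mul, ENNReal.toReal_ofReal hg2.le, ENNReal.toReal_ofReal (by positivity)] at e5b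
  have e6a := ENNReal.toReal_mono (ENNReal.mul_ne_top ENNReal.ofReal_ne_top fB) k5a.2
  rw [ENNReal.toReal_mul, ENNReal.toReal_ofReal hg2.le] at e6a
  have fqX : volume ((fun x => q x yt) '' Sec c U u ys bs) ≠ ⊤ :=
    (measure_mono (image_mono hsB)).trans_lt fQ.lt_top |>.ne
  have e6b := toReal_conv hg1.le fqX k5c.1
  have e6 := ENNReal.toReal_mono (ENNReal.mul_ne_top (by simp) fQ) k6
  rw [ENNReal.toReal_mul, ENNReal.toReal_mul] at e6
  simp only [ENNReal.toReal_natCast, ENNReal.toReal_pow, ENNReal.toReal_ofNat] at e6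
  have hapos : 0 < (volume (Sec c U u ys bs)).toReal := by
    by_contra hcon
    have : (volume (Sec c U u ys bs)).toReal = 0 := le_antisymm (not_lt.1 hcon) ENNReal.toReal_nonneg
    rw [this, mul_zero] at e1
    exact absurd e1 (not_le.2 (by positivity))
  have hspos : 0 < (volume (Sec c U u yt bB)).toReal :=
    hapos.trans_le (ENNReal.toReal_mono fB (measure_mono hsB))
  refine core_arith (n := n) (r := ρ / 2) (k := k * h) hapos hspos hg1 hg2 hlam hLp hcn hCn (by positivity) (by positivity)
    (Nat.cast_nonneg N) e1 e2 e3 e4 ?_ ?_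
  · refine le_trans ?_ e5b; gcongr
  · calc (N:ℝ) * (g1 * (volume (Sec c U u ys bs)).toReal) ≤ N * (volume ((fun x => q x yt) '' Sec c U u ys bs)).toReal := by gcongr
      _ ≤ 2 ^ n * (volume Q).toReal := e6
      _ ≤ _ := by gcongr

end core
end FKM

open Set MeasureTheory Metric Bornology
open scoped ENNReal NNReal Pointwise

namespace FKM
open Filter Topology
section strict
variable {n : ℕ} {c : Euc n → Euc n → ℝ} {U V : Set (Euc n)} {p q : Euc n → Euc n → Euc n}
  {A : Euc n → Euc n → Euc n →L[ℝ] Euc n} {C0 : ℝ} {u v : Euc n → ℝ}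

theorem Pkg.fsig (P : Pkg n c U V p q A C0) {yt : Euc n} (hyt : yt ∈ V) {η : ℝ} (hη : 0 < η) :
    ∃ σ0 > 0, ∀ y ∈ ball yt σ0, y ∈ V ∧ ∀ x ∈ closure U, ∀ x' ∈ closure U,
      |((c x yt - c x y) - (c x' yt - c x' y)) - (inner ℝ (q x yt - q x' yt) (y - yt) : ℝ)| ≤ η * ‖y - yt‖ := by
  obtain ⟨r, hr, hrV⟩ := Metric.isOpen_iff.1 P.oV yt hyt
  have huc := P.compS.uniformContinuousOn_of_continuous P.qc
  obtain ⟨δ, hδ, hd⟩ := Metric.uniformContinuousOn_iff.1 huc (η / 2) (by positivity)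
  refine ⟨min r δ, lt_min hr hδ, fun y hy => ⟨hrV (ball_subset_ball (min_le_left _ _) hy), fun x hx x' hx' => ?_⟩⟩
  have hyt' := subset_closure hyt
  have hb : ∀ y ∈ ball yt (min r δ), y ∈ V := fun y hy => hrV (ball_subset_ball (min_le_left _ _) hy)
  have hq : ∀ y ∈ ball yt (min r δ), ∀ x ∈ closure U, ‖q x y - q x yt‖ ≤ η / 2 := by
    intro y hy x hx
    have := hd (x, y) ⟨hx, subset_closure (hb y hy)⟩ (x, yt) ⟨hx, hyt'⟩ (by
      rw [Prod.dist_eq]; simp only [dist_self]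
      exact max_lt hδ (lt_of_lt_of_le (mem_ball.1 hy) (min_le_right _ _)))
    rw [dist_eq_norm] at this
    exact this.le
  have := Convex.norm_image_sub_le_of_norm_hasFDerivWithin_le
    (f := fun y => (c x' y - c x y) - (inner ℝ (q x yt - q x' yt) y : ℝ))
    (f' := fun y => (-(innerSL ℝ (q x' y)) - -(innerSL ℝ (q x y))) - innerSL ℝ (q x yt - q x' yt))
    (s := ball yt (min r δ)) (C := η)
    (fun y hy => by
      refine HasFDerivAt.hasFDerivWithinAt ?_
      exact ((P.c_y x' hx' y (hb y hy)).sub (P.c_y x hx y (hb y hy))).sub (innerSL ℝ (q x yt - q x' yt)).hasFDerivAt)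
    (fun y hy => by
      have e : (-(innerSL ℝ (q x' y)) - -(innerSL ℝ (q x y))) - innerSL ℝ (q x yt - q x' yt) =
        innerSL ℝ ((q x y - q x yt) - (q x' y - q x' yt)) := by simp only [map_sub]; abel
      rw [e, innerSL_apply_norm]
      refine (norm_sub_le _ _).trans ?_
      linarith [hq y hy x hx, hq y hy x' hx'])
    (convex_ball _ _) (mem_ball_self (lt_min hr hδ)) hy
  rw [Real.norm_eq_abs] at this
  convert this using 2
  simp only [inner_sub_right]
  ring

theorem Pkg.ballq (P : Pkg n c U V p q A C0) {L : ℝ} (hL : 0 < L) (hLip : ∀ y ∈ closure V, ∀ x ∈ closure U,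
    ∀ x' ∈ closure U, ‖x - x'‖ ≤ L * ‖q x y - q x' y‖) {x y : Euc n} {r : ℝ} (hr : 0 < r) (hb : ball x r ⊆ U)
    (hy : y ∈ closure V) : ball (q x y) (r / L) ⊆ (fun x => q x y) '' U := by
  have hx : x ∈ U := hb (mem_ball_self hr)
  rw [← P.q_int y hy]
  refine (convex_ball _ _).isPreconnected.subset_of_closure_inter_subset isOpen_interior
    ⟨q x y, mem_ball_self (by positivity), ?_⟩ ?_
  · rw [P.q_int y hy]; exact mem_image_of_mem _ hx
  · rintro a ⟨ha, hab⟩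
    have hcl : IsClosed ((fun x => q x y) '' closure U) :=
      (P.compU.image_of_continuousOn (P.q_cont hy)).isClosed
    obtain ⟨z, hz, rfl⟩ := closure_minimal interior_subset hcl ha
    rw [P.q_int y hy]
    refine mem_image_of_mem _ (hb ?_)
    rw [mem_ball, dist_eq_norm] at hab ⊢
    refine (hLip y hy z hz x (subset_closure hx)).trans_lt ?_
    calc L * ‖q z y - q x y‖ < L * (r / L) := by gcongr
      _ = r := by field_simp

theorem Pkg.p_bound (P : Pkg n c U V p q A C0) : ∃ B : ℝ, 0 < B ∧ ∀ x ∈ closure U, ∀ y ∈ closure V,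
    ∀ y' ∈ closure V, ‖p x y - p x y'‖ ≤ B := by
  obtain ⟨B, hB⟩ := P.compS.exists_bound_of_continuousOn P.pc
  refine ⟨2 * |B| + 1, by positivity, fun x hx y hy y' hy' => ?_⟩
  have h1 := hB (x, y) ⟨hx, hy⟩
  have h2 := hB (x, y') ⟨hx, hy'⟩
  simp only [Function.uncurry] at h1 h2
  linarith [norm_sub_le (p x y) (p x y'), le_abs_self B]

theorem Pot.width (H : Pot n c U V u v) (P : Pkg n c U V p q A C0) {L B : ℝ} (hL : 0 < L)
    (hLip : ∀ y ∈ closure V, ∀ x ∈ closure U, ∀ x' ∈ closure U, ‖x - x'‖ ≤ L * ‖q x y - q x' y‖)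
    (hB : 0 < B) (hBd : ∀ x ∈ closure U, ∀ y ∈ closure V, ∀ y' ∈ closure V, ‖p x y - p x y'‖ ≤ B)
    {x0 ys e : Euc n} {r bs h : ℝ} (hr : 0 < r) (hb : ball x0 r ⊆ U) (hys : ys ∈ closure V) (hh : 0 < h)
    (hx0 : u x0 + c x0 ys ≤ bs - h) (hhr : h < 2 * B * r) (he : ‖e‖ = 1) :
    ∃ x ∈ Sec c U u ys bs, (inner ℝ e (q x ys - q x0 ys) : ℝ) = h / (2 * B * L) := by
  have hx0U : x0 ∈ closure U := subset_closure (hb (mem_ball_self hr))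
  have hs : 0 < h / (2 * B * L) := by positivity
  obtain ⟨x, hx, ex⟩ := P.ballq hL hLip hr hb hys (show q x0 ys + (h / (2 * B * L)) • e ∈ _ by
    rw [mem_ball, dist_eq_norm, add_sub_cancel_left, norm_smul, he, mul_one, Real.norm_of_nonneg hs.le]
    rw [div_lt_div_iff₀ (by positivity) hL]
    nlinarith)
  simp only at ex
  have hd : q x ys - q x0 ys = (h / (2 * B * L)) • e := by rw [ex]; abel
  have hx' := subset_closure hx
  refine ⟨x, ⟨hx', ?_⟩, by rw [hd, inner_smul_right, real_inner_self_eq_norm_sq, he]; ring⟩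
  have hxx : ‖x - x0‖ ≤ h / (2 * B) := by
    refine (hLip ys hys x hx' x0 hx0U).trans ?_
    rw [hd, norm_smul, he, mul_one, Real.norm_of_nonneg hs.le]
    apply le_of_eq; field_simp
  have hxb : x ∈ ball x0 r := by
    rw [mem_ball, dist_eq_norm]
    refine hxx.trans_lt ?_
    rw [div_lt_iff₀ (by positivity)]; linarith
  obtain ⟨y, hy, e1⟩ := H.ex x hx'
  have e2 := H.ge x0 hx0U y hy
  have h1 := (abs_le.1 (P.fy_lip hb hys hy (fun x hx => hBd x hx y hy ys hys) hxb)).2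
  have h2 : B * ‖x - x0‖ ≤ h / 2 := by
    calc B * ‖x - x0‖ ≤ B * (h / (2 * B)) := by gcongr
      _ = h / 2 := by field_simp
  linarith

theorem Pot.sec_shrink (H : Pot n c U V u v) (P : Pkg n c U V p q A C0) {yt : Euc n} (hyt : yt ∈ closure V)
    {O : Set (Euc n)} (hO : IsOpen O) (hS : ∀ x, Con c U V u v x yt → x ∈ O) :
    ∃ τ > 0, Sec c U u yt (-v yt + τ) ⊆ O := by
  by_cases hne : (closure U \ O).Nonempty
  · obtain ⟨x, hx, hmin⟩ := (P.compU.diff hO).exists_isMinOn hne ((H.ut_cont P hyt).mono diff_subset)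
    have hge := H.ge x hx.1 yt hyt
    have hpos : 0 < u x + v yt + c x yt := by
      refine lt_of_le_of_ne hge fun h => hx.2 (hS x ⟨hx.1, hyt, h.symm⟩)
    refine ⟨(u x + v yt + c x yt) / 2, by positivity, fun z hz => ?_⟩
    by_contra hzO
    have := hmin (show z ∈ closure U \ O from ⟨hz.1, hzO⟩)
    simp only [mem_ofPred_eq] at this
    have h2 := hz.2
    linarith
  · exact ⟨1, one_pos, fun z hz => by
      by_contra hzO
      exact hne ⟨z, hz.1, hzO⟩⟩

set_option maxHeartbeats 2000000 in
theorem strict_conv (H : Pot n c U V u v) (P : Pkg n c U V p q A C0) {Ul : Set (Euc n)} (hUl : IsOpen Ul)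
    {lam Lam : ℝ} (hlam : 0 < lam) (hLam : 0 < Lam)
    (hMA : ∀ W ⊆ Ul, IsCompact W → ENNReal.ofReal lam * volume W ≤ volume (Im c U V u v W))
    (hMA2 : ∀ W ⊆ closure U, IsCompact W → volume (Im c U V u v W) ≤ ENNReal.ofReal Lam * volume W)
    {xt yt x1 : Euc n} (hytV : yt ∈ V) (hSU : ∀ x, Con c U V u v x yt → x ∈ U) (hxt : xt ∈ Ul)
    (ht : Con c U V u v xt yt) (h1 : Con c U V u v x1 yt) : x1 = xt := by
  by_contra hne
  obtain ⟨g1, g2, hg⟩ := P.exDt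
  obtain ⟨εn, hε, Kn, hKn, hcore⟩ := core n
  obtain ⟨δ, hδ, hcmp⟩ := P.hat_compare hε
  obtain ⟨L, hL, hLip⟩ := P.lipX
  obtain ⟨B, hB, hBd⟩ := P.p_bound
  obtain ⟨DU, hDU⟩ := P.bU.closure.subset_closedBall 0
  obtain ⟨DV, hDV⟩ := P.bV.closure.subset_closedBall 0
  have hyt := ht.2.1
  have hg1 := hg.1
  have hg2 : 0 < g2 := hg.1.trans_le hg.2.1
  set M := Real.exp (C0 * (2 * |DU|) * (2 * |DV|)) with hMdef
  have hM : ∀ x ∈ closure U, ∀ x' ∈ closure U, ∀ y ∈ closure V, ∀ y' ∈ closure V,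
      Real.exp (C0 * ‖x - x'‖ * ‖y - y'‖) ≤ M := by
    intro x hx x' hx' y hy y' hy'
    have a1 := mem_closedBall_zero_iff.1 (hDU hx)
    have a2 := mem_closedBall_zero_iff.1 (hDU hx')
    have a3 := mem_closedBall_zero_iff.1 (hDV hy)
    have a4 := mem_closedBall_zero_iff.1 (hDV hy')
    have b1 : ‖x - x'‖ ≤ 2 * |DU| := by linarith [norm_sub_le x x', le_abs_self DU]
    have b2 : ‖y - y'‖ ≤ 2 * |DV| := by linarith [norm_sub_le y y', le_abs_self DV]
    have := P.C0nn
    apply Real.exp_le_exp.2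
    gcongr
  have hM0 : 0 < M := Real.exp_pos _
  set k := min (1 / M) (δ / 2 / (2 * B * L)) with hk
  have hk0 : 0 < k := lt_min (by positivity) (by positivity)
  have hkM : k * M ≤ 1 := by
    calc k * M ≤ 1 / M * M := by gcongr; exact min_le_left _ _
      _ = 1 := by field_simp
  -- rho
  obtain ⟨r1, hr1, hr1U⟩ := Metric.isOpen_iff.1 hUl xt hxt
  obtain ⟨Q0, hQ0⟩ := P.compU.exists_bound_of_continuousOn (P.q_cont hyt)
  have hQ0' : ∀ x ∈ closure U, ∀ x' ∈ closure U, ‖q x yt - q x' yt‖ ≤ 2 * |Q0| + 1 := fun x hx x' hx' => by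
    linarith [norm_sub_le (q x yt) (q x' yt), hQ0 x hx, hQ0 x' hx', le_abs_self Q0]
  set Q1 := 2 * |Q0| + 1 with hQ1
  have hQ1p : 0 < Q1 := by positivity
  set ρ := min 1 (r1 / (2 * L * Q1)) with hρdef
  have hρ0 : 0 < ρ := lt_min one_pos (by positivity)
  have hρ1 : ρ ≤ 1 := min_le_left _ _
  have hρ : ∀ x ∈ closure U, ∀ z ∈ closure U, q x yt = (1 - ρ) • q xt yt + ρ • q z yt → x ∈ Ul := by
    intro x hx z hz e
    apply hr1U
    rw [mem_ball, dist_eq_norm]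
    have : q x yt - q xt yt = ρ • (q z yt - q xt yt) := by rw [e]; module
    calc ‖x - xt‖ ≤ L * ‖q x yt - q xt yt‖ := hLip yt hyt x hx xt ht.1
      _ = L * (ρ * ‖q z yt - q xt yt‖) := by rw [this, norm_smul, Real.norm_of_nonneg hρ0.le]
      _ ≤ L * (r1 / (2 * L * Q1) * Q1) := by gcongr; exact min_le_right _ _; exact hQ0' z hz xt ht.1
      _ = r1 / 2 := by field_simp
      _ < r1 := by linarith
  -- N
  set T := Kn * (g2 / g1) ^ 6 * (Lam / lam) * ((M * (2 * (1 + M * (1 - ρ / 2) / (ρ / 2)))) / (ρ / 2 * k)) ^ n with hT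
  obtain ⟨N0, hN0⟩ := exists_nat_gt T
  set N := N0 + 1 with hN
  have hNT : T < (N:ℝ) ^ 2 := by
    have : (N:ℝ) = N0 + 1 := by rw [hN]; push_cast; ring
    have h0 : (0:ℝ) ≤ N0 := Nat.cast_nonneg _
    nlinarith
  have hN' : (0:ℝ) < N := by rw [hN]; positivity
  set w := ‖q x1 yt - q xt yt‖ with hw
  have hw0 : 0 < w := by
    rw [hw, norm_pos_iff, sub_ne_zero]
    exact fun e => hne (P.q_inj yt hyt h1.1 ht.1 e)
  set e : Euc n := w⁻¹ • (q x1 yt - q xt yt) with he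
  have hen : ‖e‖ = 1 := by rw [he, norm_smul, norm_inv, norm_norm, ← hw]; field_simp
  set δ' := w / (4 * (1 + 4 * N * M)) with hδ'
  have hδ'0 : 0 < δ' := by positivity
  have hδ'w : δ' * (1 + 4 * N * M) = w / 4 := by rw [hδ']; field_simp
  obtain ⟨σ0, hσ0, hσ⟩ := P.fsig hytV (lt_min (half_pos hδ'0) (half_pos hw0))
  set η := min (δ' / 2) (w / 2) with hη
  have hη0 : 0 < η := lt_min (half_pos hδ'0) (half_pos hw0)
  -- the contact set
  set S : Set (Euc n) := {x | Con c U V u v x yt} with hS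
  have hSc : IsCompact S := by
    have := H.swap.Im_compact P.swap (isClosed_singleton (x := yt))
    convert this using 1
    ext x
    simp only [hS, Im, mem_ofPred_eq, mem_singleton_iff, exists_eq_left, con_swap]
  obtain ⟨r, hr, hrU⟩ := hSc.exists_thickening_subset_open P.oU (fun x hx => hSU x hx)
  have hrb : ∀ s ∈ S, ball s r ⊆ U := fun s hs x hx => hrU (mem_thickening_iff.2 ⟨s, hs, hx⟩)
  have huc := P.compU.uniformContinuousOn_of_continuous (P.q_cont hyt)
  obtain ⟨ε, hε', hεq⟩ := Metric.uniformContinuousOn_iff.1 huc (δ' / 2) (half_pos hδ'0)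
  obtain ⟨τ, hτ, hτS⟩ := H.sec_shrink P hyt (O := U ∩ thickening ε S) (P.oU.inter isOpen_thickening)
    (fun x hx => ⟨hSU x hx, self_subset_thickening hε' S hx⟩)
  obtain ⟨σ, hσp, hσ1, hσ2, hσ3, hσ4⟩ : ∃ σ > 0, σ < σ0 ∧ σ * (Q1 + η + δ') ≤ τ ∧ σ * (2 * δ') ≤ τ ∧ σ * δ' < 2 * B * r := by
    refine ⟨min (min (σ0 / 2) (τ / (Q1 + η + δ'))) (min (τ / (2 * δ')) (B * r / δ')), by positivity, ?_, ?_, ?_, ?_⟩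
    · refine lt_of_le_of_lt ((min_le_left _ _).trans (min_le_left _ _)) (by linarith)
    · rw [← le_div_iff₀ (by positivity)]; exact (min_le_left _ _).trans (min_le_right _ _)
    · rw [← le_div_iff₀ (by positivity)]; exact (min_le_right _ _).trans (min_le_left _ _)
    · have : min (min (σ0 / 2) (τ / (Q1 + η + δ'))) (min (τ / (2 * δ')) (B * r / δ')) ≤ B * r / δ' :=
        (min_le_right _ _).trans (min_le_right _ _)
      rw [le_div_iff₀ hδ'0] at this
      nlinarith [mul_pos hB hr]
  set ys := yt + σ • e with hysd
  have hyss : ys - yt = σ • e := by rw [hysd]; abel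
  have hysn : ‖ys - yt‖ = σ := by rw [hyss, norm_smul, hen, mul_one, Real.norm_of_nonneg hσp.le]
  obtain ⟨hysV, hf⟩ := hσ ys (by rw [mem_ball, dist_eq_norm, hysn]; exact hσ1)
  have hys := subset_closure hysV
  rw [hysn] at hf
  simp only [hyss, inner_smul_right] at hf
  set f : Euc n → ℝ := fun x => c x yt - c x ys with hfd
  have hf' : ∀ x ∈ closure U, ∀ x' ∈ closure U, f x - f x' ≤ σ * (‖q x yt - q x' yt‖ + η) := by
    intro x hx x' hx'
    have a := (abs_le.1 (hf x hx x' hx')).2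
    have b : (inner ℝ (q x yt - q x' yt) e : ℝ) ≤ ‖q x yt - q x' yt‖ := by
      have := real_inner_le_norm (q x yt - q x' yt) e
      rwa [hen, mul_one] at this
    simp only [hfd]
    nlinarith
  have hfc : ContinuousOn f (closure U) := (contOn_left P.cc hyt).sub (contOn_left P.cc hys)
  obtain ⟨x0, hx0, hmax⟩ := hSc.exists_isMaxOn ⟨xt, ht⟩ (hfc.mono fun x hx => hx.1)
  have hmax' : ∀ x ∈ S, f x ≤ f x0 := fun x hx => hmax hx
  set m := -v yt with hm
  have hmge : ∀ x ∈ closure U, m ≤ u x + c x yt := fun x hx => by linarith [H.ge x hx yt hyt]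
  have hmS : ∀ x ∈ S, u x + c x yt = m := fun x hx => by linarith [hx.2.2]
  set b := σ * δ' with hb
  have hb0 : 0 < b := by positivity
  have hXs : ∀ x ∈ Sec c U u ys (m - f x0 + b), x ∈ closure U ∧ u x + c x yt - m ≤ f x - f x0 + b := by
    intro x hx
    refine ⟨hx.1, ?_⟩
    have := hx.2
    simp only [hfd] at this ⊢
    linarith
  have hXup : ∀ x ∈ Sec c U u ys (m - f x0 + b), f x - f x0 ≤ b := by
    intro x hx
    obtain ⟨hxU, hxx⟩ := hXs x hx
    have h2 := hf' x hxU x0 hx0.1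
    have h3 : σ * (‖q x yt - q x0 yt‖ + η) ≤ σ * (Q1 + η) := by gcongr; exact hQ0' x hxU x0 hx0.1
    have hxτ : x ∈ Sec c U u yt (m + τ) := ⟨hxU, by linarith⟩
    obtain ⟨s, hs, hsx⟩ := mem_thickening_iff.1 (hτS hxτ).2
    have h4 := hεq x hxU s hs.1 hsx
    rw [dist_eq_norm] at h4
    have h5 := hf' x hxU s hs.1
    have h6 : σ * (‖q x yt - q s yt‖ + η) ≤ σ * (δ' / 2 + δ' / 2) := by
      gcongr; exact min_le_left _ _
    have := hmax' s hs
    linarith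
  have hsB : Sec c U u ys (m - f x0 + b) ⊆ Sec c U u yt (m + 2 * b) := by
    intro x hx
    have := hXs x hx
    exact ⟨this.1, by linarith [hXup x hx]⟩
  have hBU : Sec c U u yt (m + 2 * b) ⊆ U := fun x hx =>
    (hτS ⟨hx.1, by linarith [hx.2]⟩).1
  have hx0e : u x0 + c x0 ys = m - f x0 + b - b := by
    have := hmS x0 hx0
    simp only [hfd]; linarith
  have key := hcore H P hg (yt := yt) (ys := ys) (y1 := ys) (x0 := x0) (xt := xt) (bs := m - f x0 + b)
    (bB := m + 2 * b) (h := b) (hB := 2 * b) (M := M) (k := k) (d := δ / 2) (ρ := ρ) (lam := lam) (Lp := Lam)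
    (g0 := f x0) (Cb := b) (D := σ * (w / 2)) (N := N) (Ul := Ul) hyt hys hys hsB hBU ⟨hx0.1, by linarith⟩ hb0 hx0e
    ⟨ht.1, by linarith [hmS xt ht]⟩ (by linarith [hmS xt ht]) (fun x hx => by linarith [hmge x hx.1])
    (fun x hx x' hx' => hM x hx.1 x' hx'.1) hk0 hkM (half_pos hδ)
    (fun x hx x' hx' y hy hle => hcmp x hx.1 x' hx'.1 ys hys y hy (Or.inr (by linarith)))
    (fun e he => by
      obtain ⟨x, hx, ex⟩ := H.width P hL hLip hB hBd hr (hrb x0 hx0) hys hb0 hx0e.le hσ4 he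
      refine ⟨x, hx, x0, ⟨hx0.1, by linarith⟩, ?_⟩
      rw [ex]
      calc k * b ≤ δ / 2 / (2 * B * L) * b := by gcongr; exact min_le_right _ _
        _ = _ := by ring)
    hρ0 hρ1 (fun x hx z hz => hρ x hx.1 z hz.1) hlam hMA hLam
    (hMA2 _ (fun x hx => hx.1) (H.sec_compact P hys _))
    (fun x hx => abs_le.2 ⟨by
      have := hXs x hx
      have h2 := hmge x this.1
      simp only [hfd] at this ⊢
      linarith, hXup x hx⟩)
    (by
      have a := (abs_le.1 (hf x1 h1.1 xt ht.1)).1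
      have a2 := hmax' x1 h1
      have a3 : (inner ℝ (q x1 yt - q xt yt) e : ℝ) = w := by
        rw [he, inner_smul_right, real_inner_self_eq_norm_sq, ← hw]; field_simp
      rw [a3] at a
      have a4 : η * σ ≤ w / 2 * σ := by gcongr; exact min_le_right _ _
      simp only [hfd] at a2 ⊢
      nlinarith)
    (by rw [hb, mul_assoc, hδ'w]; gcongr; linarith) (by rw [hN]; omega)
  have e0 : M * (2 * b * (1 + M * (1 - ρ / 2) / (ρ / 2))) / (ρ / 2 * (k * b)) =
      (M * (2 * (1 + M * (1 - ρ / 2) / (ρ / 2)))) / (ρ / 2 * k) := by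
    field_simp
  rw [e0] at key
  exact absurd key (not_le.2 hNT)

end strict
end FKM

open Set MeasureTheory Metric Bornology
open scoped ENNReal NNReal Pointwise

namespace FKM
open Filter Topology
section engulf

theorem Pkg.half {n : ℕ} {c : Euc n → Euc n → ℝ} {U V : Set (Euc n)}
    {p q : Euc n → Euc n → Euc n} {A : Euc n → Euc n → Euc n →L[ℝ] Euc n} {C0 : ℝ} {u v : Euc n → ℝ}
    (H : Pot n c U V u v) (P : Pkg n c U V p q A C0) {yt yh y x z : Euc n} {M τ : ℝ}
    (hyt : yt ∈ closure V) (hyh : yh ∈ closure V) (hy : Con c U V u v x y) (hz : z ∈ closure U)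
    (hp : p x yh = (1 - (1 / 2 : ℝ)) • p x yt + (1 / 2 : ℝ) • p x y) (hM0 : 0 < M)
    (hM : Real.exp (C0 * ‖y - yt‖ * ‖z - x‖) ≤ M)
    (hτ : 0 < τ) (hx : u x + c x yt ≤ -v yt + τ)
    (hzs : u z + c z yh ≤ (c x yh - c x yt) - v yt + 2 * τ) :
    |c z yt - c z y - (c x yt - c x y)| ≤ 2 * (M + 1) * τ ∧ u z + c z yt ≤ -v yt + 2 * (M + 1) * τ := by
  have hxU := hy.1
  have q1 := P.QQy x hxU z hz yt hyt y hy.2.1 yh hyh (1 / 2) (by norm_num) (by norm_num) hp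
  have q2 := P.QQy x hxU z hz y hy.2.1 yt hyt yh hyh (1 / 2) (by norm_num) (by norm_num) (by rw [hp]; module)
  rw [norm_sub_rev yt y] at q2
  have s1 := H.support hy hz
  have s2 := H.ge z hz yt hyt
  have s3 := H.ge x hxU yt hyt
  -- g1, gh
  obtain ⟨g1, hg1⟩ : ∃ g1, g1 = (c x y - c z y) - (c x yt - c z yt) := ⟨_, rfl⟩
  obtain ⟨gh, hgh⟩ : ∃ gh, gh = (c x yh - c z yh) - (c x yt - c z yt) := ⟨_, rfl⟩
  have hMτ : 0 < M * τ := by positivity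
  have a1 : -(2 * τ) ≤ gh := by rw [hgh]; linarith
  have a2 : g1 ≤ gh + 2 * τ := by rw [hgh, hg1]; linarith
  have b1 : 0 < gh → gh ≤ M * (g1 - gh) := by
    intro h0
    have h1 := q1 (by linarith)
    have h2 : 0 ≤ g1 - gh := by
      by_contra hneg
      push Not at hneg
      have : Real.exp (C0 * ‖y - yt‖ * ‖z - x‖) * (g1 - gh) < 0 := mul_neg_of_pos_of_neg (Real.exp_pos _) hneg
      rw [hgh, hg1] at *
      nlinarith
    have h3 : Real.exp (C0 * ‖y - yt‖ * ‖z - x‖) * (g1 - gh) ≤ M * (g1 - gh) := by gcongr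
    rw [hgh, hg1] at *
    nlinarith
  have b2 : g1 < gh → gh - g1 ≤ M * (-gh) := by
    intro h0
    have h1 := q2 (by linarith)
    have h2 : 0 ≤ -gh := by
      by_contra hneg
      push Not at hneg
      have : Real.exp (C0 * ‖y - yt‖ * ‖z - x‖) * (-gh) < 0 := mul_neg_of_pos_of_neg (Real.exp_pos _) hneg
      rw [hgh, hg1] at *
      nlinarith
    have h3 : Real.exp (C0 * ‖y - yt‖ * ‖z - x‖) * (-gh) ≤ M * (-gh) := by gcongr
    rw [hgh, hg1] at *
    nlinarith
  have d1 : gh ≤ 2 * (M * τ) := by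
    rcases le_or_gt gh 0 with h | h
    · linarith
    · have := b1 h; nlinarith
  have d2 : -(2 * (M + 1) * τ) ≤ g1 := by
    rcases lt_or_ge g1 gh with h | h
    · have := b2 h; nlinarith
    · nlinarith
  refine ⟨?_, ?_⟩
  · rw [abs_le]; constructor <;> rw [hg1] at * <;> linarith
  · rw [hgh] at *; linarith

set_option maxHeartbeats 1000000 in
theorem engulf (n : ℕ) : ∃ εn > 0, ∃ Kn : ℝ, 0 < Kn ∧ ∀ {c : Euc n → Euc n → ℝ} {U V : Set (Euc n)}
    {p q : Euc n → Euc n → Euc n} {A : Euc n → Euc n → Euc n →L[ℝ] Euc n} {C0 : ℝ} {u v : Euc n → ℝ},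
    Pot n c U V u v → Pkg n c U V p q A C0 → ∀ {g1 g2 : ℝ}, Dt U V A g1 g2 →
    ∀ {Ul : Set (Euc n)} {lam Lp : ℝ}, Ul ⊆ U → 0 < lam → 0 < Lp →
    (∀ W ⊆ Ul, IsCompact W → ENNReal.ofReal lam * volume W ≤ volume (Im c U V u v W)) →
    (∀ W ⊆ Ul, IsCompact W → volume (Im c U V u v W) ≤ ENNReal.ofReal Lp * volume W) →
    ∀ {N : ℕ}, 0 < N → Kn * (g2 / g1) ^ 6 * (Lp / lam) * 144 ^ n < (N:ℝ) ^ 2 →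
    ∀ {xt yt x y : Euc n} {τ Mb : ℝ}, 0 < τ → 2 ≤ Mb → Con c U V u v xt yt → Con c U V u v x y →
    u x + c x yt ≤ -v yt + τ →
    (∀ z ∈ closure U, Real.exp (C0 * ‖y - yt‖ * ‖z - x‖) ≤ Mb) →
    Sec c U u yt (-v yt + 2 * (Mb + 1) * τ) ⊆ Ul →
    (∀ z ∈ Sec c U u yt (-v yt + 2 * (Mb + 1) * τ), ∀ z' ∈ Sec c U u yt (-v yt + 2 * (Mb + 1) * τ),
      ∀ y ∈ closure V, ∀ y' ∈ closure V, Real.exp (C0 * ‖z - z'‖ * ‖y - y'‖) ≤ 2) →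
    (∀ z ∈ Sec c U u yt (-v yt + 2 * (Mb + 1) * τ), ∀ z' ∈ Sec c U u yt (-v yt + 2 * (Mb + 1) * τ),
      ∀ yb ∈ closure V, ∀ y ∈ closure V, ‖hat p A z' yb y - hat p A z yb y‖ ≤ εn * ‖hat p A z yb y‖) →
    u xt - (u x + c x y - c xt y) ≤ 6 * (1 + 8 * N) * τ := by
  obtain ⟨εn, hε, Kn, hKn, hcore⟩ := core n
  refine ⟨εn, hε, Kn, hKn, ?_⟩
  intro c U V p q A C0 u v H P g1 g2 hg Ul lam Lp hUlU hlam hLp hMA hMA2 N hN hNT xt yt x y τ Mb hτ hMb ht hxy hx hMbb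
    hSU hM2 hcmp
  by_contra hcon
  push Not at hcon
  have hyt := ht.2.1
  have hxU := hxy.1
  have hg1 := hg.1
  have hg2 : 0 < g2 := hg.1.trans_le hg.2.1
  obtain ⟨yh, hyh, hp⟩ := P.exY hxU hyt hxy.2.1 (t := 1 / 2) (by norm_num) (by norm_num)
  set Sb := Sec c U u yt (-v yt + 2 * (Mb + 1) * τ) with hSb
  set bs := (c x yh - c x yt) - v yt + 2 * τ with hbs
  have hbig : ∀ z ∈ Sec c U u yh bs, z ∈ Sb := fun z hz =>
    ⟨hz.1, (Pkg.half H P hyt hyh hxy hz.1 hp (by linarith) (hMbb z hz.1) hτ hx hz.2).2⟩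
  have h6 : -v yt + 6 * τ ≤ -v yt + 2 * (Mb + 1) * τ := by nlinarith
  have hsub6 : Sec c U u yt (-v yt + 6 * τ) ⊆ Sb := fun z hz => ⟨hz.1, hz.2.trans h6⟩
  have hxSb : x ∈ Sb := hsub6 ⟨hxU, by linarith⟩
  have hsm : ∀ z ∈ Sec c U u yh bs, |c z yt - c z y - (c x yt - c x y)| ≤ 6 * τ ∧ u z + c z yt ≤ -v yt + 6 * τ := by
    intro z hz
    have := Pkg.half H P hyt hyh hxy hz.1 hp (M := 2) (by norm_num) (by
      have := hM2 z (hbig z hz) x hxSb y hxy.2.1 yt hyt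
      rwa [mul_right_comm] at this) hτ hx hz.2
    norm_num at this ⊢
    exact this
  have hxt0 : u xt + c xt yt = -v yt := by linarith [ht.2.2]
  have hge := H.ge x hxU yt hyt
  have hheq : u x + c x yh = bs - (bs - (u x + c x yh)) := by ring
  have hh : τ ≤ bs - (u x + c x yh) := by rw [hbs]; linarith
  set h := bs - (u x + c x yh) with hhd
  have hh0 : 0 < h := hτ.trans_le hh
  obtain ⟨L, hL, hLip⟩ := P.lipX
  obtain ⟨B, hB, hBd⟩ := P.p_bound
  obtain ⟨r, hr, hrU⟩ := Metric.isOpen_iff.1 P.oU x (hUlU (hSU hxSb))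
  set h' := min h (B * r) with hh'
  have hh'0 : 0 < h' := lt_min hh0 (by positivity)
  have key := hcore H P hg (yt := yt) (ys := yh) (y1 := y) (x0 := x) (xt := xt) (bs := bs)
    (bB := -v yt + 6 * τ) (h := h) (hB := 6 * τ) (M := 2) (k := 1 / 2) (d := 1 / 2 * h / (h' / (2 * B * L))) (ρ := 1)
    (lam := lam) (Lp := Lp)
    (g0 := c x yt - c x y) (Cb := 6 * τ) (D := 6 * (1 + 8 * N) * τ + τ / 2 + ((u xt - (u x + c x y - c xt y)) - 6 * (1 + 8 * N) * τ) / 2 - τ / 2) (N := N) (Ul := Ul)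
    hyt hyh hxy.2.1 (fun z hz => ⟨hz.1, (hsm z hz).2⟩) ((hsub6.trans hSU).trans hUlU) ⟨hxU, by linarith⟩ hh0 hheq
    ⟨ht.1, by linarith⟩ (by linarith) (fun z hz => by linarith [H.ge z hz.1 yt hyt])
    (fun z hz z' hz' => hM2 z (hsub6 hz) z' (hsub6 hz')) (by norm_num) (by norm_num) (by positivity)
    (fun z hz z' hz' y hy _ => hcmp z (hbig z hz) z' (hbig z' hz') yh hyh y hy)
    (fun e he => by
      obtain ⟨z, hz, ez⟩ := H.width P hL hLip hB hBd hr hrU hyh hh'0 (bs := bs) (by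
        have : h' ≤ h := min_le_left _ _
        linarith) (by
        have : h' ≤ B * r := min_le_right _ _
        nlinarith [mul_pos hB hr]) he
      refine ⟨z, hz, x, ⟨hxU, by linarith⟩, ?_⟩
      rw [ez]
      apply le_of_eq
      field_simp)
    one_pos le_rfl (fun z hz _ _ _ => hSU (hsub6 hz)) hlam hMA hLp
    (hMA2 _ (fun z hz => hSU (hbig z hz)) (H.sec_compact P hyh _))
    (fun z hz => (hsm z hz).1) (by linarith) (by nlinarith) hN
  refine absurd key (not_le.2 (lt_of_le_of_lt ?_ hNT))
  have e0 : 2 * (6 * τ * (1 + 2 * (1 - 1 / 2) / (1 / 2))) / (1 / 2 * (1 / 2 * h)) ≤ 144 := by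
    rw [div_le_iff₀ (by positivity)]; norm_num; linarith
  gcongr

theorem Pot.small (n : ℕ) {c : Euc n → Euc n → ℝ} {U V : Set (Euc n)}
    {p q : Euc n → Euc n → Euc n} {A : Euc n → Euc n → Euc n →L[ℝ] Euc n} {C0 : ℝ} {u v : Euc n → ℝ}
    (H : Pot n c U V u v) (P : Pkg n c U V p q A C0) {K : Set (Euc n)} (hK : IsCompact K)
    (hst : ∀ x ∈ K, ∀ y, Con c U V u v x y → ∀ x', Con c U V u v x' y → x' = x) {ε : ℝ} (hε : 0 < ε) :
    ∃ τ > 0, ∀ x ∈ K, ∀ y, Con c U V u v x y → Sec c U u y (-v y + τ) ⊆ ball x ε := by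
  set G : Set ((Euc n × Euc n) × Euc n) := {z | (Con c U V u v z.1.1 z.1.2 ∧ z.1.1 ∈ K) ∧ z.2 ∈ closure U ∧ ε ≤ dist z.2 z.1.1} with hG
  have hGc : IsCompact G := by
    have h1 : IsCompact ({z : Euc n × Euc n | Con c U V u v z.1 z.2} ∩ Prod.fst ⁻¹' K) :=
      (H.graph_compact P).inter_right (hK.isClosed.preimage continuous_fst)
    have h2 := (h1.prod P.compU).inter_right (isClosed_le (f := fun _ : (Euc n × Euc n) × Euc n => ε)
      (g := fun z => dist z.2 z.1.1) continuous_const (by fun_prop))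
    convert h2 using 1
    ext z
    simp only [hG, mem_ofPred_eq, mem_inter_iff, mem_prod, mem_preimage]
    tauto
  by_cases hne : G.Nonempty
  · have hc : ContinuousOn (fun z : (Euc n × Euc n) × Euc n => u z.2 + v z.1.2 + Function.uncurry c (z.2, z.1.2)) G := by
      refine ((H.uc.comp continuousOn_snd (fun z hz => hz.2.1)).add
        (H.vc.comp (f := fun z : (Euc n × Euc n) × Euc n => z.1.2) (by fun_prop) (fun z hz => hz.1.1.2.1))).add
        (P.cc.comp (f := fun z : (Euc n × Euc n) × Euc n => (z.2, z.1.2)) (by fun_prop) (fun z hz => ⟨hz.2.1, hz.1.1.2.1⟩))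
    obtain ⟨z, hz, hmin⟩ := hGc.exists_isMinOn hne hc
    have hge := H.ge z.2 hz.2.1 z.1.2 hz.1.1.2.1
    have hpos : 0 < u z.2 + v z.1.2 + c z.2 z.1.2 := by
      refine lt_of_le_of_ne hge fun h => ?_
      have := hst z.1.1 hz.1.2 z.1.2 hz.1.1 z.2 ⟨hz.2.1, hz.1.1.2.1, h.symm⟩
      have h2 := hz.2.2
      rw [this, dist_self] at h2
      linarith
    refine ⟨(u z.2 + v z.1.2 + c z.2 z.1.2) / 2, by positivity, fun x hx y hxy w hw => ?_⟩
    by_contra hwb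
    have := hmin (show ((x, y), w) ∈ G from ⟨⟨hxy, hx⟩, hw.1, not_lt.1 hwb⟩)
    simp only [mem_ofPred_eq, Function.uncurry] at this
    have h2 := hw.2
    linarith
  · refine ⟨1, one_pos, fun x hx y hxy w hw => ?_⟩
    by_contra hwb
    exact hne ⟨((x, y), w), ⟨hxy, hx⟩, hw.1, not_lt.1 hwb⟩

end engulf
end FKM

open Set MeasureTheory Metric Bornology
open scoped ENNReal NNReal Pointwise

namespace FKM
open Filter Topology
section growth

theorem bdd_norm {n : ℕ} {S : Set (Euc n)} (h : IsCompact S) : ∃ D : ℝ, 0 < D ∧ ∀ a ∈ S, ∀ b ∈ S, ‖a - b‖ ≤ D := by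
  obtain ⟨B, hB⟩ := h.isBounded.exists_norm_le
  refine ⟨2 * |B| + 1, by positivity, fun a ha b hb => ?_⟩
  have := norm_sub_le a b
  have h1 := hB a ha
  have h2 := hB b hb
  have := le_abs_self B
  linarith

set_option maxHeartbeats 2000000 in
theorem stepA (n : ℕ) : ∃ Kn : ℝ, 0 < Kn ∧ ∀ {c : Euc n → Euc n → ℝ} {U V : Set (Euc n)}
    {p q : Euc n → Euc n → Euc n} {A : Euc n → Euc n → Euc n →L[ℝ] Euc n} {C0 : ℝ} {u v : Euc n → ℝ},
    Pot n c U V u v → Pkg n c U V p q A C0 → ∀ {g1 g2 : ℝ}, Dt U V A g1 g2 →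
    ∀ {Ul : Set (Euc n)} {lam Lp : ℝ}, IsOpen Ul → Ul ⊆ U → 0 < lam → 0 < Lp →
    (∀ W ⊆ Ul, IsCompact W → ENNReal.ofReal lam * volume W ≤ volume (Im c U V u v W)) →
    (∀ W ⊆ Ul, IsCompact W → volume (Im c U V u v W) ≤ ENNReal.ofReal Lp * volume W) →
    (∀ x ∈ Ul, ∀ y, Con c U V u v x y → ∀ x', Con c U V u v x' y → x' = x) →
    ∀ {N : ℕ}, 0 < N → Kn * (g2 / g1) ^ 6 * (Lp / lam) * 144 ^ n < (N:ℝ) ^ 2 →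
    ∀ x0 ∈ Ul, ∃ r > 0, ball x0 r ⊆ Ul ∧ ∀ x ∈ ball x0 r, ∀ xt ∈ ball x0 r, ∀ y yt,
      Con c U V u v x y → Con c U V u v xt yt →
      u x + c x yt + v yt ≤ 6 * (1 + 8 * N) * (u xt + c xt y + v y) := by
  obtain ⟨εn, hεn, Kn, hKn, heng⟩ := engulf n
  refine ⟨Kn, hKn, ?_⟩
  intro c U V p q A C0 u v H P g1 g2 hg Ul lam Lp hUl hUlU hlam hLp hMA hMA2 hst N hN hNT x0 hx0
  obtain ⟨R, hR, hRU⟩ := nhds_basis_closedBall.mem_iff.1 (hUl.mem_nhds hx0)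
  obtain ⟨DU, hDU, hDU2⟩ := bdd_norm P.compU
  obtain ⟨DV, hDV, hDV2⟩ := bdd_norm P.compV
  obtain ⟨δ, hδ, hcmp⟩ := P.hat_compare hεn
  have hC0 := P.C0nn
  set Mb := max 2 (Real.exp (C0 * DV * DU)) with hMb
  have hMb2 : 2 ≤ Mb := le_max_left _ _
  have hl2 : 0 < Real.log 2 := Real.log_pos (by norm_num)
  obtain ⟨ε, hε, h1, h2, h3⟩ : ∃ ε > 0, ε ≤ R / 2 ∧ 2 * ε < δ ∧ C0 * (2 * ε) * DV ≤ Real.log 2 := by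
    refine ⟨min (min (R / 2) (δ / 3)) (Real.log 2 / (2 * (C0 + 1) * DV)), by positivity,
      (min_le_left _ _).trans (min_le_left _ _), ?_, ?_⟩
    · have := (min_le_left (min (R / 2) (δ / 3)) (Real.log 2 / (2 * (C0 + 1) * DV))).trans (min_le_right _ _)
      linarith
    · have := min_le_right (min (R / 2) (δ / 3)) (Real.log 2 / (2 * (C0 + 1) * DV))
      set e := min (min (R / 2) (δ / 3)) (Real.log 2 / (2 * (C0 + 1) * DV))
      have he : 0 < e := by positivity
      rw [le_div_iff₀ (by positivity)] at this
      nlinarith [mul_pos he hDV]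
  have hKc : IsCompact (closedBall x0 (R / 2)) := isCompact_closedBall _ _
  have hKU : closedBall x0 (R / 2) ⊆ Ul := (closedBall_subset_closedBall (by linarith)).trans hRU
  obtain ⟨τ2, hτ2, hsm⟩ := Pot.small n H P hKc (fun x hx => hst x (hKU hx)) hε
  set τ1 := τ2 / (2 * (Mb + 1)) with hτ1
  have hτ1p : 0 < τ1 := by positivity
  have huu := Metric.uniformContinuousOn_iff.1 (P.compU.uniformContinuousOn_of_continuous H.uc) (τ1 / 2) (by positivity)
  have hcu := Metric.uniformContinuousOn_iff.1 (P.compS.uniformContinuousOn_of_continuous P.cc) (τ1 / 2) (by positivity)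
  obtain ⟨d1, hd1, hd1'⟩ := huu
  obtain ⟨d2, hd2, hd2'⟩ := hcu
  refine ⟨min (R / 2) (min (d1 / 2) (d2 / 2)), by positivity, fun z hz => hKU (ball_subset_closedBall (ball_subset_ball (min_le_left _ _) hz)), ?_⟩
  intro x hx xt hxt y yt hxy hxyt
  have hxK : x ∈ closedBall x0 (R / 2) := ball_subset_closedBall (ball_subset_ball (min_le_left _ _) hx)
  have hdd : dist xt x < d1 ∧ dist xt x < d2 := by
    rw [mem_ball] at hx hxt
    have := dist_triangle_right xt x x0
    have e1 := min_le_right (R / 2) (min (d1 / 2) (d2 / 2))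
    have e2 := min_le_left (d1 / 2) (d2 / 2)
    have e3 := min_le_right (d1 / 2) (d2 / 2)
    constructor <;> linarith
  set τ := u xt + c xt y + v y with hτ
  have hxe := hxy.2.2
  have hτ0 : 0 ≤ τ := by
    have := H.ge xt hxyt.1 y hxy.2.1
    linarith
  have hττ : τ < τ1 := by
    have e1 := hd1' xt hxyt.1 x hxy.1 hdd.1
    have e2 := hd2' (xt, y) ⟨hxyt.1, hxy.2.1⟩ (x, y) ⟨hxy.1, hxy.2.1⟩ (by
      rw [Prod.dist_eq]; simpa using hdd.2)
    rw [Real.dist_eq, abs_lt] at e1 e2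
    simp only [Function.uncurry] at e2
    linarith [e1.2, e2.2]
  rcases hτ0.eq_or_lt with h0 | h0
  · have hc : Con c U V u v xt y := ⟨hxyt.1, hxy.2.1, by linarith⟩
    have : xt = x := hst x (hKU hxK) y hxy xt hc
    subst this
    rw [← h0]
    have := hxyt.2.2
    linarith
  have hsec : ∀ z ∈ Sec c U u y (-v y + 2 * (Mb + 1) * τ), z ∈ ball x ε := by
    intro z hz
    refine hsm x hxK y hxy ⟨hz.1, hz.2.trans ?_⟩
    have : 2 * (Mb + 1) * τ ≤ 2 * (Mb + 1) * τ1 := by gcongr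
    have e : 2 * (Mb + 1) * τ1 = τ2 := by rw [hτ1]; field_simp
    linarith
  have hzz : ∀ z ∈ Sec c U u y (-v y + 2 * (Mb + 1) * τ), ∀ z' ∈ Sec c U u y (-v y + 2 * (Mb + 1) * τ),
      ‖z - z'‖ ≤ 2 * ε := by
    intro z hz z' hz'
    have a1 := hsec z hz
    have a2 := hsec z' hz'
    rw [mem_ball] at a1 a2
    have := dist_triangle_right z z' x
    rw [← dist_eq_norm]
    linarith
  have key := heng H P hg hUlU hlam hLp hMA hMA2 hN hNT (τ := τ) (Mb := Mb) h0 hMb2 hxy hxyt (by linarith) ?_ ?_ ?_ ?_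
  · have := hxyt.2.2
    linarith
  · intro z hz
    refine le_trans (Real.exp_le_exp.2 ?_) (le_max_right _ _)
    have e1 := hDV2 yt hxyt.2.1 y hxy.2.1
    have e2 := hDU2 z hz xt hxyt.1
    gcongr
  · intro z hz
    refine hRU ?_
    have a1 := hsec z hz
    rw [mem_ball] at a1
    rw [mem_closedBall] at hxK ⊢
    have := dist_triangle z x x0
    linarith
  · intro z hz z' hz' y1 hy1 y2 hy2
    rw [← Real.exp_log (show (0:ℝ) < 2 by norm_num)]
    refine Real.exp_le_exp.2 (le_trans ?_ h3)
    have := hzz z hz z' hz'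
    have := hDV2 y1 hy1 y2 hy2
    gcongr
  · intro z hz z' hz' yb hyb y1 hy1
    exact hcmp z hz.1 z' hz'.1 yb hyb y1 hy1 (Or.inl ((hzz z hz z' hz').trans_lt h2))

/-- Dyadic growth lemma. -/
theorem dyadic {n : ℕ} {ψ : Euc n → ℝ} {s C1 β : ℝ} (hs : 0 < s) (hβ : 0 < β)
    (hC : ∀ a, ‖a‖ < s → ψ a ≤ C1) (hC1 : 0 ≤ C1)
    (hd : ∀ a, ‖(2:ℝ) • a‖ < s → 2 ^ β * ψ a ≤ ψ ((2:ℝ) • a)) (h0 : ψ 0 ≤ 0) (a : Euc n) (ha : ‖a‖ < s) :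
    ψ a ≤ C1 * (2 * ‖a‖ / s) ^ β := by
  have key : ∀ k : ℕ, ∀ a : Euc n, ‖a‖ < s → s ≤ 2 ^ (k+1) * ‖a‖ → ψ a ≤ C1 * (2 * ‖a‖ / s) ^ β := by
    intro k
    induction k with
    | zero =>
      intro a ha hk
      refine (hC a ha).trans ?_
      have : 1 ≤ (2 * ‖a‖ / s) ^ β := Real.one_le_rpow (by rw [le_div_iff₀ hs]; simpa using hk) hβ.le
      nlinarith
    | succ k ih =>
      intro a ha hk
      by_cases h2 : s ≤ 2 * ‖a‖
      · refine (hC a ha).trans ?_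
        have : 1 ≤ (2 * ‖a‖ / s) ^ β := Real.one_le_rpow (by rw [le_div_iff₀ hs]; simpa using h2) hβ.le
        nlinarith
      · push Not at h2
        have hn : ‖(2:ℝ) • a‖ = 2 * ‖a‖ := by rw [norm_smul]; norm_num
        have e1 := ih ((2:ℝ) • a) (by rw [hn]; exact h2) (by rw [hn]; refine hk.trans_eq ?_; ring)
        have e2 := hd a (by rw [hn]; exact h2)
        rw [hn, show 2 * (2 * ‖a‖) / s = 2 * (2 * ‖a‖ / s) by ring, Real.mul_rpow (by norm_num) (by positivity)] at e1
        have h2p : (0:ℝ) < 2 ^ β := by positivity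
        have : 2 ^ β * ψ a ≤ 2 ^ β * (C1 * (2 * ‖a‖ / s) ^ β) := by linarith
        exact le_of_mul_le_mul_left this h2p
  rcases eq_or_ne a 0 with rfl | hne
  · refine h0.trans (by positivity)
  · have hp : 0 < ‖a‖ := norm_pos_iff.2 hne
    obtain ⟨k, hk⟩ := pow_unbounded_of_one_lt (s / ‖a‖) (show (1:ℝ) < 2 by norm_num)
    refine key k a ha ?_
    rw [div_lt_iff₀ hp] at hk
    rw [pow_succ]
    nlinarith [pow_pos (show (0:ℝ) < 2 by norm_num) k, mul_pos (pow_pos (show (0:ℝ) < 2 by norm_num) k) hp]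

set_option maxHeartbeats 2000000 in
theorem stepB {n : ℕ} {c : Euc n → Euc n → ℝ} {U V : Set (Euc n)}
    {p q : Euc n → Euc n → Euc n} {A : Euc n → Euc n → Euc n →L[ℝ] Euc n} {C0 : ℝ} {u v : Euc n → ℝ}
    (H : Pot n c U V u v) (P : Pkg n c U V p q A C0) {x0 : Euc n} {r K0 β : ℝ} (hK0 : 0 < K0) (hr : 0 < r)
    (hβ : 0 < β) (hβ2 : (2:ℝ) ^ β ≤ 2 + 1 / (2 * K0))
    (hrU : ball x0 r ⊆ U) (hA : ∀ x ∈ ball x0 r, ∀ xt ∈ ball x0 r, ∀ y yt,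
      Con c U V u v x y → Con c U V u v xt yt → u x + c x yt + v yt ≤ K0 * (u xt + c xt y + v y)) :
    ∃ r' > 0, r' ≤ r / 2 ∧ ∃ C : ℝ, 0 ≤ C ∧ ∀ xt ∈ ball x0 r', ∀ yt, Con c U V u v xt yt → ∀ x ∈ ball xt r',
      u x + c x yt + v yt ≤ C * ‖x - xt‖ ^ β := by
  obtain ⟨DV, hDV, hDV2⟩ := bdd_norm P.compV
  obtain ⟨L, hL, hLip⟩ := P.lipX
  obtain ⟨B, hB, hBA⟩ := P.Ai_bound
  have hC0 := P.C0nn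
  set M := (1 + 1 / K0) / (1 + 1 / (2 * K0)) with hM
  have hM1 : 1 < M := by
    rw [hM, lt_div_iff₀ (by positivity)]
    have : 1 / (2 * K0) < 1 / K0 := by
      apply one_div_lt_one_div_of_lt hK0; linarith
    linarith
  have hlM : 0 < Real.log M := Real.log_pos hM1
  set r2 := min (r / 2) (Real.log M / ((C0 + 1) * DV)) with hr2
  have hr2p : 0 < r2 := by positivity
  have hr2a : r2 ≤ r / 2 := min_le_left _ _
  have hr2b : C0 * r2 * DV ≤ Real.log M := by
    have : r2 ≤ Real.log M / ((C0 + 1) * DV) := min_le_right _ _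
    rw [le_div_iff₀ (by positivity)] at this
    nlinarith [mul_pos hr2p hDV]
  set s := r2 / L with hs
  have hsp : 0 < s := by positivity
  obtain ⟨B1, hB1⟩ := P.compU.exists_bound_of_continuousOn H.uc
  obtain ⟨B2, hB2⟩ := P.compV.exists_bound_of_continuousOn H.vc
  obtain ⟨B3, hB3⟩ := P.compS.exists_bound_of_continuousOn P.cc
  set C1 := |B1| + |B2| + |B3| with hC1
  have hC1b : ∀ x ∈ closure U, ∀ y ∈ closure V, u x + c x y + v y ≤ C1 := by
    intro x hx y hy
    have a1 := (le_abs_self _).trans ((hB1 x hx).trans (le_abs_self _))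
    have a2 := (le_abs_self _).trans ((hB2 y hy).trans (le_abs_self _))
    have a3 := (le_abs_self _).trans ((hB3 (x, y) ⟨hx, hy⟩).trans (le_abs_self _))
    simp only [Function.uncurry] at a3
    linarith
  set r3 := min r2 (s / B) with hr3
  have hr3p : 0 < r3 := by positivity
  have hr32 : r3 ≤ r2 := min_le_left _ _
  refine ⟨r3, hr3p, hr32.trans hr2a, C1 * (2 * B / s) ^ β, by positivity, ?_⟩
  intro xt hxt yt hc x hx
  have hyt := hc.2.1
  have hxt2 : ball xt r2 ⊆ ball x0 r := by
    intro z hz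
    rw [mem_ball] at *
    have := dist_triangle z xt x0
    linarith
  have hbU : ball xt r2 ⊆ U := hxt2.trans hrU
  have hbq : ball (q xt yt) s ⊆ (fun x => q x yt) '' U := P.ballq hL hLip hr2p hbU hyt
  have hcl : ∀ a : Euc n, ‖a‖ < s → q xt yt + a ∈ (fun x => q x yt) '' closure U := by
    intro a ha
    exact image_mono subset_closure (hbq (by simpa [mem_ball, dist_eq_norm] using ha))
  set Z : Euc n → Euc n := fun a => Xi q U yt (q xt yt + a) with hZ
  have hZm : ∀ a : Euc n, ‖a‖ < s → Z a ∈ closure U := fun a ha => Xi_mem (hcl a ha)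
  have hZq : ∀ a : Euc n, ‖a‖ < s → q (Z a) yt = q xt yt + a := fun a ha => Xi_eq (hcl a ha)
  have hZd : ∀ a : Euc n, ‖a‖ < s → ‖Z a - xt‖ < r2 := by
    intro a ha
    have := hLip yt hyt (Z a) (hZm a ha) xt hc.1
    rw [hZq a ha, add_sub_cancel_left] at this
    have h2 : L * ‖a‖ < L * s := by gcongr
    have h3 : L * s = r2 := by rw [hs]; field_simp
    linarith
  set ψ : Euc n → ℝ := fun a => u (Z a) + c (Z a) yt + v yt with hψ
  have hxtball : xt ∈ ball x0 r := hxt2 (mem_ball_self hr2p)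
  have hmain := dyadic (ψ := ψ) (s := s) (C1 := C1) (β := β) hsp hβ (fun a ha => hC1b _ (hZm a ha) _ hyt)
    (by positivity) ?_ ?_ (q x yt - q xt yt)
  · have hxU : x ∈ closure U := subset_closure (hbU (ball_subset_ball hr32 hx))
    have hq : ‖q x yt - q xt yt‖ ≤ B * ‖x - xt‖ := by
      refine (convex_ball xt r2).norm_image_sub_le_of_norm_hasFDerivWithin_le (f := fun x => q x yt) (f' := fun z => A z yt)
        ?_ ?_ (mem_ball_self hr2p) (ball_subset_ball hr32 hx)
      · intro z hz
        exact (P.q_x z (subset_closure (hbU hz)) yt hyt).mono (hbU.trans subset_closure)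
      · intro z hz
        exact (hBA z (subset_closure (hbU hz)) yt hyt).1
    have hxd : ‖x - xt‖ < s / B := by
      have := ball_subset_ball (min_le_right r2 (s / B)) hx
      rwa [mem_ball, dist_eq_norm] at this
    rw [lt_div_iff₀ hB] at hxd
    have h1 := hmain (by linarith)
    have hZx : Z (q x yt - q xt yt) = x := by
      simp only [hZ, add_sub_cancel]
      exact P.Xi_q hxU hyt
    simp only [hψ, hZx] at h1
    refine h1.trans ?_
    rw [mul_assoc, ← Real.mul_rpow (by positivity) (by positivity)]
    gcongr
    rw [div_mul_eq_mul_div]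
    gcongr ?_ / s
    linarith
  · intro a ha2
    have hn : ‖(2:ℝ) • a‖ = 2 * ‖a‖ := by rw [norm_smul]; norm_num
    have ha : ‖a‖ < s := by
      rw [hn] at ha2
      have := norm_nonneg a
      linarith
    set x := Z a with hxd
    set x1 := Z ((2:ℝ) • a) with hx1d
    have hxU := hZm a ha
    have hx1U := hZm _ ha2
    obtain ⟨y, hyV, hy⟩ := H.ex x hxU
    have hcon : Con c U V u v x y := ⟨hxU, hyV, hy⟩
    have hxb : x ∈ ball x0 r := hxt2 (by rw [mem_ball, dist_eq_norm]; exact hZd a ha)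
    have hAA := hA x hxb xt hxtball y yt hcon hc
    have hnn : 0 ≤ u x + c x yt + v yt := by
      have := H.ge x hxU yt hyt; linarith
    have e1 : u x1 + v y + c x1 y ≥ 0 := H.ge x1 hx1U y hyV
    have e2 : u x1 + v yt + c x1 yt ≥ 0 := H.ge x1 hx1U yt hyt
    have e3 := hc.2.2
    change 2 ^ β * (u x + c x yt + v yt) ≤ u x1 + c x1 yt + v yt
    set w := u x + c x yt + v yt with hw
    rcases hnn.eq_or_lt with h0 | h0
    · rw [← h0]; linarith
    set w1 := u xt + c xt y + v y with hw1
    have hw1 : w / K0 ≤ w1 := by rw [div_le_iff₀ hK0]; linarith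
    have hw0 : 0 < w / K0 := by positivity
    have hQ := P.QQx yt hyt y hyV xt hc.1 x1 hx1U x hxU (1 / 2) (by norm_num) (by norm_num) (by
      rw [hxd, hx1d, hZq a ha, hZq _ ha2]
      module) (by linarith)
    have hexp : Real.exp (C0 * ‖x1 - xt‖ * ‖y - yt‖) ≤ M := by
      rw [← Real.exp_log (show 0 < M by linarith)]
      refine Real.exp_le_exp.2 (le_trans ?_ hr2b)
      have := (hZd _ ha2).le
      have := hDV2 y hyV yt hyt
      gcongr
    set E := Real.exp (C0 * ‖x1 - xt‖ * ‖y - yt‖) with hE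
    have hEp : 0 < E := Real.exp_pos _
    set m1 := (c x1 yt - c x1 y) - (c x yt - c x y) with hm1
    have hA1 : (1 + 1 / K0) * w ≤ (c x yt - c x y) - (c xt yt - c xt y) := by
      have : (1 + 1 / K0) * w = w + w / K0 := by ring
      linarith
    have hm2 : (1 + 1 / K0) * w ≤ E * m1 := by linarith
    have hm1p : 0 < m1 := by
      have : 0 < E * m1 := lt_of_lt_of_le (by positivity) hm2
      exact (pos_iff_pos_of_mul_pos this).1 hEp
    have hm3 : (1 + 1 / K0) * w ≤ M * m1 := hm2.trans (by gcongr)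
    have hm4 : (1 + 1 / (2 * K0)) * w ≤ m1 := by
      rw [hM, div_mul_eq_mul_div, le_div_iff₀ (by positivity)] at hm3
      have : (1 + 1 / K0) * ((1 + 1 / (2 * K0)) * w) ≤ (1 + 1 / K0) * m1 := by linarith
      exact le_of_mul_le_mul_left this (by positivity)
    have : 2 ^ β * w ≤ (2 + 1 / (2 * K0)) * w := by gcongr
    linarith
  · have : Z 0 = xt := by simp only [hZ, add_zero]; exact P.Xi_q hc.1 hyt
    simp only [hψ, this]
    have := hc.2.2
    linarith

end growth
end FKM

open Set MeasureTheory Metric Bornology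
open scoped ENNReal NNReal Pointwise

namespace FKM
open Filter Topology
section grad
variable {n : ℕ} {c : Euc n → Euc n → ℝ} {U V : Set (Euc n)} {p q : Euc n → Euc n → Euc n}
  {A : Euc n → Euc n → Euc n →L[ℝ] Euc n} {C0 : ℝ} {u v : Euc n → ℝ}

theorem Pot.hasF (H : Pot n c U V u v) (P : Pkg n c U V p q A C0) {x y : Euc n} {r α C : ℝ} (hr : 0 < r)
    (hα : 0 < α) (hC : 0 ≤ C) (hxU : ball x r ⊆ U) (hc : Con c U V u v x y)
    (hg : ∀ z ∈ ball x r, u z + c z y + v y ≤ C * ‖z - x‖ ^ (1 + α)) :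
    HasFDerivAt u (innerSL ℝ (p x y)) x := by
  have hx := hxU (mem_ball_self hr)
  have h1 := P.c_x x hx y hc.2.1
  have h2 : HasFDerivAt (fun z => u z + c z y + v y) (0 : Euc n →L[ℝ] ℝ) x := by
    rw [hasFDerivAt_iff_isLittleO, Asymptotics.isLittleO_iff]
    intro ε hε
    have ht : Tendsto (fun z : Euc n => C * ‖z - x‖ ^ α) (𝓝 x) (𝓝 0) := by
      have : ContinuousAt (fun z : Euc n => C * ‖z - x‖ ^ α) x := by
        refine continuousAt_const.mul (ContinuousAt.rpow_const (by fun_prop) (Or.inr hα.le))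
      have h := this.tendsto
      simpa [Real.zero_rpow hα.ne'] using h
    filter_upwards [ht.eventually (gt_mem_nhds hε), ball_mem_nhds x hr] with z hz hzb
    have e1 := hg z hzb
    have e2 : 0 ≤ u z + v y + c z y := H.ge z (subset_closure (hxU hzb)) y hc.2.1
    have e3 := hc.2.2
    have e4 : u z + c z y + v y - (u x + c x y + v y) - (0 : Euc n →L[ℝ] ℝ) (z - x) = u z + c z y + v y := by
      simp; linarith
    rw [e4, Real.norm_of_nonneg (by linarith)]
    rw [Real.rpow_add_of_nonneg (norm_nonneg _) (by norm_num) hα.le, Real.rpow_one] at e1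
    nlinarith [norm_nonneg (z - x)]
  have h3 := (h2.sub h1).sub_const (v y)
  refine (h3.congr_fderiv (by simp)).congr_of_eventuallyEq (Eventually.of_forall fun z => ?_)
  simp; ring

set_option maxHeartbeats 1000000 in
theorem Pot.holder (H : Pot n c U V u v) (P : Pkg n c U V p q A C0) {L : ℝ} (hL : 0 ≤ L)
    (hPL : ∀ x r, ball x r ⊆ U → ∀ z ∈ ball x r, ∀ z' ∈ ball x r, ∀ y ∈ closure V, ‖p z y - p z' y‖ ≤ L * ‖z - z'‖)
    {x0 : Euc n} {r α C : ℝ} (hr : 0 < r) (hr1 : r ≤ 1)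
    (hα : 0 < α) (hα1 : α ≤ 1) (hC : 0 ≤ C) (hxU : ball x0 (2 * r) ⊆ U)
    (hg : ∀ xt ∈ ball x0 r, ∀ yt, Con c U V u v xt yt → ∀ z ∈ ball xt r, u z + c z yt + v yt ≤ C * ‖z - xt‖ ^ (1 + α)) :
    ∀ xt ∈ ball x0 (r / 4), ∀ x ∈ ball x0 (r / 4), ∀ yt y, Con c U V u v xt yt → Con c U V u v x y →
      ‖p x y - p xt yt‖ ≤ (3 * L + C * 4) * ‖x - xt‖ ^ α := by
  intro xt hxt x hx yt y hct hc
  set s := ‖x - xt‖ with hs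
  have hs2 : s < r / 2 := by
    rw [mem_ball] at hx hxt
    have := dist_triangle_right x xt x0
    rw [hs, ← dist_eq_norm]; linarith
  have hbb : ∀ z ∈ ball x0 (r / 4), z ∈ ball x0 (2 * r) := fun z hz => ball_subset_ball (by linarith) hz
  have hyt := hct.2.1
  have hy := hc.2.1
  rcases (norm_nonneg (x - xt)).eq_or_lt with h0 | h0
  · have hxx : x = xt := by rw [← sub_eq_zero, ← norm_eq_zero, ← h0]
    subst hxx
    have hxU' : ball x r ⊆ U := by
      intro z hz
      apply hxU
      rw [mem_ball] at *
      have := dist_triangle z x x0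
      linarith
    have hxr : x ∈ ball x0 r := ball_subset_ball (by linarith) hx
    have a1 := H.hasF P hr hα hC hxU' hc (hg x hxr y hc)
    have a2 := H.hasF P hr hα hC hxU' hct (hg x hxr yt hct)
    have a3 := a1.unique a2
    have : p x y = p x yt := by
      have h := congrArg (fun T : Euc n →L[ℝ] ℝ => T (p x y - p x yt)) a3
      simp only [innerSL_apply_apply] at h
      rw [← sub_eq_zero, ← inner_sub_left, inner_self_eq_zero, sub_eq_zero] at h
      exact h
    rw [this, sub_self, norm_zero]; positivity
  rw [← hs] at h0
  set Q := p x y - p x yt with hQ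
  have hs1 : s ≤ s ^ α := by
    calc s = s ^ (1:ℝ) := (Real.rpow_one _).symm
      _ ≤ s ^ α := Real.rpow_le_rpow_of_exponent_ge h0 (by linarith) hα1
  have hB : closedBall x s ⊆ ball x0 (2 * r) := by
    intro z hz
    rw [mem_closedBall] at hz
    rw [mem_ball] at hx ⊢
    have := dist_triangle z x x0
    linarith
  have key : ‖Q‖ ≤ 2 * L * s + C * 4 * s ^ α := by
    rcases eq_or_ne Q 0 with hQ0 | hQ0
    · rw [hQ0, norm_zero]; positivity
    have hQp : 0 < ‖Q‖ := norm_pos_iff.2 hQ0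
    set z := x + (s / ‖Q‖) • Q with hz
    have hzx : ‖z - x‖ = s := by
      rw [hz, add_sub_cancel_left, norm_smul, Real.norm_of_nonneg (by positivity)]; field_simp
    have hzB : z ∈ closedBall x s := by rw [mem_closedBall, dist_eq_norm, hzx]
    have hxB : x ∈ closedBall x s := mem_closedBall_self h0.le
    set G : Euc n → ℝ := fun w => c w yt - c w y - inner ℝ Q w with hG
    have hd : ∀ w ∈ closedBall x s, HasFDerivWithinAt G (innerSL ℝ ((p w y - p x y) - (p w yt - p x yt))) (closedBall x s) w := by
      intro w hw
      have hwU := hxU (hB hw)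
      have e := ((P.c_x w hwU yt hyt).sub (P.c_x w hwU y hy)).sub (innerSL ℝ Q).hasFDerivAt
      refine (e.congr_fderiv ?_).hasFDerivWithinAt
      ext1 w
      simp only [hQ, map_sub, ContinuousLinearMap.sub_apply, ContinuousLinearMap.neg_apply]
      ring
    have hm := (convex_closedBall x s).norm_image_sub_le_of_norm_hasFDerivWithin_le hd (C := 2 * L * s) (by
      intro w hw
      rw [innerSL_apply_norm]
      have e1 := hPL x0 _ hxU w (hB hw) x (hB hxB) y hy
      have e2 := hPL x0 _ hxU w (hB hw) x (hB hxB) yt hyt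
      have e3 : ‖w - x‖ ≤ s := by rwa [mem_closedBall, dist_eq_norm] at hw
      have e4 := norm_sub_le (p w y - p x y) (p w yt - p x yt)
      have e5 : L * ‖w - x‖ ≤ L * s := by gcongr
      linarith) hxB hzB
    rw [hzx, Real.norm_eq_abs] at hm
    have hm1 := (abs_le.1 hm).1
    have hin : inner ℝ Q z - inner ℝ Q x = s * ‖Q‖ := by
      rw [← inner_sub_right, hz, add_sub_cancel_left, inner_smul_right, real_inner_self_eq_norm_sq]
      field_simp
    have hzr : z ∈ ball xt r := by
      rw [mem_ball, dist_eq_norm]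
      have := norm_add_le (z - x) (x - xt)
      rw [sub_add_sub_cancel] at this
      linarith
    have hg1 := hg xt (ball_subset_ball (by linarith) hxt) yt hct z hzr
    have hzU := subset_closure (hxU (hB hzB))
    have e1 := H.ge z hzU y hy
    have e2 := H.ge x hc.1 yt hyt
    have e3 := hc.2.2
    have e4 : C * ‖z - xt‖ ^ (1 + α) ≤ C * (4 * (s ^ α * s)) := by
      have : ‖z - xt‖ ≤ 2 * s := by
        have := norm_add_le (z - x) (x - xt)
        rw [sub_add_sub_cancel] at this
        linarith
      have h4 : ‖z - xt‖ ^ (1 + α) ≤ (2 * s) ^ (1 + α) := Real.rpow_le_rpow (norm_nonneg _) this (by linarith)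
      have h5 : (2 * s) ^ (1 + α) = 2 ^ (1 + α) * (s ^ α * s) := by
        rw [Real.mul_rpow (by norm_num) h0.le, Real.rpow_add h0, Real.rpow_one]; ring
      have h6 : (2:ℝ) ^ (1 + α) ≤ 4 := by
        calc (2:ℝ) ^ (1 + α) ≤ 2 ^ (2:ℝ) := Real.rpow_le_rpow_of_exponent_le (by norm_num) (by linarith)
          _ = 4 := by norm_num
      have h7 : 2 ^ (1 + α) * (s ^ α * s) ≤ 4 * (s ^ α * s) := by gcongr
      have : ‖z - xt‖ ^ (1 + α) ≤ 4 * (s ^ α * s) := by linarith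
      gcongr
    have e5 : s * ‖Q‖ ≤ s * (2 * L * s + C * 4 * s ^ α) := by
      simp only [hG] at hm1
      nlinarith
    exact le_of_mul_le_mul_left e5 h0
  have hl := hPL x0 _ hxU x (hbb x hx) xt (hbb xt hxt) yt hyt
  have hsplit : p x y - p xt yt = Q + (p x yt - p xt yt) := by rw [hQ]; abel
  have := norm_add_le Q (p x yt - p xt yt)
  rw [← hsplit] at this
  have : L * s ≤ L * s ^ α := by gcongr
  rw [← hs] at hl
  linarith

theorem grad_of {x g : Euc n} (h : HasFDerivAt u (innerSL ℝ g) x) : gradient u x = g := by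
  have : HasGradientAt u g x := by
    rw [hasGradientAt_iff_hasFDerivAt]; exact h
  exact this.gradient

theorem holderOn_of {f : Euc n → Euc n} {S : Set (Euc n)} {C α : ℝ} (hC : 0 ≤ C) (hα : 0 < α)
    (h : ∀ x ∈ S, ∀ x' ∈ S, ‖f x - f x'‖ ≤ C * ‖x - x'‖ ^ α) : HolderOnWith C.toNNReal α.toNNReal f S := by
  intro x hx x' hx'
  rw [edist_dist, edist_dist, dist_eq_norm, dist_eq_norm, Real.coe_toNNReal _ hα.le,
    ENNReal.ofReal_rpow_of_nonneg (norm_nonneg _) hα.le]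
  change _ ≤ ENNReal.ofReal C * _
  rw [← ENNReal.ofReal_mul hC]
  exact ENNReal.ofReal_le_ofReal (h x hx x' hx')

/-- Local conclusion. -/
theorem Pot.concl (H : Pot n c U V u v) (P : Pkg n c U V p q A C0) {L : ℝ} (hL : 0 ≤ L)
    (hPL : ∀ x r, ball x r ⊆ U → ∀ z ∈ ball x r, ∀ z' ∈ ball x r, ∀ y ∈ closure V, ‖p z y - p z' y‖ ≤ L * ‖z - z'‖)
    {Ul : Set (Euc n)} (hUl : IsOpen Ul) {α : ℝ} (hα : 0 < α) (hα1 : α ≤ 1)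
    (hg : ∀ x0 ∈ Ul, ∃ r > 0, r ≤ 1 ∧ ball x0 (2 * r) ⊆ U ∧ ∃ C : ℝ, 0 ≤ C ∧ ∀ xt ∈ ball x0 r, ∀ yt,
      Con c U V u v xt yt → ∀ z ∈ ball xt r, u z + c z yt + v yt ≤ C * ‖z - xt‖ ^ (1 + α)) :
    ContDiffOn ℝ 1 u Ul ∧ ∀ x ∈ Ul, ∃ ε > 0, ∃ C : ℝ≥0,
      HolderOnWith C (Real.toNNReal α) (fun z => gradient u z) (Metric.ball x ε) := by
  have hloc : ∀ x0 ∈ Ul, ∃ ε > 0, (∀ x ∈ ball x0 ε, DifferentiableAt ℝ u x) ∧ ∃ C : ℝ≥0,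
      HolderOnWith C (Real.toNNReal α) (fun z => gradient u z) (Metric.ball x0 ε) := by
    intro x0 hx0
    obtain ⟨r, hr, hr1, hrU, C, hC, hgr⟩ := hg x0 hx0
    have hD : ∀ x ∈ ball x0 (r / 4), ∃ y, Con c U V u v x y ∧ HasFDerivAt u (innerSL ℝ (p x y)) x := by
      intro x hx
      have hxU : x ∈ closure U := subset_closure (hrU (ball_subset_ball (by linarith) hx))
      obtain ⟨y, hy, hxy⟩ := H.ex x hxU
      have hxr : x ∈ ball x0 r := ball_subset_ball (by linarith) hx
      refine ⟨y, ⟨hxU, hy, hxy⟩, H.hasF P hr hα hC ?_ ⟨hxU, hy, hxy⟩ (hgr x hxr y ⟨hxU, hy, hxy⟩)⟩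
      intro z hz
      apply hrU
      rw [mem_ball] at *
      have := dist_triangle z x x0
      linarith
    refine ⟨r / 4, by positivity, fun x hx => ?_, (3 * L + C * 4).toNNReal, holderOn_of (by positivity) hα ?_⟩
    · obtain ⟨y, -, h⟩ := hD x hx
      exact h.differentiableAt
    · intro x hx x' hx'
      obtain ⟨y, h1, h2⟩ := hD x hx
      obtain ⟨y', h1', h2'⟩ := hD x' hx'
      rw [grad_of h2, grad_of h2']
      exact H.holder P hL hPL hr hr1 hα hα1 hC hrU hgr x' hx' x hx y' y h1' h1
  refine ⟨?_, fun x hx => ?_⟩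
  · rw [show (1 : WithTop ℕ∞) = 0 + 1 by norm_num, contDiffOn_succ_iff_fderiv_of_isOpen hUl]
    refine ⟨fun x hx => ?_, by simp, ?_⟩
    · obtain ⟨ε, hε, h, -⟩ := hloc x hx
      exact (h x (mem_ball_self hε)).differentiableWithinAt
    · rw [contDiffOn_zero]
      intro x hx
      obtain ⟨ε, hε, -, C, h⟩ := hloc x hx
      have h1 : ContinuousAt (fun z => gradient u z) x :=
        ((h.continuousOn (Real.toNNReal_pos.2 hα)) x (mem_ball_self hε)).continuousAt (ball_mem_nhds x hε)
      have h2 : (fderiv ℝ u) = fun z => (InnerProductSpace.toDual ℝ (Euc n)) (gradient u z) := by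
        ext1 z; simp [gradient]
      rw [h2]
      exact ((InnerProductSpace.toDual ℝ (Euc n)).continuous.continuousAt.comp h1).continuousWithinAt
  · obtain ⟨ε, hε, -, h⟩ := hloc x hx
    exact ⟨ε, hε, h⟩

end grad
end FKM

open Set MeasureTheory Metric Bornology
open scoped ENNReal NNReal Pointwise

namespace FKM
open Filter Topology
section final
variable {n : ℕ} {c : Euc n → Euc n → ℝ} {U V : Set (Euc n)} {p q : Euc n → Euc n → Euc n}
  {A : Euc n → Euc n → Euc n →L[ℝ] Euc n} {C0 : ℝ} {u v : Euc n → ℝ}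

theorem Pot.strict (H : Pot n c U V u v) (P : Pkg n c U V p q A C0) {Ul : Set (Euc n)} (hUl : IsOpen Ul)
    (hUlU : Ul ⊆ U) {lam Lam : ℝ} (hlam : 0 < lam) (hLam : 0 < Lam)
    (hMA : ∀ W ⊆ Ul, IsCompact W → ENNReal.ofReal lam * volume W ≤ volume (Im c U V u v W))
    (hMA2 : ∀ W ⊆ closure U, IsCompact W → volume (Im c U V u v W) ≤ ENNReal.ofReal Lam * volume W) :
    ∀ x ∈ Ul, ∀ y, Con c U V u v x y → ∀ x', Con c U V u v x' y → x' = x := by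
  intro x hx y hc x' hc'
  obtain ⟨r, hr, hrU⟩ := Metric.isOpen_iff.1 hUl x hx
  have hyV : y ∈ V := H.lemE P hr hlam (hUlU hx) hc (fun K hK hKb => hMA K (hKb.trans hrU) hK)
  obtain ⟨r', hr', hrV⟩ := Metric.isOpen_iff.1 P.oV y hyV
  refine strict_conv H P hUl hlam hLam hMA hMA2 hyV ?_ hx hc hc'
  intro z hz
  refine H.swap.lemE P.swap hr' (inv_pos.2 hLam) hyV (con_swap.2 hz) ?_
  intro Y hY hYb
  have hX := H.swap.Im_compact P.swap hY.isClosed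
  set X := Im (fun y x => c x y) V U v u Y with hXd
  have hXU : X ⊆ closure U := by
    rintro a ⟨b, hb, h⟩; exact h.2.1
  have hYI : Y ⊆ Im c U V u v X := by
    intro b hb
    have hbV := subset_closure (hrV (hYb hb))
    obtain ⟨a, ha, h⟩ := H.ey b hbV
    exact ⟨a, ⟨b, hb, con_swap.2 ⟨ha, hbV, h⟩⟩, ha, hbV, h⟩
  have h1 := (measure_mono hYI).trans (hMA2 X hXU hX)
  calc ENNReal.ofReal Lam⁻¹ * volume Y ≤ ENNReal.ofReal Lam⁻¹ * (ENNReal.ofReal Lam * volume X) := by gcongr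
    _ = volume X := by
      rw [← mul_assoc, ← ENNReal.ofReal_mul (by positivity), inv_mul_cancel₀ hLam.ne']; simp

theorem main_pkg (n : ℕ) (Γ : ℝ) : ∃ α : ℝ, 0 < α ∧ α < 1 ∧ ∀ {c : Euc n → Euc n → ℝ} {U V : Set (Euc n)}
    {p q : Euc n → Euc n → Euc n} {A : Euc n → Euc n → Euc n →L[ℝ] Euc n} {C0 : ℝ} {u v : Euc n → ℝ},
    Pot n c U V u v → Pkg n c U V p q A C0 → ∀ {g1 g2 : ℝ}, Dt U V A g1 g2 → ∀ {L : ℝ}, 0 ≤ L →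
    (∀ x r, ball x r ⊆ U → ∀ z ∈ ball x r, ∀ z' ∈ ball x r, ∀ y ∈ closure V, ‖p z y - p z' y‖ ≤ L * ‖z - z'‖) →
    ∀ {Ul : Set (Euc n)} {lam Lam : ℝ}, IsOpen Ul → Ul ⊆ U → 0 < lam → 0 < Lam →
    (∀ W ⊆ Ul, IsCompact W → ENNReal.ofReal lam * volume W ≤ volume (Im c U V u v W)) →
    (∀ W ⊆ Ul, IsCompact W → volume (Im c U V u v W) ≤ ENNReal.ofReal (1 / lam) * volume W) →
    (∀ W ⊆ closure U, IsCompact W → volume (Im c U V u v W) ≤ ENNReal.ofReal Lam * volume W) →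
    g2 / g1 ≤ Γ * lam →
    ContDiffOn ℝ 1 u Ul ∧ ∀ x ∈ Ul, ∃ ε > 0, ∃ C : ℝ≥0,
      HolderOnWith C (Real.toNNReal α) (fun z => gradient u z) (Metric.ball x ε) := by
  obtain ⟨Kn, hKn, hst⟩ := stepA n
  obtain ⟨N, hN⟩ := exists_nat_gt (Kn * Γ ^ 6 * Γ ^ 2 * 144 ^ n + 1)
  set K0 : ℝ := 6 * (1 + 8 * N) with hK0
  have hK0p : 6 ≤ K0 := by rw [hK0]; nlinarith [Nat.cast_nonneg (α := ℝ) N]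
  set α := Real.logb 2 (1 + 1 / (4 * K0)) with hα
  have h4 : 0 < 1 / (4 * K0) := by positivity
  have h5 : 1 / (4 * K0) < 1 := by
    rw [div_lt_one (by positivity)]; linarith
  have hα0 : 0 < α := Real.logb_pos (by norm_num) (by linarith)
  have hα1 : α < 1 := by
    rw [hα, Real.logb_lt_iff_lt_rpow (by norm_num) (by linarith)]; norm_num; norm_num at h5; linarith
  have hαe : (2:ℝ) ^ α = 1 + 1 / (4 * K0) := Real.rpow_logb (by norm_num) (by norm_num) (by linarith)
  refine ⟨α, hα0, hα1, ?_⟩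
  intro c U V p q A C0 u v H P g1 g2 hg L hL hPL Ul lam Lam hUl hUlU hlam hLam hMA hMA2 hMA3 hΓ
  refine H.concl P hL hPL hUl hα0 hα1.le ?_
  intro x0 hx0
  have hlam1 : lam ≤ 1 := by
    obtain ⟨R, hR, hRU⟩ := nhds_basis_closedBall.mem_iff.1 (hUl.mem_nhds hx0)
    have hcpt : IsCompact (closedBall x0 R) := isCompact_closedBall _ _
    have h := (hMA _ hRU hcpt).trans (hMA2 _ hRU hcpt)
    have hv0 : volume (closedBall x0 R) ≠ 0 := (measure_closedBall_pos volume x0 hR).ne'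
    have hvt : volume (closedBall x0 R) ≠ ⊤ := hcpt.measure_lt_top.ne
    rw [ENNReal.mul_le_mul_iff_left hv0 hvt, ENNReal.ofReal_le_ofReal_iff (by positivity),
      le_div_iff₀ hlam] at h
    nlinarith
  have hg1 := hg.1
  have hgg : 1 ≤ g2 / g1 := by rw [le_div_iff₀ hg1]; linarith [hg.2.1]
  have hΓ0 : 0 < Γ := by
    by_contra hh
    push Not at hh
    nlinarith
  have hΓ1 : g2 / g1 ≤ Γ := by nlinarith
  have hl2 : 1 / lam ≤ Γ := by rw [div_le_iff₀ hlam]; linarith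
  have hl3 : 1 / lam / lam ≤ Γ ^ 2 := by
    have : 1 / lam / lam = (1 / lam) ^ 2 := by field_simp
    rw [this]
    exact pow_le_pow_left₀ (by positivity) hl2 2
  have hN1 : (1:ℝ) < N := by
    have : 0 ≤ Kn * Γ ^ 6 * Γ ^ 2 * 144 ^ n := by positivity
    linarith
  have hcond : Kn * (g2 / g1) ^ 6 * (1 / lam / lam) * 144 ^ n < (N:ℝ) ^ 2 := by
    have : Kn * (g2 / g1) ^ 6 * (1 / lam / lam) * 144 ^ n ≤ Kn * Γ ^ 6 * Γ ^ 2 * 144 ^ n := by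
      gcongr
    nlinarith
  have hstr := H.strict P hUl hUlU hlam hLam hMA hMA3
  obtain ⟨r, hr, hrU, hA⟩ := hst H P hg hUl hUlU hlam (one_div_pos.2 hlam) hMA hMA2 hstr
    (by exact_mod_cast (zero_lt_one.trans hN1)) hcond x0 hx0
  obtain ⟨r', hr', hrr, C, hC, hB⟩ := stepB H P (K0 := K0) (β := 1 + α) (by linarith) hr (by linarith) (by
    rw [Real.rpow_add (by norm_num), hαe, Real.rpow_one]
    apply le_of_eq
    field_simp; ring) (hrU.trans hUlU) hA
  refine ⟨min r' 1, by positivity, min_le_right _ _, ?_, C, hC, ?_⟩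
  · refine (ball_subset_ball ?_).trans (hrU.trans hUlU)
    have := min_le_left r' 1
    linarith
  · intro xt hxt yt hc z hz
    exact hB xt (ball_subset_ball (min_le_left _ _) hxt) yt hc z (ball_subset_ball (min_le_left _ _) hz)

end final
end FKM

open Set MeasureTheory Metric Bornology
open scoped ENNReal NNReal Pointwise

namespace FKM
open Filter Topology

section
variable {n : ℕ}

theorem geo1 {f : Euc n → Euc n} {U : Set (Euc n)} (oU : IsOpen U) (bU : IsBounded U)
    (neU : U.Nonempty) (hf : DiffeoOnto n f (closure U)) (hc : Convex ℝ (f '' U)) :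
    UniqueDiffOn ℝ (closure U) ∧ IsOpen (f '' U) ∧ f '' closure U = closure (f '' U) ∧
    interior (f '' closure U) = f '' U ∧
    ∀ x ∈ closure U, ∀ L : Euc n →L[ℝ] Euc n, HasFDerivWithinAt f L (closure U) x →
      Function.Injective L := by
  obtain ⟨hi, hd, hg⟩ := hf
  have hK : IsCompact (closure U) := Metric.isCompact_of_isClosed_isBounded isClosed_closure bU.closure
  set G := Function.invFunOn f (closure U) with hG
  have hGf : LeftInvOn G f (closure U) := hi.leftInvOn_invFunOn
  have hfc : ContinuousOn f (closure U) := hd.continuousOn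
  -- derivative injective if unique differentiability
  have key : ∀ x ∈ closure U, UniqueDiffWithinAt ℝ (closure U) x → ∀ L : Euc n →L[ℝ] Euc n,
      HasFDerivWithinAt f L (closure U) x → Function.Injective L := by
    intro x hx hu L hL
    have h1 : HasFDerivWithinAt G (fderivWithin ℝ G (f '' closure U) (f x)) (f '' closure U) (f x) :=
      (hg.differentiableOn (by norm_num) _ (mem_image_of_mem _ hx)).hasFDerivWithinAt
    have h2 := h1.comp x hL (mapsTo_image _ _)
    have h3 : HasFDerivWithinAt (G ∘ f) (ContinuousLinearMap.id ℝ (Euc n)) (closure U) x :=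
      (hasFDerivWithinAt_id x _).congr (fun z hz => hGf hz) (hGf hx)
    have h4 := hu.eq h2 h3
    intro a b hab
    have := congrArg (fun T : Euc n →L[ℝ] Euc n => T a) h4
    have h' := congrArg (fun T : Euc n →L[ℝ] Euc n => T b) h4
    simp only [ContinuousLinearMap.comp_apply, ContinuousLinearMap.id_apply] at this h'
    rw [← this, ← h', hab]
  have hop : IsOpen (f '' U) := by
    rw [isOpen_iff_mem_nhds]
    rintro _ ⟨x, hx, rfl⟩
    have hn : closure U ∈ 𝓝 x := mem_of_superset (oU.mem_nhds hx) subset_closure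
    have hcd : ContDiffAt ℝ 1 f x := (hd x (subset_closure hx)).contDiffAt hn
    have hs := hcd.hasStrictFDerivAt (by norm_num)
    have hinj := key x (subset_closure hx) (uniqueDiffWithinAt_of_mem_nhds hn) _
      hs.hasFDerivAt.hasFDerivWithinAt
    obtain ⟨e, he⟩ := exists_equiv hinj
    rw [← he] at hs
    have := hs.map_nhds_eq_of_equiv
    rw [← this]
    exact image_mem_map (oU.mem_nhds hx)
  have hcl : f '' closure U = closure (f '' U) := by
    apply subset_antisymm
    · exact hfc.image_closure
    · exact closure_minimal (image_mono subset_closure) (hK.image_of_continuousOn hfc).isClosed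
  have hne : (interior (f '' U)).Nonempty := by rw [hop.interior_eq]; exact neU.image _
  have hinter : interior (f '' closure U) = f '' U := by
    rw [hcl, hc.interior_closure_eq_interior_of_nonempty_interior hne, hop.interior_eq]
  have hud : UniqueDiffOn ℝ (f '' closure U) := by
    refine uniqueDiffOn_convex (by rw [hcl]; exact hc.closure) ?_
    rw [hinter]; exact neU.image _
  have hudU : UniqueDiffOn ℝ (closure U) := by
    intro x hx
    have hfx := mem_image_of_mem f hx
    have h1 : HasFDerivWithinAt G (fderivWithin ℝ G (f '' closure U) (f x)) (f '' closure U) (f x) :=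
      (hg.differentiableOn (by norm_num) _ hfx).hasFDerivWithinAt
    have hGx : G (f x) = x := hGf hx
    have h2 : HasFDerivWithinAt f (fderivWithin ℝ f (closure U) x) (closure U) (G (f x)) := by
      rw [hGx]; exact (hd.differentiableOn (by norm_num) _ hx).hasFDerivWithinAt
    have hm : MapsTo G (f '' closure U) (closure U) := by
      rintro _ ⟨z, hz, rfl⟩
      rw [hGf hz]; exact hz
    have h3 := h2.comp (f x) h1 hm
    have h4 : HasFDerivWithinAt (f ∘ G) (ContinuousLinearMap.id ℝ (Euc n)) (f '' closure U) (f x) :=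
      (hasFDerivWithinAt_id _ _).congr (by
        rintro _ ⟨z, hz, rfl⟩
        simp only [Function.comp, hGf hz, id]) (by simp only [Function.comp, hGx, id])
    have h5 := (hud _ hfx).eq h3 h4
    have hinj : Function.Injective (fderivWithin ℝ G (f '' closure U) (f x)) := by
      intro a b hab
      have := congrArg (fun T : Euc n →L[ℝ] Euc n => T a) h5
      have h' := congrArg (fun T : Euc n →L[ℝ] Euc n => T b) h5
      simp only [ContinuousLinearMap.comp_apply, ContinuousLinearMap.id_apply] at this h'
      rw [← this, ← h', hab]
    obtain ⟨e, he⟩ := exists_equiv hinj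
    have h6 := h1.uniqueDiffWithinAt (hud _ hfx) (by rw [← he]; exact e.surjective.denseRange)
    have h7 : G '' (f '' closure U) = closure U := hGf.image_image
    rwa [h7, hGx] at h6
  exact ⟨hudU, hop, hcl, hinter, fun x hx => key x hx (hudU x hx)⟩

theorem strong_mid {Q : Set (Euc n)} (h : StronglyConvexSet n Q) :
    ∃ R : ℝ, 0 < R ∧ ∀ a ∈ closure Q, ∀ b ∈ closure Q, ∀ v : Euc n, ‖v‖ ≤ ‖a - b‖ ^ 2 / R →
      (1 / 2 : ℝ) • (a + b) + v ∈ closure Q := by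
  obtain ⟨hc, R, hR, hs⟩ := h
  refine ⟨16 * R, by positivity, fun a ha b hb v hv => ?_⟩
  by_contra hw
  set m := (1 / 2 : ℝ) • (a + b) with hm
  have hmQ : m ∈ closure Q := by
    have := hc.closure ha hb (by norm_num : (0:ℝ) ≤ 1/2) (by norm_num : (0:ℝ) ≤ 1/2) (by norm_num)
    rwa [← smul_add] at this
  have hseg : IsPreconnected (segment ℝ m (m + v)) := (convex_segment _ _).isPreconnected
  obtain ⟨z, hz, hzf⟩ : ∃ z ∈ segment ℝ m (m + v), z ∈ frontier (closure Q) := by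
    by_contra hcon
    push Not at hcon
    have hcov : ∀ z ∈ segment ℝ m (m + v), z ∈ closure Q → z ∈ interior (closure Q) := by
      intro z hz hzc
      by_contra hni
      refine hcon z hz ?_
      rw [isClosed_closure.frontier_eq]
      exact ⟨hzc, hni⟩
    obtain ⟨z, hz, hz1, hz2⟩ := hseg (interior (closure Q)) (closure Q)ᶜ isOpen_interior
      isClosed_closure.isOpen_compl
      (fun z hz => (em (z ∈ closure Q)).elim (fun h => Or.inl (hcov z hz h)) Or.inr)
      ⟨m, left_mem_segment ℝ _ _, hcov m (left_mem_segment ℝ _ _) hmQ⟩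
      ⟨m + v, right_mem_segment ℝ _ _, hw⟩
    exact hz2 (interior_subset hz1)
  obtain ⟨o, ho, hQ⟩ := hs z (frontier_closure_subset hzf)
  have hQ' : closure Q ⊆ closedBall o R := closure_minimal hQ isClosed_closedBall
  have ha' := hQ' ha
  have hb' := hQ' hb
  rw [mem_closedBall, dist_eq_norm] at ha' hb'
  rw [dist_eq_norm] at ho
  rw [segment_eq_image'] at hz
  obtain ⟨t, ⟨ht0, ht1⟩, rfl⟩ := hz
  have hzv : m + t • (m + v - m) - o = (m - o) + t • v := by
    rw [add_sub_cancel_left]; abel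
  simp only [hzv] at ho
  have hle : R ≤ ‖m - o‖ + ‖v‖ := by
    rw [← ho]
    refine (norm_add_le _ _).trans ?_
    rw [norm_smul, Real.norm_of_nonneg ht0]
    have := mul_le_of_le_one_left (norm_nonneg v) ht1
    linarith
  have hpar : ‖m - o‖ ^ 2 = (‖a - o‖ ^ 2 + ‖b - o‖ ^ 2) / 2 - ‖a - b‖ ^ 2 / 4 := by
    have h1 : m - o = (1 / 2 : ℝ) • ((a - o) + (b - o)) := by rw [hm]; module
    have h2 : a - b = (a - o) - (b - o) := by abel
    have := parallelogram_law_with_norm ℝ (a - o) (b - o)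
    rw [h1, norm_smul, h2, mul_pow, Real.norm_of_nonneg (by norm_num)]
    linear_combination this / 4
  set d := ‖a - b‖ with hd
  have hd0 : 0 ≤ d := norm_nonneg _
  rcases hd0.eq_or_lt with h0 | hdpos
  · rw [← h0] at hv
    have : v = 0 := by
      have : ‖v‖ ≤ 0 := by simpa using hv
      simpa using this
    rw [this, add_zero] at hw
    exact hw hmQ
  have hdR : d ≤ 2 * R := by
    have : d ≤ ‖a - o‖ + ‖b - o‖ := by
      rw [hd, show a - b = (a - o) - (b - o) by abel]; exact norm_sub_le _ _
    linarith
  have hv' : ‖v‖ * (16 * R) ≤ d ^ 2 := by rwa [le_div_iff₀ (by positivity)] at hv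
  have hsq : ‖m - o‖ ^ 2 ≤ R ^ 2 - d ^ 2 / 4 := by
    have := norm_nonneg (a - o)
    have := norm_nonneg (b - o)
    nlinarith
  have hvR : ‖v‖ ≤ R / 4 := by nlinarith [norm_nonneg v]
  have : (R - ‖v‖) ^ 2 ≤ ‖m - o‖ ^ 2 := by
    apply pow_le_pow_left₀ <;> linarith
  have hdd : 0 < d ^ 2 := by positivity
  nlinarith [norm_nonneg v, sq_nonneg ‖v‖]

/-- accumulation -/
theorem acc_pt {U : Set (Euc n)} (hn : 1 ≤ n) (oU : IsOpen U) {x : Euc n} (hx : x ∈ closure U) :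
    (𝓝[U \ {x}] x).NeBot := by
  have : Nonempty (Fin n) := ⟨⟨0, hn⟩⟩
  have h := (dense_compl_singleton x).open_subset_closure_inter oU
  rw [← mem_closure_iff_nhdsWithin_neBot]
  exact closure_minimal h isClosed_closure hx

end
end FKM

open Set MeasureTheory Metric Bornology
open scoped ENNReal NNReal Pointwise

namespace FKM
open Filter Topology

section
variable {n : ℕ} {c : Euc n → Euc n → ℝ} {U V : Set (Euc n)}

/-- Riesz representation as a linear map -/
noncomputable def rz (n : ℕ) : (Euc n →L[ℝ] ℝ) →L[ℝ] Euc n :=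
  LinearMap.toContinuousLinearMap
    { toFun := fun l => (InnerProductSpace.toDual ℝ (Euc n)).symm l
      map_add' := fun a b => by simp
      map_smul' := fun a b => by simp }

theorem rz_apply (l : Euc n →L[ℝ] ℝ) : rz n l = (InnerProductSpace.toDual ℝ (Euc n)).symm l := rfl

theorem inner_rz (l : Euc n →L[ℝ] ℝ) (v : Euc n) : inner ℝ (rz n l) v = l v := by
  rw [rz_apply, InnerProductSpace.toDual_symm_apply]

theorem innerSL_rz (l : Euc n →L[ℝ] ℝ) : innerSL ℝ (rz n l) = l := by
  ext v; simp [inner_rz]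

/-- `-D_y c`, intrinsically on the closure -/
noncomputable def qw (n : ℕ) (c : Euc n → Euc n → ℝ) (V : Set (Euc n)) (x y : Euc n) : Euc n :=
  -(rz n (fderivWithin ℝ (fun y' => c x y') (closure V) y))

/-- `-D_x D_y c` -/
noncomputable def Aw (n : ℕ) (c : Euc n → Euc n → ℝ) (U V : Set (Euc n)) (x y : Euc n) :
    Euc n →L[ℝ] Euc n :=
  fderivWithin ℝ (fun x' => qw n c V x' y) (closure U) x

structure Hyp (n : ℕ) (c : Euc n → Euc n → ℝ) (U V : Set (Euc n)) : Prop where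
  hn : 1 ≤ n
  neU : U.Nonempty
  neV : V.Nonempty
  b0 : B0cond n c U V
  b1 : B1cond n c U V
  b2 : B2cond n c U V
  b2s : B2scond n c U V

theorem contDiffOn_flip {F : Type*} [NormedAddCommGroup F] [NormedSpace ℝ F] {k : ℕ∞}
    {f : Euc n → Euc n → F} (h : ContDiffOn ℝ k (Function.uncurry f) (closure U ×ˢ closure V)) :
    ContDiffOn ℝ k (Function.uncurry fun y x => f x y) (closure V ×ˢ closure U) := by
  have : (Function.uncurry fun y x => f x y) = Function.uncurry f ∘ Prod.swap := by
    ext ⟨a, b⟩; rfl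
  rw [this]
  refine h.comp (contDiff_snd.prodMk contDiff_fst).contDiffOn ?_
  rintro ⟨a, b⟩ ⟨ha, hb⟩
  exact ⟨hb, ha⟩

theorem Hyp.swap (H : Hyp n c U V) : Hyp n (fun y x => c x y) V U where
  hn := H.hn
  neU := H.neV
  neV := H.neU
  b0 := ⟨H.b0.2.2.1, H.b0.2.2.2.1, H.b0.1, H.b0.2.1, contDiffOn_flip (k := 4) H.b0.2.2.2.2⟩
  b1 := ⟨H.b1.2, H.b1.1⟩
  b2 := ⟨H.b2.2, H.b2.1⟩
  b2s := ⟨H.b2s.2, H.b2s.1⟩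

theorem Hyp.geo (H : Hyp n c U V) {y : Euc n} (hy : y ∈ closure V) :
    UniqueDiffOn ℝ (closure U) ∧ IsOpen (Uyset n c U y) ∧
    (fun x => -gradY n c x y) '' closure U = closure (Uyset n c U y) ∧
    interior ((fun x => -gradY n c x y) '' closure U) = Uyset n c U y ∧
    ∀ x ∈ closure U, ∀ L : Euc n →L[ℝ] Euc n,
      HasFDerivWithinAt (fun x => -gradY n c x y) L (closure U) x → Function.Injective L :=
  geo1 H.b0.1 H.b0.2.1 H.neU (H.b1.1 y hy) (H.b2.1 y hy)

theorem Hyp.udU (H : Hyp n c U V) : UniqueDiffOn ℝ (closure U) :=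
  (H.geo (subset_closure H.neV.some_mem)).1
theorem Hyp.udV (H : Hyp n c U V) : UniqueDiffOn ℝ (closure V) := H.swap.udU
theorem Hyp.udS (H : Hyp n c U V) : UniqueDiffOn ℝ (closure U ×ˢ closure V) := H.udU.prod H.udV

theorem part_y {F : Type*} [NormedAddCommGroup F] [NormedSpace ℝ F] {f : Euc n → Euc n → F}
    {L : Euc n × Euc n →L[ℝ] F} {x y : Euc n} (hx : x ∈ closure U)
    (h : HasFDerivWithinAt (Function.uncurry f) L (closure U ×ˢ closure V) (x, y)) :
    HasFDerivWithinAt (fun y' => f x y') (L ∘L ContinuousLinearMap.inr ℝ _ _) (closure V) y := by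
  have := h.comp (f := fun y' => (x, y')) y (hasFDerivAt_prodMk_right x y).hasFDerivWithinAt (t := closure U ×ˢ closure V)
    (s := closure V) (fun y' hy' => ⟨hx, hy'⟩)
  exact this

theorem part_x {F : Type*} [NormedAddCommGroup F] [NormedSpace ℝ F] {f : Euc n → Euc n → F}
    {L : Euc n × Euc n →L[ℝ] F} {x y : Euc n} (hy : y ∈ closure V)
    (h : HasFDerivWithinAt (Function.uncurry f) L (closure U ×ˢ closure V) (x, y)) :
    HasFDerivWithinAt (fun x' => f x' y) (L ∘L ContinuousLinearMap.inl ℝ _ _) (closure U) x := by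
  have := h.comp (f := fun x' => (x', y)) x (hasFDerivAt_prodMk_left x y).hasFDerivWithinAt (t := closure U ×ˢ closure V)
    (s := closure U) (fun y' hy' => ⟨hy', hy⟩)
  exact this

theorem Hyp.dc (H : Hyp n c U V) {x y : Euc n} (hx : x ∈ closure U) (hy : y ∈ closure V) :
    HasFDerivWithinAt (Function.uncurry c) (fderivWithin ℝ (Function.uncurry c) (closure U ×ˢ closure V) (x, y))
      (closure U ×ˢ closure V) (x, y) :=
  (H.b0.2.2.2.2.differentiableOn (by norm_num) (x, y) ⟨hx, hy⟩).hasFDerivWithinAt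

theorem Hyp.q_eq (H : Hyp n c U V) {x y : Euc n} (hx : x ∈ closure U) (hy : y ∈ closure V) :
    qw n c V x y = -(rz n (fderivWithin ℝ (Function.uncurry c) (closure U ×ˢ closure V) (x, y) ∘L
      ContinuousLinearMap.inr ℝ _ _)) := by
  rw [qw, (part_y hx (H.dc hx hy)).fderivWithin (H.udV y hy)]

theorem Hyp.p_eq (H : Hyp n c U V) {x y : Euc n} (hx : x ∈ closure U) (hy : y ∈ closure V) :
    qw n (fun y x => c x y) U y x =
      -(rz n (fderivWithin ℝ (Function.uncurry c) (closure U ×ˢ closure V) (x, y) ∘L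
      ContinuousLinearMap.inl ℝ _ _)) := by
  rw [qw, (part_x hy (H.dc hx hy)).fderivWithin (H.udU x hx)]

theorem Hyp.qC3 (H : Hyp n c U V) :
    ContDiffOn ℝ 3 (Function.uncurry (qw n c V)) (closure U ×ˢ closure V) := by
  have h1 : ContDiffOn ℝ 3 (fderivWithin ℝ (Function.uncurry c) (closure U ×ˢ closure V))
      (closure U ×ˢ closure V) := H.b0.2.2.2.2.fderivWithin H.udS (by norm_num)
  have h2 : ContDiffOn ℝ 3 (fun z => -(rz n (fderivWithin ℝ (Function.uncurry c) (closure U ×ˢ closure V) z ∘L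
      ContinuousLinearMap.inr ℝ _ _))) (closure U ×ˢ closure V) :=
    ((rz n).contDiff.comp_contDiffOn (h1.clm_comp contDiffOn_const)).neg
  refine h2.congr ?_
  rintro ⟨x, y⟩ ⟨hx, hy⟩
  exact H.q_eq hx hy

theorem Hyp.dq (H : Hyp n c U V) {x y : Euc n} (hx : x ∈ closure U) (hy : y ∈ closure V) :
    HasFDerivWithinAt (Function.uncurry (qw n c V))
      (fderivWithin ℝ (Function.uncurry (qw n c V)) (closure U ×ˢ closure V) (x, y))
      (closure U ×ˢ closure V) (x, y) :=
  (H.qC3.differentiableOn (by norm_num) (x, y) ⟨hx, hy⟩).hasFDerivWithinAt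

theorem Hyp.q_x (H : Hyp n c U V) {x y : Euc n} (hx : x ∈ closure U) (hy : y ∈ closure V) :
    HasFDerivWithinAt (fun x' => qw n c V x' y) (Aw n c U V x y) (closure U) x := by
  have := part_x hy (H.dq hx hy)
  exact this.differentiableWithinAt.hasFDerivWithinAt

theorem Hyp.A_eq (H : Hyp n c U V) {x y : Euc n} (hx : x ∈ closure U) (hy : y ∈ closure V) :
    Aw n c U V x y =
      fderivWithin ℝ (Function.uncurry (qw n c V)) (closure U ×ˢ closure V) (x, y) ∘L
      ContinuousLinearMap.inl ℝ _ _ := by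
  rw [Aw, (part_x hy (H.dq hx hy)).fderivWithin (H.udU x hx)]

theorem Hyp.AC2 (H : Hyp n c U V) :
    ContDiffOn ℝ 2 (Function.uncurry (Aw n c U V)) (closure U ×ˢ closure V) := by
  have h1 : ContDiffOn ℝ 2 (fderivWithin ℝ (Function.uncurry (qw n c V)) (closure U ×ˢ closure V))
      (closure U ×ˢ closure V) := H.qC3.fderivWithin H.udS (by norm_num)
  refine (h1.clm_comp (contDiffOn_const (c := ContinuousLinearMap.inl ℝ (Euc n) (Euc n)))).congr ?_
  rintro ⟨x, y⟩ ⟨hx, hy⟩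
  exact H.A_eq hx hy

theorem Hyp.c_y (H : Hyp n c U V) {x y : Euc n} (hx : x ∈ closure U) (hy : y ∈ closure V) :
    HasFDerivWithinAt (fun y' => c x y') (-(innerSL ℝ (qw n c V x y))) (closure V) y := by
  rw [qw, map_neg, neg_neg, innerSL_rz]
  exact (part_y hx (H.dc hx hy)).differentiableWithinAt.hasFDerivWithinAt

theorem Hyp.gradY_of_diff (H : Hyp n c U V) {x y : Euc n} (hy : y ∈ closure V)
    (h : DifferentiableAt ℝ (fun y' => c x y') y) : gradY n c x y = -qw n c V x y := by
  rw [qw, neg_neg, gradY, gradient, rz_apply, h.fderivWithin (H.udV y hy)]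

theorem Hyp.gradY_eq (H : Hyp n c U V) {x y : Euc n} (hx : x ∈ closure U) (hy : y ∈ closure V) :
    gradY n c x y = -qw n c V x y := by
  by_cases h : DifferentiableAt ℝ (fun y' => c x y') y
  · exact H.gradY_of_diff hy h
  have hz : ∀ x', ¬ DifferentiableAt ℝ (fun y' => c x' y') y → gradY n c x' y = 0 := by
    intro x' hx'
    rw [gradY, gradient, fderiv_zero_of_not_differentiableAt hx', map_zero]
  have hoth : ∀ x' ∈ U \ {x}, gradY n c x' y = -qw n c V x' y := by
    rintro x' ⟨hx', hne⟩
    by_cases h' : DifferentiableAt ℝ (fun y' => c x' y') y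
    · exact H.gradY_of_diff hy h'
    · exact absurd ((H.b1.1 y hy).1 (subset_closure hx') hx (by simp only [hz _ h, hz _ h'])) hne
  have := acc_pt H.hn H.b0.1 hx
  have c1 : Tendsto (fun x' => -gradY n c x' y) (𝓝[U \ {x}] x) (𝓝 (-gradY n c x y)) :=
    ((H.b1.1 y hy).2.1.continuousOn x hx).mono_left
      (nhdsWithin_mono _ (sdiff_subset.trans subset_closure))
  have c2 : Tendsto (fun x' => qw n c V x' y) (𝓝[U \ {x}] x) (𝓝 (qw n c V x y)) :=
    (H.q_x hx hy).continuousWithinAt.mono_left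
      (nhdsWithin_mono _ (sdiff_subset.trans subset_closure))
  have c3 : Tendsto (fun x' => -gradY n c x' y) (𝓝[U \ {x}] x) (𝓝 (qw n c V x y)) := by
    refine c2.congr' ?_
    filter_upwards [self_mem_nhdsWithin] with x' hx'
    rw [hoth x' hx', neg_neg]
  rw [← tendsto_nhds_unique c1 c3, neg_neg]

theorem Hyp.img (H : Hyp n c U V) {y : Euc n} (hy : y ∈ closure V) {T : Set (Euc n)}
    (hT : T ⊆ closure U) :
    (fun x => qw n c V x y) '' T = (fun x => -gradY n c x y) '' T := by
  refine image_congr fun x hx => ?_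
  rw [H.gradY_eq (hT hx) hy, neg_neg]

theorem Hyp.A_inv (H : Hyp n c U V) {x y : Euc n} (hx : x ∈ closure U) (hy : y ∈ closure V) :
    Function.Injective (Aw n c U V x y) := by
  refine (H.geo hy).2.2.2.2 x hx _ ((H.q_x hx hy).congr (fun x' hx' => ?_) ?_)
  · rw [H.gradY_eq hx' hy, neg_neg]
  · simp only [H.gradY_eq hx hy, neg_neg]

theorem Hyp.adj (H : Hyp n c U V) {x y : Euc n} (hx : x ∈ closure U) (hy : y ∈ closure V) :
    Aw n (fun y x => c x y) V U y x = ContinuousLinearMap.adjoint (Aw n c U V x y) := by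
  set S := closure U ×ˢ closure V with hS
  have hz : (x, y) ∈ S := ⟨hx, hy⟩
  have hsym : IsSymmSndFDerivWithinAt ℝ (Function.uncurry c) S (x, y) := by
    refine (H.b0.2.2.2.2 (x, y) hz).isSymmSndFDerivWithinAt (by simp; norm_num) H.udS ?_ hz
    have : U ×ˢ V ⊆ interior S :=
      (H.b0.1.prod H.b0.2.2.1).subset_interior_iff.2 (prod_mono subset_closure subset_closure)
    refine closure_mono this ?_
    rw [closure_prod_eq]; exact hz
  have h1 : ContDiffOn ℝ 3 (fderivWithin ℝ (Function.uncurry c) S) S :=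
    H.b0.2.2.2.2.fderivWithin H.udS (by norm_num)
  have h2 := (h1.differentiableOn (by norm_num) (x, y) hz).hasFDerivWithinAt
  set D2 := fderivWithin ℝ (fderivWithin ℝ (Function.uncurry c) S) S (x, y) with hD2
  -- x-derivative of q
  have hq : HasFDerivWithinAt (fun x' => qw n c V x' y)
      ((-(rz n ∘L ((ContinuousLinearMap.compL ℝ (Euc n) (Euc n × Euc n) ℝ).flip
        (ContinuousLinearMap.inr ℝ _ _)))) ∘L (D2 ∘L ContinuousLinearMap.inl ℝ _ _)) (closure U) x := by
    have h3 := part_x (f := fun a b => fderivWithin ℝ (Function.uncurry c) S (a, b)) hy h2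
    refine ((ContinuousLinearMap.hasFDerivAt _).comp_hasFDerivWithinAt x h3).congr (fun x' hx' => ?_) ?_
    · rw [H.q_eq hx' hy]; rfl
    · rw [H.q_eq hx hy]; rfl
  have hp : HasFDerivWithinAt (fun y' => qw n (fun y x => c x y) U y' x)
      ((-(rz n ∘L ((ContinuousLinearMap.compL ℝ (Euc n) (Euc n × Euc n) ℝ).flip
        (ContinuousLinearMap.inl ℝ _ _)))) ∘L (D2 ∘L ContinuousLinearMap.inr ℝ _ _)) (closure V) y := by
    have h3 := part_y (f := fun a b => fderivWithin ℝ (Function.uncurry c) S (a, b)) hx h2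
    refine ((ContinuousLinearMap.hasFDerivAt _).comp_hasFDerivWithinAt y h3).congr (fun x' hx' => ?_) ?_
    · rw [H.p_eq hx hx']; rfl
    · rw [H.p_eq hx hy]; rfl
  have e1 : Aw n c U V x y = _ := hq.fderivWithin (H.udU x hx)
  have e2 : Aw n (fun y x => c x y) V U y x = _ := hp.fderivWithin (H.udV y hy)
  rw [ContinuousLinearMap.eq_adjoint_iff]
  intro a b
  rw [e1, e2, real_inner_comm _ a]
  simp only [ContinuousLinearMap.comp_apply, neg_apply,
    ContinuousLinearMap.flip_apply, ContinuousLinearMap.compL_apply, inner_neg_left, inner_rz,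
    ContinuousLinearMap.inl_apply, ContinuousLinearMap.inr_apply]
  rw [hsym]

theorem adj_inj {L : Euc n →L[ℝ] Euc n} (h : Function.Injective L) :
    Function.Injective (ContinuousLinearMap.adjoint L) := by
  intro a b hab
  have hl : ContinuousLinearMap.adjoint L.inverse ∘L ContinuousLinearMap.adjoint L = ContinuousLinearMap.id ℝ _ := by
    rw [← ContinuousLinearMap.adjoint_comp]
    have : L ∘L L.inverse = ContinuousLinearMap.id ℝ _ := by ext v; simp [inverse_right h]
    rw [this, ContinuousLinearMap.adjoint_id]
  have h1 := congrArg (fun T : Euc n →L[ℝ] Euc n => T a) hl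
  have h2 := congrArg (fun T : Euc n →L[ℝ] Euc n => T b) hl
  simp only [ContinuousLinearMap.comp_apply, ContinuousLinearMap.id_apply] at h1 h2
  rw [← h1, ← h2, hab]

theorem Hyp.q_inj (H : Hyp n c U V) {y : Euc n} (hy : y ∈ closure V) :
    InjOn (fun x => qw n c V x y) (closure U) := by
  intro a ha b hb hab
  refine (H.b1.1 y hy).1 ha hb ?_
  simp only [H.gradY_eq ha hy, H.gradY_eq hb hy, neg_neg]
  exact hab

theorem Hyp.q_cl (H : Hyp n c U V) {y : Euc n} (hy : y ∈ closure V) :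
    (fun x => qw n c V x y) '' closure U = closure (Uyset n c U y) := by
  rw [H.img hy subset_rfl]; exact (H.geo hy).2.2.1

theorem Hyp.q_conv (H : Hyp n c U V) {y : Euc n} (hy : y ∈ closure V) :
    Convex ℝ ((fun x => qw n c V x y) '' closure U) := by
  rw [H.q_cl hy]; exact (H.b2.1 y hy).closure

theorem Hyp.q_str (H : Hyp n c U V) {y : Euc n} (hy : y ∈ closure V) :
    ∃ R : ℝ, 0 < R ∧ ∀ a ∈ (fun x => qw n c V x y) '' closure U,
    ∀ b ∈ (fun x => qw n c V x y) '' closure U, ∀ v : Euc n, ‖v‖ ≤ ‖a - b‖ ^ 2 / R →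
      (1 / 2 : ℝ) • (a + b) + v ∈ (fun x => qw n c V x y) '' closure U := by
  rw [H.q_cl hy]; exact strong_mid (H.b2s.1 y hy)

theorem Hyp.q_int (H : Hyp n c U V) {y : Euc n} (hy : y ∈ closure V) :
    interior ((fun x => qw n c V x y) '' closure U) = (fun x => qw n c V x y) '' U := by
  rw [H.img hy subset_rfl, H.img hy subset_closure]; exact (H.geo hy).2.2.2.1

theorem Hyp.pkg (H : Hyp n c U V) :
    Pkg0 n c U V (fun x y => qw n (fun y x => c x y) U y x) (qw n c V) (Aw n c U V) where
  oU := H.b0.1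
  oV := H.b0.2.2.1
  bU := H.b0.2.1
  bV := H.b0.2.2.2.1
  neU := H.neU
  neV := H.neV
  cc := H.b0.2.2.2.2.continuousOn
  pc := uncurry_flip_cont H.swap.qC3.continuousOn
  qc := H.qC3.continuousOn
  Ac := H.AC2.continuousOn
  c_x := fun x hx y hy => (H.swap.c_y hy (subset_closure hx)).hasFDerivAt
    (mem_of_superset (H.b0.1.mem_nhds hx) subset_closure)
  c_y := fun x hx y hy => (H.c_y hx (subset_closure hy)).hasFDerivAt
    (mem_of_superset (H.b0.2.2.1.mem_nhds hy) subset_closure)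
  q_x := fun x hx y hy => H.q_x hx hy
  p_y := fun x hx y hy => by
    rw [← H.adj hx hy]; exact H.swap.q_x hy hx
  A_inv := fun x hx y hy => H.A_inv hx hy
  At_inv := fun x hx y hy => adj_inj (H.A_inv hx hy)
  q_inj := fun y hy => H.q_inj hy
  p_inj := fun x hx => H.swap.q_inj hx
  q_conv := fun y hy => H.q_conv hy
  p_conv := fun x hx => H.swap.q_conv hx
  q_str := fun y hy => H.q_str hy
  p_str := fun x hx => H.swap.q_str hx
  q_int := fun y hy => H.q_int hy
  p_int := fun x hx => H.swap.q_int hx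

end
end FKM

open Set MeasureTheory Metric Bornology
open scoped ENNReal NNReal Pointwise

namespace FKM
open Filter Topology

section
variable {n : ℕ} {c : Euc n → Euc n → ℝ} {U V : Set (Euc n)}

theorem Hyp.Dxy (H : Hyp n c U V) {x y : Euc n} (hx : x ∈ U) (hy : y ∈ V) :
    DxyC n c x y = -Aw n c U V x y := by
  have h1 := (H.q_x (subset_closure hx) (subset_closure hy)).neg.hasFDerivAt
    (mem_of_superset (H.b0.1.mem_nhds hx) subset_closure)
  have h2 : HasFDerivAt (fun x' => gradY n c x' y) (-Aw n c U V x y) x := by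
    refine h1.congr_of_eventuallyEq ?_
    filter_upwards [H.b0.1.mem_nhds hx] with x' hx'
    exact H.gradY_eq (subset_closure hx') (subset_closure hy)
  exact h2.fderiv

theorem det_neg_abs (L : Euc n →L[ℝ] Euc n) :
    |LinearMap.det ((-L : Euc n →L[ℝ] Euc n) : Euc n →ₗ[ℝ] Euc n)| = |L.det| := by
  have : ((-L : Euc n →L[ℝ] Euc n) : Euc n →ₗ[ℝ] Euc n) = (-1 : ℝ) • (L : Euc n →ₗ[ℝ] Euc n) := by
    ext; simp
  rw [this, LinearMap.det_smul, abs_mul, abs_pow]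
  simp [ContinuousLinearMap.det]

theorem Hyp.dt (H : Hyp n c U V) :
    0 < gammaMinus n c U V ∧ Dt U V (Aw n c U V) (1 / gammaMinus n c U V) (gammaPlus n c U V) := by
  have P := H.pkg
  have hcont : ContinuousOn (fun z : Euc n × Euc n => |(Aw n c U V z.1 z.2).det|)
      (closure U ×ˢ closure V) := by
    have h1 : ContinuousOn (fun z : Euc n × Euc n => Aw n c U V z.1 z.2) (closure U ×ˢ closure V) :=
      H.AC2.continuousOn
    exact (det_cont.comp_continuousOn h1).abs
  have hpos : ∀ z ∈ closure U ×ˢ closure V, 0 < |(Aw n c U V z.1 z.2).det| := by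
    rintro ⟨x, y⟩ ⟨hx, hy⟩
    exact abs_pos.2 (det_ne (H.A_inv hx hy))
  have hcont' : ContinuousOn (fun z : Euc n × Euc n => |(Aw n c U V z.1 z.2).det|⁻¹)
      (closure U ×ˢ closure V) := hcont.inv₀ fun z hz => (hpos z hz).ne'
  have hval : ∀ z ∈ U ×ˢ V, |LinearMap.det ((DxyC n c z.1 z.2 : Euc n →L[ℝ] Euc n) : Euc n →ₗ[ℝ] Euc n)|
      = |(Aw n c U V z.1 z.2).det| := by
    rintro ⟨x, y⟩ ⟨hx, hy⟩
    simp only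
    rw [H.Dxy hx hy, det_neg_abs]
  have hsub : U ×ˢ V ⊆ closure U ×ˢ closure V := prod_mono subset_closure subset_closure
  have hcl : closure U ×ˢ closure V = closure (U ×ˢ V) := by rw [closure_prod_eq]
  have b1 : ∀ z ∈ closure U ×ˢ closure V, |(Aw n c U V z.1 z.2).det| ≤ gammaPlus n c U V := by
    have h1 : ∀ z ∈ U ×ˢ V, |(Aw n c U V z.1 z.2).det| ≤ gammaPlus n c U V := by
      intro z hz
      unfold gammaPlus
      rw [image_congr hval]
      refine le_csSup ?_ (mem_image_of_mem _ hz)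
      exact (P.compS.image_of_continuousOn hcont).bddAbove.mono (image_mono hsub)
    intro z hz
    rw [hcl] at hz hcont
    exact le_on_closure h1 hcont continuousOn_const hz
  have b2 : ∀ z ∈ closure U ×ˢ closure V, |(Aw n c U V z.1 z.2).det|⁻¹ ≤ gammaMinus n c U V := by
    have h1 : ∀ z ∈ U ×ˢ V, |(Aw n c U V z.1 z.2).det|⁻¹ ≤ gammaMinus n c U V := by
      intro z hz
      unfold gammaMinus
      rw [image_congr (g := fun z : Euc n × Euc n => |(Aw n c U V z.1 z.2).det|⁻¹)
        (fun z hz => by rw [hval z hz])]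
      refine le_csSup ?_ (mem_image_of_mem _ hz)
      exact (P.compS.image_of_continuousOn hcont').bddAbove.mono (image_mono hsub)
    intro z hz
    rw [hcl] at hz hcont'
    exact le_on_closure h1 hcont' continuousOn_const hz
  obtain ⟨x0, hx0⟩ := H.neU
  obtain ⟨y0, hy0⟩ := H.neV
  have hz0 : (x0, y0) ∈ closure U ×ˢ closure V := ⟨subset_closure hx0, subset_closure hy0⟩
  have hgm : 0 < gammaMinus n c U V := (inv_pos.2 (hpos _ hz0)).trans_le (b2 _ hz0)
  have b3 : ∀ z ∈ closure U ×ˢ closure V, 1 / gammaMinus n c U V ≤ |(Aw n c U V z.1 z.2).det| := by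
    intro z hz
    rw [one_div]
    exact inv_le_of_inv_le₀ (hpos z hz) (b2 z hz)
  exact ⟨hgm, by positivity, (b3 _ hz0).trans (b1 _ hz0),
    fun x hx y hy => ⟨b3 (x, y) ⟨hx, hy⟩, b1 (x, y) ⟨hx, hy⟩⟩⟩

theorem Hyp.pl (H : Hyp n c U V) : ∃ L : ℝ, 0 ≤ L ∧
    ∀ x r, ball x r ⊆ U → ∀ z ∈ ball x r, ∀ z' ∈ ball x r, ∀ y ∈ closure V,
      ‖qw n (fun y x => c x y) U y z - qw n (fun y x => c x y) U y z'‖ ≤ L * ‖z - z'‖ := by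
  have hs := H.swap
  have hc : ContinuousOn (fderivWithin ℝ (Function.uncurry (qw n (fun y x => c x y) U)) (closure V ×ˢ closure U))
      (closure V ×ˢ closure U) := (hs.qC3.fderivWithin (m := 2) hs.udS (by norm_num)).continuousOn
  obtain ⟨L, hL⟩ := hs.pkg.compS.exists_bound_of_continuousOn hc
  refine ⟨max L 0, le_max_right _ _, fun x r hb z hz z' hz' y hy => ?_⟩
  have hb' : ball x r ⊆ closure U := hb.trans subset_closure
  refine (convex_ball x r).norm_image_sub_le_of_norm_hasFDerivWithin_le
    (f := fun z => qw n (fun y x => c x y) U y z)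
    (fun w hw => (part_y hy (hs.dq hy (hb' hw))).mono hb') (fun w hw => ?_) hz' hz
  refine le_max_of_le_left (le_trans ?_ (hL (y, w) ⟨hy, hb' hw⟩))
  refine (ContinuousLinearMap.opNorm_comp_le _ _).trans ?_
  refine mul_le_of_le_one_right (norm_nonneg _) ?_
  exact ContinuousLinearMap.opNorm_le_bound _ zero_le_one (fun v => by simp)

end
end FKM

open Set MeasureTheory Metric Bornology
open scoped ENNReal NNReal Pointwise

namespace FKM
open Filter Topology

section realvar

theorem gron {g g' : ℝ → ℝ} {k a b : ℝ} (hk : 0 ≤ k) (hab : a ≤ b) (hba : b - a ≤ 1)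
    (hg : ∀ s ∈ Icc a b, HasDerivAt g (g' s) s) (hg' : ∀ s ∈ Icc a b, -(k * |g s|) ≤ g' s)
    (ha : 0 < g a) : g a ≤ Real.exp k * g b := by
  have hG : ∀ s ∈ Icc a b, HasDerivAt (fun s => g s * Real.exp (k * s))
      (g' s * Real.exp (k * s) + g s * (Real.exp (k * s) * (k * 1))) s := by
    intro s hs
    exact (hg s hs).mul (((hasDerivAt_id s).const_mul k).exp)
  have mono : ∀ d ∈ Icc a b, (∀ s ∈ Ioo a d, 0 ≤ g s) →
      g a * Real.exp (k * a) ≤ g d * Real.exp (k * d) := by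
    intro d hd hpos
    have hsub : Icc a d ⊆ Icc a b := Icc_subset_Icc_right hd.2
    refine monotoneOn_of_deriv_nonneg (convex_Icc a d)
      (fun s hs => (hG s (hsub hs)).continuousAt.continuousWithinAt)
      (fun s hs => ?_) (fun s hs => ?_) (left_mem_Icc.2 hd.1) (right_mem_Icc.2 hd.1) hd.1
    · rw [interior_Icc] at hs
      exact (hG s (hsub (Ioo_subset_Icc_self hs))).differentiableAt.differentiableWithinAt
    · rw [interior_Icc] at hs
      rw [(hG s (hsub (Ioo_subset_Icc_self hs))).deriv]
      have h1 := hg' s (hsub (Ioo_subset_Icc_self hs))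
      rw [abs_of_nonneg (hpos s hs)] at h1
      have := Real.exp_pos (k * s)
      nlinarith
  have hpos : ∀ s ∈ Icc a b, 0 < g s := by
    by_contra hcon
    push Not at hcon
    obtain ⟨s, hs, hgs⟩ := hcon
    have hcont : ContinuousOn g (Icc a b) := fun s hs => (hg s hs).continuousAt.continuousWithinAt
    have hcl : IsClosed (Icc a b ∩ g ⁻¹' Iic 0) := hcont.preimage_isClosed_of_isClosed isClosed_Icc isClosed_Iic
    have hcomp : IsCompact (Icc a b ∩ g ⁻¹' Iic 0) := isCompact_Icc.of_isClosed_subset hcl inter_subset_left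
    obtain ⟨d, ⟨hd, hgd⟩, hmin⟩ := hcomp.exists_isLeast ⟨s, hs, hgs⟩
    have := mono d hd (fun s hs => by
      by_contra hneg
      push Not at hneg
      have := hmin ⟨⟨hs.1.le, hs.2.le.trans hd.2⟩, hneg.le⟩
      exact absurd hs.2 (not_lt.2 this))
    have h2 : g d * Real.exp (k * d) ≤ 0 := mul_nonpos_of_nonpos_of_nonneg hgd (Real.exp_pos _).le
    have h3 : 0 < g a * Real.exp (k * a) := by positivity
    linarith
  have h := mono b (right_mem_Icc.2 hab) (fun s hs => (hpos s (Ioo_subset_Icc_self hs)).le)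
  have h2 : g a ≤ g b * Real.exp (k * (b - a)) := by
    rw [show k * (b - a) = k * b - k * a by ring, Real.exp_sub, ← mul_div_assoc, le_div_iff₀ (Real.exp_pos _)]
    exact h
  have h3 : Real.exp (k * (b - a)) ≤ Real.exp k := by
    apply Real.exp_le_exp.2; nlinarith
  have := hpos b (right_mem_Icc.2 hab)
  nlinarith

theorem qq_real {f g g' : ℝ → ℝ} {k t : ℝ} (hk : 0 ≤ k)
    (hf : ∀ s ∈ Icc (0:ℝ) 1, HasDerivAt f (g s) s)
    (hg : ∀ s ∈ Icc (0:ℝ) 1, HasDerivAt g (g' s) s)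
    (hg' : ∀ s ∈ Icc (0:ℝ) 1, -(k * |g s|) ≤ g' s) (ht0 : 0 < t) (ht1 : t < 1) (hlt : f 0 < f t) :
    (1 - t) * (f t - f 0) ≤ Real.exp k * t * (f 1 - f t) := by
  have hc : ∀ a b, 0 ≤ a → b ≤ 1 → ContinuousOn f (Icc a b) := fun a b ha hb s hs =>
    (hf s ⟨ha.trans hs.1, hs.2.trans hb⟩).continuousAt.continuousWithinAt
  obtain ⟨s1, hs1, e1⟩ := exists_hasDerivAt_eq_slope f g ht0 (hc 0 t le_rfl ht1.le)
    (fun s hs => hf s ⟨hs.1.le, hs.2.le.trans ht1.le⟩)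
  obtain ⟨s2, hs2, e2⟩ := exists_hasDerivAt_eq_slope f g ht1 (hc t 1 ht0.le le_rfl)
    (fun s hs => hf s ⟨ht0.le.trans hs.1.le, hs.2.le⟩)
  have hsub : Icc s1 s2 ⊆ Icc 0 1 := Icc_subset_Icc hs1.1.le hs2.2.le
  have e1' : f t - f 0 = t * g s1 := by rw [e1, sub_zero]; field_simp
  have ht1' : 1 - t ≠ 0 := by linarith
  have e2' : f 1 - f t = (1 - t) * g s2 := by rw [e2]; field_simp
  have hp : 0 < g s1 := by
    rw [e1]; apply div_pos <;> linarith
  have := gron hk (hs1.2.le.trans hs2.1.le) (by linarith [hs1.1, hs2.2])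
    (fun s hs => hg s (hsub hs)) (fun s hs => hg' s (hsub hs)) hp
  rw [e1', e2']
  have h3 : 0 < (1 - t) * t := mul_pos (by linarith) ht0
  nlinarith

theorem taylor_real {f g h : ℝ → ℝ} {κ : ℝ}
    (hf : ∀ s ∈ Icc (0:ℝ) 1, HasDerivAt f (g s) s)
    (hg : ∀ s ∈ Icc (0:ℝ) 1, HasDerivAt g (h s) s) (hκ : 0 ≤ κ)
    (hh : ∀ s ∈ Icc (0:ℝ) 1, -κ ≤ h s) (h0 : g 0 = 0) : -κ ≤ f 1 - f 0 := by
  obtain ⟨s, hs, e⟩ := exists_hasDerivAt_eq_slope f g zero_lt_one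
    (fun s hs => (hf s hs).continuousAt.continuousWithinAt)
    (fun s hs => hf s (Ioo_subset_Icc_self hs))
  obtain ⟨r, hr, e'⟩ := exists_hasDerivAt_eq_slope g h hs.1
    (fun r hr => (hg r ⟨hr.1, hr.2.trans hs.2.le⟩).continuousAt.continuousWithinAt)
    (fun r hr => hg r ⟨hr.1.le, hr.2.le.trans hs.2.le⟩)
  have h1 := hh r ⟨hr.1.le, hr.2.le.trans hs.2.le⟩
  rw [h0, sub_zero, sub_zero] at e'
  have h2 : g s = s * h r := by rw [e']; field_simp [hs.1.ne']
  have h3 : f 1 - f 0 = g s := by rw [e]; simp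
  rw [h3, h2]
  nlinarith [hs.1, hs.2]

/-- partial derivatives on `ℝ × ℝ` -/
noncomputable def ds (F : ℝ × ℝ → ℝ) (z : ℝ × ℝ) : ℝ := deriv (fun s => F (s, z.2)) z.1
noncomputable def dt (F : ℝ × ℝ → ℝ) (z : ℝ × ℝ) : ℝ := deriv (fun t => F (z.1, t)) z.2

theorem ds_eq {F : ℝ × ℝ → ℝ} {z : ℝ × ℝ} (h : DifferentiableAt ℝ F z) :
    ds F z = fderiv ℝ F z (1, 0) := by
  have h1 : HasDerivAt (fun s : ℝ => (s, z.2)) ((1 : ℝ), (0 : ℝ)) z.1 :=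
    (hasDerivAt_id z.1).prodMk (hasDerivAt_const z.1 z.2)
  exact (HasFDerivAt.comp_hasDerivAt (f := fun s : ℝ => (s, z.2)) (l := F) z.1 h.hasFDerivAt h1).deriv

theorem dt_eq {F : ℝ × ℝ → ℝ} {z : ℝ × ℝ} (h : DifferentiableAt ℝ F z) :
    dt F z = fderiv ℝ F z (0, 1) := by
  have h1 : HasDerivAt (fun s : ℝ => (z.1, s)) ((0 : ℝ), (1 : ℝ)) z.2 :=
    (hasDerivAt_const z.2 z.1).prodMk (hasDerivAt_id z.2)
  exact (HasFDerivAt.comp_hasDerivAt (f := fun s : ℝ => (z.1, s)) (l := F) z.2 h.hasFDerivAt h1).deriv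

theorem ds_congr {F G : ℝ × ℝ → ℝ} {O : Set (ℝ × ℝ)} (hO : IsOpen O) (h : EqOn F G O) :
    EqOn (ds F) (ds G) O := by
  intro z hz
  refine Filter.EventuallyEq.deriv_eq ?_
  have : ContinuousAt (fun s : ℝ => (s, z.2)) z.1 := by fun_prop
  filter_upwards [this.preimage_mem_nhds (hO.mem_nhds hz)] with s hs
  exact h hs

theorem dt_congr {F G : ℝ × ℝ → ℝ} {O : Set (ℝ × ℝ)} (hO : IsOpen O) (h : EqOn F G O) :
    EqOn (dt F) (dt G) O := by
  intro z hz
  refine Filter.EventuallyEq.deriv_eq ?_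
  have : ContinuousAt (fun s : ℝ => (z.1, s)) z.2 := by fun_prop
  filter_upwards [this.preimage_mem_nhds (hO.mem_nhds hz)] with s hs
  exact h hs

theorem dsdt {F : ℝ × ℝ → ℝ} {O : Set (ℝ × ℝ)} (hO : IsOpen O) (h : ContDiffOn ℝ 2 F O) :
    EqOn (ds (dt F)) (dt (ds F)) O := by
  intro z hz
  have hd : ∀ w ∈ O, DifferentiableAt ℝ F w := fun w hw =>
    (h.differentiableOn (by norm_num)).differentiableAt (hO.mem_nhds hw)
  have h1 : EqOn (dt F) (fun w => fderiv ℝ F w (0, 1)) O := fun w hw => dt_eq (hd w hw)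
  have h2 : EqOn (ds F) (fun w => fderiv ℝ F w (1, 0)) O := fun w hw => ds_eq (hd w hw)
  rw [ds_congr hO h1 hz, dt_congr hO h2 hz]
  have hc : ContDiffAt ℝ 2 F z := h.contDiffAt (hO.mem_nhds hz)
  have hD : DifferentiableAt ℝ (fderiv ℝ F) z :=
    ((hc.fderiv_right (m := 1) (by norm_num)).differentiableAt (by norm_num))
  have e : ∀ v : ℝ × ℝ, HasFDerivAt (fun w => fderiv ℝ F w v) ((fderiv ℝ (fderiv ℝ F) z).flip v) z := by
    intro v
    have := (ContinuousLinearMap.apply ℝ ℝ v).hasFDerivAt.comp z hD.hasFDerivAt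
    exact this
  rw [ds_eq (e _).differentiableAt, dt_eq (e _).differentiableAt, (e _).fderiv, (e _).fderiv]
  exact (hc.isSymmSndFDerivAt (by simp)) _ _

theorem cross_swap {F : ℝ × ℝ → ℝ} {O : Set (ℝ × ℝ)} (hO : IsOpen O) (h : ContDiffOn ℝ 2 F O)
    (hs : ContDiffOn ℝ 2 (ds F) O) (ht : ContDiffOn ℝ 2 (dt F) O)
    (hst : ContDiffOn ℝ 2 (ds (dt F)) O) :
    EqOn (ds (ds (dt (dt F)))) (dt (dt (ds (ds F)))) O := by
  intro z hz
  rw [ds_congr hO (dsdt hO ht) hz, dsdt hO hst hz]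
  refine dt_congr hO ?_ hz
  intro w hw
  rw [ds_congr hO (dsdt hO h) hw, dsdt hO hs hw]

end realvar
end FKM

open Set MeasureTheory Metric Bornology
open scoped ENNReal NNReal Pointwise

namespace FKM
open Filter Topology

section
variable {n : ℕ} {c : Euc n → Euc n → ℝ} {U V : Set (Euc n)}

/-- `-D_y q` -/
noncomputable def Ly (n : ℕ) (c : Euc n → Euc n → ℝ) (U V : Set (Euc n)) (x y : Euc n) :
    Euc n →L[ℝ] Euc n :=
  -(fderivWithin ℝ (Function.uncurry (qw n c V)) (closure U ×ˢ closure V) (x, y) ∘L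
      ContinuousLinearMap.inr ℝ _ _)

/-- derivative in `q` coordinates -/
noncomputable def Dq {F : Type*} [NormedAddCommGroup F] [NormedSpace ℝ F] (n : ℕ)
    (c : Euc n → Euc n → ℝ) (U V : Set (Euc n)) (f : Euc n → Euc n → F) (x y : Euc n) :
    Euc n →L[ℝ] F :=
  (fderivWithin ℝ (Function.uncurry f) (closure U ×ˢ closure V) (x, y) ∘L
      ContinuousLinearMap.inl ℝ _ _) ∘L Ai (Aw n c U V) x y

/-- first derivative of `Ly` in `q` coordinates -/
noncomputable def Jt (n : ℕ) (c : Euc n → Euc n → ℝ) (U V : Set (Euc n)) (x y : Euc n) :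
    Euc n →L[ℝ] Euc n →L[ℝ] Euc n := Dq n c U V (Ly n c U V) x y

/-- second derivative of `Ly` in `q` coordinates -/
noncomputable def Tt (n : ℕ) (c : Euc n → Euc n → ℝ) (U V : Set (Euc n)) (x y w : Euc n) :
    Euc n →L[ℝ] Euc n →L[ℝ] Euc n := Dq n c U V (Jt n c U V) x y w

theorem Hyp.AiC2 (H : Hyp n c U V) :
    ContDiffOn ℝ 2 (Function.uncurry (Ai (Aw n c U V))) (closure U ×ˢ closure V) := by
  rintro ⟨x, y⟩ ⟨hx, hy⟩
  obtain ⟨e, he⟩ := exists_equiv (H.A_inv hx hy)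
  have h1 : ContDiffAt ℝ 2 (ContinuousLinearMap.inverse : (Euc n →L[ℝ] Euc n) → _)
      (Function.uncurry (Aw n c U V) (x, y)) := by
    have : Function.uncurry (Aw n c U V) (x, y) = e := he.symm
    rw [this]; exact contDiffAt_map_inverse e
  exact h1.comp_contDiffWithinAt (x, y) (H.AC2 (x, y) ⟨hx, hy⟩)

theorem Hyp.LyC2 (H : Hyp n c U V) :
    ContDiffOn ℝ 2 (Function.uncurry (Ly n c U V)) (closure U ×ˢ closure V) := by
  have h1 : ContDiffOn ℝ 2 (fderivWithin ℝ (Function.uncurry (qw n c V)) (closure U ×ˢ closure V))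
      (closure U ×ˢ closure V) := H.qC3.fderivWithin H.udS (by norm_num)
  exact (h1.clm_comp (contDiffOn_const (c := ContinuousLinearMap.inr ℝ (Euc n) (Euc n)))).neg

theorem Hyp.DqC (H : Hyp n c U V) {F : Type*} [NormedAddCommGroup F] [NormedSpace ℝ F]
    {f : Euc n → Euc n → F} {m k : ℕ} (hm : m ≤ 2) (hk : m + 1 = k)
    (hf : ContDiffOn ℝ k (Function.uncurry f) (closure U ×ˢ closure V)) :
    ContDiffOn ℝ m (Function.uncurry (Dq n c U V f)) (closure U ×ˢ closure V) := by
  have h1 : ContDiffOn ℝ m (fderivWithin ℝ (Function.uncurry f) (closure U ×ˢ closure V))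
      (closure U ×ˢ closure V) := hf.fderivWithin H.udS (by exact_mod_cast hk.le)
  exact (h1.clm_comp (contDiffOn_const (c := ContinuousLinearMap.inl ℝ (Euc n) (Euc n)))).clm_comp
    (H.AiC2.of_le (by exact_mod_cast hm))

theorem Hyp.Dq_bd (H : Hyp n c U V) {F : Type*} [NormedAddCommGroup F] [NormedSpace ℝ F]
    {f : Euc n → Euc n → F} 
    (hf : ContDiffOn ℝ 1 (Function.uncurry f) (closure U ×ˢ closure V)) :
    ∃ C : ℝ, 0 ≤ C ∧ ∀ x ∈ closure U, ∀ y ∈ closure V, ∀ w, ‖Dq n c U V f x y w‖ ≤ C * ‖w‖ := by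
  obtain ⟨C, hC⟩ := H.pkg.compS.exists_bound_of_continuousOn
    (H.DqC (m := 0) (k := 1) (by norm_num) rfl (by exact_mod_cast hf)).continuousOn
  refine ⟨max C 0, le_max_right _ _, fun x hx y hy w => ?_⟩
  refine (ContinuousLinearMap.le_opNorm _ _).trans ?_
  gcongr
  exact (hC (x, y) ⟨hx, hy⟩).trans (le_max_left _ _)

theorem Hyp.JtC1 (H : Hyp n c U V) :
    ContDiffOn ℝ 1 (Function.uncurry (Jt n c U V)) (closure U ×ˢ closure V) := 
  H.DqC (m := 1) (k := 2) (by norm_num) rfl (by exact_mod_cast H.LyC2)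

theorem Hyp.Tt_bd (H : Hyp n c U V) : ∃ C : ℝ, 0 ≤ C ∧ ∀ x ∈ closure U, ∀ y ∈ closure V,
    ∀ w, ‖Tt n c U V x y w‖ ≤ C * ‖w‖ := H.Dq_bd H.JtC1

theorem Hyp.Tt_bd4 (H : Hyp n c U V) : ∃ C : ℝ, 0 ≤ C ∧ ∀ x ∈ closure U, ∀ y ∈ closure V,
    ∀ w w' η η', |inner ℝ (Tt n c U V x y w w' η) η'| ≤ C * ‖w‖ * ‖w'‖ * ‖η‖ * ‖η'‖ := by
  obtain ⟨C, h0, hC⟩ := H.Tt_bd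
  refine ⟨C, h0, fun x hx y hy w w' η η' => ?_⟩
  refine (abs_real_inner_le_norm _ _).trans ?_
  gcongr
  refine (ContinuousLinearMap.le_opNorm _ _).trans ?_
  gcongr
  refine (ContinuousLinearMap.le_opNorm _ _).trans ?_
  gcongr
  exact hC x hx y hy w

theorem Hyp.sym (H : Hyp n c U V) {x y : Euc n} (hx : x ∈ closure U) (hy : y ∈ closure V)
    (ξ η : Euc n) :
    fderivWithin ℝ (Function.uncurry (Ly n c U V)) (closure U ×ˢ closure V) (x, y) (ξ, 0) η =
    -(fderivWithin ℝ (Function.uncurry (Aw n c U V)) (closure U ×ˢ closure V) (x, y) (0, η) ξ) := by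
  set S := closure U ×ˢ closure V with hS
  have hz : (x, y) ∈ S := ⟨hx, hy⟩
  have hsym : IsSymmSndFDerivWithinAt ℝ (Function.uncurry (qw n c V)) S (x, y) := by
    refine (H.qC3 (x, y) hz).isSymmSndFDerivWithinAt (by simp; norm_num) H.udS ?_ hz
    have : U ×ˢ V ⊆ interior S :=
      (H.b0.1.prod H.b0.2.2.1).subset_interior_iff.2 (prod_mono subset_closure subset_closure)
    refine closure_mono this ?_
    rw [closure_prod_eq]; exact hz
  have h1 : ContDiffOn ℝ 2 (fderivWithin ℝ (Function.uncurry (qw n c V)) S) S :=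
    H.qC3.fderivWithin H.udS (by norm_num)
  have h2 := (h1.differentiableOn (by norm_num) (x, y) hz).hasFDerivWithinAt
  set D2 := fderivWithin ℝ (fderivWithin ℝ (Function.uncurry (qw n c V)) S) S (x, y) with hD2
  have hL : HasFDerivWithinAt (Function.uncurry (Ly n c U V))
      ((-((ContinuousLinearMap.compL ℝ (Euc n) (Euc n × Euc n) (Euc n)).flip
        (ContinuousLinearMap.inr ℝ _ _))) ∘L D2) S (x, y) := by
    refine ((ContinuousLinearMap.hasFDerivAt _).comp_hasFDerivWithinAt (x, y) h2).congr ?_ ?_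
    · rintro ⟨a, b⟩ ⟨ha, hb⟩; rfl
    · rfl
  have hA : HasFDerivWithinAt (Function.uncurry (Aw n c U V))
      ((((ContinuousLinearMap.compL ℝ (Euc n) (Euc n × Euc n) (Euc n)).flip
        (ContinuousLinearMap.inl ℝ _ _))) ∘L D2) S (x, y) := by
    refine ((ContinuousLinearMap.hasFDerivAt _).comp_hasFDerivWithinAt (x, y) h2).congr ?_ ?_
    · rintro ⟨a, b⟩ ⟨ha, hb⟩; exact H.A_eq ha hb
    · exact H.A_eq hx hy
  rw [hL.fderivWithin (H.udS _ hz), hA.fderivWithin (H.udS _ hz)]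
  simp only [ContinuousLinearMap.comp_apply, neg_apply,
    ContinuousLinearMap.flip_apply, ContinuousLinearMap.compL_apply, 
    ContinuousLinearMap.inl_apply, ContinuousLinearMap.inr_apply]
  rw [hsym]

theorem Hyp.XiU (H : Hyp n c U V) {y a : Euc n} (hy : y ∈ closure V)
    (ha : a ∈ (fun x => qw n c V x y) '' U) : Xi (qw n c V) U y a ∈ U ∧ qw n c V (Xi (qw n c V) U y a) y = a := by
  obtain ⟨x, hx, rfl⟩ := ha
  simp only
  rw [H.pkg.Xi_q (subset_closure hx) hy]
  exact ⟨hx, rfl⟩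

theorem Hyp.qU_open (H : Hyp n c U V) {y : Euc n} (hy : y ∈ closure V) :
    IsOpen ((fun x => qw n c V x y) '' U) := by
  rw [H.img hy subset_closure]; exact (H.geo hy).2.1

theorem Hyp.qU_conv (H : Hyp n c U V) {y : Euc n} (hy : y ∈ closure V) :
    Convex ℝ ((fun x => qw n c V x y) '' U) := by
  rw [H.img hy subset_closure]; exact H.b2.1 y hy

theorem Hyp.X_deriv (H : Hyp n c U V) {y a w : Euc n} (hy : y ∈ closure V) {s : ℝ}
    (ha : a + s • w ∈ (fun x => qw n c V x y) '' U) :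
    HasDerivAt (fun s : ℝ => Xi (qw n c V) U y (a + s • w))
      (Ai (Aw n c U V) (Xi (qw n c V) U y (a + s • w)) y w) s := by
  have h1 := (H.pkg.Xi_deriv hy (image_mono subset_closure ha)).hasFDerivAt
    (mem_of_superset ((H.qU_open hy).mem_nhds ha) (image_mono subset_closure))
  have h2 : HasDerivAt (fun s : ℝ => a + s • w) w s := by
    simpa using ((hasDerivAt_id s).smul_const w).const_add a
  exact h1.comp_hasDerivAt s h2

theorem part_x_at {F : Type*} [NormedAddCommGroup F] [NormedSpace ℝ F] {f : Euc n → Euc n → F}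
    (oU : IsOpen U) (h : DifferentiableOn ℝ (Function.uncurry f) (closure U ×ˢ closure V))
    {x y : Euc n} (hx : x ∈ U) (hy : y ∈ closure V) :
    HasFDerivAt (fun x' => f x' y)
      (fderivWithin ℝ (Function.uncurry f) (closure U ×ˢ closure V) (x, y) ∘L
        ContinuousLinearMap.inl ℝ _ _) x :=
  (part_x hy (h (x, y) ⟨subset_closure hx, hy⟩).hasFDerivWithinAt).hasFDerivAt
    (mem_of_superset (oU.mem_nhds hx) subset_closure)

theorem part_y_at {F : Type*} [NormedAddCommGroup F] [NormedSpace ℝ F] {f : Euc n → Euc n → F}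
    (oV : IsOpen V) (h : DifferentiableOn ℝ (Function.uncurry f) (closure U ×ˢ closure V))
    {x y : Euc n} (hx : x ∈ closure U) (hy : y ∈ V) :
    HasFDerivAt (fun y' => f x y')
      (fderivWithin ℝ (Function.uncurry f) (closure U ×ˢ closure V) (x, y) ∘L
        ContinuousLinearMap.inr ℝ _ _) y :=
  (part_y hx (h (x, y) ⟨hx, subset_closure hy⟩).hasFDerivWithinAt).hasFDerivAt
    (mem_of_superset (oV.mem_nhds hy) subset_closure)

theorem Hyp.DqX (H : Hyp n c U V) {F : Type*} [NormedAddCommGroup F] [NormedSpace ℝ F]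
    {f : Euc n → Euc n → F} 
    (hf : ContDiffOn ℝ 1 (Function.uncurry f) (closure U ×ˢ closure V))
    {y a w : Euc n} (hy : y ∈ closure V) {s : ℝ}
    (ha : a + s • w ∈ (fun x => qw n c V x y) '' U) :
    HasDerivAt (fun s : ℝ => f (Xi (qw n c V) U y (a + s • w)) y)
      (Dq n c U V f (Xi (qw n c V) U y (a + s • w)) y w) s := by
  have h1 := part_x_at (V := V) (f := f) H.b0.1 (hf.differentiableOn (by norm_num)) (H.XiU hy ha).1 hy
  exact HasFDerivAt.comp_hasDerivAt s h1 (H.X_deriv hy ha)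

theorem Hyp.LyX (H : Hyp n c U V) {y a w : Euc n} (hy : y ∈ closure V) {s : ℝ}
    (ha : a + s • w ∈ (fun x => qw n c V x y) '' U) :
    HasDerivAt (fun s : ℝ => Ly n c U V (Xi (qw n c V) U y (a + s • w)) y)
      (Jt n c U V (Xi (qw n c V) U y (a + s • w)) y w) s :=
  H.DqX (H.LyC2.of_le (by norm_num)) hy ha

theorem Hyp.JtX (H : Hyp n c U V) {y a w : Euc n} (hy : y ∈ closure V) {s : ℝ}
    (ha : a + s • w ∈ (fun x => qw n c V x y) '' U) :
    HasDerivAt (fun s : ℝ => Jt n c U V (Xi (qw n c V) U y (a + s • w)) y)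
      (Tt n c U V (Xi (qw n c V) U y (a + s • w)) y w) s :=
  H.DqX H.JtC1 hy ha

/-- first derivative of the cost along a curve -/
theorem Hyp.cY (H : Hyp n c U V) {x : Euc n} (hx : x ∈ closure U) {Y : ℝ → Euc n} {Y1 : Euc n} {t : ℝ}
    (hY : Y t ∈ V) (h : HasDerivAt Y Y1 t) :
    HasDerivAt (fun t => c x (Y t)) (-(inner ℝ (qw n c V x (Y t)) Y1)) t := by
  have := (H.pkg.c_y x hx (Y t) hY).comp_hasDerivAt t h
  exact this

theorem Hyp.qY (H : Hyp n c U V) {x : Euc n} (hx : x ∈ closure U) {Y Y1 : ℝ → Euc n} {Y2 : Euc n} {t : ℝ}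
    (hY : Y t ∈ V) (h : HasDerivAt Y (Y1 t) t) (h1 : HasDerivAt Y1 Y2 t) :
    HasDerivAt (fun t => -(inner ℝ (qw n c V x (Y t)) (Y1 t)))
      (inner ℝ (Ly n c U V x (Y t) (Y1 t)) (Y1 t) - inner ℝ (qw n c V x (Y t)) Y2) t := by
  have h2 := (part_y_at H.b0.2.2.1 (H.qC3.differentiableOn (by norm_num)) hx hY).comp_hasDerivAt t h
  have h3 := (h2.inner ℝ h1).neg
  refine h3.congr_deriv ?_
  simp only [Function.comp, Ly, neg_apply, inner_neg_left]
  ring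

/-- second derivative of the cost along a curve, frozen style -/
theorem Hyp.cY2 (H : Hyp n c U V) {x : Euc n} (hx : x ∈ closure U) {Y Y1 : ℝ → Euc n} {Y2 : Euc n} {t0 : ℝ}
    (h : ∀ᶠ t in 𝓝 t0, Y t ∈ V ∧ HasDerivAt Y (Y1 t) t) (h1 : HasDerivAt Y1 Y2 t0) :
    deriv (deriv (fun t => c x (Y t))) t0 =
      inner ℝ (Ly n c U V x (Y t0) (Y1 t0)) (Y1 t0) - inner ℝ (qw n c V x (Y t0)) Y2 := by
  have e : deriv (fun t => c x (Y t)) =ᶠ[𝓝 t0] fun t => -(inner ℝ (qw n c V x (Y t)) (Y1 t)) := by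
    filter_upwards [h] with t ht
    exact (H.cY hx ht.1 ht.2).deriv
  rw [e.deriv_eq]
  exact (H.qY hx h.self_of_nhds.1 h.self_of_nhds.2 h1).deriv

end
end FKM

open Set MeasureTheory Metric Bornology
open scoped ENNReal NNReal Pointwise

namespace FKM
open Filter Topology

section
variable {n : ℕ} {c : Euc n → Euc n → ℝ} {U V : Set (Euc n)} {p q : Euc n → Euc n → Euc n}
  {A : Euc n → Euc n → Euc n →L[ℝ] Euc n}

/-- forward Lipschitz bound -/
theorem Pkg0.fwdX (P : Pkg0 n c U V p q A) : ∃ L : ℝ, 0 < L ∧ ∀ y ∈ closure V, ∀ x ∈ closure U,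
    ∀ x' ∈ closure U, ‖q x y - q x' y‖ ≤ L * ‖x - x'‖ := by
  obtain ⟨B, hB, hb⟩ := P.Ai_bound
  obtain ⟨L0, hL0, hl⟩ := P.lipX
  have uc := P.compS.uniformContinuousOn_of_continuous P.Ai_cont
  obtain ⟨δ, hδ, h1⟩ := Metric.uniformContinuousOn_iff.1 uc (1 / (2 * B)) (by positivity)
  have uq := P.compS.uniformContinuousOn_of_continuous P.qc
  obtain ⟨δ2, hδ2, h2⟩ := Metric.uniformContinuousOn_iff.1 uq (δ / L0) (by positivity)
  obtain ⟨M, hM⟩ := P.compS.exists_bound_of_continuousOn P.qc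
  refine ⟨2 * B + 2 * |M| / δ2, by positivity, fun y hy x' hx' x hx => ?_⟩
  by_cases hr : ‖q x' y - q x y‖ < δ / L0
  · set a := q x y with ha
    set a' := q x' y with ha'
    have hmv := Convex.norm_image_sub_le_of_norm_hasFDerivWithin_le' (f := Xi q U y)
      (s := (fun x => q x y) '' closure U ∩ ball a (δ / L0)) (C := 1 / (2 * B))
      (φ := Ai A x y) (f' := fun b => Ai A (Xi q U y b) y) (x := a) (y := a')
      (fun b hb => (P.Xi_deriv hy hb.1).mono inter_subset_left) ?_
      ((P.q_conv y hy).inter (convex_ball _ _))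
      ⟨mem_image_of_mem _ hx, mem_ball_self (by positivity)⟩
      ⟨mem_image_of_mem _ hx', by rwa [mem_ball_iff_norm]⟩
    · rw [ha, ha', P.Xi_q hx hy, P.Xi_q hx' hy, ← ha, ← ha'] at hmv
      have e : a' - a = A x y (Ai A x y (a' - a)) := (P.Ai_right hx hy _).symm
      have h3 : ‖a' - a‖ ≤ B * ‖Ai A x y (a' - a)‖ := by
        nth_rewrite 1 [e]
        refine (ContinuousLinearMap.le_opNorm _ _).trans ?_
        gcongr
        exact (hb x hx y hy).1
      have h4 : ‖Ai A x y (a' - a)‖ ≤ ‖x' - x‖ + 1 / (2 * B) * ‖a' - a‖ := by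
        have := norm_sub_le (x' - x) (x' - x - Ai A x y (a' - a))
        rw [sub_sub_cancel] at this
        linarith
      have h5 : B * (‖x' - x‖ + 1 / (2 * B) * ‖a' - a‖) = B * ‖x' - x‖ + ‖a' - a‖ / 2 := by
        field_simp
      have h6 : ‖a' - a‖ ≤ 2 * B * ‖x' - x‖ := by nlinarith [mul_le_mul_of_nonneg_left h4 hB.le]
      refine h6.trans ?_
      gcongr
      have : 0 ≤ 2 * |M| / δ2 := by positivity
      linarith
    · rintro b ⟨hb1, hb2⟩
      rw [← dist_eq_norm]
      refine (h1 (Xi q U y b, y) ⟨Xi_mem hb1, hy⟩ (x, y) ⟨hx, hy⟩ ?_).le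
      rw [Prod.dist_eq, dist_self]
      refine max_lt ?_ hδ
      rw [dist_eq_norm]
      refine (hl y hy _ (Xi_mem hb1) x hx).trans_lt ?_
      rw [Xi_eq hb1]
      rw [mem_ball_iff_norm] at hb2
      calc L0 * ‖b - a‖ < L0 * (δ / L0) := by gcongr
        _ = δ := by field_simp
  · have h3 : δ2 ≤ ‖x' - x‖ := by
      by_contra h
      push Not at h
      apply hr
      have := h2 (x', y) ⟨hx', hy⟩ (x, y) ⟨hx, hy⟩ (by
        rw [Prod.dist_eq, dist_self, dist_eq_norm]; exact max_lt h hδ2)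
      rwa [dist_eq_norm] at this
    have h4 : ‖q x' y - q x y‖ ≤ 2 * |M| := by
      refine (norm_sub_le _ _).trans ?_
      have a1 := hM (x', y) ⟨hx', hy⟩
      have a2 := hM (x, y) ⟨hx, hy⟩
      simp only [Function.uncurry] at a1 a2
      linarith [le_abs_self M]
    calc _ ≤ 2 * |M| := h4
      _ = 2 * |M| / δ2 * δ2 := by field_simp
      _ ≤ 2 * |M| / δ2 * ‖x' - x‖ := by gcongr
      _ ≤ _ := by gcongr; linarith

theorem Pkg0.fwdY (P : Pkg0 n c U V p q A) : ∃ L : ℝ, 0 < L ∧ ∀ x ∈ closure U, ∀ y ∈ closure V,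
    ∀ y' ∈ closure V, ‖p x y - p x y'‖ ≤ L * ‖y - y'‖ := P.swap.fwdX

end
end FKM

open Set MeasureTheory Metric Bornology
open scoped ENNReal NNReal Pointwise

namespace FKM
open Filter Topology

section
variable {n : ℕ} {c : Euc n → Euc n → ℝ} {U V : Set (Euc n)}

/-- the `x`-segment -/
noncomputable def Xs (n : ℕ) (c : Euc n → Euc n → ℝ) (U V : Set (Euc n)) (y a w : Euc n) (s : ℝ) :
    Euc n := Xi (qw n c V) U y (a + s • w)

/-- parameter domain -/
def Is (n : ℕ) (c : Euc n → Euc n → ℝ) (U V : Set (Euc n)) (y a w : Euc n) : Set ℝ :=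
  {s | a + s • w ∈ (fun x => qw n c V x y) '' U}

/-- velocity -/
noncomputable def X1 (n : ℕ) (c : Euc n → Euc n → ℝ) (U V : Set (Euc n)) (y a w : Euc n) (s : ℝ) :
    Euc n := Ai (Aw n c U V) (Xs n c U V y a w s) y w

theorem Hyp.Is_open (H : Hyp n c U V) {y a w : Euc n} (hy : y ∈ closure V) :
    IsOpen (Is n c U V y a w) :=
  (H.qU_open hy).preimage (f := fun s : ℝ => a + s • w) (by fun_prop)

theorem Hyp.Xs_mem (H : Hyp n c U V) {y a w : Euc n} (hy : y ∈ closure V) {s : ℝ}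
    (hs : s ∈ Is n c U V y a w) : Xs n c U V y a w s ∈ U := (H.XiU hy hs).1

theorem Hyp.Xs_q (H : Hyp n c U V) {y a w : Euc n} (hy : y ∈ closure V) {s : ℝ}
    (hs : s ∈ Is n c U V y a w) : qw n c V (Xs n c U V y a w s) y = a + s • w := (H.XiU hy hs).2

theorem Hyp.Xs_d (H : Hyp n c U V) {y a w : Euc n} (hy : y ∈ closure V) {s : ℝ}
    (hs : s ∈ Is n c U V y a w) :
    HasDerivAt (Xs n c U V y a w) (X1 n c U V y a w s) s := H.X_deriv hy hs

theorem Hyp.X1_C (H : Hyp n c U V) {y a w : Euc n} (hy : y ∈ closure V) {k : ℕ} (hk : k ≤ 2)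
    (h : ContDiffOn ℝ k (Xs n c U V y a w) (Is n c U V y a w)) :
    ContDiffOn ℝ k (X1 n c U V y a w) (Is n c U V y a w) := by
  have h1 : ContDiffOn ℝ k (fun s => (Xs n c U V y a w s, y)) (Is n c U V y a w) :=
    h.prodMk contDiffOn_const
  have h2 := (H.AiC2.of_le (m := k) (by exact_mod_cast hk)).comp h1
    (fun s hs => ⟨subset_closure (H.Xs_mem hy hs), hy⟩)
  exact h2.clm_apply contDiffOn_const

theorem Hyp.Xs_step (H : Hyp n c U V) {y a w : Euc n} (hy : y ∈ closure V) {k : ℕ} (hk : k ≤ 2)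
    (h : ContDiffOn ℝ k (Xs n c U V y a w) (Is n c U V y a w)) :
    ContDiffOn ℝ ((k + 1 : ℕ)) (Xs n c U V y a w) (Is n c U V y a w) := by
  push_cast
  rw [contDiffOn_succ_iff_deriv_of_isOpen (H.Is_open hy)]
  refine ⟨fun s hs => (H.Xs_d hy hs).differentiableAt.differentiableWithinAt, by simp, ?_⟩
  exact (H.X1_C hy hk h).congr fun s hs => (H.Xs_d hy hs).deriv

theorem Hyp.Xs_C (H : Hyp n c U V) {y a w : Euc n} (hy : y ∈ closure V) :
    ContDiffOn ℝ 2 (Xs n c U V y a w) (Is n c U V y a w) := by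
  have h0 : ContDiffOn ℝ ((0 : ℕ)) (Xs n c U V y a w) (Is n c U V y a w) := by
    refine contDiffOn_zero.2 fun s hs => (H.Xs_d hy hs).continuousAt.continuousWithinAt
  exact H.Xs_step hy (by norm_num) (H.Xs_step hy (by norm_num) h0)

theorem Hyp.X1_C2 (H : Hyp n c U V) {y a w : Euc n} (hy : y ∈ closure V) :
    ContDiffOn ℝ 2 (X1 n c U V y a w) (Is n c U V y a w) :=
  H.X1_C hy le_rfl (H.Xs_C hy)

theorem Hyp.X1_d (H : Hyp n c U V) {y a w : Euc n} (hy : y ∈ closure V) {s : ℝ}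
    (hs : s ∈ Is n c U V y a w) :
    HasDerivAt (X1 n c U V y a w) (deriv (X1 n c U V y a w) s) s :=
  (((H.X1_C2 hy).differentiableOn (by norm_num)).differentiableAt
    ((H.Is_open hy).mem_nhds hs)).hasDerivAt

/-- weak form of (B3) -/
def B3w (n : ℕ) (c : Euc n → Euc n → ℝ) (U V : Set (Euc n)) : Prop :=
  ∀ x ∈ U, ∀ y ∈ V, ∀ w ζ : Euc n,
    Icc (-1 : ℝ) 1 ⊆ Is n c U V y (qw n c V x y) w →
    Icc (-1 : ℝ) 1 ⊆ Is n (fun y x => c x y) V U x (qw n (fun y x => c x y) U y x) ζ →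
    crossDiff2 n c (Xs n c U V y (qw n c V x y) w)
      (Xs n (fun y x => c x y) V U x (qw n (fun y x => c x y) U y x) ζ) = 0 →
    crossDiff4 n c (Xs n c U V y (qw n c V x y) w)
      (Xs n (fun y x => c x y) V U x (qw n (fun y x => c x y) U y x) ζ) ≤ 0

theorem Hyp.Xs0 (H : Hyp n c U V) {x y w : Euc n} (hx : x ∈ closure U) (hy : y ∈ closure V) :
    Xs n c U V y (qw n c V x y) w 0 = x := by
  rw [Xs, zero_smul, add_zero, H.pkg.Xi_q hx hy]

theorem Hyp.b3w (H : Hyp n c U V) (h : B3cond n c U V) : B3w n c U V := by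
  intro x hx y hy w ζ h1 h2 
  have hx' := subset_closure hx
  have hy' := subset_closure hy
  refine h _ _ (fun t ht => subset_closure (H.Xs_mem hy' (h1 ht)))
    (fun t ht => subset_closure (H.swap.Xs_mem hx' (h2 ht))) ?_
  refine ⟨(-qw n c V x y, -qw n (fun y x => c x y) U y x), (-w, -ζ), fun t ht => ?_⟩
  simp only
  rw [H.Xs0 hx' hy', H.swap.Xs0 hy' hx']
  refine Prod.ext ?_ ?_
  · simp only [Prod.fst_add, Prod.smul_fst]
    rw [H.gradY_eq (subset_closure (H.Xs_mem hy' (h1 ht))) hy', H.Xs_q hy' (h1 ht), neg_add, smul_neg]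
  · simp only [Prod.snd_add, Prod.smul_snd]
    have := H.swap.gradY_eq (subset_closure (H.swap.Xs_mem hx' (h2 ht))) hx'
    rw [H.swap.Xs_q hx' (h2 ht), neg_add] at this
    rw [smul_neg]
    exact this

theorem Hyp.cswap (H : Hyp n c U V) {x y a b w ζ : Euc n} (hx : x ∈ U) (hy : y ∈ V)
    (h1 : (0 : ℝ) ∈ Is n c U V y a w) (h2 : (0 : ℝ) ∈ Is n (fun y x => c x y) V U x b ζ) :
    crossDiff2 n (fun y x => c x y) (Xs n (fun y x => c x y) V U x b ζ) (Xs n c U V y a w) =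
      crossDiff2 n c (Xs n c U V y a w) (Xs n (fun y x => c x y) V U x b ζ) ∧
    crossDiff4 n (fun y x => c x y) (Xs n (fun y x => c x y) V U x b ζ) (Xs n c U V y a w) =
      crossDiff4 n c (Xs n c U V y a w) (Xs n (fun y x => c x y) V U x b ζ) := by
  have hx' := subset_closure hx
  have hy' := subset_closure hy
  set X := Xs n c U V y a w with hX
  set Y := Xs n (fun y x => c x y) V U x b ζ with hY
  set X' := X1 n c U V y a w with hX'
  set Y' := X1 n (fun y x => c x y) V U x b ζ with hY'
  set I := Is n c U V y a w with hI
  set J := Is n (fun y x => c x y) V U x b ζ with hJ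
  set F : ℝ × ℝ → ℝ := fun z => c (X z.1) (Y z.2) with hF
  set O : Set (ℝ × ℝ) := I ×ˢ J with hO
  have oO : IsOpen O := (H.Is_open hy').prod (H.swap.Is_open hx')
  have z0 : ((0 : ℝ), (0 : ℝ)) ∈ O := ⟨h1, h2⟩
  have cX : ContDiffOn ℝ 2 (fun z : ℝ × ℝ => X z.1) O :=
    (H.Xs_C hy').comp contDiffOn_fst (fun z hz => hz.1)
  have cY : ContDiffOn ℝ 2 (fun z : ℝ × ℝ => Y z.2) O :=
    (H.swap.Xs_C hx').comp contDiffOn_snd (fun z hz => hz.2)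
  have cX' : ContDiffOn ℝ 2 (fun z : ℝ × ℝ => X' z.1) O :=
    (H.X1_C2 hy').comp contDiffOn_fst (fun z hz => hz.1)
  have cY' : ContDiffOn ℝ 2 (fun z : ℝ × ℝ => Y' z.2) O :=
    (H.swap.X1_C2 hx').comp contDiffOn_snd (fun z hz => hz.2)
  have mX : ∀ z ∈ O, X z.1 ∈ U := fun z hz => H.Xs_mem hy' hz.1
  have mY : ∀ z ∈ O, Y z.2 ∈ V := fun z hz => H.swap.Xs_mem hx' hz.2
  have cXY : ContDiffOn ℝ 2 (fun z : ℝ × ℝ => (X z.1, Y z.2)) O := cX.prodMk cY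
  have mXY : MapsTo (fun z : ℝ × ℝ => (X z.1, Y z.2)) O (closure U ×ˢ closure V) :=
    fun z hz => ⟨subset_closure (mX z hz), subset_closure (mY z hz)⟩
  have cF : ContDiffOn ℝ 2 F O := (H.b0.2.2.2.2.of_le (by norm_num)).comp cXY mXY
  have et : EqOn (FKM.dt F) (fun z => -(inner ℝ (qw n c V (X z.1) (Y z.2)) (Y' z.2))) O := fun z hz =>
    (H.cY (subset_closure (mX z hz)) (mY z hz) (H.swap.Xs_d hx' hz.2)).deriv
  have es : EqOn (ds F) (fun z => -(inner ℝ (qw n (fun y x => c x y) U (Y z.2) (X z.1)) (X' z.1))) O :=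
    fun z hz => (H.swap.cY (subset_closure (mY z hz)) (mX z hz) (H.Xs_d hy' hz.1)).deriv
  have cq : ContDiffOn ℝ 2 (fun z : ℝ × ℝ => qw n c V (X z.1) (Y z.2)) O :=
    (H.qC3.of_le (by norm_num)).comp cXY mXY
  have cp : ContDiffOn ℝ 2 (fun z : ℝ × ℝ => qw n (fun y x => c x y) U (Y z.2) (X z.1)) O :=
    (H.swap.qC3.of_le (by norm_num)).comp (cY.prodMk cX) (fun z hz => ⟨(mXY hz).2, (mXY hz).1⟩)
  have cA : ContDiffOn ℝ 2 (fun z : ℝ × ℝ => Aw n c U V (X z.1) (Y z.2)) O :=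
    H.AC2.comp cXY mXY
  have ct : ContDiffOn ℝ 2 (FKM.dt F) O := (cq.inner ℝ cY').neg.congr et
  have cs : ContDiffOn ℝ 2 (ds F) O := (cp.inner ℝ cX').neg.congr es
  have est : EqOn (ds (FKM.dt F))
      (fun z => -(inner ℝ (Aw n c U V (X z.1) (Y z.2) (X' z.1)) (Y' z.2))) O := by
    intro z hz
    rw [ds_congr oO et hz]
    have hq := (H.q_x (mXY hz).1 (mXY hz).2).hasFDerivAt
      (mem_of_superset (H.b0.1.mem_nhds (mX z hz)) subset_closure)
    have hd := HasFDerivAt.comp_hasDerivAt z.1 hq (H.Xs_d hy' hz.1)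
    have := (hd.inner ℝ (hasDerivAt_const z.1 (Y' z.2))).neg
    refine this.deriv.trans ?_
    simp only [inner_zero_right, zero_add]
    rfl
  have cst : ContDiffOn ℝ 2 (ds (FKM.dt F)) O := ((cA.clm_apply cX').inner ℝ cY').neg.congr est
  exact ⟨(dsdt oO cF z0).symm, (cross_swap oO cF cs ct cst z0).symm⟩

theorem Hyp.b3w_swap (H : Hyp n c U V) (h : B3w n c U V) : B3w n (fun y x => c x y) V U := by
  intro y hy x hx ζ w h1 h2 h3
  have z : (0 : ℝ) ∈ Icc (-1 : ℝ) 1 := by simp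
  obtain ⟨e1, e2⟩ := H.cswap hx hy (h2 z) (h1 z)
  have h3' := e1.symm.trans h3
  exact e2.trans_le (h x hx y hy w ζ h2 h1 h3')

theorem Hyp.Y1_0 (H : Hyp n c U V) {x y η : Euc n} (hx : x ∈ closure U) (hy : y ∈ closure V) :
    X1 n (fun y x => c x y) V U x (qw n (fun y x => c x y) U y x)
      (Aw n (fun y x => c x y) V U y x η) 0 = η := by
  rw [X1, H.swap.Xs0 hy hx]
  exact H.swap.pkg.Ai_left hy hx η

theorem Hyp.tens0 (H : Hyp n c U V) (h : B3w n c U V) {x y w η : Euc n} (hx : x ∈ U) (hy : y ∈ V)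
    (h1 : Icc (-1 : ℝ) 1 ⊆ Is n c U V y (qw n c V x y) w)
    (h2 : Icc (-1 : ℝ) 1 ⊆ Is n (fun y x => c x y) V U x (qw n (fun y x => c x y) U y x)
      (Aw n (fun y x => c x y) V U y x η)) (h0 : inner ℝ w η = 0) :
    inner ℝ (Tt n c U V x y w w η) η ≤ 0 := by
  have hx' := subset_closure hx
  have hy' := subset_closure hy
  have z : (0 : ℝ) ∈ Icc (-1 : ℝ) 1 := by simp
  have key := h x hx y hy w _ h1 h2
  set X := Xs n c U V y (qw n c V x y) w with hX
  set I := Is n c U V y (qw n c V x y) w with hI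
  set ζ := Aw n (fun y x => c x y) V U y x η with hζ
  set b := qw n (fun y x => c x y) U y x with hb
  set Y := Xs n (fun y x => c x y) V U x b ζ with hY
  set Y' := X1 n (fun y x => c x y) V U x b ζ with hY'
  set J := Is n (fun y x => c x y) V U x b ζ with hJ
  have hY0 : Y 0 = y := H.swap.Xs0 hy' hx'
  have hX0 : X 0 = x := H.Xs0 hx' hy'
  have hY1 : Y' 0 = η := H.Y1_0 hx' hy'
  have oI : I ∈ 𝓝 (0 : ℝ) := (H.Is_open hy').mem_nhds (h1 z)
  have oJ : J ∈ 𝓝 (0 : ℝ) := (H.swap.Is_open hx').mem_nhds (h2 z)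
  set Y2 := deriv Y' 0
  have hY2 : HasDerivAt Y' Y2 0 := H.swap.X1_d hx' (h2 z)
  have e2 : crossDiff2 n c X Y = 0 := by
    have : (fun s => deriv (fun t => c (X s) (Y t)) 0) =ᶠ[𝓝 0]
        fun s => -(inner ℝ (qw n c V x y + s • w) η) := by
      filter_upwards [oI] with s hs
      have := (H.cY (subset_closure (H.Xs_mem hy' hs)) (H.swap.Xs_mem hx' (h2 z))
        (H.swap.Xs_d hx' (h2 z))).deriv
      refine this.trans ?_
      change -(inner ℝ (qw n c V (X s) (Y 0)) (Y' 0)) = _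
      rw [hY0, hY1, hX, H.Xs_q hy' hs]
    rw [crossDiff2, this.deriv_eq]
    have hd : HasDerivAt (fun s : ℝ => -(inner ℝ (qw n c V x y + s • w) η)) (-(inner ℝ w η)) 0 := by
      have h3 : HasDerivAt (fun s : ℝ => qw n c V x y + s • w) w 0 := by
        simpa using ((hasDerivAt_id (0:ℝ)).smul_const w).const_add (qw n c V x y)
      have h4 := (h3.inner ℝ (hasDerivAt_const 0 η)).neg
      exact h4.congr_deriv (by simp)
    rw [hd.deriv, h0, neg_zero]
  have e4 : crossDiff4 n c X Y = inner ℝ (Tt n c U V x y w w η) η := by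
    have a1 : (fun s => deriv (deriv (fun t => c (X s) (Y t))) 0) =ᶠ[𝓝 0]
        fun s => inner ℝ (Ly n c U V (X s) y η) η - inner ℝ (qw n c V x y + s • w) Y2 := by
      filter_upwards [oI] with s hs
      have := H.cY2 (subset_closure (H.Xs_mem hy' hs)) (t0 := 0) (Y := Y) (Y1 := Y') (Y2 := Y2)
        (by filter_upwards [oJ] with t ht
            exact ⟨H.swap.Xs_mem hx' ht, H.swap.Xs_d hx' ht⟩) hY2
      refine this.trans ?_
      rw [hY0, hY1, H.Xs_q hy' hs]
    have a2 : deriv (fun s => deriv (deriv (fun t => c (X s) (Y t))) 0) =ᶠ[𝓝 0]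
        fun s => inner ℝ (Jt n c U V (X s) y w η) η - inner ℝ w Y2 := by
      refine a1.deriv.trans ?_
      filter_upwards [oI] with s hs
      have h3 : HasDerivAt (fun s : ℝ => qw n c V x y + s • w) w s := by
        simpa using ((hasDerivAt_id s).smul_const w).const_add (qw n c V x y)
      have h4 := ((H.LyX hy' hs).clm_apply (hasDerivAt_const s η)).inner ℝ (hasDerivAt_const s η)
      have h5 := h4.sub (h3.inner ℝ (hasDerivAt_const s Y2))
      refine h5.deriv.trans ?_
      simp only [inner_zero_right, zero_add, map_zero, add_zero]
      rfl
    rw [crossDiff4, a2.deriv_eq]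
    have h4 := (((H.JtX hy' (h1 z)).clm_apply (hasDerivAt_const 0 w)).clm_apply
      (hasDerivAt_const 0 η)).inner ℝ (hasDerivAt_const 0 η)
    have h5 := h4.sub_const (inner ℝ w Y2)
    refine h5.deriv.trans ?_
    simp only [inner_zero_right, zero_add, map_zero, add_zero]
    rw [zero_smul, add_zero, H.pkg.Xi_q hx' hy']
  have := key e2
  rwa [e4] at this

theorem Hyp.seg_small (H : Hyp n c U V) {x y w : Euc n} (hx : x ∈ U) (hy : y ∈ closure V) :
    ∃ δ : ℝ, 0 < δ ∧ ∀ ε : ℝ, 0 < ε → ε < δ → Icc (-1 : ℝ) 1 ⊆ Is n c U V y (qw n c V x y) (ε • w) := by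
  obtain ⟨r, hr, hb⟩ := Metric.isOpen_iff.1 (H.qU_open hy) (qw n c V x y) (mem_image_of_mem _ hx)
  refine ⟨r / (‖w‖ + 1), by positivity, fun ε h0 h1 t ht => hb ?_⟩
  rw [mem_ball_iff_norm, add_sub_cancel_left, norm_smul, norm_smul, Real.norm_eq_abs,
    Real.norm_eq_abs, abs_of_pos h0]
  have : |t| ≤ 1 := abs_le.2 ht
  rw [lt_div_iff₀ (by positivity)] at h1
  calc |t| * (ε * ‖w‖) ≤ 1 * (ε * ‖w‖) := by gcongr
    _ < r := by nlinarith

theorem Hyp.tens1 (H : Hyp n c U V) (h : B3w n c U V) {x y w η : Euc n} (hx : x ∈ U) (hy : y ∈ V)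
    (h0 : inner ℝ w η = 0) :
    inner ℝ (Tt n c U V x y w w η) η ≤ 0 := by
  have hx' := subset_closure hx
  have hy' := subset_closure hy
  obtain ⟨δ1, hδ1, k1⟩ := H.seg_small (w := w) hx hy'
  obtain ⟨δ2, hδ2, k2⟩ := H.swap.seg_small (w := Aw n (fun y x => c x y) V U y x η) hy hx'
  set ε := min δ1 δ2 / 2 with hε
  have hm : 0 < min δ1 δ2 := lt_min hδ1 hδ2
  have e0 : 0 < ε := by positivity
  have e1 : ε < δ1 := by have := min_le_left δ1 δ2; linarith
  have e2 : ε < δ2 := by have := min_le_right δ1 δ2; linarith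
  have k2' := k2 ε e0 e2
  rw [← map_smul] at k2'
  have := H.tens0 h hx hy (k1 ε e0 e1) k2' (by
    rw [inner_smul_left, inner_smul_right, h0]; simp)
  simp only [Tt, map_smul, smul_apply, inner_smul_left, inner_smul_right] at this
  have e : ε * (ε * (ε * (ε * inner ℝ (Tt n c U V x y w w η) η))) ≤ 0 := by
    simpa [Tt, inner_smul_left, inner_smul_right] using this
  by_contra hc
  push Not at hc
  have : 0 < ε * (ε * (ε * (ε * inner ℝ (Tt n c U V x y w w η) η))) := by positivity
  linarith

theorem Hyp.tens (H : Hyp n c U V) (h : B3w n c U V) : ∃ C : ℝ, 0 ≤ C ∧ ∀ x ∈ U, ∀ y ∈ V, ∀ w η : Euc n,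
    inner ℝ (Tt n c U V x y w w η) η ≤ C * ‖w‖ * ‖η‖ * |inner ℝ w η| := by
  obtain ⟨C, hC, hb⟩ := H.Tt_bd4
  refine ⟨3 * C, by positivity, fun x hx y hy w η => ?_⟩
  by_cases hη : η = 0
  · subst hη; simp
  have hn : 0 < ‖η‖ := norm_pos_iff.2 hη
  set v : Euc n := (inner ℝ w η / ‖η‖ ^ 2) • η with hv
  have hvn : ‖v‖ * ‖η‖ = |inner ℝ w η| := by
    rw [hv, norm_smul, Real.norm_eq_abs, abs_div, abs_of_nonneg (by positivity : 0 ≤ ‖η‖ ^ 2)]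
    field_simp
  have hvw : ‖v‖ ≤ ‖w‖ := by
    have := abs_real_inner_le_norm w η
    rw [← hvn] at this
    exact le_of_mul_le_mul_right this hn
  set w' := w - v with hw'
  have horth : inner ℝ w' η = 0 := by
    rw [hw', hv, inner_sub_left, real_inner_smul_left, real_inner_self_eq_norm_sq]
    field_simp
    ring
  have h1 := H.tens1 h hx hy horth
  have hw : w = w' + v := by rw [hw']; abel
  have hwn : ‖w'‖ ≤ 2 * ‖w‖ := (norm_sub_le _ _).trans (by linarith)
  have e : inner ℝ (Tt n c U V x y w w η) η = inner ℝ (Tt n c U V x y w' w' η) η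
      + inner ℝ (Tt n c U V x y w' v η) η + inner ℝ (Tt n c U V x y v w η) η := by
    have e1 : Tt n c U V x y w w η = Tt n c U V x y w' w η + Tt n c U V x y v w η := by
      have : Tt n c U V x y w = Tt n c U V x y w' + Tt n c U V x y v := by
        nth_rewrite 1 [hw]; exact map_add _ _ _
      rw [this]; rfl
    have e2 : Tt n c U V x y w' w η = Tt n c U V x y w' w' η + Tt n c U V x y w' v η := by
      have : Tt n c U V x y w' w = Tt n c U V x y w' w' + Tt n c U V x y w' v := by
        rw [← map_add, ← hw]
      rw [this]; rfl
    rw [e1, inner_add_left, e2, inner_add_left]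
  have b1 := (le_abs_self _).trans (hb x (subset_closure hx) y (subset_closure hy) w' v η η)
  have b2 := (le_abs_self _).trans (hb x (subset_closure hx) y (subset_closure hy) v w η η)
  have b3 : C * ‖w'‖ * ‖v‖ * ‖η‖ * ‖η‖ ≤ 2 * (C * ‖w‖ * ‖η‖ * |inner ℝ w η|) := by
    rw [← hvn]
    have : 0 ≤ C * ‖v‖ * ‖η‖ * ‖η‖ := by positivity
    nlinarith
  have b4 : C * ‖v‖ * ‖w‖ * ‖η‖ * ‖η‖ = (C * ‖w‖ * ‖η‖ * |inner ℝ w η|) := by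
    rw [← hvn]; ring
  rw [e]
  linarith

end
end FKM

open Set MeasureTheory Metric Bornology
open scoped ENNReal NNReal Pointwise

namespace FKM
open Filter Topology

section
variable {n : ℕ} {c : Euc n → Euc n → ℝ} {U V : Set (Euc n)}

theorem Hyp.seg_Is (H : Hyp n c U V) {x0 x1 y : Euc n} (h0 : x0 ∈ U) (h1 : x1 ∈ U)
    (hy : y ∈ closure V) :
    Icc (0 : ℝ) 1 ⊆ Is n c U V y (qw n c V x0 y) (qw n c V x1 y - qw n c V x0 y) := by
  intro t ht
  have := H.qU_conv hy (mem_image_of_mem _ h0) (mem_image_of_mem _ h1)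
    (sub_nonneg.2 ht.2) ht.1 (by ring)
  have e : qw n c V x0 y + t • (qw n c V x1 y - qw n c V x0 y) =
    (1 - t) • qw n c V x0 y + t • qw n c V x1 y := by module
  change qw n c V x0 y + t • (qw n c V x1 y - qw n c V x0 y) ∈ (fun x => qw n c V x y) '' U
  rw [e]; exact this

theorem Hyp.phi0 (H : Hyp n c U V) {x b ζ w : Euc n} (hx : x ∈ closure U) {t : ℝ}
    (ht : t ∈ Is n (fun y x => c x y) V U x b ζ) :
    inner ℝ (Jt n c U V x (Xs n (fun y x => c x y) V U x b ζ t) w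
      (X1 n (fun y x => c x y) V U x b ζ t)) (X1 n (fun y x => c x y) V U x b ζ t) =
    inner ℝ w (deriv (X1 n (fun y x => c x y) V U x b ζ) t) := by
  set Y := Xs n (fun y x => c x y) V U x b ζ with hY
  set Y' := X1 n (fun y x => c x y) V U x b ζ with hY'
  set J := Is n (fun y x => c x y) V U x b ζ with hJ
  have mY : ∀ s ∈ J, Y s ∈ V := fun s hs => H.swap.Xs_mem hx hs
  set y := Y t with hy
  have hyV : y ∈ closure V := subset_closure (mY t ht)
  set ξ := Ai (Aw n c U V) x y w with hξ
  have hw : Aw n c U V x y ξ = w := H.pkg.Ai_right hx hyV w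
  have hJt : Jt n c U V x y w (Y' t) =
      -(fderivWithin ℝ (Function.uncurry (Aw n c U V)) (closure U ×ˢ closure V) (x, y) (0, Y' t) ξ) := by
    rw [← H.sym hx hyV]
    rfl
  have e : (fun s => inner ℝ (Aw n c U V x (Y s) ξ) (Y' s)) =ᶠ[𝓝 t] fun _ => inner ℝ ξ ζ := by
    filter_upwards [(H.swap.Is_open hx).mem_nhds ht] with s hs
    have hs' := subset_closure (mY s hs)
    rw [← ContinuousLinearMap.adjoint_inner_right, ← H.adj hx hs']
    congr 1
    exact H.swap.pkg.Ai_right hs' hx ζ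
  have hA := part_y_at (U := U) (f := Aw n c U V) H.b0.2.2.1 (H.AC2.differentiableOn (by norm_num)) hx (mY t ht)
  have hA' := HasFDerivAt.comp_hasDerivAt t hA (H.swap.Xs_d hx ht)
  have hd := (hA'.clm_apply (hasDerivAt_const t ξ)).inner ℝ (H.swap.X1_d hx ht)
  have h0 := hd.unique ((hasDerivAt_const t (inner ℝ ξ ζ)).congr_of_eventuallyEq e)
  simp only [map_zero, add_zero] at h0
  change inner ℝ (Aw n c U V x y ξ) (deriv Y' t) + inner ℝ
    (fderivWithin ℝ (Function.uncurry (Aw n c U V)) (closure U ×ˢ closure V) (x, y) (0, Y' t) ξ) (Y' t) = 0 at h0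
  rw [hw] at h0
  rw [hJt, inner_neg_left]
  linarith

set_option maxHeartbeats 1000000 in
theorem Hyp.qq_int (H : Hyp n c U V) (h : B3w n c U V) : ∃ C : ℝ, 0 ≤ C ∧
    ∀ x0 ∈ U, ∀ x1 ∈ U, ∀ y0 ∈ V, ∀ y1 ∈ V, ∀ y ∈ closure V, ∀ t : ℝ, 0 < t → t < 1 →
    qw n (fun y x => c x y) U y x0 = (1 - t) • qw n (fun y x => c x y) U y0 x0 +
      t • qw n (fun y x => c x y) U y1 x0 →
    c x0 y0 - c x1 y0 < c x0 y - c x1 y →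
    (1 - t) * ((c x0 y - c x1 y) - (c x0 y0 - c x1 y0)) ≤
      Real.exp (C * ‖y1 - y0‖ * ‖x1 - x0‖) * t * ((c x0 y1 - c x1 y1) - (c x0 y - c x1 y)) := by
  obtain ⟨C, hC, hT⟩ := H.tens h
  obtain ⟨B, hB, hb⟩ := H.swap.pkg.Ai_bound
  obtain ⟨L, hL, hl⟩ := H.pkg.fwdX
  obtain ⟨L', hL', hl'⟩ := H.swap.pkg.fwdX
  refine ⟨C * L * (B * L'), by positivity, ?_⟩
  intro x0 hx0 x1 hx1 y0 hy0 y1 hy1 yy hyy t ht0 ht1 hp hlt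
  have cx0 := subset_closure hx0
  have cx1 := subset_closure hx1
  set b := qw n (fun y x => c x y) U y0 x0 with hbdef
  set ζ := qw n (fun y x => c x y) U y1 x0 - b with hζ
  set Y := Xs n (fun y x => c x y) V U x0 b ζ with hY
  set Y' := X1 n (fun y x => c x y) V U x0 b ζ with hY'
  set J := Is n (fun y x => c x y) V U x0 b ζ with hJ
  have hIJ : Icc (0 : ℝ) 1 ⊆ J := H.swap.seg_Is hy0 hy1 cx0
  have mY : ∀ s ∈ J, Y s ∈ V := fun s hs => H.swap.Xs_mem cx0 hs
  have Y0 : Y 0 = y0 := H.swap.Xs0 (subset_closure hy0) cx0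
  have Y1 : Y 1 = y1 := by
    rw [hY, Xs, hζ, one_smul, add_sub_cancel]
    exact H.swap.pkg.Xi_q (subset_closure hy1) cx0
  have Yt : Y t = yy := by
    have : b + t • ζ = qw n (fun y x => c x y) U yy x0 := by rw [hp, hζ]; module
    rw [hY, Xs, this]
    exact H.swap.pkg.Xi_q hyy cx0
  have dY : ∀ s ∈ J, HasDerivAt Y (Y' s) s := fun s hs => H.swap.Xs_d cx0 hs
  have dY' : ∀ s ∈ J, HasDerivAt Y' (deriv Y' s) s := fun s hs => H.swap.X1_d cx0 hs
  have hη : ∀ s ∈ J, ‖Y' s‖ ≤ B * L' * ‖y1 - y0‖ := by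
    intro s hs
    have h1 : ‖Y' s‖ ≤ B * ‖ζ‖ := by
      refine (ContinuousLinearMap.le_opNorm _ _).trans ?_
      gcongr
      exact (hb _ (subset_closure (mY s hs)) _ cx0).2
    have h2 : ‖ζ‖ ≤ L' * ‖y1 - y0‖ := hl' _ cx0 _ (subset_closure hy1) _ (subset_closure hy0)
    calc _ ≤ B * ‖ζ‖ := h1
      _ ≤ B * (L' * ‖y1 - y0‖) := by gcongr
      _ = _ := by ring
  have main := qq_real (f := fun s => c x0 (Y s) - c x1 (Y s))
    (g := fun s => -(inner ℝ (qw n c V x0 (Y s)) (Y' s)) - -(inner ℝ (qw n c V x1 (Y s)) (Y' s)))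
    (g' := fun s => (inner ℝ (Ly n c U V x0 (Y s) (Y' s)) (Y' s) - inner ℝ (qw n c V x0 (Y s)) (deriv Y' s))
      - (inner ℝ (Ly n c U V x1 (Y s) (Y' s)) (Y' s) - inner ℝ (qw n c V x1 (Y s)) (deriv Y' s)))
    (k := C * L * (B * L') * ‖y1 - y0‖ * ‖x1 - x0‖) (t := t) (by positivity)
    (fun s hs => (H.cY cx0 (mY s (hIJ hs)) (dY s (hIJ hs))).sub
      (H.cY cx1 (mY s (hIJ hs)) (dY s (hIJ hs))))
    (fun s hs => (H.qY cx0 (mY s (hIJ hs)) (dY s (hIJ hs)) (dY' s (hIJ hs))).sub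
      (H.qY cx1 (mY s (hIJ hs)) (dY s (hIJ hs)) (dY' s (hIJ hs)))) ?_ ht0 ht1
      (by simpa only [Y0, Yt] using hlt)
  · simpa only [Y0, Y1, Yt] using main
  intro s hs
  have hsJ := hIJ hs
  set y := Y s with hy
  have hyV : y ∈ V := mY s hsJ
  have cyV := subset_closure hyV
  set η := Y' s with hηd
  set Y2 := deriv Y' s with hY2
  set w := qw n c V x1 y - qw n c V x0 y with hw
  set X := Xs n c U V y (qw n c V x0 y) w with hX
  set I := Is n c U V y (qw n c V x0 y) w with hI
  have hII : Icc (0 : ℝ) 1 ⊆ I := H.seg_Is hx0 hx1 cyV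
  have X0 : X 0 = x0 := H.Xs0 cx0 cyV
  have X1' : X 1 = x1 := by
    rw [hX, Xs, hw, one_smul, add_sub_cancel]
    exact H.pkg.Xi_q cx1 cyV
  have hphi0 : inner ℝ (Jt n c U V x0 y w η) η = inner ℝ w Y2 := H.phi0 cx0 hsJ
  have tay := taylor_real
    (f := fun r => -(inner ℝ (Ly n c U V (X r) y η) η) + inner ℝ (qw n c V x0 y + r • w) Y2)
    (g := fun r => -(inner ℝ (Jt n c U V (X r) y w η) η) + inner ℝ w Y2)
    (h := fun r => -(inner ℝ (Tt n c U V (X r) y w w η) η))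
    (κ := C * ‖w‖ * ‖η‖ * |inner ℝ w η|) ?_ ?_ (by positivity) ?_ ?_
  · simp only [X0, X1', zero_smul, one_smul, add_zero] at tay
    have e1 : qw n c V x0 y + w = qw n c V x1 y := by rw [hw]; abel
    rw [e1] at tay
    have e2 : -(inner ℝ (qw n c V x0 y) η) - -(inner ℝ (qw n c V x1 y) η) = inner ℝ w η := by
      rw [hw, inner_sub_left]; ring
    rw [e2]
    have hwn : ‖w‖ ≤ L * ‖x1 - x0‖ := hl y cyV x1 cx1 x0 cx0
    have : C * ‖w‖ * ‖η‖ * |inner ℝ w η| ≤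
        C * L * (B * L') * ‖y1 - y0‖ * ‖x1 - x0‖ * |inner ℝ w η| := by
      have := hη s hsJ
      calc _ ≤ C * (L * ‖x1 - x0‖) * (B * L' * ‖y1 - y0‖) * |inner ℝ w η| := by gcongr
        _ = _ := by ring
    linarith
  · intro r hr
    have h3 : HasDerivAt (fun s : ℝ => qw n c V x0 y + s • w) w r := by
      simpa using ((hasDerivAt_id r).smul_const w).const_add (qw n c V x0 y)
    have h4 := ((H.LyX cyV (hII hr)).clm_apply (hasDerivAt_const r η)).inner ℝ (hasDerivAt_const r η)
    have h5 := h4.neg.add (h3.inner ℝ (hasDerivAt_const r Y2))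
    refine h5.congr_deriv ?_
    simp only [inner_zero_right, zero_add, map_zero, add_zero]
    rfl
  · intro r hr
    have h4 := (((H.JtX cyV (hII hr)).clm_apply (hasDerivAt_const r w)).clm_apply
      (hasDerivAt_const r η)).inner ℝ (hasDerivAt_const r η)
    have h5 := h4.neg.add_const (inner ℝ w Y2)
    refine h5.congr_deriv ?_
    simp only [inner_zero_right, zero_add, map_zero, add_zero]
    rfl
  · intro r hr
    exact neg_le_neg (hT _ (H.Xs_mem cyV (hII hr)) y hyV w η)
  · simp only [X0, hphi0]; ring

set_option maxHeartbeats 1000000 in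
theorem Hyp.qqy (H : Hyp n c U V) (h : B3w n c U V) : ∃ C : ℝ, 0 ≤ C ∧
    ∀ x0 ∈ closure U, ∀ x1 ∈ closure U, ∀ y0 ∈ closure V, ∀ y1 ∈ closure V, ∀ y ∈ closure V,
    ∀ t : ℝ, 0 < t → t < 1 →
    qw n (fun y x => c x y) U y x0 = (1 - t) • qw n (fun y x => c x y) U y0 x0 +
      t • qw n (fun y x => c x y) U y1 x0 →
    c x0 y0 - c x1 y0 < c x0 y - c x1 y →
    (1 - t) * ((c x0 y - c x1 y) - (c x0 y0 - c x1 y0)) ≤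
      Real.exp (C * ‖y1 - y0‖ * ‖x1 - x0‖) * t * ((c x0 y1 - c x1 y1) - (c x0 y - c x1 y)) := by
  obtain ⟨C, hC, hq⟩ := H.qq_int h
  refine ⟨C, hC, ?_⟩
  intro x0 hx0 x1 hx1 y0 hy0 y1 hy1 y hy t ht0 ht1 hp hlt
  obtain ⟨a0, ha0, la0⟩ := mem_closure_iff_seq_limit.1 hx0
  obtain ⟨a1, ha1, la1⟩ := mem_closure_iff_seq_limit.1 hx1
  obtain ⟨b0, hb0, lb0⟩ := mem_closure_iff_seq_limit.1 hy0
  obtain ⟨b1, hb1, lb1⟩ := mem_closure_iff_seq_limit.1 hy1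
  set p : Euc n → Euc n → Euc n := fun x y => qw n (fun y x => c x y) U y x with hpdef
  have P := H.pkg
  have ex : ∀ k, ∃ z ∈ closure V, p (a0 k) z = (1 - t) • p (a0 k) (b0 k) + t • p (a0 k) (b1 k) :=
    fun k => P.exY (subset_closure (ha0 k)) (subset_closure (hb0 k)) (subset_closure (hb1 k))
      ht0.le ht1.le
  choose z hz hzp using ex
  have lim : ∀ {E : Type} [TopologicalSpace E] {f : Euc n → Euc n → E}
      (_ : ContinuousOn (Function.uncurry f) (closure U ×ˢ closure V)) {a b : ℕ → Euc n} {a' b' : Euc n}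
      (_ : a' ∈ closure U) (_ : b' ∈ closure V) (_ : ∀ k, a k ∈ closure U) (_ : ∀ k, b k ∈ closure V)
      (_ : Tendsto a atTop (𝓝 a')) (_ : Tendsto b atTop (𝓝 b')),
      Tendsto (fun k => f (a k) (b k)) atTop (𝓝 (f a' b')) := by
    intro E _ f hf a b a' b' h1 h2 h3 h4 h5 h6
    have := (hf (a', b') ⟨h1, h2⟩).tendsto
    exact this.comp (tendsto_nhdsWithin_iff.2 ⟨h5.prodMk_nhds h6,
      Eventually.of_forall fun k => ⟨h3 k, h4 k⟩⟩)
  have ca0 : ∀ k, a0 k ∈ closure U := fun k => subset_closure (ha0 k)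
  have ca1 : ∀ k, a1 k ∈ closure U := fun k => subset_closure (ha1 k)
  have cb0 : ∀ k, b0 k ∈ closure V := fun k => subset_closure (hb0 k)
  have cb1 : ∀ k, b1 k ∈ closure V := fun k => subset_closure (hb1 k)
  obtain ⟨L, hL, hl⟩ := P.lipY
  have lz : Tendsto z atTop (𝓝 y) := by
    rw [tendsto_iff_norm_sub_tendsto_zero]
    have l1 : Tendsto (fun k => (1 - t) • p (a0 k) (b0 k) + t • p (a0 k) (b1 k) - p (a0 k) y) atTop
        (𝓝 ((1 - t) • p x0 y0 + t • p x0 y1 - p x0 y)) :=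
      (((lim P.pc hx0 hy0 ca0 cb0 la0 lb0).const_smul (1 - t)).add
        ((lim P.pc hx0 hy1 ca0 cb1 la0 lb1).const_smul t)).sub
        (lim P.pc hx0 hy ca0 (fun _ => hy) la0 tendsto_const_nhds)
    have e : (1 - t) • p x0 y0 + t • p x0 y1 - p x0 y = 0 := sub_eq_zero.2 hp.symm
    rw [e] at l1
    have l2 := l1.norm.const_mul L
    rw [norm_zero, mul_zero] at l2
    refine squeeze_zero (fun _ => norm_nonneg _) (fun k => ?_) l2
    rw [← hzp k]
    exact hl _ (ca0 k) _ (hz k) _ hy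
  have q00 := lim P.cc hx0 hy0 ca0 cb0 la0 lb0
  have q10 := lim P.cc hx1 hy0 ca1 cb0 la1 lb0
  have q01 := lim P.cc hx0 hy1 ca0 cb1 la0 lb1
  have q11 := lim P.cc hx1 hy1 ca1 cb1 la1 lb1
  have q0 := lim P.cc hx0 hy ca0 hz la0 lz
  have q1 := lim P.cc hx1 hy ca1 hz la1 lz
  have ev : ∀ᶠ k in atTop, c (a0 k) (b0 k) - c (a1 k) (b0 k) < c (a0 k) (z k) - c (a1 k) (z k) :=
    (q00.sub q10).eventually_lt (q0.sub q1) hlt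
  have l1 := (((q0.sub q1).sub (q00.sub q10)).const_mul (1 - t))
  have l2 := ((((((lb1.sub lb0).norm.const_mul C).mul (la1.sub la0).norm)).rexp.mul_const t).mul
    ((q01.sub q11).sub (q0.sub q1)))
  refine le_of_tendsto_of_tendsto l1 l2 ?_
  filter_upwards [ev] with k hk
  exact hq _ (ha0 k) _ (ha1 k) _ (hb0 k) _ (hb1 k) _ (hz k) t ht0 ht1 (hzp k) hk

theorem qq_mono {C C' D t a b : ℝ} (hD : 0 ≤ D) (hC : C ≤ C') (ht0 : 0 < t) (ht1 : t < 1) (ha : 0 < a)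
    (h : (1 - t) * a ≤ Real.exp (C * D) * t * b) : (1 - t) * a ≤ Real.exp (C' * D) * t * b := by
  have h1 : 0 < Real.exp (C * D) * t * b := lt_of_lt_of_le (mul_pos (by linarith) ha) h
  have hb : 0 < b := (mul_pos_iff_of_pos_left (by positivity)).1 h1
  refine h.trans ?_
  gcongr

theorem Hyp.fullpkg (H : Hyp n c U V) (h : B3cond n c U V) : ∃ C0,
    Pkg n c U V (fun x y => qw n (fun y x => c x y) U y x) (qw n c V) (Aw n c U V) C0 := by
  obtain ⟨C1, h1, k1⟩ := H.qqy (H.b3w h)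
  obtain ⟨C2, h2, k2⟩ := H.swap.qqy (H.b3w_swap (H.b3w h))
  refine ⟨max C1 C2, { toPkg0 := H.pkg, C0nn := h1.trans (le_max_left _ _), QQx := ?_, QQy := ?_ }⟩
  · intro y0 hy0 y1 hy1 x0 hx0 x1 hx1 x hx t ht0 ht1 e hlt
    have := k2 y0 hy0 y1 hy1 x0 hx0 x1 hx1 x hx t ht0 ht1 e hlt
    rw [mul_assoc (max C1 C2)]
    rw [mul_assoc C2] at this
    exact qq_mono (by positivity) (le_max_right _ _) ht0 ht1 (sub_pos.2 hlt) this
  · intro x0 hx0 x1 hx1 y0 hy0 y1 hy1 y hy t ht0 ht1 e hlt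
    have := k1 x0 hx0 x1 hx1 y0 hy0 y1 hy1 y hy t ht0 ht1 e hlt
    rw [mul_assoc (max C1 C2)]
    rw [mul_assoc C1] at this
    exact qq_mono (by positivity) (le_max_left _ _) ht0 ht1 (sub_pos.2 hlt) this

end
end FKM

/-- (Theorem 9.5: Hölder continuity of optimal maps to strongly
`c`-convex targets: `u ∈ C^{1,1/K}_loc(U^λ)`, where `K > 1` is the engulfing constant,
depending only on the dimension `n` and on a bound `Γ` for `γ⁺_c γ⁻_c / λ`). -/
theorem C1alpha_regularity (n : ℕ) (Γ : ℝ) :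
    ∃ K : ℝ, 1 < K ∧
      ∀ (c : Euc n → Euc n → ℝ) (U V Ulam : Set (Euc n)) (u : Euc n → ℝ)
        (lam Lam : ℝ),
        B0cond n c U V → B1cond n c U V → B2cond n c U V → B3cond n c U V →
        B2scond n c U V →
        IsOpen Ulam → Ulam ⊆ U →
        CConvexOn n c (closure U) (closure V) u →
        0 < lam → 0 < Lam →
        MAge n c (closure U) (closure V) u lam Ulam →
        MAle n c (closure U) (closure V) u (1 / lam) Ulam →
        MAle n c (closure U) (closure V) u Lam (closure U) →
        -- `γ⁺_c γ⁻_c / λ ≤ Γ`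
        gammaPlus n c U V * gammaMinus n c U V ≤ Γ * lam →
        -- `u ∈ C^{1,1/K}_loc(U^λ)`
        ContDiffOn ℝ 1 u Ulam ∧
        ∀ x ∈ Ulam, ∃ ε > 0, ∃ C : ℝ≥0,
          HolderOnWith C (Real.toNNReal (1 / K)) (fun z => gradient u z)
            (Metric.ball x ε) := by
  obtain ⟨α, h0, h1, hmain⟩ := FKM.main_pkg n Γ
  refine ⟨1 / α, by rw [lt_div_iff₀ h0]; linarith, ?_⟩
  intro c U V Ulam u lam Lam b0 b1 b2 b3 b2s oUl hUl hcc hlam hLam m1 m2 m3 hg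
  rw [one_div_one_div]
  rcases Ulam.eq_empty_or_nonempty with rfl | hne
  · exact ⟨contDiffOn_empty, fun x hx => hx.elim⟩
  have neU : U.Nonempty := hne.mono hUl
  rcases V.eq_empty_or_nonempty with rfl | neV
  · exfalso
    have h := m1 Ulam subset_rfl oUl.measurableSet
    have e : cSubdiffImg n c (closure U) (closure ∅) u Ulam = ∅ := by
      rw [closure_empty]
      refine Set.eq_empty_of_forall_notMem fun y hy => ?_
      simp only [cSubdiffImg, mem_iUnion] at hy
      obtain ⟨x, _, hxy⟩ := hy
      exact hxy.2.1
    rw [e, measure_empty] at h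
    have h2 : 0 < ENNReal.ofReal lam * volume Ulam :=
      ENNReal.mul_pos (by simpa using hlam) (oUl.measure_pos volume hne).ne'
    exact absurd h (not_le.2 h2)
  rcases Nat.eq_zero_or_pos n with hn | hn
  · subst hn
    refine ⟨?_, fun x _ => ⟨1, one_pos, 0, fun a _ b _ => ?_⟩⟩
    · have : u = fun _ => u 0 := funext fun x => congrArg u (Subsingleton.elim _ _)
      rw [this]; exact contDiffOn_const
    · rw [Subsingleton.elim a b, edist_self]; exact zero_le
  have H : FKM.Hyp n c U V := ⟨hn, neU, neV, b0, b1, b2, b2s⟩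
  obtain ⟨C0, P⟩ := H.fullpkg b3
  obtain ⟨hgm, D⟩ := H.dt
  obtain ⟨L, hL, hpl⟩ := H.pl
  have hpot := FKM.Pot.of_cconvex P.compU P.compV neU neV P.cc hcc
  have hIm : ∀ W, FKM.Im c U V u (cStarT n c (closure U) u) W =
      cSubdiffImg n c (closure U) (closure V) u W := by
    intro W
    ext y
    simp only [cSubdiffImg, mem_iUnion, exists_prop]
    rfl
  refine hmain hpot P D hL hpl oUl hUl hlam hLam ?_ ?_ ?_ ?_
  · intro W hW hc; rw [hIm]; exact m1 W hW hc.measurableSet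
  · intro W hW hc; rw [hIm]; exact m2 W hW hc.measurableSet
  · intro W hW hc; rw [hIm]; exact m3 W hW hc.measurableSet
  · rwa [div_div_eq_mul_div, div_one]
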